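/- (Ol'shanskii) Let I be a countable index set with at least 2 elements and let (H_i)_{i ∈ I} be a family of countable nontrivial groups. Then there exists a 2-generated simple group S together with injective group homomorphisms φ_i : H_i → S (write K_i := φ_i(H_i) for the image subgroups) such that: (1) for all i ≠ j in I with |H_j| ≥ 3, S is generated by K_i ∪ K_j; (2) for all i ≠ j in I, K_i ∩ K_j = {1}; (3) every element of finite order in S is conjugate in S to an element of K_i for some i ∈ I; (4) every proper subgroup of S is infinite cyclic (isomorphic to ℤ), or infinite dihedral, or conjugate in S to a subgroup of K_i for some i ∈ I; (5) if for some i ∈ I, x ∈ K_i with x ≠ 1 and y ∈ S with y ∉ K_i, then S is generated by {x, y}, or both x and y are involutions, or both x and x·y are involutions; (6) for all i ≠ j in I and every x ∈ S, K_i ∩ x K_j x⁻¹ = {1}; (7) for every i ∈ I, K_i is malnormal in S, i.e., for every x ∈ S with x ∉ K_i, K_i ∩ x K_i x⁻¹ = {1}. -/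

import Mathlib

namespace Olsh

/-- A geodesic metric with values in the natural numbers. -/
structure IsGeod {V : Type*} (d : V → V → ℕ) : Prop where
  zero : ∀ x y, d x y = 0 ↔ x = y
  symm : ∀ x y, d x y = d y x
  tri : ∀ x y z, d x z ≤ d x y + d y z
  mid : ∀ x y k, k ≤ d x y → ∃ z, d x z = k ∧ k + d z y = d x y

/-- The four point condition. -/
def Hyp {V : Type*} (d : V → V → ℕ) (δ : ℕ) : Prop :=
  ∀ x y z w, d x y + d z w ≤ d x z + d y w + δ ∨ d x y + d z w ≤ d x w + d y z + δ

/-- `L` is nonempty and nearest point projections to `L` are coarsely on the way. -/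
def QC {V : Type*} (d : V → V → ℕ) (C : ℕ) (L : Set V) : Prop :=
  L.Nonempty ∧ ∀ x, ∀ p ∈ L, (∀ q ∈ L, d x p ≤ d x q) → ∀ q ∈ L, d x p + d p q ≤ d x q + C

/-- `p` is a nearest point of `L` to `x`. -/
def IsProj {V : Type*} (d : V → V → ℕ) (L : Set V) (x p : V) : Prop :=
  p ∈ L ∧ ∀ q ∈ L, d x p ≤ d x q

/-- The distance between two sets. -/
noncomputable def setDist {V : Type*} (d : V → V → ℕ) (A B : Set V) : ℕ :=
  sInf {n | ∃ a ∈ A, ∃ b ∈ B, d a b = n}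

section
variable {V : Type*} {d : V → V → ℕ} {δ C : ℕ}

namespace IsGeod
variable (hd : IsGeod d)
include hd

theorem self (x : V) : d x x = 0 := (hd.zero x x).2 rfl

end IsGeod

theorem exists_proj (d : V → V → ℕ) {L : Set V} (hL : L.Nonempty) (x : V) :
    ∃ p, IsProj d L x p := by
  obtain ⟨p, hp, h⟩ := WellFounded.has_min (measure (fun p => d x p)).wf L hL
  exact ⟨p, hp, fun q hq => not_lt.1 (h q hq)⟩

theorem setDist_le {A B : Set V} {a b : V} (ha : a ∈ A) (hb : b ∈ B) :
    setDist d A B ≤ d a b := Nat.sInf_le ⟨a, ha, b, hb, rfl⟩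

theorem exists_setDist {A B : Set V} (hA : A.Nonempty) (hB : B.Nonempty) :
    ∃ a ∈ A, ∃ b ∈ B, d a b = setDist d A B := by
  obtain ⟨a, ha⟩ := hA
  obtain ⟨b, hb⟩ := hB
  exact Nat.sInf_mem (s := {n | ∃ a ∈ A, ∃ b ∈ B, d a b = n}) ⟨d a b, a, ha, b, hb, rfl⟩

theorem setDist_singleton (x y : V) : setDist d {x} {y} = d x y := by
  obtain ⟨a, ha, b, hb, h⟩ := exists_setDist (d := d) (Set.singleton_nonempty x)
    (Set.singleton_nonempty y)
  rw [← h, Set.mem_singleton_iff.1 ha, Set.mem_singleton_iff.1 hb]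

theorem IsProj.setDist_eq {L : Set V} {x p : V} (h : IsProj d L x p) :
    setDist d {x} L = d x p := by
  obtain ⟨a, ha, b, hb, e⟩ := exists_setDist (d := d) (Set.singleton_nonempty x) ⟨p, h.1⟩
  refine le_antisymm (setDist_le rfl h.1) ?_
  rw [← e, Set.mem_singleton_iff.1 ha]
  exact h.2 b hb

theorem setDist_comm (hd : IsGeod d) (A B : Set V) : setDist d A B = setDist d B A := by
  unfold setDist
  congr 1
  ext n
  constructor <;> rintro ⟨a, ha, b, hb, h⟩ <;> exact ⟨b, hb, a, ha, by rw [hd.symm, h]⟩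

variable (hd : IsGeod d) (hy : Hyp d δ)
include hd hy

/-- A point almost between `x` and `y` is close to a point between them. -/
theorem exists_between_near {x y z : V} (h : d x z + d z y ≤ d x y + C) :
    ∃ z', d x z' + d z' y = d x y ∧ d z z' ≤ C + δ := by
  by_cases hxz : d x z ≤ d x y
  · obtain ⟨z', h1, h2⟩ := hd.mid x y _ hxz
    refine ⟨z', by omega, ?_⟩
    have := hd.symm z x
    have := hd.symm z' x
    have := hd.symm x z'
    have := hd.symm y z'
    have := hd.symm y x
    have := hd.symm z' z
    rcases hy z z' x y with h | h <;> omega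
  · refine ⟨y, by simp [hd.self], by omega⟩

/-- Triangles are thin. -/
theorem between_thin {x y z : V} (m : V) (h : d x z + d z y = d x y) :
    d x z + d z m ≤ d x m + δ ∨ d m z + d z y ≤ d m y + δ := by
  have := hd.symm m y
  have := hd.symm m z
  have := hd.symm z y
  rcases hy x y z m with h' | h' <;> omega

theorem between_thin_near {x y z : V} (m : V) (h : d x z + d z y = d x y) :
    ∃ z', d z z' ≤ 2 * δ ∧ (d x z' + d z' m = d x m ∨ d m z' + d z' y = d m y) := by
  rcases between_thin hd hy m h with h | h
  · obtain ⟨z', h1, h2⟩ := exists_between_near hd hy h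
    exact ⟨z', by omega, Or.inl h1⟩
  · obtain ⟨z', h1, h2⟩ := exists_between_near hd hy h
    exact ⟨z', by omega, Or.inr h1⟩

omit hy in
theorem QC.near_of_between {L : Set V} (hL : QC d C L) {x y z : V} (hx : x ∈ L) (hy' : y ∈ L)
    (h : d x z + d z y = d x y) : ∃ p ∈ L, d z p ≤ C := by
  obtain ⟨p, hp, hm⟩ := exists_proj d hL.1 z
  have h1 := hL.2 z p hp hm x hx
  have h2 := hL.2 z p hp hm y hy'
  have := hd.symm z x
  have := hd.symm p x
  have := hd.tri x p y
  exact ⟨p, hp, by omega⟩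

/-- The basic projection estimate. -/
theorem QC.proj_proj {L : Set V} (hL : QC d C L) {x y p q : V} (hp : IsProj d L x p)
    (hq : IsProj d L y q) :
    d x p + d p q + d q y ≤ d x y + (2 * C + δ) ∨ 2 * d p q ≤ 2 * C + δ := by
  have h1 := hL.2 x p hp.1 hp.2 q hq.1
  have h2 := hL.2 y q hq.1 hq.2 p hp.1
  have := hd.symm q p
  have := hd.symm y q
  have := hd.symm y p
  have := hd.symm q y
  have := hd.symm y x
  rcases hy x q y p with h | h <;> omega

end

/-- Walks of length `n` for the relation `r` with vertices satisfying `P`. -/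
inductive Reach {V : Type*} (r : V → V → Prop) (P : V → Prop) : ℕ → V → V → Prop
  | refl (x) : P x → Reach r P 0 x x
  | step {n x y z} : Reach r P n x y → r y z → P z → Reach r P (n + 1) x z

section
variable {V : Type*} {r r' : V → V → Prop} {P Q : V → Prop} {n m : ℕ} {x y z : V}

namespace Reach

theorem right (h : Reach r P n x y) : P y := by
  cases h <;> assumption

theorem left (h : Reach r P n x y) : P x := by
  induction h <;> assumption

theorem trans (h : Reach r P n x y) (h' : Reach r P m y z) : Reach r P (n + m) x z := by
  induction h' with
  | refl => exact h
  | step _ hr hp ih => exact (ih h).step hr hp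

theorem mono (h : Reach r P n x y) (hP : ∀ v, P v → Q v)
    (hr : ∀ u v, P u → P v → r u v → r' u v) : Reach r' Q n x y := by
  induction h with
  | refl x hx => exact .refl x (hP x hx)
  | step h h1 h2 ih => exact ih.step (hr _ _ h.right h2 h1) (hP _ h2)

theorem single (hx : P x) (hy : P y) (h : r x y) : Reach r P 1 x y :=
  (Reach.refl x hx).step h hy

theorem symm (hs : ∀ u v, r u v → r v u) (h : Reach r P n x y) : Reach r P n y x := by
  induction h with
  | refl x hx => exact .refl x hx
  | @step n x y z h h1 h2 ih =>
    rw [add_comm]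
    exact (single h2 h.right (hs _ _ h1)).trans ih

theorem split (h : Reach r P n x y) : ∀ a b, a + b = n →
    ∃ z, Reach r P a x z ∧ Reach r P b z y := by
  induction h with
  | refl x hx =>
    intro a b h
    obtain ⟨rfl, rfl⟩ : a = 0 ∧ b = 0 := by omega
    exact ⟨x, .refl x hx, .refl x hx⟩
  | @step n x y z h h1 h2 ih =>
    intro a b hab
    rcases b with _ | b
    · subst hab
      exact ⟨z, h.step h1 h2, .refl z h2⟩
    · obtain ⟨w, hw, hw'⟩ := ih a b (by omega)
      exact ⟨w, hw, hw'.step h1 h2⟩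

theorem zero_eq (h : Reach r P 0 x y) : x = y := by
  cases h; rfl

theorem one_rel (h : Reach r P 1 x y) : r x y := by
  cases h with
  | step h1 h2 => rwa [h1.zero_eq]

theorem exists_fun (h : Reach r P n x y) : ∃ f : ℕ → V, f 0 = x ∧ f n = y ∧
    (∀ i, i < n → r (f i) (f (i + 1))) ∧ ∀ i, i ≤ n → P (f i) := by
  induction h with
  | refl x hx => exact ⟨fun _ => x, rfl, rfl, by simp, by simp [hx]⟩
  | @step n x y z h h1 h2 ih =>
    obtain ⟨f, h0, hn, hf, hP⟩ := ih
    refine ⟨fun i => if i ≤ n then f i else z, by simp [h0], by simp, ?_, ?_⟩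
    · intro i hi
      rcases Nat.lt_or_ge i n with h' | h'
      · simpa [h'.le, Nat.succ_le_of_lt h'] using hf i h'
      · obtain rfl : i = n := by omega
        simpa [hn] using h1
    · intro i hi
      by_cases h' : i ≤ n
      · simpa [h'] using hP i h'
      · simpa [h'] using h2

theorem of_fun {f : ℕ → V} (hf : ∀ i, i < n → r (f i) (f (i + 1))) (hP : ∀ i, i ≤ n → P (f i))
    {i k : ℕ} (hk : i + k ≤ n) : Reach r P k (f i) (f (i + k)) := by
  induction k with
  | zero => exact .refl _ (hP _ (by omega))
  | succ k ih => exact (ih (by omega)).step (hf _ (by omega)) (hP _ hk)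

theorem of_fun' (hs : ∀ u v, r u v → r v u) {f : ℕ → V} (hf : ∀ i, i < n → r (f i) (f (i + 1)))
    (hP : ∀ i, i ≤ n → P (f i)) {i j : ℕ} (hi : i ≤ n) (hj : j ≤ n) :
    ∃ k, Reach r P k (f i) (f j) ∧ (k + i = j ∨ k + j = i) := by
  rcases le_total i j with h | h
  · obtain ⟨k, rfl⟩ := Nat.exists_eq_add_of_le h
    exact ⟨k, of_fun hf hP hj, by omega⟩
  · obtain ⟨k, rfl⟩ := Nat.exists_eq_add_of_le h
    exact ⟨k, (of_fun hf hP hi).symm hs, by omega⟩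

end Reach

/-- The path metric of a relation. -/
noncomputable def pathDist (r : V → V → Prop) (x y : V) : ℕ :=
  sInf {n | Reach r (fun _ => True) n x y}

theorem Reach.pathDist_le (h : Reach r P n x y) : pathDist r x y ≤ n :=
  Nat.sInf_le (h.mono (fun _ _ => trivial) fun _ _ _ _ h => h)

theorem isGeod_pathDist (hs : ∀ u v, r u v → r v u)
    (hc : ∀ x y, ∃ n, Reach r (fun _ => True) n x y) :
    IsGeod (pathDist r) ∧ ∀ x y, Reach r (fun _ => True) (pathDist r x y) x y := by
  have hr : ∀ x y, Reach r (fun _ => True) (pathDist r x y) x y := fun x y => Nat.sInf_mem (hc x y)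
  have hsy : ∀ x y, pathDist r x y ≤ pathDist r y x := fun x y => ((hr y x).symm hs).pathDist_le
  have ht : ∀ x y z, pathDist r x z ≤ pathDist r x y + pathDist r y z :=
    fun x y z => ((hr x y).trans (hr y z)).pathDist_le
  refine ⟨⟨fun x y => ⟨fun h => ?_, ?_⟩, fun x y => le_antisymm (hsy x y) (hsy y x), ht, ?_⟩, hr⟩
  · have := hr x y
    rw [h] at this
    exact this.zero_eq
  · rintro rfl
    exact Nat.le_zero.1 (Reach.refl (r := r) (P := fun _ => True) x trivial).pathDist_le
  · intro x y k hk
    obtain ⟨z, h1, h2⟩ := (hr x y).split k (pathDist r x y - k) (by omega)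
    have := ht x z y
    have := h1.pathDist_le
    have := h2.pathDist_le
    exact ⟨z, by omega, by omega⟩

/-- Adjacency in the cone-off. -/
def ConeAdj {Y : Type*} (d : V → V → ℕ) (L : Y → Set V) (x y : V) : Prop :=
  d x y ≤ 1 ∨ ∃ c, x ∈ L c ∧ y ∈ L c

/-- The metric of the cone-off. -/
noncomputable abbrev coneDist {Y : Type*} (d : V → V → ℕ) (L : Y → Set V) : V → V → ℕ :=
  pathDist (ConeAdj d L)

end

section
variable {V Y : Type*} {d : V → V → ℕ} {L : Y → Set V} {δ C Δ : ℕ}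
variable (hd : IsGeod d)
include hd

theorem ConeAdj.symm (u v : V) (h : ConeAdj d L u v) : ConeAdj d L v u := by
  rcases h with h | ⟨c, h, h'⟩
  · exact Or.inl (hd.symm u v ▸ h)
  · exact Or.inr ⟨c, h', h⟩

theorem coneReach_dist (x y : V) : Reach (ConeAdj d L) (fun _ => True) (d x y) x y := by
  generalize h : d x y = n
  induction n generalizing y with
  | zero => rw [(hd.zero x y).1 h]; exact .refl _ trivial
  | succ n ih =>
    obtain ⟨z, hz, hz'⟩ := hd.mid x y n (by omega)
    exact (ih z hz).step (Or.inl (by omega)) trivial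

theorem isGeod_cone : IsGeod (coneDist d L) :=
  (isGeod_pathDist (ConeAdj.symm hd) fun x y => ⟨_, coneReach_dist hd x y⟩).1

theorem cone_reach (x y : V) : Reach (ConeAdj d L) (fun _ => True) (coneDist d L x y) x y :=
  (isGeod_pathDist (ConeAdj.symm hd) fun x y => ⟨_, coneReach_dist hd x y⟩).2 x y

theorem cone_le (x y : V) : coneDist d L x y ≤ d x y :=
  (coneReach_dist hd x y).pathDist_le

omit hd in
theorem cone_le_one {x y : V} {c : Y} (hx : x ∈ L c) (hy : y ∈ L c) : coneDist d L x y ≤ 1 :=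
  (Reach.single (r := ConeAdj d L) (P := fun _ => True) trivial trivial (Or.inr ⟨c, hx, hy⟩)).pathDist_le

variable (hy : Hyp d δ) (hL : ∀ c, QC d C (L c))
include hy hL

theorem cone_walk_near {P : V → Prop} {z : V} (k : ℕ) : ∀ {n : ℕ} {x y : V}, n ≤ 2 ^ k →
    Reach (ConeAdj d L) P n x y → d x z + d z y = d x y →
    ∃ v, P v ∧ coneDist d L z v ≤ k * (2 * δ) + (C + 1) := by
  have hc := isGeod_cone (L := L) hd
  induction k generalizing z with
  | zero =>
    intro n x y hn h hz
    have hx := h.left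
    have hy' := h.right
    obtain rfl | rfl : n = 0 ∨ n = 1 := by rw [pow_zero] at hn; omega
    · have := h.zero_eq
      subst this
      have : z = x := by
        rw [hd.self] at hz
        exact ((hd.zero x z).1 (by omega)).symm
      subst this
      exact ⟨z, hx, by rw [hc.self]; omega⟩
    · rcases h.one_rel with h | ⟨c, h1, h2⟩
      · refine ⟨x, hx, ?_⟩
        have := cone_le (L := L) hd z x
        have := hd.symm x z
        omega
      · obtain ⟨p, hp, hzp⟩ := (hL c).near_of_between hd h1 h2 hz
        refine ⟨x, hx, ?_⟩
        have := hc.tri z p x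
        have := cone_le (L := L) hd z p
        have := cone_le_one (d := d) hp h1
        omega
  | succ k ih =>
    intro n x y hn h hz
    obtain ⟨m, h1, h2⟩ := h.split (n / 2) (n - n / 2) (by omega)
    have hn' : n / 2 ≤ 2 ^ k ∧ n - n / 2 ≤ 2 ^ k := by
      rw [pow_succ] at hn; omega
    obtain ⟨z', hz', h' | h'⟩ := between_thin_near hd hy m hz
    · obtain ⟨v, hv, hv'⟩ := ih hn'.1 h1 h'
      refine ⟨v, hv, ?_⟩
      have := hc.tri z z' v
      have := cone_le (L := L) hd z z'
      have : (k + 1) * (2 * δ) = k * (2 * δ) + 2 * δ := by ring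
      omega
    · obtain ⟨v, hv, hv'⟩ := ih hn'.2 h2 h'
      refine ⟨v, hv, ?_⟩
      have := hc.tri z z' v
      have := cone_le (L := L) hd z z'
      have : (k + 1) * (2 * δ) = k * (2 * δ) + 2 * δ := by ring
      omega

end

/-- The Morse constant of the cone-off. -/
def morseConst (δ C : ℕ) : ℕ := 2 ^ (2 * δ + (C + 1) + 11)

theorem le_morseConst {δ C K : ℕ}
    (h : ∀ k, 8 * K ≤ 2 ^ k → K ≤ k * (2 * δ) + (C + 1)) : K ≤ morseConst δ C := by
  have key : ∀ k, 11 ≤ k → 16 * k * k ≤ 2 ^ k := by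
    intro k hk
    induction k, hk using Nat.le_induction with
    | base => norm_num
    | succ k hk ih => rw [pow_succ]; nlinarith
  unfold morseConst
  by_contra hK
  obtain ⟨k, hk⟩ : ∃ k, 8 * K ≤ 2 ^ k := ⟨8 * K, Nat.lt_two_pow_self.le⟩
  classical
  have hex : ∃ k, 8 * K ≤ 2 ^ k := ⟨k, hk⟩
  obtain ⟨h1, h2⟩ := And.intro (Nat.find_spec hex) (fun m => Nat.find_min hex (m := m))
  set k := Nat.find hex with hkdef
  have h3 := h k h1
  have h4 : 2 * δ + (C + 1) + 11 < k := by
    by_contra h'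
    have : 2 ^ k ≤ 2 ^ (2 * δ + (C + 1) + 11) := Nat.pow_le_pow_right (by norm_num) (by omega)
    omega
  have h5 := h2 (k - 1) (by omega)
  have h6 : 2 ^ k = 2 * 2 ^ (k - 1) := by
    rw [← pow_succ']; congr 1; omega
  have h7 := key k (by omega)
  nlinarith

section
variable {V Y : Type*} {d : V → V → ℕ} {L : Y → Set V} {δ C Δ : ℕ}

theorem exists_far_point (hd : IsGeod d) (P : V → Prop) {K : ℕ} {x z : V} (hx : P x)
    (hP : ∀ v, P v → K ≤ coneDist d L z v)
    (hI : ∀ w, d x w + d w z = d x z → ∃ u, P u ∧ coneDist d L w u ≤ K) :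
    ∃ x' u k, d x x' + d x' z = d x z ∧ coneDist d L x' z ≤ 2 * K ∧ P u ∧
      coneDist d L x' u ≤ K ∧ k ≤ K ∧
      Reach (ConeAdj d L) (fun v => K ≤ coneDist d L z v) k x' u := by
  have hc := isGeod_cone (L := L) hd
  classical
  have hz0 : d x z + d z z = d x z ∧ coneDist d L z z ≤ 2 * K := by
    rw [hd.self, hc.self]; omega
  let S : Set V := {w | d x w + d w z = d x z ∧ coneDist d L w z ≤ 2 * K}
  obtain ⟨x', ⟨h1, h2⟩, hmin⟩ := WellFounded.has_min (measure fun w => d x w).wf S ⟨z, hz0⟩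
  by_cases hxx : x = x'
  · subst hxx
    exact ⟨x, x, 0, h1, h2, hx, by rw [hc.self]; omega, by omega, .refl _ (hP x hx)⟩
  · obtain ⟨u, hu, hu'⟩ := hI x' h1
    refine ⟨x', u, _, h1, h2, hu, hu', hu', ?_⟩
    have hpos : d x x' ≠ 0 := fun h => hxx ((hd.zero _ _).1 h)
    obtain ⟨w, hw1, hw2⟩ := hd.mid x x' (d x x' - 1) (by omega)
    have hwz : d w z = d x' z + 1 := by
      have := hd.tri x w z
      have := hd.tri w x' z
      omega
    have hwK : 2 * K < coneDist d L w z := by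
      by_contra hcon
      exact hmin w ⟨by omega, by omega⟩ (show d x w < d x x' by omega)
    have hge : 2 * K ≤ coneDist d L x' z := by
      have := hc.tri w x' z
      have := cone_le (L := L) hd w x'
      omega
    obtain ⟨g, h0, hn, hg, -⟩ := (cone_reach (L := L) hd x' u).exists_fun
    have hQ : ∀ i, i ≤ coneDist d L x' u → K ≤ coneDist d L z (g i) := by
      intro i hi
      have h3 := (Reach.of_fun (i := 0) (k := i) (P := fun _ => True) hg (by simp)
        (by omega)).pathDist_le
      rw [h0, zero_add] at h3
      have := hc.tri x' (g i) z
      have := hc.symm (g i) z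
      simp only [coneDist] at *
      omega
    have := Reach.of_fun (P := fun v => K ≤ coneDist d L z v) (i := 0)
      (k := coneDist d L x' u) hg hQ (by omega)
    rwa [h0, zero_add, hn] at this

variable (hd : IsGeod d) (hy : Hyp d δ) (hL : ∀ c, QC d C (L c))
include hd hy hL

/-- Geodesics of `d` stay close to geodesics of the cone-off. -/
theorem morse {x y z : V} (hz : d x z + d z y = d x y) {f : ℕ → V} {n : ℕ} (h0 : f 0 = x)
    (hn : f n = y) (hf : ∀ i, i < n → ConeAdj d L (f i) (f (i + 1)))
    (hgeo : n = coneDist d L x y) :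
    ∃ i, i ≤ n ∧ coneDist d L z (f i) ≤ morseConst δ C := by
  have hc := isGeod_cone (L := L) hd
  set P : V → Prop := fun v => ∃ i, i ≤ n ∧ v = f i with hPdef
  have hPne : {v | P v}.Nonempty := ⟨f 0, 0, by omega, rfl⟩
  let m : V → ℕ := fun w => setDist (coneDist d L) {w} {v | P v}
  have hm : ∀ w, ∃ u, P u ∧ coneDist d L w u = m w := by
    intro w
    obtain ⟨a, ha, b, hb, h⟩ := exists_setDist (d := coneDist d L) (Set.singleton_nonempty w) hPne
    rw [Set.mem_singleton_iff.1 ha] at h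
    exact ⟨b, hb, h⟩
  have hm' : ∀ w u, P u → m w ≤ coneDist d L w u := fun w u hu => setDist_le rfl hu
  have hPx : P x := ⟨0, by omega, h0.symm⟩
  have hPy : P y := ⟨n, le_rfl, hn.symm⟩
  set S : Set ℕ := {k | ∃ w, d x w + d w y = d x y ∧ m w = k} with hS
  have hSb : BddAbove S := by
    refine ⟨d x y, ?_⟩
    rintro k ⟨w, hw, rfl⟩
    have := hm' w y hPy
    have := cone_le (L := L) hd w y
    omega
  obtain ⟨w, hw, hwK⟩ := Nat.sSup_mem (s := S) ⟨m z, z, hz, rfl⟩ hSb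
  have hmax : ∀ w', d x w' + d w' y = d x y → m w' ≤ m w := fun w' h' => by
    rw [hwK]; exact le_csSup hSb ⟨w', h', rfl⟩
  suffices h : m w ≤ morseConst δ C by
    obtain ⟨u, ⟨i, hi, rfl⟩, hu'⟩ := hm z
    exact ⟨i, hi, by have := hmax z hz; omega⟩
  apply le_morseConst
  intro k hk
  have hfar := hm' w
  obtain ⟨x', u, k1, hx1, hx2, hx3, hx4, hx5, hx6⟩ :=
    exists_far_point (z := w) hd P hPx hfar (fun w' hw' => by
      obtain ⟨u, hu, hu'⟩ := hm w'
      have := hd.tri x w' y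
      have := hd.tri w' w y
      exact ⟨u, hu, by have := hmax w' (by omega); omega⟩)
  obtain ⟨y', v, k2, hy1, hy2, hy3, hy4, hy5, hy6⟩ :=
    exists_far_point (z := w) hd P hPy hfar (fun w' hw' => by
      obtain ⟨u, hu, hu'⟩ := hm w'
      have := hd.tri x w' y
      have := hd.tri x w w'
      have := hd.symm y w'
      have := hd.symm y w
      have := hd.symm w' w
      exact ⟨u, hu, by have := hmax w' (by omega); omega⟩)
  obtain ⟨i, hi, rfl⟩ := hx3
  obtain ⟨j, hj, rfl⟩ := hy3
  obtain ⟨k3, hk3, hk3'⟩ := Reach.of_fun' (P := P) (ConeAdj.symm hd) hf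
    (fun i hi => ⟨i, hi, rfl⟩) hi hj
  have hk3K : k3 ≤ coneDist d L (f i) (f j) := by
    have a1 := (Reach.of_fun (i := 0) (k := i) (P := fun _ => True) hf (by simp)
        (by omega)).pathDist_le
    have a2 := (Reach.of_fun (i := 0) (k := j) (P := fun _ => True) hf (by simp)
        (by omega)).pathDist_le
    have a3 := (Reach.of_fun (i := i) (k := n - i) (P := fun _ => True) hf (by simp)
        (by omega)).pathDist_le
    have a4 := (Reach.of_fun (i := j) (k := n - j) (P := fun _ => True) hf (by simp)
        (by omega)).pathDist_le
    rw [zero_add, h0] at a1 a2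
    rw [show i + (n - i) = n by omega, hn] at a3
    rw [show j + (n - j) = n by omega, hn] at a4
    have := hc.tri x (f i) y
    have := hc.tri (f i) (f j) y
    have := hc.tri x (f j) y
    have := hc.tri (f j) (f i) y
    have := hc.symm (f i) (f j)
    simp only [coneDist] at *
    omega
  have hwalk := (hx6.trans (hk3.mono (fun v hv => hfar v hv) fun _ _ _ _ h => h)).trans
    (hy6.symm (ConeAdj.symm hd))
  have hlen : k1 + k3 + k2 ≤ 2 ^ k := by
    have := hc.tri (f i) x' (f j)
    have := hc.tri x' w (f j)
    have := hc.tri w y' (f j)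
    have := hc.symm x' (f i)
    have := hc.symm y' w
    omega
  have hbet : d x' w + d w y' = d x' y' := by
    have := hd.tri x x' y
    have := hd.tri x' y' y
    have := hd.tri x' w y'
    have := hd.symm y y'
    have := hd.symm y' w
    have := hd.symm y w
    omega
  obtain ⟨v, hv1, hv2⟩ := cone_walk_near hd hy hL k hlen hwalk hbet
  exact hv1.trans hv2

/-- Almost betweenness passes to the cone-off. -/
theorem cone_between {x y z : V} {E : ℕ} (hz : d x z + d z y ≤ d x y + E) :
    coneDist d L x z + coneDist d L z y ≤
      coneDist d L x y + 2 * (morseConst δ C + (E + δ)) := by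
  have hc := isGeod_cone (L := L) hd
  obtain ⟨z', hz', hzz⟩ := exists_between_near hd hy hz
  obtain ⟨f, h0, hn, hf, -⟩ := (cone_reach (L := L) hd x y).exists_fun
  obtain ⟨i, hi, hzi⟩ := morse hd hy hL hz' h0 hn hf rfl
  have a1 := (Reach.of_fun (i := 0) (k := i) (P := fun _ => True) hf (by simp)
        (by omega)).pathDist_le
  have a3 := (Reach.of_fun (i := i) (k := coneDist d L x y - i) (P := fun _ => True) hf (by simp)
        (by omega)).pathDist_le
  rw [zero_add, h0] at a1
  rw [show i + (coneDist d L x y - i) = coneDist d L x y by omega, hn] at a3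
  have := cone_le (L := L) hd z z'
  have := hc.tri z z' (f i)
  have := hc.tri x (f i) z
  have := hc.tri z (f i) y
  have := hc.symm z (f i)
  simp only [coneDist] at *
  omega

/-- The hyperbolicity constant of the cone-off. -/
def coneConst (δ C : ℕ) : ℕ := 4 * (morseConst δ C + 6 * δ + 3)

omit hL in
theorem exists_center (x y w : V) : ∃ m, d x m + d m y ≤ d x y + (δ + 1) ∧
    d x m + d m w ≤ d x w + (δ + 1) ∧ d y m + d m w ≤ d y w + (δ + 1) := by
  have h1 := hd.tri x w y
  have h2 := hd.tri x y w
  have h3 := hd.tri y x w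
  have s1 := hd.symm w y
  have s2 := hd.symm y x
  obtain ⟨m, hm, hm'⟩ := hd.mid x y ((d x y + d x w - d y w) / 2) (by omega)
  have s3 := hd.symm w x
  have s4 := hd.symm y m
  have s5 := hd.symm w m
  have s6 := hd.symm m x
  refine ⟨m, by omega, ?_⟩
  rcases hy x y w m with h | h <;> constructor <;> omega

/-- The cone-off is hyperbolic with a constant depending only on `δ` and `C`. -/
theorem hyp_cone : Hyp (coneDist d L) (coneConst δ C) := by
  have hc := isGeod_cone (L := L) hd
  intro x z y w
  unfold coneConst
  obtain ⟨m, hm1, hm2, hm3⟩ := exists_center hd hy x y w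
  obtain ⟨n, hn1, hn2, hn3⟩ := exists_center hd hy y z w
  have h4 := hy w y m n
  have t0 := hc.tri x m z
  have t1 := hc.tri y m w
  have t2 := hc.tri x n z
  have t3 := hc.tri y n w
  have e1 := hc.symm m y
  have e2 := hc.symm n y
  have e3 := hc.symm m z
  have e4 := hc.symm n x
  have e5 := hc.symm w m
  have e6 := hc.symm w z
  have e7 := hc.symm w n
  have e8 := hc.symm w x
  have e9 := hc.symm z y
  have e10 := hc.symm z n
  have f1 := hd.symm y m
  have f2 := hd.symm m w
  have f3 := hd.symm y n
  have f4 := hd.symm n w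
  have f5 := hd.symm y w
  have f6 := hd.symm z w
  have f7 := hd.symm n z
  have f8 := hd.symm x w
  have f9 := hd.symm m x
  have f10 := hd.symm m n
  have t4 := hd.tri m n z
  have t5 := hd.tri n m x
  rcases le_total (d w m) (d w n) with h | h
  · left
    have := cone_between hd hy hL (x := x) (y := y) (z := m) (E := δ + 1) (by omega)
    have := cone_between hd hy hL (x := w) (y := z) (z := m) (E := 5 * δ + 3) (by omega)
    omega
  · right
    have := cone_between hd hy hL (x := y) (y := z) (z := n) (E := δ + 1) (by omega)
    have := cone_between hd hy hL (x := w) (y := x) (z := n) (E := 5 * δ + 3) (by omega)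
    omega

end
section
variable {V Y : Type*} {d : V → V → ℕ} {L : Y → Set V} {δ C Δ : ℕ}

/-- Distinct members of the family have bounded projection to each other. -/
def SmallOverlap (d : V → V → ℕ) (L : Y → Set V) (Δ : ℕ) : Prop :=
  ∀ c c', c ≠ c' → ∀ u v p q, u ∈ L c' → v ∈ L c' → IsProj d (L c) u p → IsProj d (L c) v q →
    d p q ≤ Δ

/-- Projections larger than this constant are seen by cone-off geodesics. -/
def bgiConst (δ C Δ : ℕ) : ℕ :=
  (6 * (morseConst δ C + 2 * C + 2 * δ) + 13) * (Δ + 2 * C + δ + 1) + 2 * (2 * C + δ)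

theorem exists_away_point (hd : IsGeod d) (K : ℕ) (c : Y) {x p : V} (hp : p ∈ L c) :
    ∃ z, d x z + d z p = d x p ∧ coneDist d L z p ≤ K + 6 ∧
      (z = x ∨ ∀ v, coneDist d L z v ≤ K → v ∉ L c) := by
  have hc := isGeod_cone (L := L) hd
  let S : Set V := {w | d x w + d w p = d x p ∧ coneDist d L w p ≤ K + 6}
  obtain ⟨z, ⟨h1, h2⟩, hmin⟩ := WellFounded.has_min (measure fun w => d x w).wf S
    ⟨p, by rw [hd.self]; omega, by rw [hc.self]; omega⟩
  refine ⟨z, h1, h2, ?_⟩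
  by_cases hxx : z = x
  · exact Or.inl hxx
  · right
    intro v hv hvc
    have hpos : d x z ≠ 0 := fun h => hxx ((hd.zero _ _).1 h).symm
    obtain ⟨w, hw1, hw2⟩ := hd.mid x z (d x z - 1) (by omega)
    have hK : K + 6 < coneDist d L w p := by
      by_contra hcon
      have := hd.tri w z p
      have := hd.tri x w p
      exact hmin w ⟨by omega, by omega⟩ (show d x w < d x z by omega)
    have := hc.tri w z p
    have := hc.tri z v p
    have := cone_le (L := L) hd w z
    have := cone_le_one (d := d) hvc hp
    omega

variable (hd : IsGeod d) (hy : Hyp d δ) (hL : ∀ c, QC d C (L c)) (hΔ : SmallOverlap d L Δ)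
include hd hy hL hΔ

theorem walk_proj (c : Y) {n : ℕ} {x y : V}
    (h : Reach (fun u v => ConeAdj d L u v ∧ ¬ (u ∈ L c ∧ v ∈ L c)) (fun _ => True) n x y) :
    ∀ p q, IsProj d (L c) x p → IsProj d (L c) y q →
      d p q ≤ n * (Δ + 2 * C + δ + 1) + (2 * C + δ) := by
  induction h with
  | refl x hx =>
    intro p q hp hq
    have := hd.self x
    rcases (hL c).proj_proj hd hy hp hq with h | h <;> omega
  | @step n x y z h h1 h2 ih =>
    intro p q hp hq
    obtain ⟨t, ht⟩ := exists_proj d (hL c).1 y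
    have h3 := ih p t hp ht
    have h4 : d t q ≤ Δ + 2 * C + δ + 1 := by
      obtain ⟨h1 | ⟨c', h1, h1'⟩, h5⟩ := h1
      · rcases (hL c).proj_proj hd hy ht hq with h | h <;> omega
      · have hcc : c ≠ c' := by
          rintro rfl
          exact h5 ⟨h1, h1'⟩
        have := hΔ c c' hcc y z t q h1 h1' ht hq
        omega
    have := hd.tri p t q
    rw [add_mul]
    omega

/-- Bounded geodesic image. -/
theorem bgi {c : Y} {x y p q : V} (hp : IsProj d (L c) x p) (hq : IsProj d (L c) y q)
    (hB : bgiConst δ C Δ < d p q) :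
    ∃ a ∈ L c, ∃ b ∈ L c, coneDist d L x a + 1 + coneDist d L b y ≤ coneDist d L x y := by
  have hc := isGeod_cone (L := L) hd
  obtain ⟨f, h0, hn, hf, -⟩ := (cone_reach (L := L) hd x y).exists_fun
  by_contra hcon
  have hav : ∀ i, i < coneDist d L x y →
      ConeAdj d L (f i) (f (i + 1)) ∧ ¬ (f i ∈ L c ∧ f (i + 1) ∈ L c) := by
    refine fun i hi => ⟨hf i hi, fun ⟨h1, h2⟩ => hcon ⟨f i, h1, f (i + 1), h2, ?_⟩⟩
    have a1 := (Reach.of_fun (i := 0) (k := i) (P := fun _ => True) hf (by simp)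
        (by omega)).pathDist_le
    have a3 := (Reach.of_fun (i := i + 1) (k := coneDist d L x y - (i + 1)) (P := fun _ => True)
      hf (by simp) (by omega)).pathDist_le
    rw [zero_add, h0] at a1
    rw [show i + 1 + (coneDist d L x y - (i + 1)) = coneDist d L x y by omega, hn] at a3
    simp only [coneDist] at *
    omega
  unfold bgiConst at hB
  set S := Δ + 2 * C + δ + 1 with hS
  set K := morseConst δ C + 2 * C + 2 * δ with hK
  have hlong : d x p + d p q + d q y ≤ d x y + (2 * C + δ) := by
    rcases (hL c).proj_proj hd hy hp hq with h | h
    · exact h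
    · exfalso
      have : S * 13 ≤ (6 * K + 13) * S := by nlinarith
      omega
  have near : ∀ z, d x z + d z y ≤ d x y + (2 * C + δ) →
      ∃ i, i ≤ coneDist d L x y ∧ coneDist d L z (f i) ≤ K := by
    intro z hz
    obtain ⟨z', hz', hzz⟩ := exists_between_near hd hy hz
    obtain ⟨i, hi, hzi⟩ := morse hd hy hL hz' h0 hn hf rfl
    have := cone_le (L := L) hd z z'
    have := hc.tri z z' (f i)
    exact ⟨i, hi, by omega⟩
  have avoid : ∀ z w, (∀ v, coneDist d L z v ≤ K → v ∉ L c) → coneDist d L z w ≤ K →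
      Reach (fun u v => ConeAdj d L u v ∧ ¬ (u ∈ L c ∧ v ∈ L c)) (fun _ => True)
        (coneDist d L z w) z w := by
    intro z w hz hw
    obtain ⟨g, g0, gn, hg, -⟩ := (cone_reach (L := L) hd z w).exists_fun
    have := Reach.of_fun (r := fun u v => ConeAdj d L u v ∧ ¬ (u ∈ L c ∧ v ∈ L c))
      (P := fun _ => True) (f := g) (n := coneDist d L z w) (i := 0) (k := coneDist d L z w)
      (fun i hi => ⟨hg i hi, fun h => hz (g i) ?_ h.1⟩) (by simp) (by omega)
    · rwa [zero_add, g0, gn] at this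
    · have a1 := (Reach.of_fun (i := 0) (k := i) (P := fun _ => True) hg (by simp)
        (by omega)).pathDist_le
      rw [zero_add, g0] at a1
      simp only [coneDist] at *
      omega
  have hr : ∀ u v, (ConeAdj d L u v ∧ ¬ (u ∈ L c ∧ v ∈ L c)) →
      (ConeAdj d L v u ∧ ¬ (v ∈ L c ∧ u ∈ L c)) :=
    fun u v h => ⟨ConeAdj.symm hd u v h.1, fun h' => h.2 h'.symm⟩
  obtain ⟨z₁, hz1, hz1', hz1''⟩ := exists_away_point (L := L) hd K c (x := x) hp.1
  obtain ⟨z₂, hz2, hz2', hz2''⟩ := exists_away_point (L := L) hd K c (x := y) hq.1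
  have proj_of : ∀ x z p, IsProj d (L c) x p → d x z + d z p = d x p → IsProj d (L c) z p := by
    intro x z p hp h
    refine ⟨hp.1, fun q hq => ?_⟩
    have := hp.2 q hq
    have := hd.tri x z q
    omega
  have hpz := proj_of _ _ _ hp hz1
  have hqz := proj_of _ _ _ hq hz2
  have n1 : ∃ i, i ≤ coneDist d L x y ∧ ∃ k, k ≤ K ∧ coneDist d L z₁ (f i) ≤ K ∧
      Reach (fun u v => ConeAdj d L u v ∧ ¬ (u ∈ L c ∧ v ∈ L c)) (fun _ => True) k z₁ (f i) := by
    rcases hz1'' with h | h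
    · exact ⟨0, by omega, 0, by omega, by rw [h, h0, hc.self]; omega,
        by rw [h, h0]; exact .refl _ trivial⟩
    · obtain ⟨i, hi, hi'⟩ := near z₁ (by
        have := hd.tri z₁ p y
        have := hd.tri p q y
        have := hd.symm q y
        omega)
      exact ⟨i, hi, _, hi', hi', avoid _ _ h hi'⟩
  have n2 : ∃ i, i ≤ coneDist d L x y ∧ ∃ k, k ≤ K ∧ coneDist d L z₂ (f i) ≤ K ∧
      Reach (fun u v => ConeAdj d L u v ∧ ¬ (u ∈ L c ∧ v ∈ L c)) (fun _ => True) k z₂ (f i) := by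
    rcases hz2'' with h | h
    · exact ⟨_, le_rfl, 0, by omega, by rw [h, hn, hc.self]; omega,
        by rw [h, hn]; exact .refl _ trivial⟩
    · obtain ⟨i, hi, hi'⟩ := near z₂ (by
        have := hd.tri x p z₂
        have := hd.tri p q z₂
        have := hd.symm q z₂
        have := hd.symm y z₂
        have := hd.symm y q
        omega)
      exact ⟨i, hi, _, hi', hi', avoid _ _ h hi'⟩
  obtain ⟨i, hi, k1, hk1, hi1, hw1⟩ := n1
  obtain ⟨j, hj, k2, hk2, hj1, hw2⟩ := n2
  obtain ⟨k3, hw3, hk3⟩ := Reach.of_fun' (P := fun _ => True) hr hav (by simp) hi hj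
  have hk3' : k3 ≤ coneDist d L (f i) (f j) := by
    have a1 := (Reach.of_fun (i := 0) (k := i) (P := fun _ => True) hf (by simp)
        (by omega)).pathDist_le
    have a2 := (Reach.of_fun (i := 0) (k := j) (P := fun _ => True) hf (by simp)
        (by omega)).pathDist_le
    have a3 := (Reach.of_fun (i := i) (k := coneDist d L x y - i) (P := fun _ => True) hf (by simp)
        (by omega)).pathDist_le
    have a4 := (Reach.of_fun (i := j) (k := coneDist d L x y - j) (P := fun _ => True) hf (by simp)
        (by omega)).pathDist_le
    rw [zero_add, h0] at a1 a2
    rw [show i + (coneDist d L x y - i) = coneDist d L x y by omega, hn] at a3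
    rw [show j + (coneDist d L x y - j) = coneDist d L x y by omega, hn] at a4
    have := hc.tri x (f i) y
    have := hc.tri (f i) (f j) y
    have := hc.tri x (f j) y
    have := hc.tri (f j) (f i) y
    have := hc.symm (f i) (f j)
    simp only [coneDist] at *
    omega
  have hwalk := walk_proj hd hy hL hΔ c ((hw1.trans hw3).trans (hw2.symm hr)) p q hpz hqz
  have hlen : k1 + k3 + k2 ≤ 6 * K + 13 := by
    have := hc.tri (f i) z₁ (f j)
    have := hc.tri z₁ p (f j)
    have := hc.tri p q (f j)
    have := hc.tri q z₂ (f j)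
    have := hc.symm z₁ (f i)
    have := hc.symm z₂ q
    have := cone_le_one (d := d) hp.1 hq.1
    omega
  rw [← hS] at hwalk
  have := Nat.mul_le_mul_right S hlen
  omega

end

/-- The setting of the windmill argument: an action on apices `Y` and points `Q ⊇ Y`, with
angles `ρ` and levels `φ`. -/
structure Windmill (G Y Q : Type*) [Group G] [MulAction G Y] [MulAction G Q] where
  ι : Y → Q
  x : Q
  ρ : Y → Q → Q → ℕ
  φ : Y → ℕ
  B : ℕ
  Lh : ℕ
  L : ℕ
  ι_inj : Function.Injective ι
  ι_smul : ∀ (g : G) c, ι (g • c) = g • ι c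
  base : ∀ (g : G) c, g • x ≠ ι c
  tri : ∀ c p e r, e ≠ ι c → ρ c p r ≤ ρ c p e + ρ c e r
  symm : ∀ c p r, ρ c p r = ρ c r p
  equi : ∀ (g : G) c p r, ρ (g • c) (g • p) (g • r) = ρ c p r
  refl : ∀ c, ρ c x x ≤ B
  self : ∀ c p, ρ c (ι c) p ≤ B
  beh : ∀ c c' p, c ≠ c' → B < ρ c p (ι c') → ρ c' p (ι c) ≤ B
  v1 : ∀ f c, B < ρ f x (ι c) → φ f < φ c
  v2 : ∀ f c, Lh < ρ f x (ι c) → ∃ g : G, g • f = f ∧ φ (g • c) < φ c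
  rot : ∀ (g : G) c, g • c = c → g ≠ 1 → L ≤ ρ c x (g • x)
  B_pos : 0 < B
  B_le : B ≤ Lh
  le_L : Lh + 40 * B ≤ L

namespace Windmill
variable {G Y Q : Type*} [Group G] [MulAction G Y] [MulAction G Q] (w : Windmill G Y Q)

/-- The subgroup generated by rotations about apices of level less than `t`. -/
def N (t : ℕ) : Subgroup G := Subgroup.closure {g | ∃ c, w.φ c < t ∧ g • c = c}

/-- The apices in the orbit of apices of level less than `t`. -/
def Ys (t : ℕ) : Set Y := {c | ∃ n ∈ w.N t, w.φ (n • c) < t}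

/-- A point which is not rotated away from the base point at stage `t`. -/
def TRed (t : ℕ) (a : Q) : Prop :=
  (∀ c ∈ w.Ys t, a ≠ w.ι c) ∧ ∀ f ∈ w.Ys t, w.ρ f w.x a ≤ w.Lh

/-- `y` equals `a` or lies beyond `a` as seen from `c`. -/
def Bey (a : Q) (c : Y) (y : Q) : Prop :=
  y = a ∨ ∃ a', a = w.ι a' ∧ 2 * w.B < w.ρ a' y (w.ι c)

/-- Elements of `N (t + 1)` that are products with `m` rotations of level `t`. -/
def Wd (t : ℕ) : ℕ → G → Prop
  | 0, h => h ∈ w.N t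
  | m + 1, h => ∃ h₀ ∈ w.N t, ∃ c g h', w.φ c = t ∧ g • c = c ∧ Wd t m h' ∧ h = h₀ * g * h'

/-- The main statement of the induction. -/
def S (t : ℕ) : Prop := ∀ h ∈ w.N t, ∀ c, c ∉ w.Ys t → ∀ a b y z, w.TRed t a → w.TRed t b →
  w.ρ c w.x a ≤ w.B → w.ρ c (h • w.x) (h • b) ≤ w.B → w.Bey a c y → w.Bey (h • b) c z →
  w.ρ c y z ≤ 6 * w.B

variable {w} {t : ℕ}

theorem N_mono {s t : ℕ} (h : s ≤ t) : w.N s ≤ w.N t :=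
  Subgroup.closure_mono fun _ ⟨c, hc, hg⟩ => ⟨c, by omega, hg⟩

theorem Ys_mono {s t : ℕ} (h : s ≤ t) {c : Y} (hc : c ∈ w.Ys s) : c ∈ w.Ys t := by
  obtain ⟨n, hn, hc⟩ := hc
  exact ⟨n, N_mono h hn, by omega⟩

theorem mem_Ys {c : Y} (h : w.φ c < t) : c ∈ w.Ys t := ⟨1, one_mem _, by rwa [one_smul]⟩

theorem smul_mem_Ys {n : G} (hn : n ∈ w.N t) {c : Y} : n • c ∈ w.Ys t ↔ c ∈ w.Ys t := by
  constructor
  · rintro ⟨k, hk, h⟩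
    exact ⟨k * n, mul_mem hk hn, by rwa [mul_smul]⟩
  · rintro ⟨k, hk, h⟩
    exact ⟨k * n⁻¹, mul_mem hk (inv_mem hn), by rwa [mul_smul, inv_smul_smul]⟩

theorem mem_N_of_stab {c : Y} (hc : c ∈ w.Ys t) {g : G} (hg : g • c = c) : g ∈ w.N t := by
  obtain ⟨n, hn, h⟩ := hc
  have : n * g * n⁻¹ ∈ w.N t :=
    Subgroup.subset_closure ⟨n • c, h, by rw [mul_smul, mul_smul, inv_smul_smul, hg]⟩
  have h2 := mul_mem (mul_mem (inv_mem hn) this) hn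
  simpa [mul_assoc] using h2

theorem tred_base : w.TRed t w.x :=
  ⟨fun c _ h => w.base 1 c (by rwa [one_smul]), fun f _ => (w.refl f).trans w.B_le⟩

theorem TRed.anti {s t : ℕ} (h : s ≤ t) {a : Q} (ha : w.TRed t a) : w.TRed s a :=
  ⟨fun c hc => ha.1 c (Ys_mono h hc), fun f hf => ha.2 f (Ys_mono h hf)⟩

theorem tred_apex {c : Y} (h : w.φ c = t) (hc : c ∉ w.Ys t) : w.TRed t (w.ι c) := by
  refine ⟨fun c' hc' h' => hc (w.ι_inj h' ▸ hc'), fun f hf => ?_⟩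
  by_contra hcon
  obtain ⟨g, hg, hlt⟩ := w.v2 f c (not_le.1 hcon)
  exact hc ⟨g, mem_N_of_stab hf hg, by omega⟩

theorem rho_apex {c f : Y} (h : w.φ c = t) (hf : f ∉ w.Ys t) : w.ρ f w.x (w.ι c) ≤ w.B := by
  by_contra hcon
  exact hf (mem_Ys (by have := w.v1 f c (not_le.1 hcon); omega))

theorem equi' (g : G) (c : Y) (p r : Q) : w.ρ (g • c) p r = w.ρ c (g⁻¹ • p) (g⁻¹ • r) := by
  conv_rhs => rw [← w.equi g, smul_inv_smul, smul_inv_smul]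

theorem tri_base (g : G) (c : Y) (p r : Q) :
    w.ρ c p r ≤ w.ρ c p (g • w.x) + w.ρ c (g • w.x) r := w.tri _ _ _ _ (w.base g c)

theorem tri_x (c : Y) (p r : Q) :
    w.ρ c p r ≤ w.ρ c p w.x + w.ρ c w.x r := by simpa using tri_base (1 : G) c p r

theorem S.rho_base (hS : w.S t) {h : G} (hh : h ∈ w.N t) {c : Y} (hc : c ∉ w.Ys t) :
    w.ρ c w.x (h • w.x) ≤ 6 * w.B :=
  hS h hh c hc w.x w.x _ _ tred_base tred_base (w.refl c)
    (by rw [show c = h • h⁻¹ • c by simp, w.equi]; exact w.refl _) (Or.inl rfl) (Or.inl rfl)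

theorem Bey.rho_le {a y : Q} {c : Y} (h : w.Bey a c y) (hac : a ≠ w.ι c) (e : Q) :
    w.ρ c y e ≤ w.ρ c a e + w.B := by
  rcases h with rfl | ⟨a', rfl, h⟩
  · omega
  · have := w.tri c y (w.ι a') e hac
    have := w.beh a' c y (fun h => hac (h ▸ rfl)) (by have := w.B_pos; omega)
    omega

/-- Being beyond `a` from `c` persists when there is an apex `f` between `c` and `a`. -/
theorem Bey.rho_ge {a y : Q} {c f : Y} (h : w.Bey a c y) (haf : a ≠ w.ι f) (hcf : c ≠ f)
    (hf : 5 * w.B ≤ w.ρ f a (w.ι c)) : 2 * w.B < w.ρ f y (w.ι c) := by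
  have hB := w.B_pos
  rcases h with rfl | ⟨a', rfl, h⟩
  · omega
  · have hne : f ≠ a' := fun h => haf (h ▸ rfl)
    have h1 := w.beh f a' (w.ι c) hne (by rw [w.symm]; omega)
    have h2 := w.tri a' y (w.ι f) (w.ι c) (fun h => hne (w.ι_inj h))
    rw [w.symm a' (w.ι f)] at h2
    have h3 := w.beh a' f y hne.symm (by omega)
    have h4 := w.tri f (w.ι a') y (w.ι c) ?_
    · have := w.symm f (w.ι a') (w.ι c)
      have := w.symm f (w.ι a') y
      omega
    · rintro rfl
      have h5 := w.self f (w.ι a')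
      have : w.ρ a' (w.ι f) (w.ι c) ≤ w.B := by rw [w.symm]; exact h1
      omega

theorem smul_Wd {m : ℕ} {n h : G} (hn : n ∈ w.N t) (h' : w.Wd t m h) : w.Wd t m (n * h) := by
  cases m with
  | zero => exact mul_mem hn h'
  | succ m =>
    obtain ⟨h₀, h0, c, g, k, hc, hg, hk, rfl⟩ := h'
    exact ⟨n * h₀, mul_mem hn h0, c, g, k, hc, hg, hk, by group⟩

theorem Wd.mul {m n : ℕ} {h k : G} (hm : w.Wd t m h) (hn : w.Wd t n k) :
    w.Wd t (m + n) (h * k) := by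
  induction m generalizing h with
  | zero => rw [zero_add]; exact smul_Wd hm hn
  | succ m ih =>
    obtain ⟨h₀, h0, c, g, k', hc, hg, hk, rfl⟩ := hm
    rw [add_right_comm]
    exact ⟨h₀, h0, c, g, k' * k, hc, hg, ih hk, by group⟩

theorem Wd.inv {m : ℕ} {h : G} (hm : w.Wd t m h) : w.Wd t m h⁻¹ := by
  induction m generalizing h with
  | zero => exact (w.N t).inv_mem hm
  | succ m ih =>
    obtain ⟨h₀, h0, c, g, k', hc, hg, hk, rfl⟩ := hm
    have h1 : w.Wd t 1 (g⁻¹ * h₀⁻¹) :=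
      ⟨1, one_mem _, c, g⁻¹, h₀⁻¹, hc, by rw [inv_smul_eq_iff, hg], (w.N t).inv_mem h0,
        by group⟩
    simpa [mul_inv_rev, mul_assoc] using (ih hk).mul h1

theorem exists_Wd {h : G} (hh : h ∈ w.N (t + 1)) : ∃ m, w.Wd t m h := by
  induction hh using Subgroup.closure_induction with
  | mem g hg =>
    obtain ⟨c, hc, hg⟩ := hg
    rcases Nat.lt_or_ge (w.φ c) t with h | h
    · exact ⟨0, Subgroup.subset_closure ⟨c, h, hg⟩⟩
    · exact ⟨1, 1, one_mem _, c, g, 1, by omega, hg, one_mem (w.N t), by group⟩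
  | one => exact ⟨0, one_mem (w.N t)⟩
  | mul a b _ _ ha hb =>
    obtain ⟨m, hm⟩ := ha
    obtain ⟨n, hn⟩ := hb
    exact ⟨_, hm.mul hn⟩
  | inv a _ ha =>
    obtain ⟨m, hm⟩ := ha
    exact ⟨m, hm.inv⟩

theorem Wd.mem {m : ℕ} {h : G} (hm : w.Wd t m h) : h ∈ w.N (t + 1) := by
  induction m generalizing h with
  | zero => exact N_mono (Nat.le_succ t) hm
  | succ m ih =>
    obtain ⟨h₀, h0, c, g, k', hc, hg, hk, rfl⟩ := hm
    exact mul_mem (mul_mem (N_mono (Nat.le_succ t) h0)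
      (Subgroup.subset_closure ⟨c, by omega, hg⟩)) (ih hk)

/-- `τ` cannot be shortened, even after rotating about `c`. -/
def Rd (w : Windmill G Y Q) (t : ℕ) (c : Y) (m : ℕ) (τ : G) : Prop :=
  w.φ c = t ∧ c ∉ w.Ys t ∧ ∀ g, g • c = c → ∀ k < m, ¬ w.Wd t k (g * τ)

theorem Wd.decomp {m : ℕ} {h : G} (hm : w.Wd t (m + 1) h) (hmin : ∀ k < m + 1, ¬ w.Wd t k h) :
    ∃ h₀ ∈ w.N t, ∃ c g τ, g • c = c ∧ g ≠ 1 ∧ w.Wd t m τ ∧ w.Rd t c m τ ∧ h = h₀ * g * τ := by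
  obtain ⟨h₀, h0, c, g, τ, hc, hg, hτ, rfl⟩ := hm
  have hr : ∀ g', g' • c = c → ∀ k < m, ¬ w.Wd t k (g' * τ) := by
    intro g' hg' k hk hw
    exact hmin (k + 1) (by omega) ⟨h₀, h0, c, g * g'⁻¹, g' * τ, hc,
      by rw [mul_smul, inv_smul_eq_iff.2 hg'.symm, hg], hw, by group⟩
  have hcY : c ∉ w.Ys t := by
    intro h
    exact hmin m (by omega) (smul_Wd (mul_mem h0 (mem_N_of_stab h hg)) hτ)
  refine ⟨h₀, h0, c, g, τ, hg, ?_, hτ, ⟨hc, hcY, hr⟩, rfl⟩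
  rintro rfl
  exact hmin m (by omega) (by rw [mul_one]; exact smul_Wd h0 hτ)

theorem Rd.ne {c₀ c : Y} {m : ℕ} {h₀ g τ : G} (h0 : h₀ ∈ w.N t) (hτ : w.Wd t m τ)
    (hg : g • c = c) (hr : w.Rd t c₀ (m + 1) (h₀ * g * τ)) : c₀ ≠ h₀ • c := by
  rintro rfl
  refine hr.2.2 (h₀ * g⁻¹ * h₀⁻¹) ?_ m (by omega) ?_
  · rw [mul_smul, mul_smul, inv_smul_smul, inv_smul_eq_iff.2 hg.symm]
  · have : h₀ * g⁻¹ * h₀⁻¹ * (h₀ * g * τ) = h₀ * τ := by group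
    rw [this]
    exact smul_Wd h0 hτ

/-- The angle at the first apex of a word. -/
theorem rho_first (hS : w.S t) {h₀ g τ : G} {c : Y} (h0 : h₀ ∈ w.N t) (hg : g • c = c)
    (hg1 : g ≠ 1) (hc : c ∉ w.Ys t) {a b : Q} (ha : a ≠ w.ι (h₀ • c)) (hb : τ • b ≠ w.ι c) :
    w.L ≤ w.ρ (h₀ • c) w.x a + w.ρ (h₀ • c) a ((h₀ * g * τ) • b) + w.ρ c w.x (τ • b) +
      6 * w.B := by
  have h1 := w.rot g c hg hg1
  have h2 := hS.rho_base (inv_mem h0) hc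
  have h3 : w.ρ c (h₀⁻¹ • w.x) (g • τ • b) = w.ρ (h₀ • c) w.x ((h₀ * g * τ) • b) := by
    rw [← w.equi h₀, smul_inv_smul, mul_smul, mul_smul]
  have h4 : w.ρ c (g • τ • b) (g • w.x) = w.ρ c w.x (τ • b) := by
    conv_lhs => rw [← hg]
    rw [w.equi, w.symm]
  have h5 : w.ρ c w.x (g • w.x) ≤ w.ρ c w.x (h₀⁻¹ • w.x) + w.ρ c (h₀⁻¹ • w.x) (g • w.x) :=
    tri_base h₀⁻¹ _ _ _
  have h7 := w.tri (h₀ • c) w.x a ((h₀ * g * τ) • b) ha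
  have h6 := w.tri c (h₀⁻¹ • w.x) (g • τ • b) (g • w.x) (by
    intro h
    exact hb (by rw [← inv_smul_smul g (τ • b), h, ← w.ι_smul, inv_smul_eq_iff.2 hg.symm]))
  omega

theorem smul_ne_apex {b : Q} (hb : w.TRed (t + 1) b) {m : ℕ} {τ : G} (hτ : w.Wd t m τ) {c : Y}
    (hc : w.φ c = t) : τ • b ≠ w.ι c := by
  intro h
  refine hb.1 (τ⁻¹ • c) ?_ ?_
  · rw [smul_mem_Ys (inv_mem hτ.mem)]
    exact mem_Ys (by omega)
  · rw [w.ι_smul, ← h, inv_smul_smul]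

theorem tail (hS : w.S t) {b : Q} (hb : w.TRed (t + 1) b) {m : ℕ} : ∀ {c₀ : Y} {τ : G},
    w.Wd t m τ → w.Rd t c₀ m τ → w.ρ c₀ w.x (τ • b) ≤ 6 * w.B + w.Lh ∧
      (m ≠ 0 → w.ρ c₀ w.x (τ • b) ≤ 6 * w.B) := by
  have hBl := w.B_le
  have hL := w.le_L
  have hB := w.B_pos
  induction m with
  | zero =>
    intro c₀ τ hτ hr
    refine ⟨?_, fun h => absurd rfl h⟩
    have h1 := hS.rho_base hτ hr.2.1
    have h2 := tri_base (w := w) τ c₀ w.x (τ • b)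
    have h3 := hb.2 (τ⁻¹ • c₀) (by
      rw [smul_mem_Ys (inv_mem hτ.mem)]
      exact mem_Ys (by have := hr.1; omega))
    have h4 := equi' (w := w) τ⁻¹ c₀ w.x b
    rw [inv_inv] at h4
    omega
  | succ m ih =>
    intro c₀ τ hτ hr
    obtain ⟨h₀, h0, c, g, τ', hg, hg1, hτ', hr', rfl⟩ := hτ.decomp
      (by simpa using hr.2.2 1 (one_smul _ _))
    suffices h : w.ρ c₀ w.x ((h₀ * g * τ') • b) ≤ 6 * w.B from ⟨by omega, fun _ => h⟩
    have hne : c₀ ≠ h₀ • c := hr.ne h0 hτ' hg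
    have hcb := smul_ne_apex hb hτ' hr'.1
    have h1 := (ih hτ' hr').1
    have hf : h₀ • c ∉ w.Ys t := by rw [smul_mem_Ys h0]; exact hr'.2.1
    have h2 := rho_first hS h0 hg hg1 hr'.2.1 (a := w.ι c₀) (b := b)
      (fun h => hne (w.ι_inj h)) hcb
    have h3 := rho_apex hr.1 hf
    refine hS h₀ h0 c₀ hr.2.1 w.x (w.ι c) _ _ tred_base (tred_apex hr'.1 hr'.2.1) (w.refl _) ?_
      (Or.inl rfl) (Or.inr ⟨h₀ • c, (w.ι_smul _ _).symm, ?_⟩)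
    · have h4 := equi' (w := w) h₀⁻¹ c₀ w.x (w.ι c)
      rw [inv_inv] at h4
      rw [← h4]
      exact rho_apex hr'.1 (by rw [smul_mem_Ys (inv_mem h0)]; exact hr.2.1)
    · rw [w.symm]
      omega

/-- Common part of the induction steps: the word turns substantially at its first apex. -/
theorem turn (hS : w.S t) {a b : Q} (hb : w.TRed (t + 1) b) {m : ℕ} {h₀ g τ : G} {c₁ c : Y}
    {y z : Q} (h0 : h₀ ∈ w.N t) (hg : g • c₁ = c₁) (hτ : w.Wd t m τ)
    (hr : w.Rd t c₁ m τ) (ha : w.TRed t a) (haf : a ≠ w.ι (h₀ • c₁))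
    (hc : c ∉ w.Ys (t + 1)) (hxa : w.ρ c w.x a ≤ w.B)
    (hxb : w.ρ c ((h₀ * g * τ) • w.x) ((h₀ * g * τ) • b) ≤ w.B) (hy : w.Bey a c y)
    (hz : w.Bey ((h₀ * g * τ) • b) c z)
    (hlarge : 10 * w.B ≤ w.ρ (h₀ • c₁) a ((h₀ * g * τ) • b))
    (ih : ∀ c' y' z', c' ∉ w.Ys (t + 1) → w.ρ c' (τ • w.x) (τ • b) ≤ w.B →
      w.Bey (w.ι c₁) c' y' → w.Bey (τ • b) c' z' → w.ρ c' y' z' ≤ 6 * w.B) :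
    w.ρ c y z ≤ 6 * w.B := by
  have hB := w.B_pos
  have hct : c ∉ w.Ys t := fun h => hc (Ys_mono (Nat.le_succ t) h)
  have hfY : h₀ • c₁ ∈ w.Ys (t + 1) := by
    rw [smul_mem_Ys (N_mono (Nat.le_succ t) h0)]
    exact mem_Ys (by have := hr.1; omega)
  have hcf : c ≠ h₀ • c₁ := fun h => hc (h ▸ hfY)
  have hgN : g ∈ w.N (t + 1) := Subgroup.subset_closure ⟨c₁, by have := hr.1; omega, hg⟩
  have hkN : h₀ * g ∈ w.N (t + 1) := mul_mem (N_mono (Nat.le_succ t) h0) hgN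
  have hbf : (h₀ * g * τ) • b ≠ w.ι (h₀ • c₁) := by
    intro h
    refine smul_ne_apex hb hτ hr.1 ?_
    rw [mul_smul, mul_smul, w.ι_smul, smul_left_cancel_iff] at h
    rw [← inv_smul_smul g (τ • b)]
    rw [h, ← w.ι_smul, inv_smul_eq_iff.2 hg.symm]
  have h1 := w.tri (h₀ • c₁) a (w.ι c) ((h₀ * g * τ) • b) (fun h => hcf (w.ι_inj h))
  rcases Nat.lt_or_ge (w.ρ (h₀ • c₁) (w.ι c) ((h₀ * g * τ) • b)) (5 * w.B) with h2 | h2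
  · have h3 := hy.rho_ge haf hcf (by omega)
    have e : ∀ p r, w.ρ c p r = w.ρ ((h₀ * g)⁻¹ • c) ((h₀ * g)⁻¹ • p) ((h₀ * g)⁻¹ • r) :=
      fun p r => (w.equi _ _ _ _).symm
    rw [e]
    refine ih _ _ _ ?_ ?_ ?_ ?_
    · rwa [smul_mem_Ys (inv_mem hkN)]
    · rw [e] at hxb
      simpa only [mul_smul _ τ, inv_smul_smul] using hxb
    · refine Or.inr ⟨c₁, rfl, ?_⟩
      rw [w.ι_smul, ← w.equi (h₀ * g), smul_inv_smul, smul_inv_smul, mul_smul, hg]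
      exact h3
    · rcases hz with rfl | ⟨b', hb', hz⟩
      · exact Or.inl (by rw [mul_smul, inv_smul_smul])
      · refine Or.inr ⟨(h₀ * g)⁻¹ • b', ?_, ?_⟩
        · rw [w.ι_smul, ← hb', mul_smul _ τ, inv_smul_smul]
        · rwa [w.ι_smul, w.equi]
  · have h3 := hz.rho_ge hbf hcf (by rw [w.symm]; exact h2)
    refine hS h₀ h0 c hct a (w.ι c₁) y z ha (tred_apex hr.1 hr.2.1) hxa ?_ hy
      (Or.inr ⟨h₀ • c₁, (w.ι_smul _ _).symm, h3⟩)
    have h4 := equi' (w := w) h₀⁻¹ c w.x (w.ι c₁)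
    rw [inv_inv] at h4
    rw [← h4]
    exact rho_apex hr.1 (by rwa [smul_mem_Ys (inv_mem h0)])

theorem inner (hS : w.S t) {b : Q} (hb : w.TRed (t + 1) b) {m : ℕ} : ∀ {h : G} {c₀ c : Y} {y z : Q},
    w.Wd t m h → w.Rd t c₀ m h → c ∉ w.Ys (t + 1) → w.ρ c (h • w.x) (h • b) ≤ w.B →
    w.Bey (w.ι c₀) c y → w.Bey (h • b) c z → w.ρ c y z ≤ 6 * w.B := by
  have hBl := w.B_le
  have hL := w.le_L
  have hB := w.B_pos
  induction m with
  | zero =>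
    intro h c₀ c y z hh hr hc hhb hy hz
    have hct : c ∉ w.Ys t := fun h => hc (Ys_mono (Nat.le_succ t) h)
    exact hS h hh c hct _ b y z (tred_apex hr.1 hr.2.1) (hb.anti (Nat.le_succ t))
      (rho_apex hr.1 hct) hhb hy hz
  | succ m ih =>
    intro h c₀ c y z hh hr hc hhb hy hz
    have hct : c ∉ w.Ys t := fun h => hc (Ys_mono (Nat.le_succ t) h)
    obtain ⟨h₀, h0, c₁, g, τ, hg, hg1, hτ, hr', rfl⟩ := hh.decomp
      (by simpa using hr.2.2 1 (one_smul _ _))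
    have hne : c₀ ≠ h₀ • c₁ := hr.ne h0 hτ hg
    have hne' : w.ι c₀ ≠ w.ι (h₀ • c₁) := fun h => hne (w.ι_inj h)
    have hf : h₀ • c₁ ∉ w.Ys t := by rw [smul_mem_Ys h0]; exact hr'.2.1
    refine turn hS hb h0 hg hτ hr' (tred_apex hr.1 hr.2.1) hne' hc (rho_apex hr.1 hct) hhb hy hz
      ?_ (fun c' y' z' h1 h2 h3 h4 => ih hτ hr' h1 h2 h3 h4)
    have h1 := rho_first hS h0 hg hg1 hr'.2.1 hne' (smul_ne_apex hb hτ hr'.1)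
    have h2 := (tail hS hb hτ hr').1
    have h3 := rho_apex hr.1 hf
    omega

theorem S_zero : w.S 0 := by
  intro h hh c hc a b y z ha hb hxa hxb hy hz
  have hh1 : h = 1 := by
    have : w.N 0 = ⊥ := by
      unfold N
      simp
    rw [this] at hh
    exact hh
  subst hh1
  rw [one_smul] at hxb hz
  rw [one_smul] at hxb
  have hB := w.B_pos
  by_cases hac : a = w.ι c
  · subst hac
    rcases hy with rfl | ⟨a', h, h'⟩
    · exact (w.self _ _).trans (by omega)
    · rw [← w.ι_inj h, w.symm] at h'
      have := w.self c y
      omega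
  by_cases hbc : b = w.ι c
  · subst hbc
    rcases hz with rfl | ⟨a', h, h'⟩
    · rw [w.symm]; exact (w.self _ _).trans (by omega)
    · rw [← w.ι_inj h, w.symm] at h'
      have := w.self c z
      omega
  have h1 := hy.rho_le hac w.x
  have h2 := hz.rho_le hbc w.x
  have h3 := tri_x (w := w) c y z
  have := w.symm c a w.x
  have := w.symm c b w.x
  have := w.symm c z w.x
  omega

theorem S_succ (hS : w.S t) : w.S (t + 1) := by
  intro h hh c hc a b y z ha hb hxa hxb hy hz
  have hBl := w.B_le
  have hL := w.le_L
  have hB := w.B_pos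
  have hct : c ∉ w.Ys t := fun h => hc (Ys_mono (Nat.le_succ t) h)
  classical
  have hex := exists_Wd hh
  obtain ⟨hm, hmin⟩ := And.intro (Nat.find_spec hex) (fun k => Nat.find_min hex (m := k))
  generalize Nat.find hex = m at hm hmin
  rcases m with _ | m
  · exact hS h hm c hct a b y z (ha.anti (Nat.le_succ t)) (hb.anti (Nat.le_succ t)) hxa hxb hy hz
  obtain ⟨h₀, h0, c₁, g, τ, hg, hg1, hτ, hr, rfl⟩ := hm.decomp (fun k hk => hmin k hk)
  have hfY : h₀ • c₁ ∈ w.Ys (t + 1) := by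
    rw [smul_mem_Ys (N_mono (Nat.le_succ t) h0)]
    exact mem_Ys (by have := hr.1; omega)
  have haf := ha.1 _ hfY
  have h1 := rho_first hS h0 hg hg1 hr.2.1 haf (smul_ne_apex hb hτ hr.1)
  have h2 := tail hS hb hτ hr
  have h3 := ha.2 _ hfY
  rcases Nat.lt_or_ge (w.ρ (h₀ • c₁) a ((h₀ * g * τ) • b)) (10 * w.B) with hlt | hge
  swap
  · exact turn hS hb h0 hg hτ hr (ha.anti (Nat.le_succ t)) haf hc hxa hxb hy hz hge
      (fun c' y' z' h1 h2 h3 h4 => inner hS hb hτ hr h1 h2 h3 h4)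
  have hm0 : m = 0 := by
    by_contra hm0
    have := h2.2 hm0
    omega
  subst hm0
  set f := h₀ • c₁ with hfdef
  have hcf : c ≠ f := fun h => hc (h ▸ hfY)
  have hbf : (h₀ * g * τ) • b ≠ w.ι f := by
    intro h
    refine hb.1 ((h₀ * g * τ)⁻¹ • f) ?_ ?_
    · rwa [smul_mem_Ys (inv_mem hm.mem)]
    · rw [w.ι_smul, ← h, inv_smul_smul]
  have h4 := (hS.rho_base hτ hr.2.1)
  have h5 := rho_first hS h0 hg hg1 hr.2.1 haf (b := w.x) (w.base τ c₁)
  rw [← hfdef] at h5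
  have h6 := w.tri f a ((h₀ * g * τ) • b) ((h₀ * g * τ) • w.x) hbf
  have h7 : w.ρ f ((h₀ * g * τ) • b) ((h₀ * g * τ) • w.x) ≤ w.Lh := by
    have := equi' (w := w) (h₀ * g * τ)⁻¹ f b w.x
    rw [inv_inv] at this
    rw [← this, w.symm]
    exact hb.2 _ (by rwa [smul_mem_Ys (inv_mem hm.mem)])
  have key : ∀ k : G, k ∈ w.N (t + 1) → ∀ e, w.ρ c (k • w.x) e ≤ w.B → e ≠ w.ι c →
      18 * w.B ≤ w.ρ f (k • w.x) e → w.ρ c e (w.ι f) ≤ 2 * w.B := by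
    intro k hk e he hec hfe
    have t1 := w.tri f (k • w.x) (w.ι c) e (fun h => hcf (w.ι_inj h))
    rcases Nat.lt_or_ge w.B (w.ρ f (w.ι c) e) with h | h
    · have := w.beh f c e hcf.symm (by rw [w.symm]; exact h)
      omega
    · have := w.beh f c (k • w.x) hcf.symm (by omega)
      have t2 := tri_base (w := w) k c e (w.ι f)
      have := w.symm c e (k • w.x)
      omega
  by_cases hac : a = w.ι c
  · subst hac
    rcases hy with rfl | ⟨a', h, h'⟩
    · exact (w.self _ _).trans (by omega)
    · rw [← w.ι_inj h, w.symm] at h'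
      have := w.self c y
      omega
  by_cases hbc : (h₀ * g * τ) • b = w.ι c
  · rcases hz with rfl | ⟨a', h, h'⟩
    · rw [w.symm, hbc]; exact (w.self _ _).trans (by omega)
    · rw [hbc] at h
      rw [← w.ι_inj h, w.symm] at h'
      have := w.self c z
      omega
  have k1 := key 1 (one_mem _) a (by rwa [one_smul]) hac (by rw [one_smul]; omega)
  have k2 := key _ hh _ hxb hbc (by rw [w.symm]; omega)
  have k3 := hy.rho_le hac (w.ι f)
  have k4 := hz.rho_le hbc (w.ι f)
  have k5 := w.tri c y (w.ι f) z (fun h => hcf (w.ι_inj h).symm)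
  have := w.symm c z (w.ι f)
  omega

theorem S_all (t : ℕ) : w.S t := by
  induction t with
  | zero => exact S_zero
  | succ t ih => exact S_succ ih

theorem mem_N_iff {n : G} : (∃ t, n ∈ w.N t) ↔
    n ∈ Subgroup.closure {g : G | ∃ c : Y, g • c = c} := by
  constructor
  · rintro ⟨t, ht⟩
    refine Subgroup.closure_mono ?_ ht
    rintro g ⟨c, -, hg⟩
    exact ⟨c, hg⟩
  · intro h
    induction h using Subgroup.closure_induction with
    | mem g hg =>
      obtain ⟨c, hg⟩ := hg
      exact ⟨w.φ c + 1, Subgroup.subset_closure ⟨c, by omega, hg⟩⟩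
    | one => exact ⟨0, one_mem _⟩
    | mul a b _ _ ha hb =>
      obtain ⟨s, hs⟩ := ha
      obtain ⟨t, ht⟩ := hb
      exact ⟨max s t, mul_mem (N_mono (le_max_left _ _) hs) (N_mono (le_max_right _ _) ht)⟩
    | inv a _ ha =>
      obtain ⟨s, hs⟩ := ha
      exact ⟨s, inv_mem hs⟩

/-- Induction along shortenings of elements of the normal subgroup generated by rotations. -/
theorem greendlinger (w : Windmill G Y Q) (P : G → Prop) (h1 : P 1)
    (hstep : ∀ n c g, g • c = c → w.L ≤ w.ρ c w.x (n • w.x) + 13 * w.B → P (g * n) → P n) :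
    ∀ n ∈ Subgroup.closure {g : G | ∃ c : Y, g • c = c}, P n := by
  have key : ∀ t, ∀ n ∈ w.N t, P n := by
    intro t
    induction t with
    | zero =>
      intro n hn
      have : w.N 0 = ⊥ := by
        unfold N
        simp
      rw [this] at hn
      rwa [Subgroup.mem_bot.1 hn]
    | succ t ih =>
      intro n hn
      obtain ⟨m, hm⟩ := exists_Wd hn
      induction m using Nat.strong_induction_on generalizing n with
      | _ m ihm =>
        classical
        by_cases hmin : ∃ k < m, w.Wd t k n
        · obtain ⟨k, hk, hk'⟩ := hmin
          exact ihm k hk n hn hk'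
        push Not at hmin
        rcases m with _ | m
        · exact ih n hm
        obtain ⟨h₀, h0, c, g, τ, hg, hg1, hτ, hr, rfl⟩ := hm.decomp hmin
        have h0' := N_mono (Nat.le_succ t) h0
        have hS := S_all (w := w) t
        have e1 := rho_first hS h0 hg hg1 hr.2.1 (a := w.x) (b := w.x)
          (by simpa using w.base 1 (h₀ • c)) (w.base τ c)
        have e2 : w.ρ c w.x (τ • w.x) ≤ 6 * w.B := by
          rcases m with _ | m
          · exact hS.rho_base hτ hr.2.1
          · exact (tail hS tred_base hτ hr).2 (by omega)
        have e3 := w.refl (h₀ • c)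
        have hB := w.B_pos
        have hkey : (h₀ * g⁻¹ * h₀⁻¹) * (h₀ * g * τ) = h₀ * τ := by group
        have hw : w.Wd t m (h₀ * τ) := smul_Wd h0 hτ
        refine hstep _ (h₀ • c) (h₀ * g⁻¹ * h₀⁻¹) ?_ ?_ ?_
        · rw [mul_smul, mul_smul, inv_smul_smul, inv_smul_eq_iff.2 hg.symm]
        · omega
        · rw [hkey]
          exact ihm m (by omega) _ hw.mem hw
  intro n hn
  obtain ⟨t, ht⟩ := (mem_N_iff (w := w)).2 hn
  exact key t n ht

end Windmill

/-- A family of quasi-convex sets whose stabilizers act with large translation length. -/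
structure RotFam (G : Type*) {V Y : Type*} [Group G] [MulAction G V] [MulAction G Y]
    (d : V → V → ℕ) (L : Y → Set V) (δ C Δ La Lr : ℕ) : Prop where
  hd : IsGeod d
  hy : Hyp d δ
  inv : ∀ (g : G) x y, d (g • x) (g • y) = d x y
  qc : ∀ c, QC d C (L c)
  ov : SmallOverlap d L Δ
  Lsmul : ∀ (g : G) c x, g • x ∈ L (g • c) ↔ x ∈ L c
  rot : ∀ (g : G) c p, g • c = c → g ≠ 1 → p ∈ L c → Lr ≤ d p (g • p)
  tr : ∀ c p q, p ∈ L c → q ∈ L c → La ≤ d p q →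
    ∃ g : G, g • c = c ∧ 2 * d p (g • q) + 10 * bgiConst δ C Δ ≤ d p q
  B_le : bgiConst δ C Δ ≤ La
  le_Lr : La + 100 * bgiConst δ C Δ ≤ Lr

/-- The subset represented by a point or by an apex. -/
def pts {V Y : Type*} (L : Y → Set V) : V ⊕ Y → Set V := Sum.elim (fun x => {x}) L

/-- The angle at `c` between two subsets. -/
noncomputable def angle {V Y : Type*} (d : V → V → ℕ) (L : Y → Set V) (c : Y) (P R : V ⊕ Y) : ℕ :=
  setDist d (pts L P) (pts L R) - setDist d (pts L P) (L c) - setDist d (pts L R) (L c)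

/-- The subgroup generated by all stabilizers. -/
def rotSubgroup (G : Type*) [Group G] (Y : Type*) [MulAction G Y] : Subgroup G :=
  Subgroup.closure {g | ∃ c : Y, g • c = c}

instance (G : Type*) [Group G] (Y : Type*) [MulAction G Y] : (rotSubgroup G Y).Normal := by
  refine ⟨fun n hn g => ?_⟩
  induction hn using Subgroup.closure_induction with
  | mem n hn =>
    obtain ⟨c, hc⟩ := hn
    exact Subgroup.subset_closure ⟨g • c, by rw [mul_smul, mul_smul, inv_smul_smul, hc]⟩
  | one => simp
  | mul a b _ _ ha hb =>
    have := mul_mem ha hb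
    simpa [mul_assoc] using this
  | inv a _ ha =>
    have := inv_mem ha
    simpa [mul_assoc] using this

theorem mem_rotSubgroup {G Y : Type*} [Group G] [MulAction G Y] {g : G} {c : Y} (h : g • c = c) :
    g ∈ rotSubgroup G Y := Subgroup.subset_closure ⟨c, h⟩

theorem le_bgiConst (δ C Δ : ℕ) : 13 * Δ + 30 * C + 15 * δ + 13 ≤ bgiConst δ C Δ := by
  unfold bgiConst
  have : 13 * (Δ + 2 * C + δ + 1) ≤
    (6 * (morseConst δ C + 2 * C + 2 * δ) + 13) * (Δ + 2 * C + δ + 1) :=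
    Nat.mul_le_mul_right _ (by omega)
  omega

theorem setDist_smul {G V : Type*} [Group G] [MulAction G V] {d : V → V → ℕ}
    (inv : ∀ (g : G) x y, d (g • x) (g • y) = d x y) (g : G) {A B A' B' : Set V}
    (hA : ∀ x, g • x ∈ A' ↔ x ∈ A) (hB : ∀ x, g • x ∈ B' ↔ x ∈ B) :
    setDist d A' B' = setDist d A B := by
  unfold setDist
  congr 1
  ext n
  constructor
  · rintro ⟨a, ha, b, hb, h⟩
    refine ⟨g⁻¹ • a, ?_, g⁻¹ • b, ?_, by rw [inv, h]⟩
    · rwa [← hA, smul_inv_smul]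
    · rwa [← hB, smul_inv_smul]
  · rintro ⟨a, ha, b, hb, h⟩
    exact ⟨g • a, (hA a).2 ha, g • b, (hB b).2 hb, by rw [inv, h]⟩

namespace RotFam
variable {G V Y : Type*} [Group G] [MulAction G V] [MulAction G Y]
  {d : V → V → ℕ} {L : Y → Set V} {δ C Δ La Lr : ℕ} (hR : RotFam G d L δ C Δ La Lr)
include hR

theorem pts_nonempty (P : V ⊕ Y) : (pts L P).Nonempty := by
  rcases P with x | c
  · exact ⟨x, rfl⟩
  · exact (hR.qc c).1

theorem smul_pts (g : G) (P : V ⊕ Y) (x : V) : g • x ∈ pts L (g • P) ↔ x ∈ pts L P := by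
  rcases P with y | c
  · simp [pts, Sum.smul_inl]
  · exact hR.Lsmul g c x

theorem angle_smul (g : G) (c : Y) (P R : V ⊕ Y) :
    angle d L (g • c) (g • P) (g • R) = angle d L c P R := by
  unfold angle
  rw [setDist_smul hR.inv g (hR.smul_pts g P) (hR.smul_pts g R),
    setDist_smul hR.inv g (hR.smul_pts g P) (hR.Lsmul g c),
    setDist_smul hR.inv g (hR.smul_pts g R) (hR.Lsmul g c)]

theorem angle_comm (c : Y) (P R : V ⊕ Y) : angle d L c P R = angle d L c R P := by
  unfold angle
  rw [setDist_comm hR.hd (pts L P) (pts L R)]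
  omega

theorem setDist_self (x : V) : setDist d {x} {x} = 0 := by
  rw [setDist_singleton, hR.hd.self]

theorem angle_self (c : Y) (P : V ⊕ Y) : angle d L c (Sum.inr c) P = 0 := by
  unfold angle
  have := setDist_comm hR.hd (pts L P) (L c)
  simp only [pts, Sum.elim_inr] at *
  omega

theorem proj_unique {c : Y} {x p q : V} (hp : IsProj d (L c) x p) (hq : IsProj d (L c) x q) :
    d p q ≤ C := by
  have := (hR.qc c).2 x p hp.1 hp.2 q hq.1
  have := hq.2 p hp.1
  omega

theorem proj_pts {c : Y} {P : V ⊕ Y} (hP : P ≠ Sum.inr c) {a b p q : V} (ha : a ∈ pts L P)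
    (hb : b ∈ pts L P) (hp : IsProj d (L c) a p) (hq : IsProj d (L c) b q) : d p q ≤ Δ + C := by
  rcases P with x | c'
  · obtain rfl : a = x := ha
    obtain rfl : b = a := hb
    have := hR.proj_unique hp hq
    omega
  · have := hR.ov c c' (fun h => hP (h ▸ rfl)) a b p q ha hb hp hq
    omega

/-- Existence of projections realizing distances. -/
theorem exists_near (c : Y) (P : V ⊕ Y) : ∃ a ∈ pts L P, ∃ p, IsProj d (L c) a p ∧
    d a p = setDist d (pts L P) (L c) := by
  obtain ⟨a, ha, p, hp, h⟩ := exists_setDist (d := d) (hR.pts_nonempty P) (hR.qc c).1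
  refine ⟨a, ha, p, ⟨hp, fun q hq => ?_⟩, h⟩
  rw [h]
  exact setDist_le ha hq

theorem dist_le_angle {c : Y} {P R : V ⊕ Y} (hP : P ≠ Sum.inr c) (hR' : R ≠ Sum.inr c)
    {a b p q : V} (ha : a ∈ pts L P) (hb : b ∈ pts L R) (hp : IsProj d (L c) a p)
    (hq : IsProj d (L c) b q) : d p q ≤ angle d L c P R + (2 * C + δ) + 2 * (Δ + C) := by
  obtain ⟨a', ha', b', hb', h⟩ := exists_setDist (d := d) (hR.pts_nonempty P) (hR.pts_nonempty R)
  obtain ⟨p', hp'⟩ := exists_proj d (hR.qc c).1 a'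
  obtain ⟨q', hq'⟩ := exists_proj d (hR.qc c).1 b'
  have h1 := hR.proj_pts hP ha ha' hp hp'
  have h2 := hR.proj_pts hR' hb' hb hq' hq
  have h3 := hR.hd.tri p p' q
  have h4 := hR.hd.tri p' q' q
  have h5 := setDist_le (d := d) ha' hp'.1
  have h6 := setDist_le (d := d) hb' hq'.1
  have h7 := hR.hd.symm q' b'
  unfold angle
  rcases (hR.qc c).proj_proj hR.hd hR.hy hp' hq' with h8 | h8 <;> omega

theorem angle_le_dist {c : Y} {P R : V ⊕ Y} (hP : P ≠ Sum.inr c) (hR' : R ≠ Sum.inr c)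
    {a b p q : V} (ha : a ∈ pts L P) (hb : b ∈ pts L R) (hp : IsProj d (L c) a p)
    (hq : IsProj d (L c) b q) : angle d L c P R ≤ d p q + 2 * (Δ + C) := by
  obtain ⟨a', ha', p', hp', e1⟩ := hR.exists_near c P
  obtain ⟨b', hb', q', hq', e2⟩ := hR.exists_near c R
  have h1 := hR.proj_pts hP ha' ha hp' hp
  have h2 := hR.proj_pts hR' hb hb' hq hq'
  have h3 := hR.hd.tri p' p q'
  have h4 := hR.hd.tri p q q'
  have h5 := setDist_le (d := d) ha' hb'
  have h6 := hR.hd.tri a' p' b'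
  have h7 := hR.hd.tri p' q' b'
  have h8 := hR.hd.symm q' b'
  unfold angle
  omega

theorem angle_le_dist' {c : Y} {P R : V ⊕ Y}
    {a b p q : V} (ha : a ∈ pts L P) (hb : b ∈ pts L R)
    (hp : d a p = setDist d (pts L P) (L c))
    (hq : d b q = setDist d (pts L R) (L c)) : angle d L c P R ≤ d p q := by
  have h5 := setDist_le (d := d) ha hb
  have h6 := hR.hd.tri a p b
  have h7 := hR.hd.tri p q b
  have h8 := hR.hd.symm q b
  unfold angle
  omega

theorem angle_tri {c : Y} {P E R : V ⊕ Y} (hE : E ≠ Sum.inr c) :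
    angle d L c P R ≤ angle d L c P E + angle d L c E R + bgiConst δ C Δ := by
  have hB := le_bgiConst δ C Δ
  by_cases hP : P = Sum.inr c
  · rw [hP, hR.angle_self]; omega
  by_cases hR' : R = Sum.inr c
  · rw [hR', hR.angle_comm, hR.angle_self]; omega
  obtain ⟨a, ha, p, hp, e1⟩ := hR.exists_near c P
  obtain ⟨b, hb, q, hq, e2⟩ := hR.exists_near c R
  obtain ⟨e, he, r, hr, e3⟩ := hR.exists_near c E
  have h1 := hR.dist_le_angle hP hE ha he hp hr
  have h2 := hR.dist_le_angle hE hR' he hb hr hq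
  have h3 := hR.angle_le_dist' ha hb e1 e2
  have h4 := hR.hd.tri p r q
  omega

/-- The angle, corrected to satisfy the triangle inequality. -/
noncomputable def rho (_ : RotFam G d L δ C Δ La Lr) (c : Y) (P R : V ⊕ Y) : ℕ :=
  angle d L c P R + bgiConst δ C Δ

theorem smul_proj (g : G) {c : Y} {x p : V} (h : IsProj d (L c) x p) :
    IsProj d (L (g • c)) (g • x) (g • p) := by
  refine ⟨(hR.Lsmul g c p).2 h.1, fun q hq => ?_⟩
  have := h.2 (g⁻¹ • q) (by rwa [← hR.Lsmul g, smul_inv_smul])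
  rwa [← hR.inv g, ← hR.inv g x, smul_inv_smul] at this

/-- The windmill of a rotating family, as seen from a base point. -/
noncomputable def windmill (x : V) : Windmill G Y (V ⊕ Y) where
  ι := Sum.inr
  x := Sum.inl x
  ρ := hR.rho
  φ c := setDist d {x} (L c)
  B := bgiConst δ C Δ
  Lh := La + 2 * bgiConst δ C Δ
  L := Lr
  ι_inj := Sum.inr_injective
  ι_smul _ _ := rfl
  base g c h := by cases h
  tri c P E R hE := by
    have := hR.angle_tri (P := P) (R := R) hE
    unfold rho
    omega
  symm c P R := by unfold rho; rw [hR.angle_comm]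
  equi g c P R := by unfold rho; rw [hR.angle_smul]
  refl c := by
    unfold rho angle
    have : setDist d (pts L (Sum.inl x : V ⊕ Y)) (pts L (Sum.inl x)) = 0 := hR.setDist_self x
    omega
  self c P := by
    unfold rho
    rw [hR.angle_self]
    omega
  beh c c' P _ h := by
    unfold rho angle at *
    have : setDist d (pts L P) (pts L (Sum.inr c')) = setDist d (pts L P) (L c') := rfl
    have : setDist d (pts L P) (pts L (Sum.inr c)) = setDist d (pts L P) (L c) := rfl
    omega
  v1 f c h := by
    unfold rho angle at h
    have : setDist d (pts L (Sum.inl x)) (pts L (Sum.inr c)) = setDist d {x} (L c) := rfl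
    have : setDist d (pts L (Sum.inl x)) (L f) = setDist d {x} (L f) := rfl
    omega
  v2 f c h := by
    have hB := le_bgiConst δ C Δ
    have hcf : (Sum.inr c : V ⊕ Y) ≠ Sum.inr f := by
      intro h'
      have := hR.angle_self f (Sum.inl x)
      rw [h'] at h
      unfold rho at h
      rw [hR.angle_comm] at h
      omega
    obtain ⟨a, ha, p, hp, e1⟩ := hR.exists_near f (Sum.inl x : V ⊕ Y)
    obtain rfl : a = x := ha
    obtain ⟨b, hb, q, hq, e2⟩ := hR.exists_near f (Sum.inr c : V ⊕ Y)
    have ha : a ∈ pts L (Sum.inl a : V ⊕ Y) := rfl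
    have h1 := hR.dist_le_angle (by simp) hcf ha hb hp hq
    have h2 := hR.angle_le_dist' ha hb e1 e2
    unfold rho at h
    obtain ⟨g, hg, h3⟩ := hR.tr f p q hp.1 hq.1 (by omega)
    refine ⟨g, hg, ?_⟩
    have h4 := setDist_le (d := d) (Set.mem_singleton a) ((hR.Lsmul g c b).2 hb)
    have h5 := hR.hd.tri a p (g • b)
    have h6 := hR.hd.tri p (g • q) (g • b)
    rw [hR.inv] at h6
    have h7 := hR.hd.symm q b
    have h8 : angle d L f (Sum.inl a) (Sum.inr c) =
      setDist d {a} (L c) - setDist d (pts L (Sum.inl a)) (L f) -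
        setDist d (pts L (Sum.inr c)) (L f) := rfl
    omega
  rot g c hg hg1 := by
    have hB := le_bgiConst δ C Δ
    obtain ⟨p, hp⟩ := exists_proj d (hR.qc c).1 x
    have hp' := hR.smul_proj g hp
    rw [hg] at hp'
    have h1 := hR.dist_le_angle (P := Sum.inl x) (R := Sum.inl (g • x)) (by simp) (by simp) rfl rfl
      hp hp'
    have h2 := hR.rot g c p hg hg1 hp.1
    have : angle d L c (Sum.inl x) (g • Sum.inl x) =
      angle d L c (Sum.inl x) (Sum.inl (g • x)) := rfl
    unfold rho
    omega
  B_pos := by have hB := le_bgiConst δ C Δ; omega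
  B_le := by omega
  le_L := by have := hR.le_Lr; omega

end RotFam

/-- The quotient of a set by the action of a subgroup. -/
def OrbQ {G : Type*} [Group G] (N : Subgroup G) (V : Type*) [MulAction G V] : Type _ :=
  MulAction.orbitRel.Quotient N V

namespace OrbQ
variable {G V : Type*} [Group G] [MulAction G V] {N : Subgroup G}

/-- The class of a point. -/
def mk (N : Subgroup G) (x : V) : OrbQ N V := Quotient.mk'' x

theorem exists_rep (a : OrbQ N V) : ∃ x, mk N x = a := Quotient.exists_rep a

theorem mk_eq {x y : V} : mk N x = mk N y ↔ ∃ n ∈ N, n • y = x := by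
  have h : mk N x = mk N y ↔ MulAction.orbitRel N V x y := Quotient.eq''
  rw [h, MulAction.orbitRel_apply, MulAction.mem_orbit_iff]
  constructor
  · rintro ⟨⟨n, hn⟩, h⟩
    exact ⟨n, hn, h⟩
  · rintro ⟨n, hn, h⟩
    exact ⟨⟨n, hn⟩, h⟩

theorem mk_smul {n : G} (hn : n ∈ N) (x : V) : mk N (n • x) = mk N x := mk_eq.2 ⟨n, hn, rfl⟩

variable [N.Normal]

theorem map_mk {g : G} {x y : V} (h : mk N x = mk N y) : mk N (g • x) = mk N (g • y) := by
  obtain ⟨n, hn, rfl⟩ := mk_eq.1 h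
  refine mk_eq.2 ⟨g * n * g⁻¹, Subgroup.Normal.conj_mem ‹_› n hn g, ?_⟩
  simp [mul_smul]

instance : MulAction (G ⧸ N) (OrbQ N V) where
  smul a b := Quotient.liftOn₂' a b (fun g x => mk N (g • x)) (by
    intro g x g' x' hg hx
    have h1 : mk N (g • x) = mk N (g • x') := map_mk (Quotient.sound' hx)
    refine h1.trans (mk_eq.2 ⟨g * g'⁻¹, ?_, by rw [mul_smul, inv_smul_smul]⟩)
    rw [QuotientGroup.leftRel_apply] at hg
    have := Subgroup.Normal.conj_mem ‹_› _ (inv_mem hg) g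
    simpa [mul_assoc] using this)
  one_smul b := by
    obtain ⟨x, rfl⟩ := exists_rep b
    change mk N ((1 : G) • x) = _
    rw [one_smul]
  mul_smul a b c := by
    obtain ⟨g, rfl⟩ := QuotientGroup.mk_surjective a
    obtain ⟨h, rfl⟩ := QuotientGroup.mk_surjective b
    obtain ⟨x, rfl⟩ := exists_rep c
    change mk N ((g * h) • x) = mk N (g • h • x)
    rw [mul_smul]

theorem mk_smul_mk (g : G) (x : V) : (g : G ⧸ N) • mk N x = mk N (g • x) := rfl

end OrbQ

/-- The quotient metric. -/
noncomputable def quotDist {G V : Type*} [Group G] [MulAction G V] (N : Subgroup G)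
    (d : V → V → ℕ) (a b : OrbQ N V) : ℕ :=
  setDist d {x | OrbQ.mk N x = a} {x | OrbQ.mk N x = b}

section
variable {G V : Type*} [Group G] [MulAction G V] {N : Subgroup G} {d : V → V → ℕ}

theorem quotDist_le (x y : V) : quotDist N d (OrbQ.mk N x) (OrbQ.mk N y) ≤ d x y :=
  setDist_le rfl rfl

theorem quotDist_rep₂ (a b : OrbQ N V) :
    ∃ x y, OrbQ.mk N x = a ∧ OrbQ.mk N y = b ∧ d x y = quotDist N d a b := by
  obtain ⟨x, hx, y, hy, h⟩ := exists_setDist (d := d) (A := {x | OrbQ.mk N x = a})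
    (B := {x | OrbQ.mk N x = b}) (OrbQ.exists_rep a) (OrbQ.exists_rep b)
  exact ⟨x, y, hx, hy, h⟩

theorem quotDist_rep (inv : ∀ (g : G) x y, d (g • x) (g • y) = d x y) (x : V) (b : OrbQ N V) :
    ∃ y, OrbQ.mk N y = b ∧ d x y = quotDist N d (OrbQ.mk N x) b := by
  obtain ⟨x', y, hx, hy, h⟩ := quotDist_rep₂ (d := d) (OrbQ.mk N x) b
  obtain ⟨n, hn, rfl⟩ := OrbQ.mk_eq.1 hx
  exact ⟨n⁻¹ • y, by rw [OrbQ.mk_smul (inv_mem hn), hy], by rw [← h, ← inv n, smul_inv_smul]⟩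

theorem isGeod_quot (hd : IsGeod d) (inv : ∀ (g : G) x y, d (g • x) (g • y) = d x y) :
    IsGeod (quotDist N d) where
  zero a b := by
    constructor
    · intro h
      obtain ⟨x, y, rfl, rfl, h'⟩ := quotDist_rep₂ (d := d) a b
      rw [(hd.zero x y).1 (h'.trans h)]
    · rintro rfl
      obtain ⟨x, rfl⟩ := OrbQ.exists_rep a
      have := quotDist_le (N := N) (d := d) x x
      rw [hd.self] at this
      omega
  symm a b := setDist_comm hd _ _
  tri a b c := by
    obtain ⟨x, y, rfl, rfl, h1⟩ := quotDist_rep₂ (d := d) a b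
    obtain ⟨z, rfl, h2⟩ := quotDist_rep inv y c
    have := quotDist_le (N := N) (d := d) x z
    have := hd.tri x y z
    omega
  mid a b k hk := by
    obtain ⟨x, y, rfl, rfl, h⟩ := quotDist_rep₂ (d := d) a b
    obtain ⟨z, h1, h2⟩ := hd.mid x y k (by omega)
    refine ⟨OrbQ.mk N z, ?_⟩
    have a1 := quotDist_le (N := N) (d := d) x z
    have a2 := quotDist_le (N := N) (d := d) z y
    obtain ⟨u, hu, h3⟩ := quotDist_rep inv x (OrbQ.mk N z)
    obtain ⟨v, hv, h4⟩ := quotDist_rep inv u (OrbQ.mk N y)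
    have h5 := hd.tri x u v
    have h6 := quotDist_le (N := N) (d := d) x v
    rw [hv] at h6
    rw [hu] at h4
    omega

theorem quotDist_smul [N.Normal] (inv : ∀ (g : G) x y, d (g • x) (g • y) = d x y) (g : G ⧸ N)
    (a b : OrbQ N V) : quotDist N d (g • a) (g • b) = quotDist N d a b := by
  have key : ∀ (g : G ⧸ N) a b, quotDist N d (g • a) (g • b) ≤ quotDist N d a b := by
    intro g a b
    obtain ⟨g, rfl⟩ := QuotientGroup.mk_surjective g
    obtain ⟨x, y, rfl, rfl, h⟩ := quotDist_rep₂ (d := d) a b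
    rw [OrbQ.mk_smul_mk, OrbQ.mk_smul_mk, ← h, ← inv g]
    exact quotDist_le _ _
  refine le_antisymm (key g a b) ?_
  have := key g⁻¹ (g • a) (g • b)
  rwa [inv_smul_smul, inv_smul_smul] at this

/-- The four point condition passes to a quotient in which quadrilaterals lift. -/
theorem hyp_quot {δ : ℕ} (hd : IsGeod d) (inv : ∀ (g : G) x y, d (g • x) (g • y) = d x y)
    (hy : Hyp d δ)
    (hl : ∀ x, ∀ n ∈ N, ∀ z y w, ∃ z' y' w', OrbQ.mk N z' = OrbQ.mk N z ∧
      OrbQ.mk N y' = OrbQ.mk N y ∧ OrbQ.mk N w' = OrbQ.mk N w ∧ d x z' ≤ d x z ∧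
      d z' y' ≤ d z y ∧ d y' w' ≤ d y w ∧ d w' x ≤ d w (n • x)) : Hyp (quotDist N d) δ := by
  intro a b c e
  obtain ⟨x, rfl⟩ := OrbQ.exists_rep a
  obtain ⟨z, rfl, h1⟩ := quotDist_rep inv x c
  obtain ⟨y, rfl, h2⟩ := quotDist_rep inv z b
  obtain ⟨w, rfl, h3⟩ := quotDist_rep inv y e
  obtain ⟨x', hx', h4⟩ := quotDist_rep inv w (OrbQ.mk N x)
  obtain ⟨n, hn, rfl⟩ := OrbQ.mk_eq.1 hx'
  obtain ⟨z', y', w', ez, ey, ew, g1, g2, g3, g4⟩ := hl x n hn z y w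
  have q1 := quotDist_le (N := N) (d := d) x y'
  have q2 := quotDist_le (N := N) (d := d) z' w'
  rw [ey] at q1
  rw [ez, ew] at q2
  have s1 := (isGeod_quot (N := N) hd inv).symm (OrbQ.mk N w) (OrbQ.mk N x)
  have s2 := (isGeod_quot (N := N) hd inv).symm (OrbQ.mk N z) (OrbQ.mk N y)
  have s3 := hd.symm w' x
  have s4 := hd.symm z' y'
  have := hy x y' z' w'
  omega

end
namespace RotFam
variable {G V Y : Type*} [Group G] [MulAction G V] [MulAction G Y]
  {d : V → V → ℕ} {L : Y → Set V} {δ C Δ La Lr : ℕ} (hR : RotFam G d L δ C Δ La Lr)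

/-- The angle at `c` between two points. -/
noncomputable def an (hR : RotFam G d L δ C Δ La Lr) (c : Y) (x y : V) : ℕ :=
  hR.rho c (Sum.inl x) (Sum.inl y)

include hR

theorem an_comm (c : Y) (x y : V) : hR.an c x y = hR.an c y x := by
  unfold an rho
  rw [hR.angle_comm]

theorem an_smul (g : G) (c : Y) (x y : V) : hR.an (g • c) (g • x) (g • y) = hR.an c x y := by
  have := hR.angle_smul g c (Sum.inl x) (Sum.inl y)
  unfold an rho
  rw [← this]
  rfl

theorem an_tri (c : Y) (x y z : V) : hR.an c x z ≤ hR.an c x y + hR.an c y z := by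
  have := hR.angle_tri (c := c) (P := Sum.inl x) (E := Sum.inl y) (R := Sum.inl z) (by simp)
  unfold an rho
  omega

theorem an_le_dist {c : Y} {x y p q : V} (hp : IsProj d (L c) x p) (hq : IsProj d (L c) y q) :
    hR.an c x y + 2 * δ ≤ d p q + 2 * bgiConst δ C Δ := by
  have := hR.angle_le_dist (P := Sum.inl x) (R := Sum.inl y) (by simp) (by simp) rfl rfl hp hq
  have := le_bgiConst δ C Δ
  unfold an rho
  omega

theorem an_le (c : Y) (x y : V) : hR.an c x y ≤ d x y + bgiConst δ C Δ := by
  unfold an rho angle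
  have : setDist d (pts L (Sum.inl x : V ⊕ Y)) (pts L (Sum.inl y)) = d x y :=
    setDist_singleton x y
  omega

theorem coneDist_smul (g : G) (x y : V) :
    coneDist d L (g • x) (g • y) = coneDist d L x y := by
  have key : ∀ (g : G) (x y : V), coneDist d L (g • x) (g • y) ≤ coneDist d L x y := by
    intro g x y
    have h := cone_reach (L := L) hR.hd x y
    generalize coneDist d L x y = n at h
    have : Reach (ConeAdj d L) (fun _ => True) n (g • x) (g • y) := by
      induction h with
      | refl x => exact .refl _ trivial
      | step h h1 h2 ih =>
        refine ih.step ?_ trivial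
        rcases h1 with h1 | ⟨c, h1, h1'⟩
        · exact Or.inl (by rwa [hR.inv])
        · exact Or.inr ⟨g • c, (hR.Lsmul g c _).2 h1, (hR.Lsmul g c _).2 h1'⟩
    exact this.pathDist_le
  refine le_antisymm (key g x y) ?_
  have := key g⁻¹ (g • x) (g • y)
  rwa [inv_smul_smul, inv_smul_smul] at this

theorem isGeod_D : IsGeod (coneDist d L) := isGeod_cone hR.hd

/-- Cone-off geodesics go through sets with large angle. -/
theorem through {c : Y} {x y : V} (h : 3 * bgiConst δ C Δ < hR.an c x y) :
    ∃ a ∈ L c, ∃ b ∈ L c, coneDist d L x a + 1 + coneDist d L b y ≤ coneDist d L x y := by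
  obtain ⟨p, hp⟩ := exists_proj d (hR.qc c).1 x
  obtain ⟨q, hq⟩ := exists_proj d (hR.qc c).1 y
  have := hR.an_le_dist hp hq
  exact bgi hR.hd hR.hy hR.qc hR.ov hp hq (by omega)

theorem through_le {c : Y} {x y a b : V} (ha : a ∈ L c) (hb : b ∈ L c) :
    coneDist d L x y ≤ coneDist d L x a + 1 + coneDist d L b y := by
  have h1 := hR.isGeod_D.tri x a y
  have h2 := hR.isGeod_D.tri a b y
  have := cone_le_one (d := d) ha hb
  omega

theorem smul_mem_L {g : G} {c : Y} (hg : g • c = c) {x : V} : g • x ∈ L c ↔ x ∈ L c := by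
  conv_lhs => rw [← hg]
  exact hR.Lsmul g c x

theorem bend {c : Y} {g : G} (hg : g • c = c) {x y : V} (h : 3 * bgiConst δ C Δ < hR.an c x y) :
    coneDist d L x (g • y) ≤ coneDist d L x y := by
  obtain ⟨a, ha, b, hb, h⟩ := hR.through h
  have h1 := hR.through_le (x := x) (y := g • y) ha ((hR.smul_mem_L hg).2 hb)
  rw [hR.coneDist_smul] at h1
  omega

theorem red {c : Y} {x y : V} (h : La + 2 * bgiConst δ C Δ < hR.an c x y) :
    ∃ g : G, g • c = c ∧ d x (g • y) + bgiConst δ C Δ < d x y := by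
  obtain ⟨p, hp⟩ := exists_proj d (hR.qc c).1 x
  obtain ⟨q, hq⟩ := exists_proj d (hR.qc c).1 y
  have h1 := hR.an_le_dist hp hq
  obtain ⟨g, hg, h2⟩ := hR.tr c p q hp.1 hq.1 (by omega)
  refine ⟨g, hg, ?_⟩
  have := le_bgiConst δ C Δ
  have h3 := hR.hd.tri x p (g • y)
  have h4 := hR.hd.tri p (g • q) (g • y)
  rw [hR.inv] at h4
  rcases (hR.qc c).proj_proj hR.hd hR.hy hp hq with h8 | h8 <;> omega

theorem greendlinger (x : V) (P : G → Prop) (h1 : P 1)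
    (hstep : ∀ n c g, g • c = c → Lr ≤ hR.an c x (n • x) + 13 * bgiConst δ C Δ →
      P (g * n) → P n) : ∀ n ∈ rotSubgroup G Y, P n :=
  (hR.windmill x).greendlinger P h1 hstep

theorem exists_large (x : V) {n : G} (hn : n ∈ rotSubgroup G Y) (h1 : n ≠ 1) :
    ∃ c, Lr ≤ hR.an c x (n • x) + 13 * bgiConst δ C Δ := by
  revert h1
  refine hR.greendlinger x (fun n => n ≠ 1 → ∃ c, Lr ≤ hR.an c x (n • x) + 13 * bgiConst δ C Δ)
    (fun h => absurd rfl h) ?_ n hn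
  intro n c g _ h _ _
  exact ⟨c, h⟩

/-- If no angle is large, distances in the cone-off are minimal among translates. -/
theorem lemmaR {x y : V} (h : ∀ c, hR.an c x y + 20 * bgiConst δ C Δ ≤ Lr) :
    ∀ n ∈ rotSubgroup G Y, coneDist d L x y ≤ coneDist d L (n • x) y := by
  refine hR.greendlinger x _ (by rw [one_smul]) ?_
  intro n c g hg hl hP
  have hB := le_bgiConst δ C Δ
  have h1 := hR.an_tri c x y (n • x)
  have h2 := h c
  have h3 := hR.bend hg (x := y) (y := n • x) (by omega)
  rw [mul_smul] at hP
  have := hR.isGeod_D.symm y (g • n • x)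
  have := hR.isGeod_D.symm y (n • x)
  omega

theorem hyp_quotient :
    Hyp (quotDist (rotSubgroup G Y) (coneDist d L)) (coneConst δ C) := by
  refine hyp_quot hR.isGeod_D hR.coneDist_smul (hyp_cone hR.hd hR.hy hR.qc) fun x => ?_
  refine hR.greendlinger x _ (fun z y w => ⟨z, y, w, rfl, rfl, rfl, le_rfl, le_rfl, le_rfl,
    by rw [one_smul]⟩) ?_
  intro n c g hg hl hP z y w
  have hB := le_bgiConst δ C Δ
  have := hR.le_Lr
  have h1 := hR.an_tri c x z (n • x)
  have h2 := hR.an_tri c z y (n • x)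
  have h3 := hR.an_tri c y w (n • x)
  have hN := mem_rotSubgroup hg
  have hD := hR.coneDist_smul g
  have hm : ∀ v : V, OrbQ.mk (rotSubgroup G Y) (g • v) = OrbQ.mk (rotSubgroup G Y) v :=
    fun v => OrbQ.mk_smul hN v
  by_cases c1 : 3 * bgiConst δ C Δ < hR.an c x z
  · obtain ⟨z', y', w', e1, e2, e3, f1, f2, f3, f4⟩ := hP (g • z) (g • y) (g • w)
    rw [hm] at e1 e2 e3
    rw [mul_smul] at f4
    rw [hD] at f2 f3 f4
    exact ⟨z', y', w', e1, e2, e3, f1.trans (hR.bend hg c1), f2, f3, f4⟩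
  by_cases c2 : 3 * bgiConst δ C Δ < hR.an c z y
  · obtain ⟨z', y', w', e1, e2, e3, f1, f2, f3, f4⟩ := hP z (g • y) (g • w)
    rw [hm] at e2 e3
    rw [mul_smul] at f4
    rw [hD] at f3 f4
    exact ⟨z', y', w', e1, e2, e3, f1, f2.trans (hR.bend hg c2), f3, f4⟩
  by_cases c3 : 3 * bgiConst δ C Δ < hR.an c y w
  · obtain ⟨z', y', w', e1, e2, e3, f1, f2, f3, f4⟩ := hP z y (g • w)
    rw [hm] at e3
    rw [mul_smul] at f4
    rw [hD] at f4
    exact ⟨z', y', w', e1, e2, e3, f1, f2, f3.trans (hR.bend hg c3), f4⟩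
  · obtain ⟨z', y', w', e1, e2, e3, f1, f2, f3, f4⟩ := hP z y w
    rw [mul_smul] at f4
    exact ⟨z', y', w', e1, e2, e3, f1, f2, f3, f4.trans (hR.bend hg (by omega))⟩

end RotFam
namespace RotFam
variable {G V Y : Type*} [Group G] [MulAction G V] [MulAction G Y]
  {d : V → V → ℕ} {L : Y → Set V} {δ C Δ La Lr : ℕ} (hR : RotFam G d L δ C Δ La Lr)

/-- The angle at `c` between a point and a set of the family. -/
noncomputable def ap (hR : RotFam G d L δ C Δ La Lr) (c : Y) (x : V) (c' : Y) : ℕ :=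
  hR.rho c (Sum.inl x) (Sum.inr c')

/-- The distance from a point to a set of the family in the cone-off. -/
noncomputable def cd (_ : RotFam G d L δ C Δ La Lr) (x : V) (c : Y) : ℕ :=
  setDist (coneDist d L) {x} (L c)

include hR

theorem cd_smul (g : G) (x : V) (c : Y) : hR.cd (g • x) (g • c) = hR.cd x c :=
  setDist_smul hR.coneDist_smul g (by simp) (hR.Lsmul g c)

theorem cd_le {x a : V} {c : Y} (ha : a ∈ L c) : hR.cd x c ≤ coneDist d L x a :=
  setDist_le rfl ha

theorem exists_cd (x : V) (c : Y) : ∃ a ∈ L c, coneDist d L x a = hR.cd x c := by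
  obtain ⟨a, ha, b, hb, h⟩ := exists_setDist (d := coneDist d L) (Set.singleton_nonempty x)
    (hR.qc c).1
  obtain rfl : a = x := ha
  exact ⟨b, hb, h⟩

theorem ap_beh {c c' : Y} {x : V} (h : bgiConst δ C Δ < hR.ap c x c') :
    hR.ap c' x c ≤ bgiConst δ C Δ :=
  (hR.windmill x).beh c c' (Sum.inl x) (by
    rintro rfl
    have := (hR.windmill x).self c (Sum.inl x)
    rw [(hR.windmill x).symm] at this
    exact absurd (h.trans_le this) (lt_irrefl _)) h

theorem ap_ne {c c' : Y} {x : V} (h : bgiConst δ C Δ < hR.ap c x c') : c' ≠ c := by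
  rintro rfl
  have := (hR.windmill x).self c' (Sum.inl x)
  rw [(hR.windmill x).symm] at this
  exact absurd (h.trans_le this) (lt_irrefl _)

theorem an_le_ap {c c' : Y} (h : c' ≠ c) (x y : V) : hR.an c x y ≤ hR.ap c x c' + hR.ap c y c' := by
  have h1 := (hR.windmill x).tri c (Sum.inl x) (Sum.inr c') (Sum.inl y) (by
    intro h'
    exact h (Sum.inr_injective h'))
  rw [(hR.windmill x).symm c (Sum.inr c')] at h1
  exact h1

theorem ap_le (c c' : Y) (x y : V) : hR.ap c x c' ≤ hR.an c x y + hR.ap c y c' :=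
  (hR.windmill x).tri c (Sum.inl x) (Sum.inl y) (Sum.inr c') (by
    intro h
    cases h)

theorem through_ap {c c' : Y} {x b : V} (h : 4 * bgiConst δ C Δ < hR.ap c x c') (hb : b ∈ L c') :
    ∃ a ∈ L c, ∃ a' ∈ L c, coneDist d L x a + 1 + coneDist d L a' b ≤ coneDist d L x b := by
  have hB := le_bgiConst δ C Δ
  obtain ⟨p, hp⟩ := exists_proj d (hR.qc c).1 x
  obtain ⟨q, hq⟩ := exists_proj d (hR.qc c).1 b
  have hne := hR.ap_ne (x := x) (c := c) (c' := c') (by omega)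
  have := hR.angle_le_dist (P := Sum.inl x) (R := Sum.inr c') (c := c) (by simp)
    (fun h => hne (Sum.inr_injective h)) rfl hb hp hq
  unfold ap rho at h
  exact bgi hR.hd hR.hy hR.qc hR.ov hp hq (by omega)

theorem cd_lt {c c' : Y} {x : V} (h : 4 * bgiConst δ C Δ < hR.ap c x c') :
    hR.cd x c < hR.cd x c' := by
  obtain ⟨b, hb, h1⟩ := hR.exists_cd x c'
  obtain ⟨a, ha, a', ha', h2⟩ := hR.through_ap h hb
  have := hR.cd_le (x := x) ha
  omega

theorem eq_of_cd {c c' : Y} {x y : V} (h : 8 * bgiConst δ C Δ < hR.an c x y)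
    (h' : 8 * bgiConst δ C Δ < hR.an c' x y) (hc : hR.cd x c = hR.cd x c') : c = c' := by
  by_contra hne
  have h1 : ¬ 4 * bgiConst δ C Δ < hR.ap c x c' := fun h => by have := hR.cd_lt h; omega
  have h2 : ¬ 4 * bgiConst δ C Δ < hR.ap c' x c := fun h => by have := hR.cd_lt h; omega
  have h3 := hR.an_le_ap (Ne.symm hne) x y
  have h4 := hR.an_le_ap hne x y
  have h5 := hR.cd_lt (c := c) (c' := c') (x := y) (by omega)
  have h6 := hR.cd_lt (c := c') (c' := c) (x := y) (by omega)
  omega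

theorem free {n : G} (hn : n ∈ rotSubgroup G Y) {x : V} (h : n • x = x) : n = 1 := by
  by_contra h1
  obtain ⟨c, hc⟩ := hR.exists_large x hn h1
  have := hR.an_le c x (n • x)
  rw [h, hR.hd.self] at this
  have := hR.le_Lr
  have := le_bgiConst δ C Δ
  rw [h] at hc
  omega

omit hR in
theorem _root_.Olsh.OrbQ.lift_fix {N : Subgroup G} [N.Normal] {g : G ⧸ N} {x : V}
    (h : g • OrbQ.mk N x = OrbQ.mk N x) : ∃ g₀ : G, (g₀ : G ⧸ N) = g ∧ g₀ • x = x := by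
  obtain ⟨g, rfl⟩ := QuotientGroup.mk_surjective g
  rw [OrbQ.mk_smul_mk] at h
  obtain ⟨n, hn, h⟩ := OrbQ.mk_eq.1 h
  refine ⟨n⁻¹ * g, ?_, by rw [mul_smul, ← h, inv_smul_smul]⟩
  have : n⁻¹ * g = g * (g⁻¹ * n⁻¹ * g⁻¹⁻¹) := by group
  rw [this, QuotientGroup.mk_mul_of_mem]
  exact Subgroup.Normal.conj_mem ‹_› _ (inv_mem hn) _

omit hR in
theorem coe_eq_one {g : G} {c : Y} (h : g • c = c) : (g : G ⧸ rotSubgroup G Y) = 1 :=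
  (QuotientGroup.eq_one_iff g).2 (mem_rotSubgroup h)

/-- Trivial intersection of stabilizers passes to the quotient. -/
theorem stab_inter (hst : ∀ (g : G) (v w : V), g • v = v → g • w = w → g ≠ 1 → v = w)
    (g : G ⧸ rotSubgroup G Y) (a b : OrbQ (rotSubgroup G Y) V) (ha : g • a = a) (hb : g • b = b)
    (hg : g ≠ 1) : a = b := by
  have hB := le_bgiConst δ C Δ
  obtain ⟨v, w, rfl, rfl, hvw⟩ := quotDist_rep₂ (d := d) a b
  have hmin : ∀ n ∈ rotSubgroup G Y, d v w ≤ d v (n • w) := by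
    intro n hn
    rw [hvw]
    have := quotDist_le (N := rotSubgroup G Y) (d := d) v (n • w)
    rwa [OrbQ.mk_smul hn] at this
  have hred : ∀ c, hR.an c v w ≤ La + 2 * bgiConst δ C Δ := by
    intro c
    by_contra hc
    obtain ⟨k, hk, h⟩ := hR.red (not_le.1 hc)
    have := hmin k (mem_rotSubgroup hk)
    omega
  obtain ⟨g, rfl, hv⟩ := OrbQ.lift_fix ha
  rw [OrbQ.mk_smul_mk] at hb
  obtain ⟨n, hn, hnw⟩ := OrbQ.mk_eq.1 hb
  by_cases hn1 : n = 1
  · subst hn1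
    rw [one_smul] at hnw
    rw [hst g v w hv hnw.symm (fun h => hg (by rw [h]; rfl))]
  obtain ⟨c, hc⟩ := hR.exists_large w hn hn1
  exfalso
  rw [hnw] at hc
  have h1 := hR.an_tri c w v (g • w)
  have h2 : hR.an c v (g • w) = hR.an (g⁻¹ • c) v w := by
    rw [← hR.an_smul g (g⁻¹ • c), smul_inv_smul, hv]
  have h3 := hred c
  have h4 := hred (g⁻¹ • c)
  have h5 := hR.an_comm c w v
  have h6 := hR.le_Lr
  have h7 : c = g⁻¹ • c := by
    refine hR.eq_of_cd (x := v) (y := w) (by omega) (by omega) ?_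
    rw [← hR.cd_smul g v (g⁻¹ • c), smul_inv_smul, hv]
  exact hg (coe_eq_one (c := c) (eq_inv_smul_iff.1 h7))

theorem cd_min {c : Y} {z y : V} (hred : ∀ f, hR.an f z y ≤ La + 2 * bgiConst δ C Δ)
    (h : 2 * bgiConst δ C Δ < hR.an c z y) : ∀ n ∈ rotSubgroup G Y, hR.cd z c ≤ hR.cd (n • z) c := by
  refine hR.greendlinger z _ (by rw [one_smul]) ?_
  intro n f g hg hl hP
  by_cases hfc : f = c
  · subst hfc
    rw [mul_smul] at hP
    conv_rhs at hP => rw [← hg]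
    rwa [hR.cd_smul] at hP
  have hB := le_bgiConst δ C Δ
  have hLr := hR.le_Lr
  have h1 : hR.ap f z c ≤ La + 3 * bgiConst δ C Δ := by
    by_contra h1
    have h2 := hR.ap_beh (c := f) (c' := c) (x := z) (by omega)
    have h3 := hR.an_le_ap (c := c) (c' := f) hfc z y
    have h4 := hR.ap_beh (c := c) (c' := f) (x := y) (by omega)
    have h5 := hR.ap_le f c z y
    have h6 := hred f
    omega
  have h2 := hR.an_le_ap (Ne.symm hfc) z (n • z)
  obtain ⟨b, hb, h3⟩ := hR.exists_cd (n • z) c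
  obtain ⟨a, ha, a', ha', h4⟩ := hR.through_ap (c := f) (c' := c) (x := n • z) (by omega) hb
  refine hP.trans ?_
  rw [← h3, mul_smul]
  refine (hR.cd_le hb).trans ?_
  have := hR.through_le (x := g • n • z) (y := b) ((hR.smul_mem_L hg).2 ha) ha'
  rw [hR.coneDist_smul] at this
  omega

/-- Two consecutive large angles in a reduced triangle are impossible. -/
theorem no_turn {p q s : V} {c₁ c₂ c₃ : Y} {n n' : G}
    (hred : ∀ f, hR.an f s q ≤ La + 2 * bgiConst δ C Δ) (hc : hR.cd p c₁ = hR.cd p c₂)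
    (hne : c₁ ≠ c₂) (h1 : 20 * bgiConst δ C Δ < hR.an c₁ s p)
    (h2 : 20 * bgiConst δ C Δ < hR.an c₂ p q) (hn : n ∈ rotSubgroup G Y)
    (hn' : n' ∈ rotSubgroup G Y) (hs : hR.cd (n • s) c₃ ≤ hR.cd s c₁)
    (hq : hR.cd (n' • q) c₃ ≤ hR.cd q c₂) : False := by
  have hB := le_bgiConst δ C Δ
  have hLr := hR.le_Lr
  have e1 : hR.an c₁ p q ≤ 8 * bgiConst δ C Δ := by
    by_contra h
    exact hne (hR.eq_of_cd (not_le.1 h) (by omega) hc)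
  have e2 : hR.an c₂ s p ≤ 8 * bgiConst δ C Δ := by
    rw [hR.an_comm] at h1 ⊢
    by_contra h
    exact hne (hR.eq_of_cd (by omega) (not_le.1 h) hc)
  have e3 := hR.an_tri c₁ s q p
  have e4 := hR.an_tri c₂ p s q
  rw [hR.an_comm c₁ q p] at e3
  rw [hR.an_comm c₂ p s] at e4
  have e5 : hR.ap c₂ s c₁ ≤ bgiConst δ C Δ := by
    by_contra h
    have f1 := hR.ap_beh (not_le.1 h)
    have f2 := hR.an_le_ap hne.symm s p
    have f3 := hR.cd_lt (c := c₁) (c' := c₂) (x := p) (by omega)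
    omega
  have e6 := hR.an_le_ap hne s q
  have e7 := hR.ap_beh (c := c₂) (c' := c₁) (x := q) (by omega)
  have e8 := hR.an_le_ap hne.symm s q
  obtain ⟨a, ha, b, hb, e9⟩ := hR.through (c := c₂) (x := s) (y := q) (by omega)
  obtain ⟨a', ha', b', hb', e10⟩ := hR.through_ap (c := c₁) (c' := c₂) (x := s) (by omega) ha
  have e11 := hR.cd_le (x := s) ha'
  have e12 := hR.cd_le (x := q) hb
  have e13 := hR.isGeod_D.symm q b
  obtain ⟨v, hv, e14⟩ := hR.exists_cd (n • s) c₃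
  obtain ⟨v', hv', e15⟩ := hR.exists_cd (n' • q) c₃
  have e16 := hR.through_le (x := n • s) (y := n' • q) hv hv'
  have e17 := hR.isGeod_D.symm v' (n' • q)
  have e18 := hR.lemmaR (x := s) (y := q) (fun c => by have := hred c; omega) (n'⁻¹ * n)
    (mul_mem (inv_mem hn') hn)
  rw [← hR.coneDist_smul n' ((n'⁻¹ * n) • s), ← mul_smul, mul_inv_cancel_left] at e18
  omega

/-- Shortening a triangle with a large angle on a side. -/
theorem red_triangle {c : Y} {x y : V} (z : V) (h : La + 2 * bgiConst δ C Δ < hR.an c x y) :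
    ∃ g : G, g • c = c ∧ (d x (g • y) + d (g • y) z < d x y + d y z ∨
      d (g • x) y + d (g • x) z < d x y + d x z) := by
  have hB := le_bgiConst δ C Δ
  obtain ⟨p, hp⟩ := exists_proj d (hR.qc c).1 x
  obtain ⟨q, hq⟩ := exists_proj d (hR.qc c).1 y
  obtain ⟨r, hr⟩ := exists_proj d (hR.qc c).1 z
  have h1 := hR.an_le_dist hp hq
  obtain ⟨g, hg, h2⟩ := hR.tr c p q hp.1 hq.1 (by omega)
  have t1 := hR.hd.tri x p (g • y)
  have t2 := hR.hd.tri p (g • q) (g • y)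
  have t3 := hR.hd.tri (g • y) (g • q) z
  have t4 := hR.hd.tri (g • q) p z
  have t5 := hR.hd.tri p r z
  have t6 := hR.hd.tri (g⁻¹ • x) (g⁻¹ • p) z
  have t7 := hR.hd.tri (g⁻¹ • p) q z
  have t8 := hR.hd.tri q r z
  have t9 : d (g⁻¹ • x) y = d x (g • y) := by rw [← hR.inv g, smul_inv_smul]
  have t10 : d (g⁻¹ • p) q = d p (g • q) := by rw [← hR.inv g, smul_inv_smul]
  rw [hR.inv] at t2 t3 t6
  have t11 := hR.hd.tri p r q
  have s1 := hR.hd.symm q y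
  have s2 := hR.hd.symm r z
  have s3 := hR.hd.symm (g • q) p
  have s4 := hR.hd.symm r q
  have p1 := (hR.qc c).proj_proj hR.hd hR.hy hp hq
  have p2 := (hR.qc c).proj_proj hR.hd hR.hy hp hr
  have p3 := (hR.qc c).proj_proj hR.hd hR.hy hq hr
  by_cases hopt : d x (g • y) + d (g • y) z < d x y + d y z
  · exact ⟨g, hg, Or.inl hopt⟩
  · refine ⟨g⁻¹, by rw [inv_smul_eq_iff, hg], Or.inr ?_⟩
    omega

end RotFam
namespace RotFam
variable {G V Y : Type*} [Group G] [MulAction G V] [MulAction G Y]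
  {d : V → V → ℕ} {L : Y → Set V} {δ C Δ La Lr : ℕ} (hR : RotFam G d L δ C Δ La Lr)
include hR

/-- Elliptic elements with elliptic product: the condition passes to the quotient. -/
theorem elliptic_mul (hst : ∀ (g : G) (v w : V), g • v = v → g • w = w → g ≠ 1 → v = w)
    (hell : ∀ (u v : G) (p q s : V), u ≠ 1 → v ≠ 1 → u • p = p → v • q = q → (u * v) • s = s →
      p = q)
    (u v : G ⧸ rotSubgroup G Y) (p q s : OrbQ (rotSubgroup G Y) V) (hu : u ≠ 1) (hv : v ≠ 1)
    (hp : u • p = p) (hq : v • q = q) (hs : (u * v) • s = s) : p = q := by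
  have hB := le_bgiConst δ C Δ
  have hLr := hR.le_Lr
  by_cases huv : u * v = 1
  · refine hR.stab_inter hst u p q hp ?_ hu
    rw [eq_inv_of_mul_eq_one_left huv, inv_smul_eq_iff, hq]
  obtain ⟨⟨⟨x, y⟩, z⟩, ⟨rfl, rfl, rfl⟩, hmin⟩ := WellFounded.has_min
    (measure fun t : (V × V) × V => d t.1.1 t.1.2 + d t.1.2 t.2 + d t.1.1 t.2).wf
    {t | OrbQ.mk _ t.1.1 = p ∧ OrbQ.mk _ t.1.2 = q ∧ OrbQ.mk _ t.2 = s} (by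
      obtain ⟨x, hx⟩ := OrbQ.exists_rep p
      obtain ⟨y, hy⟩ := OrbQ.exists_rep q
      obtain ⟨z, hz⟩ := OrbQ.exists_rep s
      exact ⟨((x, y), z), hx, hy, hz⟩)
  have hmin' : ∀ x' y' z', OrbQ.mk (rotSubgroup G Y) x' = OrbQ.mk _ x →
      OrbQ.mk (rotSubgroup G Y) y' = OrbQ.mk _ y → OrbQ.mk (rotSubgroup G Y) z' = OrbQ.mk _ z →
      d x y + d y z + d x z ≤ d x' y' + d y' z' + d x' z' :=
    fun x' y' z' h1 h2 h3 => not_lt.1 (hmin ((x', y'), z') ⟨h1, h2, h3⟩)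
  clear hmin
  dsimp only at hp hq hs ⊢
  have hm : ∀ {g : G} {c : Y}, g • c = c → ∀ v : V,
      OrbQ.mk (rotSubgroup G Y) (g • v) = OrbQ.mk _ v :=
    fun h v => OrbQ.mk_smul (mem_rotSubgroup h) v
  have r1 : ∀ c, hR.an c x y ≤ La + 2 * bgiConst δ C Δ := by
    intro c
    by_contra hc
    obtain ⟨g, hg, h | h⟩ := hR.red_triangle z (not_le.1 hc)
    · have := hmin' x (g • y) z rfl (hm hg y) rfl
      omega
    · have := hmin' (g • x) y z (hm hg x) rfl rfl
      omega
  have r2 : ∀ c, hR.an c y z ≤ La + 2 * bgiConst δ C Δ := by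
    intro c
    by_contra hc
    obtain ⟨g, hg, h | h⟩ := hR.red_triangle x (not_le.1 hc)
    · have := hmin' x y (g • z) rfl rfl (hm hg z)
      have := hR.hd.symm (g • z) x
      have := hR.hd.symm z x
      omega
    · have := hmin' x (g • y) z rfl (hm hg y) rfl
      have := hR.hd.symm (g • y) x
      have := hR.hd.symm y x
      omega
  have r3 : ∀ c, hR.an c z x ≤ La + 2 * bgiConst δ C Δ := by
    intro c
    by_contra hc
    obtain ⟨g, hg, h | h⟩ := hR.red_triangle y (not_le.1 hc)
    · have := hmin' (g • x) y z (hm hg x) rfl rfl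
      have := hR.hd.symm (g • x) z
      have := hR.hd.symm x z
      omega
    · have := hmin' x y (g • z) rfl rfl (hm hg z)
      have := hR.hd.symm (g • z) y
      have := hR.hd.symm z y
      have := hR.hd.symm (g • z) x
      have := hR.hd.symm z x
      omega
  obtain ⟨u, rfl, hux⟩ := OrbQ.lift_fix hp
  obtain ⟨v, rfl, hvy⟩ := OrbQ.lift_fix hq
  rw [← QuotientGroup.mk_mul, OrbQ.mk_smul_mk] at hs
  obtain ⟨n, hn, hnz⟩ := OrbQ.mk_eq.1 hs
  by_cases hn1 : n = 1
  · subst hn1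
    rw [one_smul] at hnz
    rw [hell u v x y z (fun h => hu (by rw [h]; rfl)) (fun h => hv (by rw [h]; rfl)) hux hvy
      hnz.symm]
  exfalso
  obtain ⟨c, hc⟩ := hR.exists_large z hn hn1
  have hw : (u * v)⁻¹ • n • z = z := by rw [hnz, inv_smul_smul]
  have ne12 : c ≠ u⁻¹ • c := by
    intro h
    exact hu (coe_eq_one (c := c) (eq_inv_smul_iff.1 h))
  have ne23 : u⁻¹ • c ≠ (u * v)⁻¹ • c := by
    intro h
    refine hv (coe_eq_one (c := u⁻¹ • c) ?_)
    rw [mul_inv_rev, mul_smul] at h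
    exact eq_inv_smul_iff.1 h
  have ne31 : (u * v)⁻¹ • c ≠ c := by
    intro h
    exact huv (coe_eq_one (c := c) (inv_smul_eq_iff.1 h).symm)
  have cx : hR.cd x c = hR.cd x (u⁻¹ • c) := by
    rw [← hR.cd_smul u x (u⁻¹ • c), smul_inv_smul, hux]
  have cy : hR.cd y (u⁻¹ • c) = hR.cd y ((u * v)⁻¹ • c) := by
    rw [← hR.cd_smul v y ((u * v)⁻¹ • c), mul_inv_rev, mul_smul, smul_inv_smul, hvy]
  have cz : hR.cd z ((u * v)⁻¹ • c) = hR.cd (n • z) c := by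
    rw [← hR.cd_smul (u * v) z ((u * v)⁻¹ • c), smul_inv_smul, ← hnz]
  set m := (u * v)⁻¹ * n⁻¹ * (u * v)⁻¹⁻¹ with hmdef
  have hmN : m ∈ rotSubgroup G Y := Subgroup.Normal.conj_mem inferInstance _ (inv_mem hn) _
  have cz' : hR.cd (m • z) ((u * v)⁻¹ • c) = hR.cd z c := by
    rw [hmdef, mul_smul, mul_smul, inv_inv, ← hnz, inv_smul_smul, hR.cd_smul]
  have a1 := hR.an_tri c z x (n • z)
  have a2 := hR.an_tri c x (u • y) (n • z)
  have a3 : hR.an c x (u • y) = hR.an (u⁻¹ • c) x y := by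
    rw [← hR.an_smul u (u⁻¹ • c), smul_inv_smul, hux]
  have a4 : hR.an c (u • y) (n • z) = hR.an ((u * v)⁻¹ • c) y z := by
    rw [← hR.an_smul (u * v) ((u * v)⁻¹ • c), smul_inv_smul, hnz, mul_smul u v y, hvy]
  have b1 := r3 c
  have b2 := r1 (u⁻¹ • c)
  have b3 := r2 ((u * v)⁻¹ • c)
  have hsm : ∀ c x y, hR.an c x y = hR.an c y x := hR.an_comm
  by_cases k1 : 20 * bgiConst δ C Δ < hR.an c z x
  · by_cases k2 : 20 * bgiConst δ C Δ < hR.an (u⁻¹ • c) x y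
    · refine hR.no_turn (p := x) (q := y) (s := z) (c₃ := (u * v)⁻¹ • c) (fun f => ?_) cx ne12 k1 k2
        hmN (one_mem _) cz'.le ?_
      · rw [hsm]; exact r2 f
      · rw [one_smul, cy]
    · refine hR.no_turn (p := z) (q := x) (s := y) (c₁ := (u * v)⁻¹ • c) (c₂ := c)
        (c₃ := u⁻¹ • c) (fun f => ?_) ?_ ne31 (by omega) k1 (one_mem _) (one_mem _) ?_ ?_
      · rw [hsm]; exact r1 f
      · refine le_antisymm ?_ ?_
        · rw [← cz']
          exact hR.cd_min (y := y) (fun f => by rw [hsm]; exact r2 f) (by rw [hsm]; omega) m hmN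
        · rw [cz]
          exact hR.cd_min (y := x) (fun f => r3 f) (by omega) n hn
      · rw [one_smul, cy]
      · rw [one_smul, cx]
  · refine hR.no_turn (p := y) (q := z) (s := x) (c₁ := u⁻¹ • c) (c₂ := (u * v)⁻¹ • c) (c₃ := c)
      (fun f => ?_) cy ne23 (by omega) (by omega) (one_mem _) hn ?_ cz.ge
    · rw [hsm]; exact r3 f
    · rw [one_smul, cx]

end RotFam

section
variable {V : Type*} {d : V → V → ℕ} {δ c : ℕ}

/-- Local-to-global principle for sequences with small Gromov products. -/
theorem chain_left (hd : IsGeod d) (hy : Hyp d δ) {x : ℤ → V}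
    (h1 : ∀ i, d (x i) (x (i + 1)) + d (x (i + 1)) (x (i + 2)) ≤ d (x i) (x (i + 2)) + c)
    (h2 : ∀ i, c + 2 * δ < d (x i) (x (i + 1))) (a : ℤ) (n : ℕ) :
    d (x a) (x (a + n)) + d (x (a + n)) (x (a + n + 1)) ≤ d (x a) (x (a + n + 1)) + (c + δ) := by
  induction n with
  | zero => simp [hd.self]
  | succ n ih =>
    have e1 : a + (n + 1 : ℕ) = a + n + 1 := by push_cast; ring
    rw [e1]
    have l1 := h1 (a + n)
    have l2 := h2 (a + n)
    have e2 : a + n + 2 = a + n + 1 + 1 := by ring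
    rw [e2] at l1
    have s := hd.symm (x (a + n + 1)) (x (a + n))
    rcases hy (x a) (x (a + n + 1)) (x (a + n)) (x (a + n + 1 + 1)) with h | h <;> omega

theorem chain_right (hd : IsGeod d) (hy : Hyp d δ) {x : ℤ → V}
    (h1 : ∀ i, d (x i) (x (i + 1)) + d (x (i + 1)) (x (i + 2)) ≤ d (x i) (x (i + 2)) + c)
    (h2 : ∀ i, c + 2 * δ < d (x i) (x (i + 1))) (a : ℤ) (n : ℕ) :
    d (x (a - n - 1)) (x (a - n)) + d (x (a - n)) (x a) ≤ d (x (a - n - 1)) (x a) + (c + δ) := by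
  have := chain_left hd hy (x := fun i => x (-i)) (c := c) ?_ ?_ (-a) n
  · simp only [neg_neg] at this
    have e1 : -(-a + (n : ℤ)) = a - n := by ring
    have e2 : -(-a + (n : ℤ) + 1) = a - n - 1 := by ring
    rw [e1, e2] at this
    have s1 := hd.symm (x (a - n - 1)) (x (a - n))
    have s2 := hd.symm (x (a - n)) (x a)
    have s3 := hd.symm (x (a - n - 1)) (x a)
    omega
  · intro i
    have := h1 (-(i + 2))
    have e1 : -(i + 2) + 1 = -(i + 1) := by ring
    have e2 : -(i + 2) + 2 = - i := by ring
    rw [e1, e2] at this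
    have s1 := hd.symm (x (-i)) (x (-(i + 1)))
    have s2 := hd.symm (x (-(i + 1))) (x (-(i + 2)))
    have s3 := hd.symm (x (-i)) (x (-(i + 2)))
    omega
  · intro i
    have := h2 (-(i + 1))
    have e1 : -(i + 1) + 1 = -i := by ring
    rw [e1] at this
    have s1 := hd.symm (x (-i)) (x (-(i + 1)))
    omega

theorem chain (hd : IsGeod d) (hy : Hyp d δ) {x : ℤ → V}
    (h1 : ∀ i, d (x i) (x (i + 1)) + d (x (i + 1)) (x (i + 2)) ≤ d (x i) (x (i + 2)) + c)
    (h2 : ∀ i, c + 2 * δ < d (x i) (x (i + 1))) {i j k : ℤ} (hij : i ≤ j) (hjk : j ≤ k) :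
    d (x i) (x j) + d (x j) (x k) ≤ d (x i) (x k) + (c + 2 * δ) := by
  rcases hjk.eq_or_lt with rfl | hjk
  · simp [hd.self]
  obtain ⟨n, rfl⟩ := Int.le.dest hij
  obtain ⟨m, hm⟩ := Int.le.dest (show i + n + 1 ≤ k by omega)
  have l1 := chain_left hd hy h1 h2 i n
  have l2 := chain_right hd hy h1 h2 k m
  have e1 : k - m = i + n + 1 := by omega
  have e2 : i + n + 1 - 1 = i + n := by ring
  rw [e1, e2] at l2
  have l3 := h2 (i + n)
  have s := hd.symm (x (i + n + 1)) (x (i + n))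
  rcases hy (x i) (x (i + n + 1)) (x (i + n)) (x k) with h | h <;> omega

end

namespace RotFam
variable {G V Y : Type*} [Group G] [MulAction G V] [MulAction G Y]
  {d : V → V → ℕ} {L : Y → Set V} {δ C Δ La Lr : ℕ} (hR : RotFam G d L δ C Δ La Lr)
include hR

/-- The distance from a point to a set of the family. -/
theorem setDist_lip (x y : V) (c : Y) : setDist d {x} (L c) ≤ d x y + setDist d {y} (L c) := by
  obtain ⟨p, hp⟩ := exists_proj d (hR.qc c).1 y
  rw [hp.setDist_eq]
  exact (setDist_le (Set.mem_singleton x) hp.1).trans (hR.hd.tri x y p)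

theorem setDist_smul_L (g : G) (x : V) (c : Y) :
    setDist d {g • x} (L (g • c)) = setDist d {x} (L c) :=
  setDist_smul hR.inv g (by simp) (hR.Lsmul g c)

theorem an_eq (c : Y) (x y : V) :
    hR.an c x y = d x y - setDist d {x} (L c) - setDist d {y} (L c) + bgiConst δ C Δ := by
  unfold an rho angle
  rw [← setDist_singleton (d := d) x y]
  rfl

theorem ap_le_setDist (c c' : Y) (x : V) :
    hR.ap c x c' ≤ setDist d {x} (L c') - setDist d {x} (L c) + bgiConst δ C Δ := by
  unfold ap rho angle
  exact Nat.add_le_add_right (Nat.sub_le _ _) _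

theorem an_mono {a b x : V} {e : ℕ} (c : Y) (h : d a x + d x b ≤ d a b + e) :
    hR.an c a x ≤ hR.an c a b + e := by
  rw [hR.an_eq, hR.an_eq]
  have := hR.setDist_lip b x c
  have := hR.hd.symm b x
  omega

/-- A point between two others is close to a set passed on the way on both sides. -/
theorem setDist_small {a b x : V} {e : ℕ} {c : Y} (h : d a x + d x b ≤ d a b + e)
    (h1 : 3 * bgiConst δ C Δ ≤ hR.an c a x) (h2 : 3 * bgiConst δ C Δ ≤ hR.an c x b) :
    2 * setDist d {x} (L c) ≤ e + 2 * (2 * C + δ) := by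
  obtain ⟨p, hp⟩ := exists_proj d (hR.qc c).1 a
  obtain ⟨q, hq⟩ := exists_proj d (hR.qc c).1 x
  obtain ⟨r, hr⟩ := exists_proj d (hR.qc c).1 b
  rw [hq.setDist_eq]
  have hB := le_bgiConst δ C Δ
  have l1 := hR.an_le_dist hp hq
  have l2 := hR.an_le_dist hq hr
  have t1 := hR.hd.tri a p b
  have t2 := hR.hd.tri p r b
  have t3 := hR.hd.tri p q r
  have s1 := hR.hd.symm q x
  rcases (hR.qc c).proj_proj hR.hd hR.hy hp hq with h8 | h8
  · rcases (hR.qc c).proj_proj hR.hd hR.hy hq hr with h9 | h9 <;> omega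
  · omega

/-- Points between a point of minimal displacement and its image. -/
theorem min_disp {f : G} {p : V} (hmin : ∀ q, d p (f • p) ≤ d q (f • q)) {i : ℤ} {y : V}
    (hy : d (f ^ i • p) y + d y (f ^ (i + 1) • p) = d p (f • p)) :
    d y (f • y) = d p (f • p) := by
  refine le_antisymm ?_ (hmin y)
  have h1 := hR.hd.tri y (f ^ (i + 1) • p) (f • y)
  have h2 : d (f ^ (i + 1) • p) (f • y) = d (f ^ i • p) y := by
    rw [add_comm, zpow_add, zpow_one, mul_smul, hR.inv]
  omega

theorem dist_step (f : G) (p : V) (i : ℤ) : d (f ^ i • p) (f ^ (i + 1) • p) = d p (f • p) := by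
  rw [zpow_add, zpow_one, mul_smul, hR.inv]

theorem orbit_local {f : G} {p : V} (hmin : ∀ q, d p (f • p) ≤ d q (f • q))
    (hbig : 2 * δ + 2 < d p (f • p)) (i : ℤ) :
    d (f ^ i • p) (f ^ (i + 1) • p) + d (f ^ (i + 1) • p) (f ^ (i + 2) • p) ≤
      d (f ^ i • p) (f ^ (i + 2) • p) + 2 * δ := by
  have e : ∀ j : ℤ, d (f ^ (i + j) • p) (f ^ (i + j + 1) • p) = d p (f • p) :=
    fun j => hR.dist_step f p _
  have e0 := e 0
  have e1 := e 1
  have e2 : i + 2 = i + 1 + 1 := by ring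
  rw [add_zero] at e0
  rw [e2]
  obtain ⟨y, hy1, hy2⟩ := hR.hd.mid (f ^ i • p) (f ^ (i + 1) • p) (d p (f • p) / 2) (by omega)
  have h1 := hR.min_disp hmin (i := i) (y := y) (by omega)
  have h3 : d (f ^ (i + 1) • p) (f • y) = d (f ^ i • p) y := by
    rw [add_comm, zpow_add, zpow_one, mul_smul, hR.inv]
  have h4 : d (f • y) (f ^ (i + 1 + 1) • p) = d y (f ^ (i + 1) • p) := by
    rw [add_comm (i + 1), zpow_add, zpow_one, mul_smul, hR.inv]
  have s1 := hR.hd.symm (f • y) (f ^ (i + 1) • p)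
  have s2 := hR.hd.symm y (f ^ (i + 1) • p)
  have s3 := hR.hd.symm y (f ^ i • p)
  have s4 := hR.hd.symm (f • y) (f ^ i • p)
  have s5 := hR.hd.symm (f ^ (i + 1) • p) (f ^ i • p)
  have t1 := hR.hy (f ^ i • p) (f ^ (i + 1) • p) y (f • y)
  have t2 := hR.hy (f ^ i • p) (f • y) (f ^ (i + 1) • p) (f ^ (i + 1 + 1) • p)
  omega

theorem orbit_chain {f : G} {p : V} (hmin : ∀ q, d p (f • p) ≤ d q (f • q))
    (hbig : 4 * δ + 2 < d p (f • p)) {i j k : ℤ} (hij : i ≤ j) (hjk : j ≤ k) :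
    d (f ^ i • p) (f ^ j • p) + d (f ^ j • p) (f ^ k • p) ≤ d (f ^ i • p) (f ^ k • p) + 4 * δ := by
  have := chain (c := 2 * δ) hR.hd hR.hy (x := fun i : ℤ => f ^ i • p)
    (hR.orbit_local hmin (by omega)) (fun i => by
      rw [hR.dist_step]
      omega) hij hjk
  omega

end RotFam
namespace RotFam
variable {G V Y : Type*} [Group G] [MulAction G V] [MulAction G Y]
  {d : V → V → ℕ} {L : Y → Set V} {δ C Δ La Lr : ℕ} (hR : RotFam G d L δ C Δ La Lr)
include hR

theorem an_lip (c : Y) (x y z : V) : hR.an c x z ≤ hR.an c x y + 2 * d y z := by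
  rw [hR.an_eq, hR.an_eq]
  have := hR.setDist_lip y z c
  have := hR.hd.tri x y z
  omega

/-- A point on a geodesic at which an angle takes an intermediate value. -/
theorem exists_between_an {a b w : V} {c : Y} {m : ℕ} (ha : hR.an c w a ≤ m)
    (hb : m < hR.an c w b) :
    ∃ y, d a y + d y b = d a b ∧ m < hR.an c w y ∧ hR.an c w y ≤ m + 2 := by
  classical
  have hex : ∃ t, ∃ y, d a y = t ∧ d a y + d y b = d a b ∧ m < hR.an c w y :=
    ⟨d a b, b, rfl, by rw [hR.hd.self, add_zero], hb⟩
  obtain ⟨y, h1, h2, h3⟩ := Nat.find_spec hex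
  refine ⟨y, h2, h3, ?_⟩
  by_cases h0 : d a y = 0
  · rw [(hR.hd.zero a y).1 h0] at ha
    omega
  obtain ⟨z, hz1, hz2⟩ := hR.hd.mid a y (d a y - 1) (by omega)
  have h4 : ¬ m < hR.an c w z := by
    intro h
    refine Nat.find_min hex (m := d a z) (by omega) ⟨z, rfl, ?_, h⟩
    have := hR.hd.tri a z b
    have := hR.hd.tri z y b
    omega
  have := hR.an_lip c w z y
  omega

/-- A lift of an element of the quotient with minimal displacement. -/
def MinDisp (_ : RotFam G d L δ C Δ La Lr) (f : G) (p : V) : Prop :=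
  ∀ n ∈ rotSubgroup G Y, ∀ q, d p (f • p) ≤ d q (n • f • q)

omit hR in
theorem MinDisp.min {hR : RotFam G d L δ C Δ La Lr} {f : G} {p : V} (h : hR.MinDisp f p) (q : V) :
    d p (f • p) ≤ d q (f • q) := by
  have := h 1 (one_mem _) q
  rwa [one_smul] at this

omit hR in
theorem MinDisp.congr {hR : RotFam G d L δ C Δ La Lr} {f : G} {p q : V} (h : hR.MinDisp f p)
    (hq : d q (f • q) = d p (f • p)) : hR.MinDisp f q := by
  intro n hn x
  rw [hq]
  exact h n hn x

theorem MinDisp.an_le {f : G} {p : V} (h : hR.MinDisp f p) (c : Y) :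
    hR.an c p (f • p) ≤ La + 2 * bgiConst δ C Δ := by
  by_contra hc
  obtain ⟨g, hg, h1⟩ := hR.red (not_le.1 hc)
  have := h g (mem_rotSubgroup hg) p
  omega

theorem MinDisp.orbit {f : G} {p : V} (h : hR.MinDisp f p) (i : ℤ) : hR.MinDisp f (f ^ i • p) := by
  refine h.congr ?_
  have := hR.dist_step f p i
  rwa [add_comm, zpow_add, zpow_one, mul_smul] at this

theorem MinDisp.an_orbit_le {f : G} {p : V} (h : hR.MinDisp f p)
    (hf : f ∉ rotSubgroup G Y) (c : Y) (k : ℕ) :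
    hR.an c p (f ^ (k : ℤ) • p) ≤ La + 60 * bgiConst δ C Δ := by
  have hB := le_bgiConst δ C Δ
  have hfc : f • c ≠ c := fun h => hf (mem_rotSubgroup h)
  generalize hBe : bgiConst δ C Δ = B at hB ⊢
  by_contra hc
  rw [not_le] at hc
  have hk : k ≠ 0 := by
    rintro rfl
    have := hR.an_le c p p
    simp only [Nat.cast_zero, zpow_zero, one_smul] at hc
    rw [hR.hd.self] at this
    omega
  have hsd : ∀ x, d x (f • x) = d p (f • p) →
      setDist d {x} (L (f • c)) ≤ d p (f • p) + setDist d {x} (L c) ∧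
      setDist d {x} (L c) ≤ d p (f • p) + setDist d {x} (L (f • c)) := by
    intro x hx
    have h1 := hR.setDist_lip x (f • x) (f • c)
    have h2 := hR.setDist_lip (f • x) x (f • c)
    rw [hR.setDist_smul_L] at h1 h2
    have := hR.hd.symm x (f • x)
    have h3 := hR.setDist_lip (f⁻¹ • x) x c
    have h4 := hR.setDist_smul_L f (f⁻¹ • x) c
    have h5 : d (f⁻¹ • x) x = d x (f • x) := by
      rw [← hR.inv f (f⁻¹ • x), smul_inv_smul]
    rw [smul_inv_smul] at h4
    have h6 := hR.setDist_lip x (f⁻¹ • x) c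
    have := hR.hd.symm x (f⁻¹ • x)
    omega
  have hD : 29 * B ≤ d p (f • p) := by
    have h1 := hR.an_le_ap hfc p (f ^ (k : ℤ) • p)
    have h2 := hR.ap_le_setDist c (f • c) p
    have h3 := hR.ap_le_setDist c (f • c) (f ^ (k : ℤ) • p)
    have h4 := hsd p rfl
    have h5 := hsd (f ^ (k : ℤ) • p) (by
      have := hR.dist_step f p k
      rwa [add_comm, zpow_add, zpow_one, mul_smul] at this)
    rw [hBe] at h2 h3
    omega
  have hch := fun {i j k : ℤ} => hR.orbit_chain h.min (by omega) (i := i) (j := j) (k := k)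
  obtain ⟨i, hik, hi1, hi2⟩ : ∃ i : ℕ, i + 1 ≤ k ∧ hR.an c p (f ^ (i : ℤ) • p) ≤ 5 * B ∧
      5 * B < hR.an c p (f ^ ((i : ℤ) + 1) • p) := by
    classical
    have hex : ∃ i : ℕ, 5 * B < hR.an c p (f ^ (i : ℤ) • p) := ⟨k, by omega⟩
    have h0 : Nat.find hex ≠ 0 := by
      intro h0
      have := Nat.find_spec hex
      rw [h0] at this
      have h1 := hR.an_le c p p
      rw [hR.hd.self] at h1
      simp only [Nat.cast_zero, zpow_zero, one_smul] at this
      omega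
    obtain ⟨i, hi⟩ := Nat.exists_eq_succ_of_ne_zero h0
    refine ⟨i, ?_, ?_, ?_⟩
    · rw [← Nat.succ_eq_add_one, ← hi]
      exact Nat.find_min' hex (by omega)
    · exact not_lt.1 (Nat.find_min hex (m := i) (by omega))
    · have := Nat.find_spec hex
      rw [hi] at this
      exact_mod_cast this
  obtain ⟨y, hy, hy1, hy2⟩ := hR.exists_between_an hi1 hi2
  rw [hR.dist_step] at hy
  have hyd := hR.min_disp h.min hy
  have hym := h.congr hyd
  rw [← hyd] at hD
  have hchy := fun {i j k : ℤ} => hR.orbit_chain hym.min (by omega) (i := i) (j := j) (k := k)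
  have c1 := hch (i := 0) (j := i) (k := i + 1) (by omega) (by omega)
  have c2 := hch (i := 0) (j := i + 1) (k := k) (by omega) (by omega)
  have c3 := hch (i := i) (j := k) (k := k + i + 1) (by omega) (by omega)
  have c4 := hch (i := i) (j := i + 1) (k := k) (by omega) (by omega)
  have c5 := hch (i := k) (j := k + i) (k := k + i + 1) (by omega) (by omega)
  simp only [zpow_zero, one_smul] at c1 c2
  have e0 := hR.dist_step f p i
  have e1 : d (f ^ ((k : ℤ) + i) • p) (f ^ (k : ℤ) • y) = d (f ^ (i : ℤ) • p) y := by
    rw [zpow_add, mul_smul, hR.inv]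
  have e2 : d (f ^ (k : ℤ) • y) (f ^ ((k : ℤ) + i + 1) • p) = d y (f ^ ((i : ℤ) + 1) • p) := by
    rw [add_assoc, zpow_add, mul_smul, hR.inv]
  have e3 := hR.dist_step f p (k + i)
  have t1 := hR.hd.tri p (f ^ (i : ℤ) • p) y
  have t2 := hR.hd.tri y (f ^ ((i : ℤ) + 1) • p) (f ^ (k : ℤ) • p)
  have t3 := hR.hd.tri (f ^ (k : ℤ) • p) (f ^ ((k : ℤ) + i) • p) (f ^ (k : ℤ) • y)
  have t4 := hR.hd.tri (f ^ (i : ℤ) • p) y (f ^ ((k : ℤ) + i + 1) • p)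
  have t5 := hR.hd.tri y (f ^ (k : ℤ) • y) (f ^ ((k : ℤ) + i + 1) • p)
  have a1 := hR.an_tri c p y (f ^ (k : ℤ) • p)
  have s1 := hR.setDist_small (a := p) (b := f ^ (k : ℤ) • p) (x := y) (e := 8 * δ) (c := c)
    (by omega) (by omega) (by omega)
  have a2 := hR.an_mono (a := y) (b := f ^ (k : ℤ) • y) (x := f ^ (k : ℤ) • p) (e := 12 * δ) c
    (by omega)
  have a3 : La + 53 * B ≤ hR.an c y (f ^ (k : ℤ) • y) := by omega
  have b1 := MinDisp.an_le hR hym c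
  have b2 := hR.an_tri c y (f • y) (f ^ (k : ℤ) • y)
  have b3 := MinDisp.an_le hR (MinDisp.orbit hR hym k) (f • c)
  have e4 : f ^ (k : ℤ) • f • y = f • f ^ (k : ℤ) • y := by
    rw [← mul_smul, ← mul_smul, (Commute.zpow_self f k).eq]
  have b4 := hR.an_smul f c y (f ^ (k : ℤ) • y)
  have b5 := hR.an_tri (f • c) (f • y) (f ^ (k : ℤ) • y) (f • f ^ (k : ℤ) • y)
  have s2 := hR.setDist_smul_L f y c
  have g1 := hchy (i := 0) (j := 1) (k := k) (by omega) (by omega)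
  simp only [zpow_zero, one_smul, zpow_one] at g1
  have s3 : setDist d {f • y} (L c) ≤ B := by
    by_cases hcase : 3 * B ≤ hR.an c y (f • y)
    · have := hR.setDist_small (c := c) g1 (by omega) (by omega)
      omega
    · have q1 := hR.an_eq c y (f • y)
      have q2 := hR.an_eq c (f • y) (f ^ (k : ℤ) • y)
      have q3 := hR.an_eq c y (f ^ (k : ℤ) • y)
      omega
  have w1 := hR.ap_le_setDist c (f • c) (f • y)
  have w2 := hR.ap_le_setDist (f • c) c (f • y)
  have w3 := hR.an_le_ap hfc (f • y) (f ^ (k : ℤ) • y)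
  have w4 := hR.an_le_ap hfc.symm (f • y) (f ^ (k : ℤ) • y)
  have w5 := hR.ap_beh (c := c) (c' := f • c) (x := f ^ (k : ℤ) • y) (by omega)
  omega

theorem exists_minDisp [Nonempty V] (g : G ⧸ rotSubgroup G Y) :
    ∃ f : G, (f : G ⧸ rotSubgroup G Y) = g ∧ ∃ p, hR.MinDisp f p := by
  obtain ⟨f₀, rfl⟩ := QuotientGroup.mk_surjective g
  obtain ⟨⟨n, p⟩, h⟩ : ∃ z : rotSubgroup G Y × V, ∀ z' : rotSubgroup G Y × V,
      d z.2 ((z.1 : G) • f₀ • z.2) ≤ d z'.2 ((z'.1 : G) • f₀ • z'.2) := by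
    have hV : Nonempty (rotSubgroup G Y × V) := inferInstance
    let F : rotSubgroup G Y × V → ℕ := fun z => d z.2 ((z.1 : G) • f₀ • z.2)
    exact ⟨Function.argmin F, fun z' => Function.argmin_le F z'⟩
  refine ⟨n * f₀, ?_, p, ?_⟩
  · rw [QuotientGroup.mk_mul, (QuotientGroup.eq_one_iff (n : G)).2 n.2, one_mul]
  · intro m hm q
    have := h (⟨m, hm⟩ * n, q)
    simpa [mul_smul] using this

end RotFam

/-- The points on geodesics. -/
def Ivl {V : Type*} (d : V → V → ℕ) (x y : V) : Set V := {z | d x z + d z y = d x y}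

/-- Isometries with a linear lower bound on displacement of powers. -/
def Lox {G V : Type*} [Group G] [MulAction G V] (d : V → V → ℕ) (g : G) : Prop :=
  ∃ (o : V) (κ : ℕ), ∀ k : ℕ, k ≤ κ * (d o (g ^ k • o) + 1)

section
variable {V : Type*} {d : V → V → ℕ} {δ C : ℕ} (hd : IsGeod d)
include hd

theorem Ivl_comm (x y : V) : Ivl d x y = Ivl d y x := by
  ext z
  simp only [Ivl, Set.mem_ofPred_eq]
  rw [hd.symm x z, hd.symm z y, hd.symm x y, add_comm]

theorem left_mem_Ivl (x y : V) : x ∈ Ivl d x y := by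
  simp [Ivl, hd.self]

theorem right_mem_Ivl (x y : V) : y ∈ Ivl d x y := by
  simp [Ivl, hd.self]

variable (hy : Hyp d δ)
include hy

theorem near_Ivl {x y p q z : V} (hp : p ∈ Ivl d x y) (hq : q ∈ Ivl d x y)
    (hz : z ∈ Ivl d p q) : d x z + d z y ≤ d x y + 2 * δ := by
  simp only [Ivl, Set.mem_ofPred_eq] at *
  have h1 := between_thin hd hy x hz
  have h2 := between_thin hd hy y hz
  have := hd.symm p x
  have := hd.symm z x
  have := hd.symm q y
  have := hd.symm z y
  have := hd.symm y q
  have := hd.tri p q y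
  have := hd.tri x p q
  have := hd.symm p y
  have := hd.symm q x
  have := hd.tri q p y
  have := hd.tri x q p
  have := hd.symm p q
  have := hd.symm y z
  have := hd.symm y p
  omega

theorem qc_Ivl (x y : V) : QC d (8 * δ + 1) (Ivl d x y) := by
  refine ⟨⟨x, left_mem_Ivl hd x y⟩, fun u p hp hmin q hq => ?_⟩
  have t1 := hd.tri u p q
  have t2 := hd.tri u q p
  have s1 := hd.symm p q
  have s2 := hd.symm p u
  obtain ⟨z, hz1, hz2⟩ := hd.mid p q ((d u p + d p q - d u q) / 2) (by omega)
  have hz : z ∈ Ivl d p q := by simp only [Ivl, Set.mem_ofPred_eq]; omega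
  obtain ⟨z', h1, h2⟩ := exists_between_near hd hy (near_Ivl hd hy hp hq hz)
  have h3 := hmin z' h1
  have h4 := hd.tri u z z'
  have s3 := hd.symm z u
  rcases between_thin hd hy u hz with h | h <;> omega

end

section
variable {G V : Type*} [Group G] [MulAction G V] {d : V → V → ℕ}

theorem Lox.bound (hd : IsGeod d) (hinv : ∀ (g : G) x y, d (g • x) (g • y) = d x y) {g : G}
    (h : Lox d g) (o : V) : ∃ κ : ℕ, ∀ k : ℕ, k ≤ κ * (d o (g ^ k • o) + 1) := by
  obtain ⟨o', κ, h⟩ := h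
  refine ⟨κ * (2 * d o o' + 1), fun k => (h k).trans ?_⟩
  have h1 := hd.tri o' o (g ^ k • o')
  have h2 := hd.tri o (g ^ k • o) (g ^ k • o')
  rw [hinv] at h2
  have := hd.symm o' o
  rw [mul_assoc]
  refine Nat.mul_le_mul_left κ ?_
  nlinarith

theorem Lox.pow_ne_one (hd : IsGeod d) {g : G} (h : Lox d g) {k : ℕ} (hk : k ≠ 0) : g ^ k ≠ 1 := by
  intro h1
  obtain ⟨o, κ, h⟩ := h
  have := h (k * (κ + 1))
  rw [pow_mul, h1, one_pow, one_smul, hd.self] at this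
  have := Nat.pos_of_ne_zero hk
  nlinarith

end

namespace RotFam
variable {G V Y : Type*} [Group G] [MulAction G V] [MulAction G Y]
  {d : V → V → ℕ} {L : Y → Set V} {δ C Δ La Lr : ℕ} (hR : RotFam G d L δ C Δ La Lr)
include hR

theorem le_an_of_near {x y a b a' b' : V} {c : Y} {e : ℕ} (ha : a ∈ Ivl d x y) (hb : b ∈ Ivl d x y)
    (ha' : a' ∈ L c) (hb' : b' ∈ L c) (h1 : d a a' ≤ e) (h2 : d b b' ≤ e) :
    d a b ≤ hR.an c x y + (δ + 2 * e) := by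
  simp only [Ivl, Set.mem_ofPred_eq] at ha hb
  rw [hR.an_eq]
  have u1 := (setDist_le (d := d) (Set.mem_singleton x) ha').trans (hR.hd.tri x a a')
  have u2 := (setDist_le (d := d) (Set.mem_singleton x) hb').trans (hR.hd.tri x b b')
  have u3 := (setDist_le (d := d) (Set.mem_singleton y) ha').trans (hR.hd.tri y a a')
  have u4 := (setDist_le (d := d) (Set.mem_singleton y) hb').trans (hR.hd.tri y b b')
  have := hR.hd.symm y a
  have := hR.hd.symm y b
  have := hR.hd.symm a b
  have := hR.hy x y a b
  have := hR.hd.tri x a b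
  omega

theorem Ivl_near_L {u v a : V} {c : Y} {e : ℕ} (hu : u ∈ L c) (hv : v ∈ L c)
    (h : d u a + d a v ≤ d u v + e) : ∃ a' ∈ L c, d a a' ≤ e + δ + C := by
  obtain ⟨z, hz1, hz2⟩ := exists_between_near hR.hd hR.hy h
  obtain ⟨p, hp, h3⟩ := (hR.qc c).near_of_between hR.hd hu hv hz1
  have := hR.hd.tri a z p
  exact ⟨p, hp, by omega⟩

/-- Projections to a geodesic without large angles move slowly along the cone-off. -/
theorem proj_slow {x y : V} {M : ℕ} (hM : ∀ c, hR.an c x y ≤ M) {k : ℕ} {u a : V}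
    (hk : coneDist d L x u ≤ k) (ha : IsProj d (Ivl d x y) u a) :
    d x a ≤ k * (M + 37 * δ + 2 * C + 4) := by
  have key : ∀ {n : ℕ} {w u : V}, Reach (ConeAdj d L) (fun _ => True) n w u → w = x → ∀ a,
      IsProj d (Ivl d x y) u a → d x a ≤ n * (M + 37 * δ + 2 * C + 4) := by
    intro n w u h
    induction h with
    | refl w h =>
      rintro rfl a ha
      have := ha.2 w (left_mem_Ivl hR.hd w y)
      rw [hR.hd.self] at this
      omega
    | @step n w u v h hadj _ ih =>
      rintro rfl b hb
      obtain ⟨a, ha⟩ := exists_proj d (qc_Ivl hR.hd hR.hy w y).1 u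
      have h1 := ih rfl a ha
      have h2 := hR.hd.tri w a b
      have hab : d a b ≤ M + 37 * δ + 2 * C + 4 := by
        rcases (qc_Ivl hR.hd hR.hy w y).proj_proj hR.hd hR.hy ha hb with h3 | h3
        · rcases hadj with h4 | ⟨c, hu, hv⟩
          · omega
          · have t1 := hR.hd.tri a b v
            have t2 := hR.hd.tri u a b
            obtain ⟨a', ha', h5⟩ := hR.Ivl_near_L (e := 17 * δ + 2) (a := a) hu hv (by omega)
            obtain ⟨b', hb', h6⟩ := hR.Ivl_near_L (e := 17 * δ + 2) (a := b) hu hv (by omega)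
            have := hR.le_an_of_near ha.1 hb.1 ha' hb' h5 h6
            have := hM c
            omega
        · omega
      linarith
  exact (key (cone_reach hR.hd x u) rfl a ha).trans (Nat.mul_le_mul_right _ hk)

theorem cone_lower {x y : V} {M : ℕ} (hM : ∀ c, hR.an c x y ≤ M) :
    d x y ≤ coneDist d L x y * (M + 37 * δ + 2 * C + 4) := by
  refine hR.proj_slow hM le_rfl ⟨right_mem_Ivl hR.hd x y, fun q _ => ?_⟩
  rw [hR.hd.self]
  exact Nat.zero_le _

/-- Long segments without large angles close in the cone-off are close. -/
theorem fellow {x y x' y' : V} {M k K : ℕ} (hM : ∀ c, hR.an c x y ≤ M)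
    (hM' : ∀ c, hR.an c x' y' ≤ M) (hx : coneDist d L x x' ≤ k) (hyy : coneDist d L y y' ≤ k)
    (hK : K = k * (M + 37 * δ + 2 * C + 4)) (hl : 2 * K + 17 * δ + 2 < d x y) :
    d x x' ≤ 2 * K + 18 * δ + 2 := by
  obtain ⟨a, ha⟩ := exists_proj d (qc_Ivl hR.hd hR.hy x y).1 x'
  obtain ⟨b, hb⟩ := exists_proj d (qc_Ivl hR.hd hR.hy x y).1 y'
  obtain ⟨a₂, ha₂⟩ := exists_proj d (qc_Ivl hR.hd hR.hy x' y').1 x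
  have h1 := hR.proj_slow hM hx ha
  have h2 := hR.proj_slow (x := y) (y := x) (a := b) (fun c => by rw [hR.an_comm]; exact hM c) hyy
    (by rwa [Ivl_comm hR.hd])
  have h3 := hR.proj_slow (k := k) hM' (by rwa [hR.isGeod_D.symm]) ha₂
  rw [← hK] at h1 h2 h3
  have t1 := hR.hd.tri x a y
  have t2 := hR.hd.tri a b y
  have s1 := hR.hd.symm b y
  have t3 := hR.hd.tri a b y'
  rcases (qc_Ivl hR.hd hR.hy x y).proj_proj hR.hd hR.hy ha hb with h4 | h4
  · obtain ⟨z, hz1, hz2⟩ := exists_between_near hR.hd hR.hy (x := x') (y := y') (z := a)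
      (C := 17 * δ + 2) (by have := hR.hd.symm x' a; omega)
    have h5 := ha₂.2 z hz1
    have t4 := hR.hd.tri x a z
    have t5 := hR.hd.tri x a₂ x'
    have s2 := hR.hd.symm a₂ x'
    omega
  · omega

/-- Lifts with minimal displacement of an element without fixed points are quasi-isometrically
embedded in the quotient. -/
theorem MinDisp.quotDist_orbit {f : G} {p : V} (h : hR.MinDisp f p)
    (hf : f ∉ rotSubgroup G Y) (k : ℕ) (hLr : La + 80 * bgiConst δ C Δ ≤ Lr) :
    quotDist (rotSubgroup G Y) (coneDist d L) (OrbQ.mk _ p)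
      ((f : G ⧸ rotSubgroup G Y) ^ k • OrbQ.mk _ p) = coneDist d L p (f ^ (k : ℤ) • p) := by
  rw [← QuotientGroup.mk_pow, OrbQ.mk_smul_mk, zpow_natCast]
  refine le_antisymm (quotDist_le _ _) ?_
  obtain ⟨n, hn, e⟩ : ∃ n ∈ rotSubgroup G Y, coneDist d L (n • p) (f ^ k • p) =
      quotDist (rotSubgroup G Y) (coneDist d L) (OrbQ.mk _ p) (OrbQ.mk _ (f ^ k • p)) := by
    obtain ⟨v, w, h1, h2, h3⟩ := quotDist_rep₂ (N := rotSubgroup G Y) (d := coneDist d L)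
      (OrbQ.mk _ p) (OrbQ.mk _ (f ^ k • p))
    obtain ⟨m, hm, rfl⟩ := OrbQ.mk_eq.1 h1
    obtain ⟨m', hm', rfl⟩ := OrbQ.mk_eq.1 h2
    refine ⟨m'⁻¹ * m, mul_mem (inv_mem hm') hm, ?_⟩
    rw [← h3, mul_smul, ← hR.coneDist_smul m', smul_inv_smul]
  rw [← e]
  refine hR.lemmaR (fun c => ?_) n hn
  have := MinDisp.an_orbit_le hR h hf c k
  rw [zpow_natCast] at this
  omega

/-- Elements of the quotient without fixed points are loxodromic. -/
theorem lox_quotient [Nonempty V] (hlox : ∀ g : G, (∀ v : V, g • v ≠ v) → Lox d g)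
    (g : G ⧸ rotSubgroup G Y) (hg : ∀ v : OrbQ (rotSubgroup G Y) V, g • v ≠ v) :
    Lox (quotDist (rotSubgroup G Y) (coneDist d L)) g := by
  obtain ⟨f, rfl, p, hp⟩ := hR.exists_minDisp g
  have hLr := hR.le_Lr
  have hf : f ∉ rotSubgroup G Y := by
    intro hf
    refine hg (OrbQ.mk _ p) ?_
    rw [(QuotientGroup.eq_one_iff f).2 hf, one_smul]
  obtain ⟨κ, hκ⟩ := (hlox f fun v hv => hg (OrbQ.mk _ v) (by rw [OrbQ.mk_smul_mk, hv])).bound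
    hR.hd hR.inv p
  refine ⟨OrbQ.mk _ p, κ * ((La + 60 * bgiConst δ C Δ) + 37 * δ + 2 * C + 4), fun k => ?_⟩
  rw [MinDisp.quotDist_orbit hR hp hf k (by omega)]
  have h1 := hR.cone_lower fun c => MinDisp.an_orbit_le hR hp hf c k
  rw [zpow_natCast] at h1 ⊢
  have hΛ : 1 ≤ La + 60 * bgiConst δ C Δ + 37 * δ + 2 * C + 4 := by omega
  generalize La + 60 * bgiConst δ C Δ + 37 * δ + 2 * C + 4 = Λ at h1 hΛ ⊢
  refine (hκ k).trans ?_
  rw [mul_assoc]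
  refine Nat.mul_le_mul_left _ ?_
  nlinarith

end RotFam

/-- Weak proper discontinuity along an element. -/
def WPD {G V : Type*} [Group G] [MulAction G V] (d : V → V → ℕ) (g : G) : Prop :=
  ∀ (o : V) (C : ℕ), ∃ K₀ : ℕ, ∀ K, K₀ ≤ K →
    {h : G | d o (h • o) ≤ C ∧ d (g ^ K • o) (h • g ^ K • o) ≤ C}.Finite

/-- The elements commensurating the cyclic subgroup generated by an element. -/
def Elem {G : Type*} [Group G] (g : G) : Set G :=
  {h | ∃ a b : ℤ, a ≠ 0 ∧ b ≠ 0 ∧ h * g ^ a * h⁻¹ = g ^ b}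

/-- Group elements moving two far away points of an orbit close to the orbit are in the
elementary subgroup. -/
def WStar {G V : Type*} [Group G] [MulAction G V] (d : V → V → ℕ) (g : G) : Prop :=
  ∀ (o : V) (C : ℕ), ∃ K : ℕ, ∀ (h : G) (k k' l l' : ℤ),
    d (g ^ k • o) (h • g ^ k' • o) ≤ C → d (g ^ l • o) (h • g ^ l' • o) ≤ C →
    K ≤ (k - l).natAbs → h ∈ Elem g

section
variable {G V : Type*} [Group G] [MulAction G V] {d : V → V → ℕ}

theorem dist_zpow (hd : IsGeod d) (hinv : ∀ (g : G) x y, d (g • x) (g • y) = d x y)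
    (g : G) (o : V) (i j : ℤ) : d (g ^ i • o) (g ^ j • o) = d o (g ^ (i - j).natAbs • o) := by
  rcases le_total i j with h | h
  · have e : g ^ j = g ^ i * g ^ (i - j).natAbs := by
      rw [← zpow_natCast, ← zpow_add]
      congr 1
      omega
    rw [e, mul_smul, hinv]
  · have e : g ^ i = g ^ j * g ^ (i - j).natAbs := by
      rw [← zpow_natCast, ← zpow_add]
      congr 1
      omega
    rw [e, mul_smul, hd.symm, hinv]

theorem Lox.unbounded (hd : IsGeod d) (hinv : ∀ (g : G) x y, d (g • x) (g • y) = d x y) {g : G}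
    (h : Lox d g) (o : V) (m : ℕ) : ∃ K : ℕ, ∀ k, K ≤ k → m < d o (g ^ k • o) := by
  obtain ⟨κ, hκ⟩ := h.bound hd hinv o
  refine ⟨κ * (m + 1) + 1, fun k hk => ?_⟩
  by_contra hm
  have h1 := hκ k
  have h2 : κ * (d o (g ^ k • o) + 1) ≤ κ * (m + 1) := Nat.mul_le_mul_left _ (by omega)
  omega

theorem Lox.not_fix (hd : IsGeod d) (hinv : ∀ (g : G) x y, d (g • x) (g • y) = d x y) {g : G}
    (h : Lox d g) (v : V) : g • v ≠ v := by
  intro hv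
  obtain ⟨K, hK⟩ := h.unbounded hd hinv v 0
  have h1 : ∀ k : ℕ, g ^ k • v = v := by
    intro k
    induction k with
    | zero => simp
    | succ k ih => rw [pow_succ, mul_smul, hv, ih]
  have := hK K le_rfl
  rw [h1, hd.self] at this
  omega

end

namespace RotFam
variable {G V Y : Type*} [Group G] [MulAction G V] [MulAction G Y]
  {d : V → V → ℕ} {L : Y → Set V} {δ C Δ La Lr : ℕ} (hR : RotFam G d L δ C Δ La Lr)
include hR

theorem exists_lift_dist (x y : V) : ∃ n ∈ rotSubgroup G Y, coneDist d L x (n • y) =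
    quotDist (rotSubgroup G Y) (coneDist d L) (OrbQ.mk _ x) (OrbQ.mk _ y) := by
  obtain ⟨z, hz, h⟩ := quotDist_rep hR.coneDist_smul (N := rotSubgroup G Y) x (OrbQ.mk _ y)
  obtain ⟨n, hn, rfl⟩ := OrbQ.mk_eq.1 hz
  exact ⟨n, hn, h⟩

theorem quotDist_eq {x y : V} (h : ∀ c, hR.an c x y + 20 * bgiConst δ C Δ ≤ Lr) :
    quotDist (rotSubgroup G Y) (coneDist d L) (OrbQ.mk _ x) (OrbQ.mk _ y) = coneDist d L x y := by
  refine le_antisymm (quotDist_le _ _) ?_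
  obtain ⟨n, hn, e⟩ := hR.exists_lift_dist x y
  rw [← e, ← hR.coneDist_smul n⁻¹ x (n • y), inv_smul_smul]
  exact hR.lemmaR h _ (inv_mem hn)

/-- Lifting of quadrilaterals. -/
theorem lift_quad {p q p' q' : V} {k : ℕ} (g : G ⧸ rotSubgroup G Y)
    (h1 : quotDist (rotSubgroup G Y) (coneDist d L) (OrbQ.mk _ p') (g • OrbQ.mk _ p) ≤ k)
    (h2 : quotDist (rotSubgroup G Y) (coneDist d L) (OrbQ.mk _ q') (g • OrbQ.mk _ q) ≤ k) :
    (∃ f : G, (f : G ⧸ rotSubgroup G Y) = g ∧ coneDist d L p' (f • p) ≤ k ∧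
      coneDist d L q' (f • q) ≤ k) ∨
    ∃ f : G, (f : G ⧸ rotSubgroup G Y) = g ∧ ∃ c,
      Lr ≤ hR.an (f • c) p' q' + hR.an c p q + 19 * bgiConst δ C Δ := by
  have hN : ∀ n ∈ rotSubgroup G Y, ∀ f : G,
      ((n * f : G) : G ⧸ rotSubgroup G Y) = (f : G ⧸ rotSubgroup G Y) := by
    intro n hn f
    rw [QuotientGroup.mk_mul, (QuotientGroup.eq_one_iff n).2 hn, one_mul]
  obtain ⟨f₀, hf₀⟩ := QuotientGroup.mk_surjective g
  rw [← hf₀, OrbQ.mk_smul_mk] at h1 h2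
  obtain ⟨n₁, hn₁, e1⟩ := hR.exists_lift_dist p' (f₀ • p)
  obtain ⟨n₂, hn₂, e2⟩ := hR.exists_lift_dist q' (f₀ • q)
  suffices H : ∀ n ∈ rotSubgroup G Y, n ∈ rotSubgroup G Y → ∀ f : G, (f : G ⧸ rotSubgroup G Y) = g →
      coneDist d L p' (f • p) ≤ k → coneDist d L q' ((n * f) • q) ≤ k →
      (∃ f : G, (f : G ⧸ rotSubgroup G Y) = g ∧ coneDist d L p' (f • p) ≤ k ∧
        coneDist d L q' (f • q) ≤ k) ∨
      ∃ f : G, (f : G ⧸ rotSubgroup G Y) = g ∧ ∃ c,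
        Lr ≤ hR.an (f • c) p' q' + hR.an c p q + 19 * bgiConst δ C Δ by
    refine H (n₂ * n₁⁻¹) (mul_mem hn₂ (inv_mem hn₁)) (mul_mem hn₂ (inv_mem hn₁)) (n₁ * f₀) (by rw [hN _ hn₁, hf₀])
      (by rw [mul_smul, e1]; exact h1) ?_
    rw [← mul_assoc, inv_mul_cancel_right, mul_smul, e2]
    exact h2
  refine hR.greendlinger p' _ ?_ ?_
  · intro _ f hf ha hb
    rw [one_mul] at hb
    exact Or.inl ⟨f, hf, ha, hb⟩
  · intro n c r hr hl hP hn f hf ha hb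
    have hrN := mem_rotSubgroup hr
    have hP := hP (mul_mem hrN hn)
    by_cases c1 : 3 * bgiConst δ C Δ < hR.an c q' ((n * f) • q)
    · refine hP f hf ha ?_
      rw [mul_assoc, mul_smul]
      exact (hR.bend hr c1).trans hb
    by_cases c2 : 3 * bgiConst δ C Δ < hR.an c ((n * f) • p) (n • p')
    · refine hP (n⁻¹ * r⁻¹ * n * f) ?_ ?_ ?_
      · rw [hN, hf]
        have : n⁻¹ * r⁻¹ * n = n⁻¹ * r⁻¹ * n⁻¹⁻¹ := by group
        rw [this]
        exact Subgroup.Normal.conj_mem inferInstance _ (inv_mem hrN) _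
      · have h3 := hR.bend hr c2
        rw [← hR.coneDist_smul (r * n)]
        have e : (r * n) • (n⁻¹ * r⁻¹ * n * f) • p = (n * f) • p := by
          rw [← mul_smul]
          congr 1
          group
        rw [e, hR.isGeod_D.symm, mul_smul r n p']
        refine h3.trans ?_
        rw [mul_smul, hR.coneDist_smul, hR.isGeod_D.symm]
        exact ha
      · have e : r * n * (n⁻¹ * r⁻¹ * n * f) = n * f := by group
        rw [e]
        exact hb
    · refine Or.inr ⟨n * f, by rw [hN n hn, hf], (n * f)⁻¹ • c, ?_⟩
      rw [smul_inv_smul]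
      have h3 := hR.an_smul (n * f) ((n * f)⁻¹ • c) p q
      rw [smul_inv_smul] at h3
      have t1 := hR.an_tri c p' q' (n • p')
      have t2 := hR.an_tri c q' ((n * f) • q) (n • p')
      have t3 := hR.an_tri c ((n * f) • q) ((n * f) • p) (n • p')
      have := hR.an_comm c ((n * f) • q) ((n * f) • p)
      omega

theorem finite_large (p q : V) : {c : Y | 8 * bgiConst δ C Δ < hR.an c p q}.Finite := by
  refine Set.Finite.of_finite_image (f := fun c => hR.cd p c)
    ((Set.finite_Iic (coneDist d L p q)).subset ?_) ?_
  · rintro _ ⟨c, hc, rfl⟩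
    have hc : 8 * bgiConst δ C Δ < hR.an c p q := hc
    obtain ⟨a, ha, b, hb, h⟩ := hR.through (c := c) (x := p) (y := q) (by omega)
    have := hR.cd_le (x := p) ha
    simp only [Set.mem_Iic]
    omega
  · intro c hc c' hc' h
    exact hR.eq_of_cd hc hc' h

theorem finite_quad {p q p' q' : V} {M : ℕ} (hM : ∀ c, hR.an c p q ≤ M)
    (hM' : ∀ c, hR.an c p' q' ≤ M) (hLr : M + 30 * bgiConst δ C Δ ≤ Lr) :
    {g : G ⧸ rotSubgroup G Y | ∃ f : G, (f : G ⧸ rotSubgroup G Y) = g ∧ ∃ c,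
      Lr ≤ hR.an (f • c) p' q' + hR.an c p q + 19 * bgiConst δ C Δ}.Finite := by
  have hB := le_bgiConst δ C Δ
  refine Set.Finite.subset (Set.Finite.biUnion ((hR.finite_large p q).prod (hR.finite_large p' q'))
    (t := fun z => {g : G ⧸ rotSubgroup G Y | ∃ f : G, (f : G ⧸ rotSubgroup G Y) = g ∧
      f • z.1 = z.2}) fun z _ => Set.Subsingleton.finite ?_) ?_
  · rintro _ ⟨f, rfl, h1⟩ _ ⟨f', rfl, h2⟩
    refine QuotientGroup.eq.2 (mem_rotSubgroup (c := z.1) ?_)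
    rw [mul_smul, h2, ← h1, inv_smul_smul]
  · rintro _ ⟨f, rfl, c, hc⟩
    have h1 := hM c
    have h2 := hM' (f • c)
    refine Set.mem_biUnion (x := (c, f • c)) ⟨?_, ?_⟩ ⟨f, rfl, rfl⟩
    · change 8 * _ < hR.an c p q
      omega
    · change 8 * _ < hR.an (f • c) p' q'
      omega

/-- Weak proper discontinuity passes to the quotient. -/
theorem wpd_quotient [Nonempty V] (hlox : ∀ g : G, (∀ v : V, g • v ≠ v) → Lox d g)
    (hW : ∀ g : G, Lox d g → WPD d g) (g : G ⧸ rotSubgroup G Y)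
    (hg : Lox (quotDist (rotSubgroup G Y) (coneDist d L)) g) :
    WPD (quotDist (rotSubgroup G Y) (coneDist d L)) g := by
  have hD := isGeod_quot (N := rotSubgroup G Y) hR.isGeod_D hR.coneDist_smul
  have hDi := quotDist_smul (N := rotSubgroup G Y) hR.coneDist_smul
  intro o' k₀
  have hnf := hg.not_fix hD hDi
  have hLr := hR.le_Lr
  obtain ⟨f, rfl, p, hp⟩ := hR.exists_minDisp g
  have hf : f ∉ rotSubgroup G Y := by
    intro hf
    refine hnf (OrbQ.mk _ p) ?_
    rw [(QuotientGroup.eq_one_iff f).2 hf, one_smul]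
  have hfl := hlox f fun v hv => hnf (OrbQ.mk _ v) (by rw [OrbQ.mk_smul_mk, hv])
  obtain ⟨k, hk⟩ : ∃ k, k = k₀ + 2 * quotDist (rotSubgroup G Y) (coneDist d L) o' (OrbQ.mk _ p) :=
    ⟨_, rfl⟩
  obtain ⟨M, hM⟩ : ∃ M, M = La + 60 * bgiConst δ C Δ := ⟨_, rfl⟩
  have han : ∀ (j : ℕ) c, hR.an c p (f ^ j • p) ≤ M := by
    intro j c
    have := MinDisp.an_orbit_le hR hp hf c j
    rwa [zpow_natCast, ← hM] at this
  obtain ⟨K₁, hK₁⟩ : ∃ K₁, K₁ = k * (M + 37 * δ + 2 * C + 4) := ⟨_, rfl⟩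
  obtain ⟨Ka, hKa⟩ := hW f hfl p (2 * K₁ + 18 * δ + 2)
  obtain ⟨Kb, hKb⟩ := hfl.unbounded hR.hd hR.inv p (2 * K₁ + 17 * δ + 2)
  refine ⟨max Ka Kb, fun K hK => ?_⟩
  have hfin := hKa K (le_of_max_le_left hK)
  have hlong := hKb K (le_of_max_le_right hK)
  refine Set.Finite.subset ((hfin.image (fun h : G => (h : G ⧸ rotSubgroup G Y))).union
    (hR.finite_quad (han K) (han K) (by omega))) ?_
  rintro g ⟨h1, h2⟩
  have close : ∀ a b : OrbQ (rotSubgroup G Y) V,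
      quotDist (rotSubgroup G Y) (coneDist d L) a b =
        quotDist (rotSubgroup G Y) (coneDist d L) o' (OrbQ.mk _ p) →
      quotDist (rotSubgroup G Y) (coneDist d L) a (g • a) ≤ k₀ →
      quotDist (rotSubgroup G Y) (coneDist d L) b (g • b) ≤ k := by
    intro a b hab ha
    have t1 := hD.tri b a (g • b)
    have t2 := hD.tri a (g • a) (g • b)
    rw [hDi] at t2
    rw [hD.symm b a] at t1
    omega
  have h3 := close _ _ rfl h1
  have h4 := close _ _ (hDi _ _ _) h2
  rw [← QuotientGroup.mk_pow, OrbQ.mk_smul_mk] at h4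
  rcases hR.lift_quad g h3 h4 with ⟨h, rfl, a1, a2⟩ | h
  · refine Or.inl ⟨h, ⟨?_, ?_⟩, rfl⟩
    · refine hR.fellow (han K) (fun c => ?_) a1 a2 hK₁ hlong
      have := hR.an_smul h (h⁻¹ • c) p (f ^ K • p)
      rw [smul_inv_smul] at this
      rw [this]
      exact han K _
    · refine hR.fellow (y := p) (y' := h • p) (fun c => ?_) (fun c => ?_) a2 a1 hK₁ ?_
      · rw [hR.an_comm]
        exact han K c
      · have := hR.an_smul h (h⁻¹ • c) p (f ^ K • p)
        rw [smul_inv_smul] at this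
        rw [hR.an_comm, this]
        exact han K _
      · rwa [hR.hd.symm]
  · exact Or.inr h

/-- Loxodromic elements with small angles stay loxodromic. -/
theorem lox_track {g : G} (hg : Lox d g) {o : V} {M : ℕ}
    (hM : ∀ (k : ℕ) c, hR.an c o (g ^ k • o) ≤ M) (hLr : M + 20 * bgiConst δ C Δ ≤ Lr) :
    Lox (quotDist (rotSubgroup G Y) (coneDist d L)) (g : G ⧸ rotSubgroup G Y) := by
  obtain ⟨κ, hκ⟩ := hg.bound hR.hd hR.inv o
  refine ⟨OrbQ.mk _ o, κ * (M + 37 * δ + 2 * C + 4), fun k => ?_⟩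
  rw [← QuotientGroup.mk_pow, OrbQ.mk_smul_mk,
    hR.quotDist_eq fun c => (Nat.add_le_add_right (hM k c) _).trans hLr]
  have h1 := hR.cone_lower (hM k)
  have hΛ : 1 ≤ M + 37 * δ + 2 * C + 4 := by omega
  generalize M + 37 * δ + 2 * C + 4 = Λ at h1 hΛ ⊢
  refine (hκ k).trans ?_
  rw [mul_assoc]
  refine Nat.mul_le_mul_left _ ?_
  nlinarith

/-- Elementary subgroups of loxodromic elements with small angles do not grow. -/
theorem elem_track {g : G} (hg : Lox d g) (hW : WStar d g) {o : V}
    (hM : ∀ (k : ℕ) c, hR.an c o (g ^ k • o) ≤ 40 * bgiConst δ C Δ) :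
    Elem (g : G ⧸ rotSubgroup G Y) ⊆
      (fun h : G => (h : G ⧸ rotSubgroup G Y)) '' Elem g := by
  have hD := isGeod_quot (N := rotSubgroup G Y) hR.isGeod_D hR.coneDist_smul
  have hDi := quotDist_smul (N := rotSubgroup G Y) hR.coneDist_smul
  rintro h ⟨a, b, ha, hb, hab⟩
  have hB := le_bgiConst δ C Δ
  have hLr := hR.le_Lr
  obtain ⟨k, hk⟩ : ∃ k, k = quotDist (rotSubgroup G Y) (coneDist d L) (OrbQ.mk _ o)
    (h • OrbQ.mk _ o) := ⟨_, rfl⟩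
  obtain ⟨K₁, hK₁⟩ : ∃ K₁, K₁ = k * (40 * bgiConst δ C Δ + 37 * δ + 2 * C + 4) := ⟨_, rfl⟩
  obtain ⟨Ka, hKa⟩ := hW o (2 * K₁ + 18 * δ + 2)
  obtain ⟨Kb, hKb⟩ := hg.unbounded hR.hd hR.inv o (2 * K₁ + 17 * δ + 2)
  have han : ∀ (i j : ℤ) c, hR.an c (g ^ i • o) (g ^ j • o) ≤ 40 * bgiConst δ C Δ := by
    have key : ∀ (i j : ℤ) c, i ≤ j → hR.an c (g ^ i • o) (g ^ j • o) ≤ 40 * bgiConst δ C Δ := by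
      intro i j c hij
      obtain ⟨n, rfl⟩ := Int.le.dest hij
      have h1 := hR.an_smul (g ^ i) (g ^ (-i) • c) o (g ^ n • o)
      rw [← mul_smul, ← mul_smul, ← zpow_add, add_neg_cancel, zpow_zero, one_smul,
        ← zpow_natCast, ← zpow_add] at h1
      rw [h1, zpow_natCast]
      exact hM n _
    intro i j c
    rcases le_total i j with hij | hij
    · exact key i j c hij
    · rw [hR.an_comm]
      exact key j i c hij
  obtain ⟨J, hJ⟩ : ∃ J : ℕ, J = Ka + Kb := ⟨_, rfl⟩
  have hcl : ∀ J : ℤ, quotDist (rotSubgroup G Y) (coneDist d L) (OrbQ.mk _ (g ^ (b * J) • o))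
      (h • OrbQ.mk _ (g ^ (a * J) • o)) ≤ k := by
    intro J
    have e : (g : G ⧸ rotSubgroup G Y) ^ (b * J) * h = h * (g : G ⧸ rotSubgroup G Y) ^ (a * J) := by
      rw [zpow_mul, zpow_mul, ← hab, conj_zpow]
      group
    rw [← OrbQ.mk_smul_mk, ← OrbQ.mk_smul_mk, ← mul_smul, QuotientGroup.mk_zpow,
      QuotientGroup.mk_zpow, ← e, mul_smul, hDi, hk]
  have hlong : ∀ c : ℤ, c ≠ 0 →
      J ≤ (c * -J - c * J).natAbs ∧ J ≤ (c * J - c * -J).natAbs := by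
    intro c hc
    have h1 : 1 ≤ c.natAbs := Int.natAbs_pos.2 hc
    have e1 : (c * -J - c * J).natAbs = c.natAbs * (2 * J) := by
      rw [← Int.natAbs_natCast (2 * J), ← Int.natAbs_mul, ← Int.natAbs_neg]
      congr 1
      push_cast
      ring
    have e2 : (c * J - c * -J).natAbs = c.natAbs * (2 * J) := by
      rw [← Int.natAbs_natCast (2 * J), ← Int.natAbs_mul]
      congr 1
      push_cast
      ring
    rw [e1, e2]
    constructor <;> nlinarith
  rcases hR.lift_quad h (hcl (-J)) (hcl J) with ⟨f, rfl, a1, a2⟩ | ⟨f, _, c, hc⟩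
  · refine ⟨f, hKa f _ _ _ _ (?_ : d (g ^ (b * -(J : ℤ)) • o) (f • g ^ (a * -(J : ℤ)) • o) ≤ _)
      (?_ : d (g ^ (b * (J : ℤ)) • o) (f • g ^ (a * (J : ℤ)) • o) ≤ _) ?_, rfl⟩
    · refine hR.fellow (han _ _) (fun c => ?_) a1 a2 hK₁ ?_
      · have := hR.an_smul f (f⁻¹ • c) (g ^ (a * -(J : ℤ)) • o) (g ^ (a * (J : ℤ)) • o)
        rw [smul_inv_smul] at this
        rw [this]
        exact han _ _ _
      · rw [dist_zpow hR.hd hR.inv]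
        exact hKb _ (by have := (hlong b hb).1; omega)
    · refine hR.fellow (han _ _) (fun c => ?_) a2 a1 hK₁ ?_
      · have := hR.an_smul f (f⁻¹ • c) (g ^ (a * (J : ℤ)) • o) (g ^ (a * -(J : ℤ)) • o)
        rw [smul_inv_smul] at this
        rw [this]
        exact han _ _ _
      · rw [dist_zpow hR.hd hR.inv]
        exact hKb _ (by have := (hlong b hb).2; omega)
    · have := (hlong b hb).1
      omega
  · have := han (b * -J) (b * J) (f • c)
    have := han (a * -J) (a * J) c
    omega

end RotFam

/-- The orbit of `o` under the powers of `F` is a quasi-geodesic. -/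
structure QG {G V : Type*} [Group G] [MulAction G V] (d : V → V → ℕ) (F : G) (o : V) (C : ℕ) :
    Prop where
  chain : ∀ i j k : ℤ, i ≤ j → j ≤ k →
    d (F ^ i • o) (F ^ j • o) + d (F ^ j • o) (F ^ k • o) ≤ d (F ^ i • o) (F ^ k • o) + C
  lox : Lox d F
  wpd : WPD d F

section
variable {G V : Type*} [Group G] [MulAction G V] {d : V → V → ℕ} {δ : ℕ}
  (hd : IsGeod d) (hinv : ∀ (g : G) x y, d (g • x) (g • y) = d x y)
include hd hinv

theorem dist_pow_le (g : G) (o : V) (n : ℕ) : d o (g ^ n • o) ≤ n * d o (g • o) := by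
  induction n with
  | zero => simp [hd.self]
  | succ n ih =>
    have := hd.tri o (g ^ n • o) (g ^ (n + 1) • o)
    rw [pow_succ, mul_smul, hinv] at this
    rw [pow_succ, mul_smul]
    linarith

theorem Lox.pow {g : G} (h : Lox d g) {n : ℕ} (hn : 1 ≤ n) : Lox d (g ^ n) := by
  obtain ⟨o, κ, h⟩ := h
  refine ⟨o, κ, fun k => ?_⟩
  rw [← pow_mul]
  exact le_trans (by nlinarith) (h (n * k))

omit hd hinv in
theorem WPD.pow {g : G} (h : WPD d g) {n : ℕ} (hn : 1 ≤ n) : WPD d (g ^ n) := by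
  intro o C
  obtain ⟨K, hK⟩ := h o C
  refine ⟨K, fun k hk => ?_⟩
  rw [← pow_mul]
  exact hK (n * k) (by nlinarith)

theorem exists_qg (hy : Hyp d δ) {g : G} (h : Lox d g) (hW : WPD d g) (o : V) :
    ∃ n : ℕ, 1 ≤ n ∧ ∃ C, QG d (g ^ n) o C := by
  obtain ⟨K, hK⟩ := h.unbounded hd hinv o (2 * δ + 1)
  obtain ⟨κ, hκ⟩ := h.bound hd hinv o
  obtain ⟨j, hj⟩ : ∃ j : ℕ, d o (g ^ ((K + 1) * 2 ^ j) • o) + 2 * δ + 1 ≤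
      d o (g ^ ((K + 1) * 2 ^ (j + 1)) • o) := by
    by_contra! hcon
    have h1 : ∀ j : ℕ, d o (g ^ ((K + 1) * 2 ^ j) • o) ≤ d o (g ^ (K + 1) • o) + j * (2 * δ) := by
      intro j
      induction j with
      | zero => simp
      | succ j ih =>
        have := hcon j
        have e : (j + 1) * (2 * δ) = j * (2 * δ) + 2 * δ := by ring
        rw [e]
        linarith
    have h2 : ∀ j : ℕ, 2 ^ j ≤ κ * (d o (g ^ (K + 1) • o) + j * (2 * δ) + 1) := by
      intro j
      refine le_trans ?_ ((hκ ((K + 1) * 2 ^ j)).trans (Nat.mul_le_mul_left κ ?_))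
      · exact Nat.le_mul_of_pos_left _ (Nat.succ_pos K)
      · have := h1 j
        omega
    generalize d o (g ^ (K + 1) • o) = b at h2
    have h3 : ∀ j : ℕ, j * j ≤ 2 * 2 ^ j := by
      intro j
      induction j with
      | zero => simp
      | succ j ih =>
        have : j + 1 ≤ 2 ^ j := Nat.lt_two_pow_self
        rw [pow_succ]
        rcases j with _ | j
        · simp
        · rcases j with _ | _ | j
          · simp
          · simp
          · nlinarith [Nat.lt_two_pow_self (n := j + 1), pow_succ 2 (j + 1)]
    obtain ⟨T, hT⟩ : ∃ T, T = 2 * κ * (b + 2 * δ + 1) + 1 := ⟨_, rfl⟩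
    have h4 := h2 T
    have h5 := h3 T
    have h6 : κ * (b + T * (2 * δ) + 1) ≤ κ * (T * (b + 2 * δ + 1)) := by
      refine Nat.mul_le_mul_left _ ?_
      have : 1 ≤ T := by omega
      nlinarith
    nlinarith
  have hn : 1 ≤ (K + 1) * 2 ^ j := Nat.one_le_iff_ne_zero.2 (by positivity)
  have hKn : K ≤ (K + 1) * 2 ^ j := by nlinarith [Nat.one_le_two_pow (n := j)]
  rw [pow_succ, ← mul_assoc] at hj
  generalize (K + 1) * 2 ^ j = n at hj hn hKn
  have hb := hK n hKn
  refine ⟨n, hn, d o (g ^ n • o) - 2 * δ - 1 + 2 * δ, ?_, h.pow hd hinv hn, hW.pow hn⟩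
  intro i j k hij hjk
  refine Olsh.chain hd hy (x := fun i : ℤ => (g ^ n) ^ i • o)
    (c := d o (g ^ n • o) - 2 * δ - 1) ?_ ?_ hij hjk
  · intro i
    have e1 : (i - (i + 1)).natAbs = 1 := by omega
    have e2 : (i + 1 - (i + 2)).natAbs = 1 := by omega
    have e3 : (i - (i + 2)).natAbs = 2 := by omega
    rw [dist_zpow hd hinv, dist_zpow hd hinv, dist_zpow hd hinv, e1, e2, e3, pow_one, ← pow_mul]
    omega
  · intro i
    have e1 : (i - (i + 1)).natAbs = 1 := by omega
    rw [dist_zpow hd hinv, e1, pow_one]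
    omega

end

section
variable {G V : Type*} [Group G] [MulAction G V] {d : V → V → ℕ} {δ C₀ : ℕ}
  (hd : IsGeod d) (hinv : ∀ (g : G) x y, d (g • x) (g • y) = d x y) (hy : Hyp d δ)
include hd hinv

theorem dist_inv_smul (g : G) (x y : V) : d (g⁻¹ • x) y = d x (g • y) := by
  rw [← hinv g, smul_inv_smul]

theorem WPD.inv {g : G} (h : WPD d g) : WPD d g⁻¹ := by
  intro o C
  obtain ⟨K₀, hK⟩ := h o C
  refine ⟨K₀, fun K hKK => ((hK K hKK).image fun h => (g ^ K)⁻¹ * h * g ^ K).subset ?_⟩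
  rintro h ⟨h1, h2⟩
  refine ⟨g ^ K * h * (g ^ K)⁻¹, ⟨?_, ?_⟩, by group⟩
  · rw [mul_smul, mul_smul, ← inv_pow, ← dist_inv_smul hd hinv, ← inv_pow]
    exact h2
  · rw [mul_smul, inv_smul_smul, mul_smul, hinv]
    exact h1

omit hd in
theorem QG.dist_pow {F : G} {o : V} (h : QG d F o C₀) {i n : ℕ} (hin : i ≤ n) :
    d o (F ^ i • o) + d o (F ^ (n - i) • o) ≤ d o (F ^ n • o) + C₀ := by
  have := h.chain 0 i n (by omega) (by omega)
  have e : F ^ (n : ℤ) = F ^ (i : ℤ) * F ^ (n - i) := by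
    rw [← zpow_natCast F (n - i), ← zpow_add]
    congr 1
    omega
  rw [e, zpow_natCast, zpow_zero, one_smul, mul_smul, hinv, ← mul_smul, ← pow_add] at this
  rwa [Nat.add_sub_cancel' hin] at this

include hy

/-- The core of the coarse stabilizer argument. -/
theorem exists_conj_pow {A A' : G} {o : V} (b : ℕ → ℕ) (hb : ∀ n, d o (A ^ n • o) = b n)
    (hb' : ∀ n, d o (A' ^ n • o) = b n) (hch : ∀ i n, i ≤ n → b i + b (n - i) ≤ b n + C₀)
    (hub : ∀ m, ∃ K, ∀ k, K ≤ k → m < b k) (hW : WPD d A) (C : ℕ) :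
    ∃ K : ℕ, ∀ (h : G) (L L' : ℕ), d o (h • o) ≤ C → d (A ^ L • o) (h • A' ^ L' • o) ≤ C →
      K ≤ L → ∃ n : ℕ, 1 ≤ n ∧ h * A' ^ n * h⁻¹ = A ^ n := by
  obtain ⟨K₁, hK₁⟩ := hW o (2 * (5 * C + C₀ + δ))
  have hfin := hK₁ K₁ le_rfl
  obtain ⟨N, hN⟩ : ∃ N, N = hfin.toFinset.card + K₁ := ⟨_, rfl⟩
  obtain ⟨K₂, hK₂⟩ := hub (N * b 1 + 2 * C)
  refine ⟨K₂ + N, fun h L L' h1 h2 hL => ?_⟩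
  have hbA : ∀ i n, i ≤ n → d (A ^ i • o) (A ^ n • o) = b (n - i) := by
    intro i n hin
    rw [← hb, ← hinv (A ^ i) o, ← mul_smul, ← pow_add, Nat.add_sub_cancel' hin]
  have hbA' : ∀ i n, i ≤ n → d (A' ^ i • o) (A' ^ n • o) = b (n - i) := by
    intro i n hin
    rw [← hb', ← hinv (A' ^ i) o, ← mul_smul, ← pow_add, Nat.add_sub_cancel' hin]
  have hbl : b L ≤ b L' + 2 * C := by
    have t1 := hd.tri o (h • o) (h • A' ^ L' • o)
    have t2 := hd.tri o (h • A' ^ L' • o) (A ^ L • o)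
    have := hd.symm (A ^ L • o) (h • A' ^ L' • o)
    rw [hinv, hb'] at t1
    rw [hb] at t2
    omega
  have hbl' : b L' ≤ b L + 2 * C := by
    have t1 := hd.tri (h • o) o (h • A' ^ L' • o)
    have t2 := hd.tri o (A ^ L • o) (h • A' ^ L' • o)
    have := hd.symm o (h • o)
    rw [hinv, hb'] at t1
    rw [hb] at t2
    omega
  have hL' : N ≤ L' := by
    by_contra hlt
    have h3 := dist_pow_le hd hinv A' o L'
    have h5 := hb' 1
    rw [pow_one] at h5
    rw [hb', h5] at h3
    have h4 := hK₂ L (by omega)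
    have : L' * b 1 ≤ N * b 1 := Nat.mul_le_mul_right _ (by omega)
    omega
  have hclose : ∀ i, i ≤ N → d (A ^ i • o) (h • A' ^ i • o) ≤ 5 * C + C₀ + δ := by
    intro i hi
    have t1 := hd.tri o (h • o) (h • A' ^ i • o)
    have t1' := hd.tri (h • o) o (h • A' ^ i • o)
    have t2 := hd.tri (h • A' ^ i • o) (h • A' ^ L' • o) (A ^ L • o)
    have s1 := hd.symm (A ^ L • o) (h • A' ^ L' • o)
    have s2 := hd.symm o (h • o)
    have s3 := hd.symm (A ^ L • o) (A ^ i • o)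
    have s4 := hd.symm (A ^ L • o) (h • A' ^ i • o)
    rw [hinv, hb'] at t1 t1'
    rw [hinv, hbA' i L' (by omega)] at t2
    have e1 := hbA i L (by omega)
    have e2 := hch i L (by omega)
    have e3 := hch i L' (by omega)
    have e4 := hb i
    have e5 := hb L
    rcases hy o (A ^ L • o) (A ^ i • o) (h • A' ^ i • o) with h' | h' <;> omega
  let u : ℕ → G := fun i => (A ^ i)⁻¹ * h * A' ^ i
  have hu : ∀ i j, i + j ≤ N → d (A ^ j • o) (u i • A' ^ j • o) ≤ 5 * C + C₀ + δ := by
    intro i j hij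
    have := hclose (i + j) hij
    simp only [u]
    rw [mul_assoc, mul_smul, hd.symm, dist_inv_smul hd hinv, hd.symm, mul_smul, ← mul_smul (A ^ i),
      ← mul_smul (A' ^ i), ← pow_add, ← pow_add]
    exact this
  have hu' : ∀ i j, i + j ≤ N → d (A ^ j • o) ((u i * (u 0)⁻¹) • A ^ j • o) ≤
      2 * (5 * C + C₀ + δ) := by
    intro i j hij
    have l1 := hu i j hij
    have l2 := hu 0 j (by omega)
    have t := hd.tri (A ^ j • o) (u i • A' ^ j • o) ((u i * (u 0)⁻¹) • A ^ j • o)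
    rw [mul_smul, hinv, hd.symm (A' ^ j • o), dist_inv_smul hd hinv] at t
    rw [mul_smul]
    omega
  obtain ⟨i, hi, j, hj, hij, hu⟩ := Finset.exists_ne_map_eq_of_card_lt_of_maps_to
    (s := Finset.range (hfin.toFinset.card + 1)) (t := hfin.toFinset)
    (f := fun i => u i * (u 0)⁻¹) (by simp) (by
      intro i hi
      rw [Finset.mem_coe, Finset.mem_range] at hi
      rw [Finset.mem_coe, Set.Finite.mem_toFinset]
      refine ⟨?_, hu' i K₁ (by omega)⟩
      simpa using hu' i 0 (by omega))
  have hu := mul_right_cancel hu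
  have key : ∀ i j, i < j → u i = u j → ∃ n : ℕ, 1 ≤ n ∧ h * A' ^ n * h⁻¹ = A ^ n := by
    intro i j hij hu
    obtain ⟨n, rfl⟩ := Nat.exists_eq_add_of_lt hij
    refine ⟨n + 1, by omega, ?_⟩
    simp only [u] at hu
    have e : i + n + 1 = (n + 1) + i := by ring
    rw [e, pow_add, pow_add A', mul_inv_rev, mul_assoc, mul_assoc, mul_assoc, mul_right_inj,
      ← mul_assoc, ← mul_assoc, mul_left_inj, mul_assoc, eq_inv_mul_iff_mul_eq] at hu
    rw [← hu]
    group
  rcases lt_or_gt_of_ne hij with h' | h'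
  · exact key i j h' hu
  · exact key j i h' hu.symm

end

section Elem
variable {G : Type*} [Group G] {g h k : G}

theorem conj_zpow_eq {h g : G} {a b : ℤ} (hab : h * g ^ a * h⁻¹ = g ^ b) (c : ℤ) :
    h * g ^ (a * c) * h⁻¹ = g ^ (b * c) := by
  rw [zpow_mul, zpow_mul, ← hab, conj_zpow]

theorem Elem.mul (hh : h ∈ Elem g) (hk : k ∈ Elem g) : h * k ∈ Elem g := by
  obtain ⟨a, b, ha, hb, hab⟩ := hh
  obtain ⟨a', b', ha', hb', hab'⟩ := hk
  refine ⟨a' * a, b * b', mul_ne_zero ha' ha, mul_ne_zero hb hb', ?_⟩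
  rw [← conj_zpow_eq hab, mul_comm a b', ← conj_zpow_eq hab' a]
  group

theorem Elem.inv (hh : h ∈ Elem g) : h⁻¹ ∈ Elem g := by
  obtain ⟨a, b, ha, hb, hab⟩ := hh
  refine ⟨b, a, hb, ha, ?_⟩
  rw [← hab]
  group

theorem Elem.zpow (n : ℤ) : g ^ n ∈ Elem g :=
  ⟨1, 1, one_ne_zero, one_ne_zero, by rw [← zpow_add, ← zpow_neg, ← zpow_add]; congr 1; ring⟩

theorem Elem.of_pow {n : ℕ} (hn : 1 ≤ n) (hh : h ∈ Elem (g ^ n)) : h ∈ Elem g := by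
  obtain ⟨a, b, ha, hb, hab⟩ := hh
  rw [← zpow_natCast, ← zpow_mul, ← zpow_mul] at hab
  exact ⟨n * a, n * b, mul_ne_zero (by omega) ha, mul_ne_zero (by omega) hb, hab⟩

theorem Elem.pow {n : ℕ} (hh : h ∈ Elem g) : h ∈ Elem (g ^ n) := by
  obtain ⟨a, b, ha, hb, hab⟩ := hh
  refine ⟨a, b, ha, hb, ?_⟩
  rw [← zpow_natCast, ← zpow_mul, ← zpow_mul, mul_comm, mul_comm (n : ℤ), conj_zpow_eq hab]

end Elem

section
variable {G V : Type*} [Group G] [MulAction G V] {d : V → V → ℕ} {δ C₀ : ℕ}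
  (hd : IsGeod d) (hinv : ∀ (g : G) x y, d (g • x) (g • y) = d x y)
include hd hinv

theorem QG.zpow_sign {F : G} {o : V} (h : QG d F o C₀) (s : ℤ) (hs : s = 1 ∨ s = -1) :
    (∀ n, d o ((F ^ s) ^ n • o) = d o (F ^ n • o)) ∧ WPD d (F ^ s) := by
  rcases hs with rfl | rfl
  · simpa using h.wpd
  · refine ⟨fun n => ?_, by simpa using h.wpd.inv hd hinv⟩
    rw [zpow_neg, zpow_one, inv_pow, hd.symm, dist_inv_smul hd hinv]

/-- Coarse coincidence of two long orbit segments makes powers conjugate. -/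
theorem QG.conj_pow (hy : Hyp d δ) {F : G} {o : V} (h : QG d F o C₀) (C : ℕ) :
    ∃ K : ℕ, ∀ (u : G) (k k' l l' : ℤ), d (F ^ k • o) (u • F ^ k' • o) ≤ C →
      d (F ^ l • o) (u • F ^ l' • o) ≤ C → K ≤ (k - l).natAbs →
      ∃ n : ℤ, 1 ≤ n ∧ ∃ s s' : ℤ, (s = 1 ∨ s = -1) ∧ (s' = 1 ∨ s' = -1) ∧
        (l - k = s * (l - k).natAbs) ∧ (l' - k' = s' * (l' - k').natAbs) ∧
        u * F ^ (s' * n) * u⁻¹ = F ^ (s * n) := by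
  have key : ∀ s s' : ℤ, (s = 1 ∨ s = -1) → (s' = 1 ∨ s' = -1) → ∃ K : ℕ,
      ∀ (u : G) (L L' : ℕ), d o (u • o) ≤ C → d ((F ^ s) ^ L • o) (u • (F ^ s') ^ L' • o) ≤ C →
      K ≤ L → ∃ n : ℕ, 1 ≤ n ∧ u * (F ^ s') ^ n * u⁻¹ = (F ^ s) ^ n := fun s s' hs hs' =>
    exists_conj_pow hd hinv hy (fun n => d o (F ^ n • o)) (h.zpow_sign hd hinv s hs).1
      (h.zpow_sign hd hinv s' hs').1 (fun _ _ hin => h.dist_pow hinv hin)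
      (h.lox.unbounded hd hinv o) (h.zpow_sign hd hinv s hs).2 C
  obtain ⟨K1, hK1⟩ := key 1 1 (by simp) (by simp)
  obtain ⟨K2, hK2⟩ := key 1 (-1) (by simp) (by simp)
  obtain ⟨K3, hK3⟩ := key (-1) 1 (by simp) (by simp)
  obtain ⟨K4, hK4⟩ := key (-1) (-1) (by simp) (by simp)
  have key : ∀ s s' : ℤ, (s = 1 ∨ s = -1) → (s' = 1 ∨ s' = -1) →
      ∀ (u : G) (L L' : ℕ), d o (u • o) ≤ C → d ((F ^ s) ^ L • o) (u • (F ^ s') ^ L' • o) ≤ C →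
      K1 + K2 + K3 + K4 ≤ L → ∃ n : ℕ, 1 ≤ n ∧ u * (F ^ s') ^ n * u⁻¹ = (F ^ s) ^ n := by
    rintro s s' (rfl | rfl) (rfl | rfl) u L L' h1 h2 hL
    · exact hK1 u L L' h1 h2 (by omega)
    · exact hK2 u L L' h1 h2 (by omega)
    · exact hK3 u L L' h1 h2 (by omega)
    · exact hK4 u L L' h1 h2 (by omega)
  refine ⟨K1 + K2 + K3 + K4, fun u k k' l l' h1 h2 hK => ?_⟩
  have hsign : ∀ z : ℤ, ∃ s : ℤ, (s = 1 ∨ s = -1) ∧ z = s * z.natAbs := by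
    intro z
    rcases le_total 0 z with hz | hz
    · exact ⟨1, by simp, by omega⟩
    · exact ⟨-1, by simp, by omega⟩
  obtain ⟨s, hs, hs2⟩ := hsign (l - k)
  obtain ⟨s', hs', hs2'⟩ := hsign (l' - k')
  have h1' : d o ((F ^ (-k) * u * F ^ k') • o) ≤ C := by
    rw [← hinv (F ^ k), ← mul_smul (F ^ k)]
    have e : F ^ k * (F ^ (-k) * u * F ^ k') = u * F ^ k' := by group
    rw [e, mul_smul]
    exact h1
  have h2' : d ((F ^ s) ^ (l - k).natAbs • o) ((F ^ (-k) * u * F ^ k') •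
      (F ^ s') ^ (l' - k').natAbs • o) ≤ C := by
    rw [← zpow_natCast, ← zpow_natCast, ← zpow_mul, ← zpow_mul, ← hs2, ← hs2', ← hinv (F ^ k),
      ← mul_smul, ← mul_smul, ← mul_smul, ← zpow_add]
    have e : F ^ k * (F ^ (-k) * u * F ^ k') * F ^ (l' - k') = u * F ^ l' := by group
    rw [e, mul_smul, add_sub_cancel]
    exact h2
  obtain ⟨n, hn, he⟩ := key s s' hs hs' _ _ _ h1' h2' (by omega)
  refine ⟨n, by omega, s, s', hs, hs', hs2, hs2', ?_⟩
  rw [← zpow_natCast, ← zpow_natCast, ← zpow_mul, ← zpow_mul] at he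
  have e : u * F ^ (s' * n) * u⁻¹ = F ^ k * (F ^ (-k) * u * F ^ k' * F ^ (s' * (n : ℤ)) *
      (F ^ (-k) * u * F ^ k')⁻¹) * F ^ (-k) := by group
  rw [e, he]
  group

theorem QG.wstar (hy : Hyp d δ) {F : G} {o : V} (h : QG d F o C₀) (C : ℕ) :
    ∃ K : ℕ, ∀ (u : G) (k k' l l' : ℤ), d (F ^ k • o) (u • F ^ k' • o) ≤ C →
      d (F ^ l • o) (u • F ^ l' • o) ≤ C → K ≤ (k - l).natAbs → u ∈ Elem F := by
  obtain ⟨K, hK⟩ := h.conj_pow hd hinv hy C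
  refine ⟨K, fun u k k' l l' h1 h2 h3 => ?_⟩
  obtain ⟨n, hn, s, s', hs, hs', -, -, he⟩ := hK u k k' l l' h1 h2 h3
  exact ⟨s' * n, s * n, by rcases hs' with rfl | rfl <;> omega,
    by rcases hs with rfl | rfl <;> omega, he⟩

theorem dist_zpow_le (g : G) (o : V) (n : ℤ) : d o (g ^ n • o) ≤ n.natAbs * d o (g • o) := by
  have := dist_zpow hd hinv g o 0 n
  rw [zpow_zero, one_smul] at this
  rw [this]
  refine (dist_pow_le hd hinv g o _).trans (Nat.mul_le_mul_right _ (by omega))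

theorem wstar_of_wpd (hy : Hyp d δ) {g : G} (h : Lox d g) (hW : WPD d g) : WStar d g := by
  intro o C
  obtain ⟨n, hn, C₀, hq⟩ := exists_qg hd hinv hy h hW o
  obtain ⟨K, hK⟩ := hq.wstar hd hinv hy (C + 2 * (n * d o (g • o)))
  refine ⟨n * (K + 2), fun u k k' l l' h1 h2 h3 => Elem.of_pow hn ?_⟩
  have hn0 : (0 : ℤ) < n := by omega
  have hb : ∀ k : ℤ, d (g ^ k • o) ((g ^ n) ^ (k / n) • o) ≤ n * d o (g • o) := by
    intro k
    rw [← zpow_natCast, ← zpow_mul, dist_zpow hd hinv]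
    refine (dist_pow_le hd hinv g o _).trans (Nat.mul_le_mul_right _ ?_)
    have := Int.emod_add_mul_ediv k n
    have := Int.emod_lt_of_pos k hn0
    have := Int.emod_nonneg k hn0.ne'
    omega
  have hc : ∀ k k' : ℤ, d (g ^ k • o) (u • g ^ k' • o) ≤ C →
      d ((g ^ n) ^ (k / n) • o) (u • (g ^ n) ^ (k' / n) • o) ≤ C + 2 * (n * d o (g • o)) := by
    intro k k' h
    have t1 := hd.tri ((g ^ n) ^ (k / n) • o) (g ^ k • o) (u • (g ^ n) ^ (k' / n) • o)
    have t2 := hd.tri (g ^ k • o) (u • g ^ k' • o) (u • (g ^ n) ^ (k' / n) • o)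
    rw [hinv] at t2
    rw [hd.symm _ (g ^ k • o)] at t1
    have := hb k
    have := hb k'
    omega
  refine hK u (k / n) (k' / n) (l / n) (l' / n) (hc _ _ h1) (hc _ _ h2) ?_
  have e1 := Int.emod_add_mul_ediv k n
  have e2 := Int.emod_lt_of_pos k hn0
  have e3 := Int.emod_nonneg k hn0.ne'
  have f1 := Int.emod_add_mul_ediv l n
  have f2 := Int.emod_lt_of_pos l hn0
  have f3 := Int.emod_nonneg l hn0.ne'
  generalize k / (n : ℤ) = a at *
  generalize l / (n : ℤ) = b at *
  generalize k % (n : ℤ) = r at *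
  generalize l % (n : ℤ) = r' at *
  by_contra hcon
  rcases le_total 0 (k - l) with hkl | hkl
  · have : n * (K + 2 : ℤ) ≤ k - l := by zify at h3; rwa [abs_of_nonneg hkl] at h3
    have : a - b < K := by omega
    nlinarith
  · have : n * (K + 2 : ℤ) ≤ l - k := by zify at h3; rw [abs_of_nonpos hkl] at h3; linarith
    have : b - a < K := by omega
    nlinarith

end

theorem exists_step (f : ℤ → ℕ) (T : ℕ) {i j : ℤ} (hij : i ≤ j) (hi : f i ≤ T) :
    ∃ k, i ≤ k ∧ k ≤ j ∧ f k ≤ T ∧ (k = j ∨ T < f (k + 1)) := by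
  obtain ⟨n, rfl⟩ := Int.le.dest hij
  induction n with
  | zero => exact ⟨i, le_rfl, by simp, hi, by simp⟩
  | succ n ih =>
    obtain ⟨k, h1, h2, h3, h4⟩ := ih (by omega)
    rcases h4 with rfl | h4
    · by_cases h : f (i + n + 1) ≤ T
      · exact ⟨i + n + 1, by omega, by push_cast; omega, h, Or.inl (by push_cast; omega)⟩
      · exact ⟨i + n, h1, by push_cast; omega, h3, Or.inr (by omega)⟩
    · exact ⟨k, h1, by push_cast; omega, h3, Or.inr h4⟩

section
variable {V : Type*} {d : V → V → ℕ} {δ : ℕ} (hd : IsGeod d) (hy : Hyp d δ)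
include hd hy

theorem near_seq {x : ℤ → V} {i j : ℤ} {y : V} {c c' b : ℕ} (hij : i ≤ j)
    (hch : ∀ k, i ≤ k → k ≤ j → d (x i) (x k) + d (x k) (x j) ≤ d (x i) (x j) + c')
    (hb : ∀ k, i ≤ k → k < j → d (x k) (x (k + 1)) ≤ b)
    (h : d (x i) y + d y (x j) ≤ d (x i) (x j) + c) :
    ∃ k, i ≤ k ∧ k ≤ j ∧ d (x k) y ≤ c + c' + δ + b := by
  obtain ⟨k, h1, h2, h3, h4⟩ := exists_step (fun k => d (x i) (x k)) (d (x i) y) hij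
    (by simp [hd.self])
  refine ⟨k, h1, h2, ?_⟩
  rcases h4 with rfl | h4
  · have := hd.symm y (x k)
    have := hd.self y
    omega
  · by_cases hkj : k = j
    · subst hkj
      have := hd.symm y (x k)
      omega
    · have t1 := hd.tri (x i) (x k) (x (k + 1))
      have t2 := hb k h1 (by omega)
      have t3 := hch k h1 h2
      have s1 := hd.symm (x i) (x k)
      have s2 := hd.symm (x i) y
      rcases hy (x k) y (x i) (x j) with h' | h' <;> omega

theorem btw_move {p p' q q' y : V} {c D : ℕ} (h : d p' y + d y q' ≤ d p' q' + c)
    (hp : d p p' ≤ D) (hq : d q q' ≤ D) (hyp : D + c + 2 * δ < d y p') (hyq : D + c + 2 * δ < d y q') :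
    d p y + d y q ≤ d p q + c + 2 * δ := by
  have s1 := hd.symm p y
  have s2 := hd.symm p' y
  have s3 := hd.symm p p'
  have s4 := hd.symm q y
  have s5 := hd.symm q' y
  have s6 := hd.symm q q'
  have s7 := hd.symm p q'
  have s8 := hd.symm p' q'
  have s9 := hd.symm p q
  have t1 := hd.tri y p p'
  have t2 := hd.tri y q q'
  have t3 := hd.tri p p' y
  have t4 := hd.tri q q' y
  have t5 := hd.tri y p' p
  have t6 := hd.tri y q' q
  have key : d p y + d y q' ≤ d p q' + c + δ := by
    rcases hy p' q' p y with h1 | h1 <;> omega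
  rcases hy p q' q y with h1 | h1 <;> omega

end

section
variable {G V : Type*} [Group G] [MulAction G V] {d : V → V → ℕ} {δ C₀ : ℕ}
  (hd : IsGeod d) (hinv : ∀ (g : G) x y, d (g • x) (g • y) = d x y) (hy : Hyp d δ)
include hd hinv

theorem Lox.zpow_far {g : G} (h : Lox d g) (o : V) (m : ℕ) :
    ∃ K : ℕ, ∀ i j : ℤ, K ≤ (i - j).natAbs → m < d (g ^ i • o) (g ^ j • o) := by
  obtain ⟨K, hK⟩ := h.unbounded hd hinv o m
  refine ⟨K, fun i j hij => ?_⟩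
  rw [dist_zpow hd hinv]
  exact hK _ hij

include hy

theorem QG.elem_near {F : G} {o : V} (hq : QG d F o C₀) {h : G} (hh : h ∈ Elem F) (n : ℤ) :
    ∃ k : ℤ, d (F ^ k • o) (h • F ^ n • o) ≤ 2 * C₀ + 3 * δ + d o (F • o) := by
  obtain ⟨a, b, ha, hb, hab⟩ := hh
  obtain ⟨D, hD⟩ : ∃ D, D = d o (h • o) := ⟨_, rfl⟩
  have hpos : ∀ J : ℤ, d (F ^ (b * J) • o) (h • F ^ (a * J) • o) = D := by
    intro J
    rw [← mul_smul, mul_inv_eq_iff_eq_mul.1 (conj_zpow_eq hab J), mul_smul, hinv, hD]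
  obtain ⟨K, hK⟩ := hq.lox.zpow_far hd hinv o (D + C₀ + 2 * δ)
  have main : ∀ J : ℤ, a * J ≤ n → n ≤ a * (-J) → K ≤ (n - a * J).natAbs →
      K ≤ (n - a * (-J)).natAbs →
      d (F ^ (b * J) • o) (h • F ^ n • o) + d (h • F ^ n • o) (F ^ (b * (-J)) • o) ≤
      d (F ^ (b * J) • o) (F ^ (b * (-J)) • o) + C₀ + 2 * δ := by
    intro J h1 h2 h3 h4
    have := hq.chain (a * J) n (a * (-J)) h1 h2
    refine btw_move hd hy (p' := h • F ^ (a * J) • o) (q' := h • F ^ (a * (-J)) • o)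
      (D := D) ?_ (hpos J).le (hpos (-J)).le ?_ ?_
    · rw [hinv, hinv, hinv]
      exact this
    · rw [hinv]
      exact hK _ _ h3
    · rw [hinv]
      exact hK _ _ h4
  have fin : ∀ i j : ℤ, i ≤ j → d (F ^ i • o) (h • F ^ n • o) + d (h • F ^ n • o) (F ^ j • o) ≤
      d (F ^ i • o) (F ^ j • o) + C₀ + 2 * δ →
      ∃ k : ℤ, d (F ^ k • o) (h • F ^ n • o) ≤ 2 * C₀ + 3 * δ + d o (F • o) := by
    intro i j hij h'
    obtain ⟨k, -, -, hk⟩ := near_seq hd hy (x := fun i : ℤ => F ^ i • o) (b := d o (F • o))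
      (y := h • F ^ n • o) (c := C₀ + 2 * δ) hij (fun k h1 h2 => hq.chain i k j h1 h2) (by
        intro k _ _
        have e : (k - (k + 1)).natAbs = 1 := by omega
        rw [dist_zpow hd hinv, e, pow_one]) (by omega)
    exact ⟨k, by omega⟩
  obtain ⟨J, hJ1, hJ2⟩ : ∃ J : ℤ, a * J ≤ -(n.natAbs + K) ∧ n.natAbs + K ≤ a * (-J) := by
    rcases lt_or_gt_of_ne ha with ha | ha
    · exact ⟨n.natAbs + K, by nlinarith, by nlinarith⟩
    · exact ⟨-(n.natAbs + K), by nlinarith, by nlinarith⟩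
  have := main J (by omega) (by omega) (by omega) (by omega)
  rcases le_total (b * J) (b * (-J)) with hbJ | hbJ
  · exact fin _ _ hbJ this
  · refine fin _ _ hbJ ?_
    have s1 := hd.symm (F ^ (b * (-J)) • o) (h • F ^ n • o)
    have s2 := hd.symm (F ^ (b * J) • o) (h • F ^ n • o)
    have s3 := hd.symm (F ^ (b * (-J)) • o) (F ^ (b * J) • o)
    omega

/-- The cyclic subgroup has finite index in the elementary subgroup. -/
theorem elem_finite {g : G} (h : Lox d g) (hW : WPD d g) [Nonempty V] :
    ∃ S : Set G, S.Finite ∧ ∀ h ∈ Elem g, ∃ k : ℤ, ∃ s ∈ S, h = g ^ k * s := by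
  obtain ⟨o⟩ := ‹Nonempty V›
  obtain ⟨n, hn, C₀, hq⟩ := exists_qg hd hinv hy h hW o
  obtain ⟨F, hF⟩ : ∃ F, F = g ^ n := ⟨_, rfl⟩
  rw [← hF] at hq
  suffices hS : ∃ S : Set G, S.Finite ∧ ∀ h ∈ Elem F, ∃ k : ℤ, ∃ s ∈ S, h = F ^ k * s by
    obtain ⟨S, h1, h2⟩ := hS
    refine ⟨S, h1, fun h hh => ?_⟩
    obtain ⟨k, s, hs, rfl⟩ := h2 h (by rw [hF]; exact Elem.pow hh)
    exact ⟨n * k, s, hs, by rw [hF, zpow_mul, zpow_natCast]⟩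
  obtain ⟨R, hR⟩ : ∃ R, R = 2 * C₀ + 3 * δ + d o (F • o) := ⟨_, rfl⟩
  obtain ⟨K₁, hK₁⟩ := hq.wpd o (2 * R)
  obtain ⟨K₂, hK₂⟩ := hq.wpd.inv hd hinv o (2 * R)
  have hfin : ∀ m : ℤ, max K₁ K₂ ≤ m.natAbs →
      {u : G | d o (u • o) ≤ 2 * R ∧ d (F ^ m • o) (u • F ^ m • o) ≤ 2 * R}.Finite := by
    intro m hm
    rcases le_total 0 m with h0 | h0
    · obtain ⟨m, rfl⟩ := Int.eq_ofNat_of_zero_le h0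
      simpa using hK₁ m (by omega)
    · obtain ⟨m', hm'⟩ := Int.eq_ofNat_of_zero_le (neg_nonneg.2 h0)
      obtain rfl : m = -m' := by omega
      have := hK₂ m' (by omega)
      rwa [inv_pow, ← zpow_natCast, ← zpow_neg] at this
  obtain ⟨N, hN⟩ := hq.lox.unbounded hd hinv o (max K₁ K₂ * d o (F • o) + 2 * R)
  obtain ⟨M, hM⟩ := hq.lox.zpow_far hd hinv o (d o (F ^ N • o) + 2 * R)
  have hfin2 : ∀ m : ℤ, max K₁ K₂ ≤ m.natAbs →
      {u : G | d o (u • o) ≤ R ∧ d (F ^ m • o) (u • F ^ N • o) ≤ R}.Finite := by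
    intro m hm
    rcases Set.eq_empty_or_nonempty
      {u : G | d o (u • o) ≤ R ∧ d (F ^ m • o) (u • F ^ N • o) ≤ R} with h0 | ⟨u₀, h1, h2⟩
    · rw [h0]
      exact Set.finite_empty
    · refine ((hfin m hm).image fun u => u * u₀).subset ?_
      rintro u ⟨h3, h4⟩
      refine ⟨u * u₀⁻¹, ⟨?_, ?_⟩, by group⟩
      · have t := hd.tri o (u • o) ((u * u₀⁻¹) • o)
        rw [mul_smul, hinv, hd.symm o (u₀⁻¹ • o), dist_inv_smul hd hinv] at t
        rw [mul_smul]
        omega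
      · have t := hd.tri (F ^ m • o) (u • F ^ N • o) ((u * u₀⁻¹) • F ^ m • o)
        rw [mul_smul, hinv, hd.symm (F ^ N • o), dist_inv_smul hd hinv] at t
        rw [mul_smul]
        omega
  refine ⟨⋃ m ∈ {m : ℤ | max K₁ K₂ ≤ m.natAbs ∧ m.natAbs ≤ M},
    {u : G | d o (u • o) ≤ R ∧ d (F ^ m • o) (u • F ^ N • o) ≤ R}, ?_, ?_⟩
  · refine Set.Finite.biUnion ?_ fun m hm => hfin2 m hm.1
    refine (Set.finite_Icc (-M : ℤ) M).subset ?_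
    rintro m ⟨-, hm⟩
    exact ⟨by omega, by omega⟩
  · intro h hh
    obtain ⟨k, hk⟩ := hq.elem_near hd hinv hy hh 0
    obtain ⟨l, hl⟩ := hq.elem_near hd hinv hy hh N
    rw [zpow_zero, one_smul, ← hR] at hk
    rw [zpow_natCast, ← hR] at hl
    refine ⟨k, F ^ (-k) * h, ?_, by group⟩
    have e1 : d o ((F ^ (-k) * h) • o) ≤ R := by
      rw [← hinv (F ^ k), ← mul_smul]
      simpa using hk
    have e2 : d (F ^ (l - k) • o) ((F ^ (-k) * h) • F ^ N • o) ≤ R := by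
      rw [← hinv (F ^ k), ← mul_smul, ← mul_smul, ← zpow_add, ← mul_assoc, ← zpow_add,
        add_neg_cancel, zpow_zero, one_mul, add_sub_cancel]
      exact hl
    refine Set.mem_biUnion (x := l - k) ⟨?_, ?_⟩ ⟨e1, e2⟩
    · by_contra! hlt
      have t1 := hd.tri (h • o) (F ^ k • o) (h • F ^ N • o)
      have t2 := hd.tri (F ^ k • o) (F ^ l • o) (h • F ^ N • o)
      rw [hinv, hd.symm (h • o)] at t1
      have t3 := dist_pow_le hd hinv F o (k - l).natAbs
      rw [← dist_zpow hd hinv] at t3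
      have t4 := hN N le_rfl
      have t5 : (k - l).natAbs * d o (F • o) ≤ max K₁ K₂ * d o (F • o) :=
        Nat.mul_le_mul_right _ (by omega)
      omega
    · by_contra! hlt
      have t1 := hd.tri (F ^ k • o) (h • o) (F ^ l • o)
      have t2 := hd.tri (h • o) (h • F ^ N • o) (F ^ l • o)
      rw [hinv, hd.symm (h • F ^ N • o)] at t2
      have t3 := hM k l (by omega)
      omega

/-- Two powers of an infinite order elementary element coincide with powers of `g`. -/
theorem elem_pow {g x : G} (h : Lox d g) (hW : WPD d g) [Nonempty V] (hx : x ∈ Elem g)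
    (hinf : ∀ n : ℕ, 1 ≤ n → x ^ n ≠ 1) : ∃ a : ℕ, ∃ b : ℤ, 1 ≤ a ∧ b ≠ 0 ∧ x ^ a = g ^ b := by
  obtain ⟨S, hS, hS'⟩ := elem_finite hd hinv hy h hW
  have hpow : ∀ n : ℕ, x ^ n ∈ Elem g := by
    intro n
    induction n with
    | zero => simpa using Elem.zpow (g := g) 0
    | succ n ih => rw [pow_succ]; exact Elem.mul ih hx
  choose k s hs he using fun n => hS' _ (hpow n)
  have := hS.to_subtype
  obtain ⟨i, j, hij, he'⟩ := Finite.exists_ne_map_eq_of_infinite fun n : ℕ => (⟨s n, hs n⟩ : S)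
  have he' : s i = s j := congrArg Subtype.val he'
  have key : ∀ i j, i < j → s i = s j →
      ∃ a : ℕ, ∃ b : ℤ, 1 ≤ a ∧ b ≠ 0 ∧ x ^ a = g ^ b := by
    intro i j hij he'
    have e : x ^ (j - i) = g ^ (k j - k i) := by
      have h1 : x ^ j = x ^ (j - i) * x ^ i := by rw [← pow_add]; congr 1; omega
      rw [he j, he i, he', ← mul_assoc, mul_left_inj] at h1
      rw [sub_eq_add_neg, zpow_add, h1]
      group
    refine ⟨j - i, k j - k i, by omega, fun h0 => ?_, e⟩
    rw [h0, zpow_zero] at e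
    exact hinf _ (by omega) e
  rcases lt_or_gt_of_ne hij with h' | h'
  · exact key i j h' he'
  · exact key j i h' he'.symm

theorem commute_pow (hlox : ∀ g : G, (∀ v : V, g • v ≠ v) → Lox d g)
    (hfree : ∀ v w : V, v ≠ w → ∀ g : G, g • v = v → g • w = w → g = 1)
    {g x : G} (h : Lox d g) (hW : WPD d g) [Nonempty V] (hx1 : x ≠ 1) {n : ℤ} (hn : n ≠ 0)
    (hx : x * g ^ n * x⁻¹ = g ^ n) : ∃ a : ℕ, ∃ b : ℤ, 1 ≤ a ∧ b ≠ 0 ∧ x ^ a = g ^ b := by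
  have hxE : x ∈ Elem g := ⟨n, n, hn, hn, hx⟩
  have hlx : Lox d x := by
    refine hlox x fun v hv => hx1 ?_
    by_contra h1
    have hgv : g ^ n • v = v := by
      by_contra hne
      refine h1 (hfree _ _ hne x ?_ hv)
      rw [← mul_smul, mul_inv_eq_iff_eq_mul.1 hx, mul_smul, hv]
    have hlg : Lox d (g ^ n.natAbs) := h.pow hd hinv (by omega)
    refine hlg.not_fix hd hinv v ?_
    rcases Int.natAbs_eq n with h2 | h2
    · rw [← zpow_natCast, ← h2, hgv]
    · rw [h2, zpow_neg, inv_smul_eq_iff, zpow_natCast] at hgv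
      exact hgv.symm
  exact elem_pow hd hinv hy h hW hxE fun n hn => Lox.pow_ne_one hd hlx (by omega)

end

/-- A sequence which is coarsely geodesic. -/
def Chn {V : Type*} (d : V → V → ℕ) (y : ℤ → V) (c : ℕ) : Prop :=
  ∀ i j k, i ≤ j → j ≤ k → d (y i) (y j) + d (y j) (y k) ≤ d (y i) (y k) + c

/-- The points coarsely between two members of a sequence. -/
def Near {V : Type*} (d : V → V → ℕ) (y : ℤ → V) (C : ℕ) (x : V) : Prop :=
  ∃ i j, i ≤ j ∧ d (y i) x + d x (y j) ≤ d (y i) (y j) + C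

section
variable {V : Type*} {d : V → V → ℕ} {δ c : ℕ} {y y' : ℤ → V} (hd : IsGeod d)
include hd

theorem near_self (k : ℤ) : Near d y 0 (y k) := ⟨k, k, le_rfl, by simp [hd.self]⟩

theorem Near.far (hc : Chn d y c) {C : ℕ} {x : V} (h : Near d y C x) :
    ∃ i j, i ≤ j ∧ ∀ i' ≤ i, ∀ j' ≥ j,
      d (y i') x + d x (y j') ≤ d (y i') (y j') + (C + 2 * c) := by
  obtain ⟨i, j, hij, h⟩ := h
  refine ⟨i, j, hij, fun i' hi j' hj => ?_⟩
  have h1 := hc i' i j' hi (by omega)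
  have h2 := hc i j j' hij hj
  have h3 := hd.tri (y i') (y i) x
  have h4 := hd.tri x (y j) (y j')
  omega

theorem Near.of_far (hc : Chn d y c) {C : ℕ} {x x' : V} (h : Near d y C x) (h' : Near d y C x') :
    ∃ i₀ j₀, i₀ ≤ j₀ ∧ ∀ i ≤ i₀, ∀ j ≥ j₀, d (y i) x + d x (y j) ≤ d (y i) (y j) + (C + 2 * c) ∧
      d (y i) x' + d x' (y j) ≤ d (y i) (y j) + (C + 2 * c) := by
  obtain ⟨i, j, hij, h1⟩ := h.far hd hc
  obtain ⟨k, l, hkl, h2⟩ := h'.far hd hc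
  exact ⟨min i k, max j l, by omega, fun i' hi j' hj =>
    ⟨h1 i' (by omega) j' (by omega), h2 i' (by omega) j' (by omega)⟩⟩

variable (hy : Hyp d δ)
include hy

theorem btw_trans {i j u v x : V} {c e : ℕ} (hu : d i u + d u j ≤ d i j + c)
    (hv : d i v + d v j ≤ d i j + c) (hx : d u x + d x v ≤ d u v + e) :
    d i x + d x j ≤ d i j + (2 * c + 2 * δ + 2 * e) := by
  have s1 := hd.symm x u
  have s2 := hd.symm x j
  have s3 := hd.symm u j
  have s4 := hd.symm v j
  have s5 := hd.symm v u
  have t1 := hd.tri u v j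
  have t2 := hd.tri v u j
  have t3 := hd.tri i u v
  have t4 := hd.tri i v u
  rcases hy i x u v with h1 | h1 <;> rcases hy j x u v with h2 | h2 <;> omega

theorem btw_close {i j x x' : V} {c : ℕ} (hx : d i x + d x j ≤ d i j + c)
    (hx' : d i x' + d x' j ≤ d i j + c) (h : d i x ≤ d i x') :
    d x x' + d i x ≤ d i x' + c + δ := by
  have s1 := hd.symm x i
  have s2 := hd.symm x' i
  rcases hy x x' i j with h1 | h1 <;> omega

theorem qc_line (hc : Chn d y c) : QC d (8 * c + 20 * δ + 2) {x | Near d y 0 x} := by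
  refine ⟨⟨y 0, near_self hd 0⟩, fun x p hp hmin q hq => ?_⟩
  obtain ⟨i, j, hij, h⟩ := Near.of_far hd hc hp hq
  obtain ⟨h1, h2⟩ := h i le_rfl j le_rfl
  obtain ⟨p', hp1, hp2⟩ := exists_between_near hd hy h1
  obtain ⟨q', hq1, hq2⟩ := exists_between_near hd hy h2
  have hI := qc_Ivl hd hy (y i) (y j)
  obtain ⟨x', hx1, hx2⟩ := exists_proj d hI.1 x
  have l1 := hI.2 x x' hx1 hx2 p' hp1
  have l2 := hI.2 x x' hx1 hx2 q' hq1
  have l3 := hmin x' ⟨i, j, hij, le_of_eq hx1⟩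
  have t1 := hd.tri x p p'
  have t2 := hd.tri x q q'
  have t3 := hd.tri p p' q
  have t4 := hd.tri p' x' q
  have t5 := hd.tri x' q' q
  have := hd.symm q' q
  have := hd.symm p' x'
  omega

/-- A long overlap of two lines forces corners of one line to be near the other line. -/
theorem overlap (hc : Chn d y c) (hc' : Chn d y' c) {A n : ℕ}
    (hA : ∀ k, d (y k) (y (k + 1)) ≤ A) (hpos : ∀ m, ∃ K : ℕ, ∀ i j : ℤ, K ≤ (i - j).natAbs →
      m < d (y i) (y j))
    {u v p q : V} (hu : Near d y' 0 u) (hv : Near d y' 0 v)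
    (hp : IsProj d {x | Near d y 0 x} u p) (hq : IsProj d {x | Near d y 0 x} v q)
    (hpq : (n + 1) * A + 40 * c + 60 * δ + 10 < d p q) :
    ∃ k₀ : ℤ, ∀ k, k₀ < k → k ≤ k₀ + n → Near d y' (60 * c + 100 * δ + 10) (y k) := by
  obtain ⟨i, j, hij, h⟩ := Near.of_far hd hc hp.1 hq.1
  wlog hle : d (y i) p ≤ d (y i) q generalizing u v p q
  · refine this hv hu hq hp ?_ (fun i' hi j' hj => ⟨(h i' hi j' hj).2, (h i' hi j' hj).1⟩)
      (by omega)
    rwa [hd.symm q p]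
  obtain ⟨K, hK⟩ := hpos (d (y i) p)
  obtain ⟨k, hk1, hk2, hk3, hk4⟩ := exists_step (fun k => d (y i) (y k)) (d (y i) p)
    (i := i) (j := max j (i + K + n + 1)) (by omega) (by simp [hd.self])
  have hlt : d (y i) p < d (y i) (y (k + 1)) := by
    rcases hk4 with rfl | h4
    · have := hK i _ (show K ≤ (i - max j (i + K + n + 1)).natAbs by omega)
      omega
    · exact h4
  obtain ⟨h1, h2⟩ := h i le_rfl (max j (k + n + 1)) (by omega)
  have hpq' := (qc_line hd hy hc).proj_proj hd hy hp hq
  have hpq1 : d u p + d p q + d q v ≤ d u v + (2 * (8 * c + 20 * δ + 2) + δ) := by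
    rcases hpq' with h | h
    · exact h
    · omega
  obtain ⟨i', j', hij', h'⟩ := Near.of_far hd hc' hu hv
  obtain ⟨h3, h4⟩ := h' i' le_rfl j' le_rfl
  have hup : ∀ m : ℕ, d (y i) (y (k + m)) ≤ d (y i) (y k) + m * A := by
    intro m
    induction m with
    | zero => simp
    | succ m ih =>
      have t := hd.tri (y i) (y (k + m)) (y (k + m + 1))
      have := hA (k + m)
      have e : k + ((m + 1 : ℕ) : ℤ) = k + m + 1 := by push_cast; ring
      rw [e, Nat.succ_mul]
      omega
  refine ⟨k, fun l hl1 hl2 => ⟨i', j', hij', ?_⟩⟩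
  have hm := hup (l - k).toNat
  have e : k + ((l - k).toNat : ℤ) = l := by omega
  rw [e] at hm
  have hmn : (l - k).toNat * A ≤ n * A := Nat.mul_le_mul_right _ (by omega)
  have hch := hc i (k + 1) l (by omega) (by omega)
  have hch2 := hc i l (max j (k + n + 1)) (by omega) (by omega)
  have e2 : (n + 1) * A = n * A + A := by ring
  rw [e2] at hpq
  have hlow : d (y i) p ≤ d (y i) (y l) + c := by omega
  have hc1 := btw_close hd hy h1 h2 hle
  obtain ⟨c', hc'⟩ : ∃ c', c' = d (y i) (y (max j (k + n + 1))) := ⟨_, rfl⟩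
  have g1 : d p (y l) + d (y i) p ≤ d (y i) (y l) + 4 * c + δ := by
    have s1 := hd.symm p (y i)
    have s2 := hd.symm (y l) (y i)
    rcases hy p (y l) (y i) (y (max j (k + n + 1))) with h | h <;> omega
  have g2 : d (y l) q + d (y i) (y l) ≤ d (y i) q + 4 * c + δ := by
    have s1 := hd.symm q (y i)
    have s2 := hd.symm (y l) (y i)
    rcases hy (y l) q (y i) (y (max j (k + n + 1))) with h | h <;> omega
  have t1 := hd.tri (y i) p q
  have g3 : d u (y l) + d (y l) v ≤ d u v + (8 * c + 2 * δ + (2 * (8 * c + 20 * δ + 2) + δ) + c + δ) := by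
    have t2 := hd.tri u p (y l)
    have t3 := hd.tri (y l) q v
    omega
  have := btw_trans hd hy h3 h4 g3
  omega

/-- A point near a line lies in one of its blocks. -/
theorem exists_block (hc : Chn d y c) {C : ℕ} {x : V} (h : Near d y C x) :
    ∃ j, d (y j) x + d x (y (j + 1)) ≤ d (y j) (y (j + 1)) + (2 * C + 2 * c + 2 * δ) := by
  obtain ⟨i, j, hij, h⟩ := h
  obtain ⟨k, hk1, hk2, hk3, hk4⟩ := exists_step (fun k => d (y i) (y k)) (d (y i) x) hij
    (by simp [hd.self])
  refine ⟨k, ?_⟩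
  by_cases hkj : k = j
  · subst hkj
    have := hd.tri x (y k) (y (k + 1))
    have := hd.symm x (y k)
    omega
  · have h4 : d (y i) x < d (y i) (y (k + 1)) := hk4.resolve_left hkj
    have c1 := hc i k j hk1 hk2
    have c2 := hc i (k + 1) j (by omega) (by omega)
    have t := hd.tri (y i) (y k) (y (k + 1))
    have s1 := hd.symm (y k) (y i)
    have s2 := hd.symm x (y i)
    have s3 := hd.symm (y (k + 1)) (y i)
    have g1 : d (y k) x + d (y i) (y k) ≤ d (y i) x + (C + c + δ) := by
      rcases hy (y k) x (y i) (y j) with h | h <;> omega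
    have g2 : d x (y (k + 1)) + d (y i) x ≤ d (y i) (y (k + 1)) + (C + c + δ) := by
      rcases hy x (y (k + 1)) (y i) (y j) with h | h <;> omega
    omega

/-- Points close to a point deep inside a block lie in the same block. -/
theorem block_stable (hc : Chn d y c) {C e R' : ℕ} {x x' : V} {j : ℤ} (h' : Near d y C x')
    (hx : d (y j) x + d x (y (j + 1)) ≤ d (y j) (y (j + 1)) + e)
    (h1 : R' + δ + c + e < d (y j) x) (h2 : R' + δ + c + e < d x (y (j + 1)))
    (hxx : d x x' ≤ R') :
    d (y j) x' + d x' (y (j + 1)) ≤ d (y j) (y (j + 1)) + (C + 4 * c + 2 * e + 2 * δ) := by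
  obtain ⟨i, k, hik, h⟩ := h'.far hd hc
  have h := h (min i j) (by omega) (max k (j + 1)) (by omega)
  obtain ⟨i, hi⟩ : ∃ i', i' = min i j := ⟨_, rfl⟩
  obtain ⟨k, hk⟩ : ∃ k', k' = max k (j + 1) := ⟨_, rfl⟩
  rw [← hi, ← hk] at h
  have hij : i ≤ j := by omega
  have hjk : j + 1 ≤ k := by omega
  clear hi hk hik
  have c1 := hc i j (j + 1) hij (by omega)
  have c2 := hc j (j + 1) k (by omega) hjk
  have t1 := hd.tri (y i) x (y (j + 1))
  have t2 := hd.tri (y j) x (y k)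
  have t3 := hd.tri (y i) (y j) (y k)
  have t4 := hd.tri (y j) (y (j + 1)) (y k)
  have s1 := hd.symm x (y j)
  have s2 := hd.symm x' (y j)
  have s3 := hd.symm x (y (j + 1))
  have s4 := hd.symm x' (y (j + 1))
  have s5 := hd.symm x (y k)
  have s6 := hd.symm x' (y k)
  have s7 := hd.symm (y k) (y (j + 1))
  have g1 : d (y i) (y j) + d (y j) x' ≤ d (y i) x' + (c + e + δ) := by
    rcases hy (y i) x (y j) x' with h | h <;> omega
  have g2 : d x' (y (j + 1)) + d (y (j + 1)) (y k) ≤ d x' (y k) + (c + e + δ) := by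
    rcases hy (y k) x (y (j + 1)) x' with h | h <;> omega
  omega

end

section
variable {V : Type*} {d : V → V → ℕ} {δ c : ℕ} (hd : IsGeod d) (hy : Hyp d δ)
include hd hy

theorem close_of_gromov {o X Q x q : V} {E Y b c : ℕ} (hc : d X Q + c < d X o + d o Q)
    (hx : d o x + d x X ≤ d o X + E) (hq : d o q + d q Q ≤ d o Q + E) (hx1 : d o x ≤ Y)
    (hx2 : Y ≤ d o x + b) (hq1 : d o q ≤ Y) (hq2 : Y ≤ d o q + b) (hcY : 2 * Y + δ < c) :
    d x q ≤ b + E + 2 * δ := by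
  have s1 := hd.symm o X
  have s2 := hd.symm x o
  have s3 := hd.symm Q X
  have s4 := hd.symm q x
  have hxQ : d o x + d x Q ≤ d o Q + (E + δ) := by
    have := hd.tri o x Q
    rcases hy x Q o X with h | h
    · omega
    · have s4 := hd.symm Q o
      omega
  rcases le_total (d o x) (d o q) with h | h
  · have := btw_close hd hy hxQ (hq.trans (by omega)) h
    omega
  · have := btw_close hd hy (hq.trans (by omega)) hxQ h
    omega

end

section
variable {G V : Type*} [Group G] [MulAction G V] {d : V → V → ℕ} {δ C₀ : ℕ}
  (hd : IsGeod d) (hinv : ∀ (g : G) x y, d (g • x) (g • y) = d x y) (hy : Hyp d δ)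
include hd hinv hy

/-- The axis of `F` makes a bounded detour at a translate by a non-elementary element. -/
theorem QG.corner {F : G} {o : V} (h : QG d F o C₀) {t : G} (ht : t ∉ Elem F) :
    ∃ c, ∀ a a' : ℕ, d ((t⁻¹ * F ^ (-(a : ℤ))) • o) o + d o (F ^ (a' : ℤ) • o) ≤
      d ((t⁻¹ * F ^ (-(a : ℤ))) • o) (F ^ (a' : ℤ) • o) + c := by
  obtain ⟨D, hD⟩ : ∃ D, D = d o (t⁻¹ • o) := ⟨_, rfl⟩
  obtain ⟨b, hb⟩ : ∃ b, b = d o (F • o) := ⟨_, rfl⟩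
  obtain ⟨K, hK⟩ := h.wstar hd hinv hy (b + (C₀ + 2 * D) + 2 * δ + D)
  obtain ⟨Y, hY⟩ : ∃ Y, Y = D + K * b + b + 1 := ⟨_, rfl⟩
  refine ⟨2 * Y + δ + 1, fun a a' => ?_⟩
  by_contra! hcon
  have hstep : ∀ k : ℤ, d (F ^ k • o) (F ^ (k + 1) • o) = b := fun k => by
    rw [zpow_add, zpow_one, mul_smul, hinv, hb]
  obtain ⟨i, hi0, hi1, hi2, hi3⟩ := exists_step (fun i => d o ((t⁻¹ * F ^ (-i)) • o)) Y
    (show (0 : ℤ) ≤ a by omega) (by simp only [neg_zero, zpow_zero, mul_one]; omega)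
  obtain ⟨j, hj0, hj1, hj2, hj3⟩ := exists_step (fun i => d o (F ^ i • o)) Y
    (show (0 : ℤ) ≤ a' by omega) (by simp [hd.self])
  obtain ⟨X, hX⟩ : ∃ X, X = (t⁻¹ * F ^ (-(a : ℤ))) • o := ⟨_, rfl⟩
  obtain ⟨Q, hQ⟩ : ∃ Q, Q = F ^ (a' : ℤ) • o := ⟨_, rfl⟩
  obtain ⟨x, hx⟩ : ∃ x, x = (t⁻¹ * F ^ (-i)) • o := ⟨_, rfl⟩
  obtain ⟨q, hq⟩ : ∃ q, q = F ^ j • o := ⟨_, rfl⟩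
  have hi4 : Y ≤ d o x + b := by
    rcases hi3 with rfl | hi3
    · have := hd.tri X o Q
      have t2 := hd.tri o X Q
      have s := hd.symm o X
      rw [← hX] at hi2 hcon
      rw [← hQ] at hcon
      omega
    · have h1 := hstep (-(i + 1))
      rw [neg_add, neg_add_cancel_right] at h1
      have := hd.tri o x ((t⁻¹ * F ^ (-(i + 1))) • o)
      rw [hx, mul_smul, mul_smul, hinv, hd.symm (F ^ (-i) • o), neg_add, h1] at this
      rw [mul_smul, neg_add] at hi3
      rw [hx, mul_smul]
      omega
  have hj4 : Y ≤ d o q + b := by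
    rcases hj3 with rfl | hj3
    · have t2 := hd.tri X Q o
      have s := hd.symm o Q
      rw [← hX, ← hQ] at hcon
      rw [← hQ] at hj2
      omega
    · have h1 := hstep j
      have := hd.tri o q (F ^ (j + 1) • o)
      rw [← hq] at h1
      omega
  have hxX : d o x + d x X ≤ d o X + (C₀ + 2 * D) := by
    have h1 := h.chain (-a) (-i) 0 (by omega) (by omega)
    rw [zpow_zero, one_smul, ← hinv t⁻¹, ← hinv t⁻¹ _ o, ← hinv t⁻¹ _ o, ← mul_smul, ← mul_smul,
      ← hx, ← hX] at h1
    have s1 := hd.symm X x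
    have s2 := hd.symm x (t⁻¹ • o)
    have s3 := hd.symm X (t⁻¹ • o)
    have s4 := hd.symm (t⁻¹ • o) o
    have := hd.tri o (t⁻¹ • o) x
    have := hd.tri (t⁻¹ • o) o X
    omega
  have hqQ : d o q + d q Q ≤ d o Q + (C₀ + 2 * D) := by
    have h1 := h.chain 0 j a' (by omega) (by omega)
    rw [zpow_zero, one_smul, ← hq, ← hQ] at h1
    omega
  rw [← hX, ← hQ] at hcon
  have hxq := close_of_gromov hd hy hcon hxX hqQ (hx ▸ hi2) hi4 (hq ▸ hj2) hj4 (by omega)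
  have := hK t⁻¹ 0 0 j (-i) (by simp only [zpow_zero, one_smul]; omega)
    (by rw [← mul_smul, ← hx, ← hq, hd.symm]; omega) (by
      by_contra! hcon
      have h1 := dist_zpow_le hd hinv F o j
      rw [← hq, ← hb] at h1
      have h2 : j.natAbs * b ≤ K * b := Nat.mul_le_mul_right _ (by omega)
      omega)
  exact ht (by simpa using Elem.inv this)

end

theorem Chn.natAbs_le {V : Type*} {d : V → V → ℕ} {y : ℤ → V} {c : ℕ} (hc : Chn d y c)
    (h : ∀ i, c < d (y i) (y (i + 1))) (i : ℤ) (n : ℕ) : n ≤ d (y i) (y (i + n)) := by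
  induction n with
  | zero => simp
  | succ n ih =>
    have h1 := hc i (i + n) (i + n + 1) (by omega) (by omega)
    have h2 := h (i + n)
    have e : i + ((n + 1 : ℕ) : ℤ) = i + n + 1 := by push_cast; ring
    rw [e]
    omega

theorem Chn.far {V : Type*} {d : V → V → ℕ} {y : ℤ → V} {c : ℕ} (hd : IsGeod d) (hc : Chn d y c)
    (h : ∀ i, c < d (y i) (y (i + 1))) (m : ℕ) :
    ∃ K : ℕ, ∀ i j : ℤ, K ≤ (i - j).natAbs → m < d (y i) (y j) := by
  refine ⟨m + 1, fun i j hij => ?_⟩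
  rcases le_total i j with hle | hle
  · obtain ⟨n, rfl⟩ := Int.le.dest hle
    have := hc.natAbs_le h i n
    omega
  · obtain ⟨n, rfl⟩ := Int.le.dest hle
    have := hc.natAbs_le h j n
    rw [hd.symm] at this
    omega

section
variable {G V : Type*} [Group G] [MulAction G V] {d : V → V → ℕ} {δ C₀ : ℕ}
  (hd : IsGeod d) (hinv : ∀ (g : G) x y, d (g • x) (g • y) = d x y) (hy : Hyp d δ)
include hd hinv

omit hd in
theorem block_near {F : G} {o : V} {t : G} {D : ℕ} (hD : d o (t • o) ≤ D) (s : G) (a : ℤ) :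
    d ((s * F ^ a) • o) ((s * F ^ a * t) • o) ≤ D := by
  rwa [mul_smul _ t, hinv]

theorem block_len {F : G} {o : V} {t : G} {D : ℕ} (hD : d o (t • o) ≤ D) (s : G) (a : ℤ) :
    d (s • o) ((s * F ^ a * t) • o) ≤ d o (F ^ a • o) + D ∧
    d o (F ^ a • o) ≤ d (s • o) ((s * F ^ a * t) • o) + D := by
  have h1 := block_near hinv (F := F) hD s a
  have h2 : d (s • o) ((s * F ^ a) • o) = d o (F ^ a • o) := by rw [mul_smul, hinv]
  have := hd.tri (s • o) ((s * F ^ a) • o) ((s * F ^ a * t) • o)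
  have := hd.tri (s • o) ((s * F ^ a * t) • o) ((s * F ^ a) • o)
  have := hd.symm ((s * F ^ a * t) • o) ((s * F ^ a) • o)
  omega

include hy

/-- The corners of a broken line with long blocks form a coarse geodesic. -/
theorem QG.chn_line {F : G} {o : V} (h : QG d F o C₀) {T : Set G} (hT : T.Finite)
    (hTE : ∀ t ∈ T, t ∉ Elem F) :
    ∃ c D, (∀ t ∈ T, d o (t • o) ≤ D) ∧ ∀ (t : ℤ → G) (a : ℤ → ℕ) (s : ℤ → G),
      (∀ i, s (i + 1) = s i * F ^ (a i : ℤ) * t i) → (∀ i, t i ∈ T) →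
      (∀ i, c + D < d o (F ^ (a i : ℤ) • o)) → Chn d (fun i => s i • o) c := by
  choose! cc hcc using fun t (ht : t ∈ T) => h.corner hd hinv hy (hTE t ht)
  obtain ⟨c₁, hc₁⟩ := (hT.image cc).bddAbove
  obtain ⟨D, hD⟩ := (hT.image fun t => d o (t • o)).bddAbove
  have hD' : ∀ t ∈ T, d o (t • o) ≤ D := fun t ht => hD ⟨t, ht, rfl⟩
  refine ⟨c₁ + 2 * D + 2 * δ, D, hD', fun t a s hs ht ha i j k hij hjk => ?_⟩
  refine Olsh.chain hd hy (x := fun i => s i • o) (c := c₁ + 2 * D) (fun i => ?_) (fun i => ?_) hij hjk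
  · have h1 := hcc _ (ht i) (a i) (a (i + 1))
    have h2 := hc₁ ⟨_, ht i, rfl⟩
    have e1 : s i = s (i + 1) * ((t i)⁻¹ * F ^ (-(a i : ℤ))) := by rw [hs i]; group
    have e2 : s (i + 2) = s (i + 1) * F ^ (a (i + 1) : ℤ) * t (i + 1) := by
      rw [← hs]; congr 1; ring
    rw [← hinv (s (i + 1)), ← hinv (s (i + 1)) o, ← hinv (s (i + 1)) _ (F ^ _ • o), ← mul_smul,
      ← mul_smul, ← e1] at h1
    have h3 := block_near hinv (F := F) (hD' _ (ht (i + 1))) (s (i + 1)) (a (i + 1))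
    rw [← e2] at h3
    have := hd.symm (s (i + 2) • o) ((s (i + 1) * F ^ (a (i + 1) : ℤ)) • o)
    have := hd.tri (s (i + 1) • o) ((s (i + 1) * F ^ (a (i + 1) : ℤ)) • o) (s (i + 2) • o)
    have := hd.tri (s i • o) (s (i + 2) • o) ((s (i + 1) * F ^ (a (i + 1) : ℤ)) • o)
    omega
  · have h1 := (block_len hd hinv (F := F) (hD' _ (ht i)) (s i) (a i)).2
    rw [← hs] at h1
    have := ha i
    omega

/-- Corners of one translate of a broken line that lie near another one are near corners. -/
theorem QG.corner_match {F : G} {o : V} (h : QG d F o C₀) (D c C : ℕ) :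
    ∃ R K : ℕ, ∀ (t : ℤ → G) (a : ℤ → ℕ) (s : ℤ → G),
      (∀ i, s (i + 1) = s i * F ^ (a i : ℤ) * t i) → (∀ i, t i ∉ Elem F) →
      (∀ i, d o (t i • o) ≤ D) → Chn d (fun i => s i • o) c → (∀ i, K ≤ a i) →
      ∀ (f : G) (k : ℤ), Near d (fun i => s i • o) C (f • s k • o) →
        Near d (fun i => s i • o) C (f • s (k + 1) • o) →
        Near d (fun i => s i • o) C (f • s (k + 2) • o) →
        ∃ σ, d (f • s (k + 1) • o) (s σ • o) ≤ R := by
  obtain ⟨b, hb⟩ : ∃ b, b = d o (F • o) := ⟨_, rfl⟩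
  obtain ⟨C₂, hC₂⟩ : ∃ C₂, C₂ = 2 * (C + 2 * c) + 2 * δ + 2 * (C₀ + 2 * D) := ⟨_, rfl⟩
  obtain ⟨e, he⟩ : ∃ e, e = 2 * C + 2 * c + 2 * δ := ⟨_, rfl⟩
  obtain ⟨e', he'⟩ : ∃ e', e' = C₂ + 4 * c + 2 * e + 2 * δ := ⟨_, rfl⟩
  obtain ⟨C₃, hC₃⟩ : ∃ C₃, C₃ = (e' + 2 * D) + C₀ + δ + b := ⟨_, rfl⟩
  obtain ⟨K, hK⟩ := h.wstar hd hinv hy C₃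
  obtain ⟨R', hR'⟩ : ∃ R', R' = K * b + D := ⟨_, rfl⟩
  refine ⟨R' + δ + c + e, K, fun t a s hs ht hD hc ha f k h0 h1 h2 => ?_⟩
  obtain ⟨j, hj⟩ := exists_block hd hy hc h1
  by_contra! hcon
  have hj1 := hcon j
  have hj2 := hcon (j + 1)
  rw [hd.symm] at hj1
  have key : ∀ P Q x', Near d (fun i => s i • o) C P → Near d (fun i => s i • o) C Q →
      d P x' + d x' Q ≤ d P Q + (C₀ + 2 * D) → d (f • s (k + 1) • o) x' ≤ R' →
      ∃ n : ℤ, d ((s j * F ^ n) • o) x' ≤ C₃ := by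
    intro P Q x' hP hQ hx hx'
    obtain ⟨i₀, j₀, hij, hn⟩ := hP.of_far hd hc hQ
    obtain ⟨n1, n2⟩ := hn i₀ le_rfl j₀ le_rfl
    have hx2 : Near d (fun i => s i • o) C₂ x' :=
      ⟨i₀, j₀, hij, (btw_trans hd hy n1 n2 hx).trans (Nat.add_le_add_left (by omega) _)⟩
    have hbl := block_stable hd hy hc hx2 (j := j) (e := e) (R' := R') (hj.trans (by omega)) hj1 hj2
      hx'
    have l1 := block_near hinv (F := F) (hD j) (s j) (a j)
    rw [← hs] at l1
    have tt := hd.tri x' (s (j + 1) • o) ((s j * F ^ (a j : ℤ)) • o)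
    have tt' := hd.tri (s j • o) ((s j * F ^ (a j : ℤ)) • o) (s (j + 1) • o)
    have s1 := hd.symm (s (j + 1) • o) ((s j * F ^ (a j : ℤ)) • o)
    obtain ⟨n, -, -, hn⟩ := near_seq hd hy (x := fun n : ℤ => (s j * F ^ n) • o) (i := 0) (j := a j)
      (y := x') (c := e' + 2 * D) (c' := C₀) (b := b) (by omega) (fun n h0 h1 => by
        simp only [mul_smul, hinv]
        exact h.chain 0 n (a j) h0 h1) (fun n _ _ => by
        rw [zpow_add, zpow_one, ← mul_assoc, mul_smul _ F, hinv, hb])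
        (by simp only [zpow_zero, mul_one]; omega)
    exact ⟨n, by omega⟩
  have two : ∀ w : G, (∃ n : ℤ, d ((s j * F ^ n) • o) (w • o) ≤ C₃) → (∀ ε : ℤ, ε = 1 ∨ ε = -1 →
      (∃ n : ℤ, d ((s j * F ^ n) • o) ((w * F ^ (ε * K)) • o) ≤ C₃) → w⁻¹ * s j ∈ Elem F) := by
    rintro w ⟨n, hn⟩ ε hε ⟨m, hm⟩
    refine hK _ 0 n (ε * K) m ?_ ?_ (by rcases hε with rfl | rfl <;> simp)
    · rw [← hinv w, zpow_zero, one_smul, ← mul_smul, ← mul_smul, hd.symm]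
      simpa [mul_assoc] using hn
    · rw [← hinv w, ← mul_smul, ← mul_smul, ← mul_smul, hd.symm]
      simpa [mul_assoc] using hm
  have hbk : ∀ ε : ℤ, ε = 1 ∨ ε = -1 → d o (F ^ (ε * K) • o) ≤ K * b := fun ε hε => by
    have := dist_zpow_le hd hinv F o (ε * K)
    rw [← hb] at this
    rcases hε with rfl | rfl <;> simpa using this
  have m1 : (f * s (k + 1))⁻¹ * s j ∈ Elem F := by
    have e2 : s (k + 2) = s (k + 1) * F ^ (a (k + 1) : ℤ) * t (k + 1) := by rw [← hs]; congr 1; ring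
    have bt : ∀ i : ℤ, 0 ≤ i → i ≤ a (k + 1) →
        d (f • s (k + 1) • o) ((f * s (k + 1) * F ^ i) • o) +
        d ((f * s (k + 1) * F ^ i) • o) (f • s (k + 2) • o) ≤
        d (f • s (k + 1) • o) (f • s (k + 2) • o) + (C₀ + 2 * D) := by
      intro i hi0 hi1
      have hch := h.chain 0 i _ hi0 hi1
      rw [zpow_zero, one_smul, ← hinv (f * s (k + 1)), ← hinv (f * s (k + 1)) _ (F ^ (a _ : ℤ) • o),
        ← hinv (f * s (k + 1)) _ (F ^ (a _ : ℤ) • o), ← mul_smul, ← mul_smul] at hch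
      have l1 := block_near hinv (F := F) (hD (k + 1)) (f * s (k + 1)) (a (k + 1))
      have e3 : f * s (k + 1) * F ^ (a (k + 1) : ℤ) * t (k + 1) = f * s (k + 2) := by
        rw [e2]; group
      rw [e3] at l1
      simp only [← mul_smul] at *
      have t1 := hd.tri ((f * s (k + 1) * F ^ i) • o) ((f * s (k + 1) * F ^ (a (k + 1) : ℤ)) • o)
        ((f * s (k + 2)) • o)
      have t2 := hd.tri ((f * s (k + 1)) • o) ((f * s (k + 2)) • o)
        ((f * s (k + 1) * F ^ (a (k + 1) : ℤ)) • o)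
      have s1 := hd.symm ((f * s (k + 2)) • o) ((f * s (k + 1) * F ^ (a (k + 1) : ℤ)) • o)
      omega
    refine two _ ?_ 1 (Or.inl rfl) ?_
    · rw [mul_smul]
      exact key _ _ _ h1 h2 (by rw [hd.self]; omega) (by rw [hd.self]; omega)
    · refine key _ _ _ h1 h2 (bt (1 * K) (by omega) (by have := ha (k + 1); omega)) ?_
      have := hbk 1 (Or.inl rfl)
      rw [← mul_smul, mul_smul _ (F ^ _), hinv]
      omega
  have m2 : (f * s (k + 1) * (t k)⁻¹)⁻¹ * s j ∈ Elem F := by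
    have e2 : s k = s (k + 1) * (t k)⁻¹ * F ^ (-(a k) : ℤ) := by rw [hs]; group
    obtain ⟨w, hw⟩ : ∃ w, w = f * s (k + 1) * (t k)⁻¹ := ⟨_, rfl⟩
    have ew : f * s k = w * F ^ (-(a k) : ℤ) := by rw [e2, hw]; group
    have dw : d (w • o) (f • s (k + 1) • o) ≤ D := by
      have : f * s (k + 1) = w * t k := by rw [hw]; group
      rw [← mul_smul, this, mul_smul, hinv]
      exact hD k
    have bt : ∀ i : ℤ, 0 ≤ i → i ≤ a k →
        d (f • s k • o) ((w * F ^ (-i)) • o) + d ((w * F ^ (-i)) • o) (f • s (k + 1) • o) ≤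
        d (f • s k • o) (f • s (k + 1) • o) + (C₀ + 2 * D) := by
      intro i hi0 hi1
      have hch := h.chain (-(a k)) (-i) 0 (by omega) (by omega)
      rw [zpow_zero, one_smul, ← hinv w, ← hinv w _ o, ← hinv w _ o, ← mul_smul, ← mul_smul,
        ← ew, mul_smul f] at hch
      have t1 := hd.tri ((w * F ^ (-i)) • o) (w • o) (f • s (k + 1) • o)
      have t2 := hd.tri (f • s k • o) (f • s (k + 1) • o) (w • o)
      have s1 := hd.symm (w • o) (f • s (k + 1) • o)
      omega
    rw [← hw]
    have q0 := bt 0 le_rfl (by omega)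
    have q1 := bt K (by omega) (by have := ha k; omega)
    rw [neg_zero, zpow_zero, mul_one] at q0
    refine two _ (key _ _ _ h0 h1 q0 (by rw [hd.symm]; omega)) (-1) (Or.inr rfl) ?_
    rw [neg_one_mul]
    refine key _ _ _ h0 h1 q1 ?_
    have := hbk (-1) (Or.inr rfl)
    have t1 := hd.tri (f • s (k + 1) • o) (w • o) ((w * F ^ (-(K : ℤ))) • o)
    rw [mul_smul, hinv] at t1
    rw [neg_one_mul] at this
    rw [hd.symm] at dw
    rw [mul_smul]
    omega
  have := Elem.mul m1 (Elem.inv m2)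
  have e3 : (f * s (k + 1))⁻¹ * s j * ((f * s (k + 1) * (t k)⁻¹)⁻¹ * s j)⁻¹ = (t k)⁻¹ := by group
  rw [e3] at this
  exact ht k (by simpa using Elem.inv this)

end

section
variable {V : Type*} {d : V → V → ℕ} {y y' : ℤ → V} {c R A A' m : ℕ} (hd : IsGeod d)
  (hc : Chn d y c) (hl : ∀ k, A ≤ d (y k) (y (k + 1))) (hu : ∀ k, d (y k) (y (k + 1)) ≤ A')
  (hl' : ∀ k, d (y' k) (y' (k + 1)) = d (y k) (y (k + 1)))
  (hA : A' + 2 * R + 2 * c < 2 * A) (hR : 2 * R < A)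
include hd hc hl hu hl' hA hR

theorem adjacent_match {k σ τ : ℤ} (h0 : d (y' k) (y σ) ≤ R) (h1 : d (y' (k + 1)) (y τ) ≤ R) :
    τ = σ + 1 ∨ σ = τ + 1 := by
  have lower : ∀ σ τ : ℤ, σ + 1 < τ → 2 * A ≤ d (y σ) (y τ) + 2 * c := fun σ τ h => by
    have h1 := hc σ (σ + 1) τ (by omega) (by omega)
    have h2 := hc (σ + 1) (σ + 1 + 1) τ (by omega) (by omega)
    have := hl σ
    have := hl (σ + 1)
    omega
  have t1 := hd.tri (y σ) (y' k) (y τ)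
  have t2 := hd.tri (y' k) (y' (k + 1)) (y τ)
  have t3 := hd.tri (y' k) (y σ) (y' (k + 1))
  have t4 := hd.tri (y σ) (y τ) (y' (k + 1))
  have s1 := hd.symm (y σ) (y' k)
  have s2 := hd.symm (y τ) (y' (k + 1))
  have e := hl' k
  have e1 := hl k
  have e2 := hu k
  have s3 := hd.symm (y σ) (y τ)
  by_contra! hcon
  rcases lt_trichotomy σ τ with h | h | h
  · have := lower σ τ (by omega)
    omega
  · subst h
    omega
  · have := lower τ σ (by omega)
    omega

theorem index_match (hm : 3 ≤ m)
    (hsep : ∀ i j, d (y i) (y (i + 1)) ≤ d (y j) (y (j + 1)) + 2 * R →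
      d (y j) (y (j + 1)) ≤ d (y i) (y (i + 1)) + 2 * R → (m : ℤ) ∣ i - j)
    {k σ τ υ : ℤ} (h0 : d (y' k) (y σ) ≤ R) (h1 : d (y' (k + 1)) (y τ) ≤ R)
    (h2 : d (y' (k + 2)) (y υ) ≤ R) : τ = σ + 1 ∧ υ = σ + 2 ∧ (m : ℤ) ∣ σ - k := by
  have sep : ∀ k σ τ : ℤ, d (y' k) (y σ) ≤ R → d (y' (k + 1)) (y τ) ≤ R →
      (τ = σ + 1 ∧ (m : ℤ) ∣ σ - k) ∨ (σ = τ + 1 ∧ (m : ℤ) ∣ τ - k) := by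
    intro k σ τ h0 h1
    have t1 := hd.tri (y σ) (y' k) (y τ)
    have t2 := hd.tri (y' k) (y' (k + 1)) (y τ)
    have t3 := hd.tri (y' k) (y σ) (y' (k + 1))
    have t4 := hd.tri (y σ) (y τ) (y' (k + 1))
    have s1 := hd.symm (y σ) (y' k)
    have s2 := hd.symm (y τ) (y' (k + 1))
    have s3 := hd.symm (y σ) (y τ)
    have e := hl' k
    rcases adjacent_match hd hc hl hu hl' hA hR h0 h1 with rfl | rfl
    · exact Or.inl ⟨rfl, hsep _ _ (by omega) (by omega)⟩
    · exact Or.inr ⟨rfl, hsep _ _ (by omega) (by omega)⟩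
  have e : k + 2 = k + 1 + 1 := by ring
  rw [e] at h2
  have nd : ∀ x : ℤ, (m : ℤ) ∣ x → x.natAbs < m → x = 0 := fun x hx hlt =>
    Int.eq_zero_of_abs_lt_dvd hx (by rw [Int.abs_eq_natAbs]; omega)
  rcases sep k σ τ h0 h1 with ⟨e1, d1⟩ | ⟨e1, d1⟩ <;>
    rcases sep (k + 1) τ υ h1 h2 with ⟨e2, d2⟩ | ⟨e2, d2⟩
  · exact ⟨e1, by omega, d1⟩
  all_goals
    have d3 := dvd_sub d1 d2
    have := nd _ d3 (by omega)
    omega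

end

section
variable {G V : Type*} [Group G] [MulAction G V] {d : V → V → ℕ} {δ C₀ : ℕ}
  (hd : IsGeod d) (hinv : ∀ (g : G) x y, d (g • x) (g • y) = d x y) (hy : Hyp d δ)
include hd hinv hy

theorem QG.commute_of_close {F : G} {o : V} (h : QG d F o C₀) (R D : ℕ) :
    ∃ K : ℕ, 1 ≤ K ∧ ∀ (t S f : G) (a : ℕ), d o (t • o) ≤ D → K ≤ a → d (f • S • o) (S • o) ≤ R →
      d (f • (S * F ^ (a : ℤ) * t) • o) ((S * F ^ (a : ℤ) * t) • o) ≤ R →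
      ∃ n : ℤ, n ≠ 0 ∧ (S⁻¹ * f * S) * F ^ n * (S⁻¹ * f * S)⁻¹ = F ^ n := by
  obtain ⟨K, hK⟩ := h.conj_pow hd hinv hy (R + 2 * D)
  refine ⟨K + 1, by omega, fun t S f a ht ha h0 h1 => ?_⟩
  have n1 := block_near hinv (F := F) ht S a
  have n2 := block_near hinv (F := F) ht (f * S) a
  have e : f * S * F ^ (a : ℤ) * t = f * (S * F ^ (a : ℤ) * t) := by group
  rw [e] at n2
  have e2 : S * (S⁻¹ * f * S) = f * S := by group
  have c0 : d (F ^ (0 : ℤ) • o) ((S⁻¹ * f * S) • F ^ (0 : ℤ) • o) ≤ R + 2 * D := by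
    rw [zpow_zero, one_smul, ← hinv S, ← mul_smul S, e2, mul_smul, hd.symm]
    omega
  have c1 : d (F ^ (a : ℤ) • o) ((S⁻¹ * f * S) • F ^ (a : ℤ) • o) ≤ R + 2 * D := by
    rw [← hinv S, ← mul_smul S (S⁻¹ * f * S), e2, ← mul_smul, ← mul_smul]
    rw [← mul_smul] at h1
    have t1 := hd.tri ((S * F ^ (a : ℤ)) • o) ((S * F ^ (a : ℤ) * t) • o)
      ((f * S * F ^ (a : ℤ)) • o)
    have t2 := hd.tri ((S * F ^ (a : ℤ) * t) • o) ((f * (S * F ^ (a : ℤ) * t)) • o)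
      ((f * S * F ^ (a : ℤ)) • o)
    have s1 := hd.symm ((S * F ^ (a : ℤ) * t) • o) ((f * (S * F ^ (a : ℤ) * t)) • o)
    have s2 := hd.symm ((f * (S * F ^ (a : ℤ) * t)) • o) ((f * S * F ^ (a : ℤ)) • o)
    omega
  obtain ⟨n, hn, s, s', hs, hs', e1, e2, he⟩ := hK _ 0 0 a a c0 c1 (by omega)
  have hss : s = s' := by
    rcases hs with rfl | rfl <;> rcases hs' with rfl | rfl <;> omega
  subst hss
  exact ⟨s * n, mul_ne_zero (by rcases hs with rfl | rfl <;> omega) (by omega), he⟩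

/-- An isometry fixing coarsely three consecutive corners is trivial. -/
theorem QG.rigid (hlox : ∀ g : G, (∀ v : V, g • v ≠ v) → Lox d g)
    (hfree : ∀ v w : V, v ≠ w → ∀ g : G, g • v = v → g • w = w → g = 1)
    {F : G} {o : V} (h : QG d F o C₀) (R D : ℕ) :
    ∃ K : ℕ, ∀ (t t' S f : G) (a a' : ℕ), t ∉ Elem F → d o (t • o) ≤ D → d o (t' • o) ≤ D →
      K ≤ a → K ≤ a' → d (f • S • o) (S • o) ≤ R →
      d (f • (S * F ^ (a : ℤ) * t) • o) ((S * F ^ (a : ℤ) * t) • o) ≤ R →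
      d (f • (S * F ^ (a : ℤ) * t * F ^ (a' : ℤ) * t') • o)
        ((S * F ^ (a : ℤ) * t * F ^ (a' : ℤ) * t') • o) ≤ R → f = 1 := by
  obtain ⟨K, -, hK⟩ := h.commute_of_close hd hinv hy R D
  refine ⟨K, fun t t' S f a a' htE ht ht' ha ha' h0 h1 h2 => ?_⟩
  obtain ⟨n, hn, hc1⟩ := hK t S f a ht ha h0 h1
  obtain ⟨n', hn', hc2⟩ := hK t' _ f a' ht' ha' h1 h2
  by_contra hf
  have : Nonempty V := ⟨o⟩
  have nt : ∀ S : G, S⁻¹ * f * S ≠ 1 := fun S hS => hf (by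
    have : S * (S⁻¹ * f * S) * S⁻¹ = 1 := by rw [hS]; group
    rw [← this]; group)
  obtain ⟨α, β, hα, hβ, e1⟩ := commute_pow hd hinv hy hlox hfree h.lox h.wpd (nt _) hn hc1
  obtain ⟨α', β', hα', hβ', e2⟩ := commute_pow hd hinv hy hlox hfree h.lox h.wpd (nt _) hn' hc2
  suffices ht : t⁻¹ ∈ Elem F from htE (by simpa using Elem.inv ht)
  refine ⟨β * α', β' * α, mul_ne_zero hβ (by omega), mul_ne_zero hβ' (by omega), ?_⟩
  rw [zpow_mul, ← e1, zpow_mul, ← e2, zpow_natCast, zpow_natCast, ← pow_mul, ← pow_mul]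
  have hcf : ((F ^ (a : ℤ))⁻¹ * (S⁻¹ * f * S) * F ^ (a : ℤ)) ^ (α * α') =
      (S⁻¹ * f * S) ^ (α * α') := by
    have : ((F ^ (a : ℤ))⁻¹ * (S⁻¹ * f * S) * F ^ (a : ℤ)) =
        (F ^ (a : ℤ))⁻¹ * (S⁻¹ * f * S) * ((F ^ (a : ℤ))⁻¹)⁻¹ := by group
    rw [this, _root_.conj_pow, pow_mul, e1]
    group
  rw [← hcf, mul_comm α' α, ← _root_.conj_pow]
  congr 1
  group

end

section
variable {G V : Type*} [Group G] [MulAction G V] {d : V → V → ℕ} {δ c c' : ℕ} {r : G} {o : V}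
  {M : Set V} (hd : IsGeod d) (hinv : ∀ (g : G) x y, d (g • x) (g • y) = d x y)
  (hc : Chn d (fun n : ℤ => r ^ n • o) c) (hM : ∀ p ∈ M, ∀ k : ℤ, r ^ k • p ∈ M)
  (hmid : ∀ p ∈ M, ∃ n₀ : ℕ, ∀ n : ℕ, n₀ ≤ n →
    d (r ^ (-n : ℤ) • o) p + d p (r ^ (n : ℤ) • o) ≤ d (r ^ (-n : ℤ) • o) (r ^ (n : ℤ) • o) + c')
include hd hinv hc hmid

theorem line_shift {p : V} (hp : p ∈ M) (k : ℕ) : ∃ n₀ : ℕ, ∀ n : ℕ, n₀ ≤ n →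
    d o (r ^ (k : ℤ) • o) + d (r ^ (-n : ℤ) • o) p ≤
      d (r ^ (-n : ℤ) • o) (r ^ (k : ℤ) • p) + (c + c') ∧
    d (r ^ (-n : ℤ) • o) (r ^ (k : ℤ) • p) ≤
      d o (r ^ (k : ℤ) • o) + d (r ^ (-n : ℤ) • o) p := by
  obtain ⟨n₀, hn₀⟩ := hmid p hp
  refine ⟨n₀, fun n hn => ?_⟩
  have h1 := hn₀ n hn
  have h2 := hc (-n) (-n + k) (n + k) (by omega) (by omega)
  have e : ∀ a b : ℤ, d (r ^ a • o) (r ^ (a + b) • o) = d o (r ^ b • o) := fun a b => by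
    rw [zpow_add, mul_smul, hinv]
  have e' : ∀ (x y : V), d (r ^ (k : ℤ) • x) (r ^ (k : ℤ) • y) = d x y := fun x y => hinv _ _ _
  have e2 : ∀ a : ℤ, r ^ (a + k) • o = r ^ (k : ℤ) • r ^ a • o := fun a => by
    rw [← mul_smul, ← zpow_add, add_comm]
  simp only at h2
  rw [e, e2, e2, e'] at h2
  have t1 := hd.tri (r ^ (-n : ℤ) • o) (r ^ (k : ℤ) • p) (r ^ (k : ℤ) • r ^ (n : ℤ) • o)
  have t2 := hd.tri (r ^ (-n : ℤ) • o) (r ^ (k : ℤ) • r ^ (-n : ℤ) • o) (r ^ (k : ℤ) • p)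
  rw [e'] at t1 t2
  rw [← e2, e] at t2
  omega

theorem line_rot {P : ℕ} (hP : ∀ k : ℕ, 1 ≤ k → P ≤ d o (r ^ (k : ℤ) • o)) {p : V} (hp : p ∈ M)
    {k : ℤ} (hk : k ≠ 0) : P ≤ d p (r ^ k • p) + (c + c') := by
  have key : ∀ k : ℕ, 1 ≤ k → P ≤ d p (r ^ (k : ℤ) • p) + (c + c') := fun k hk => by
    obtain ⟨n, hn⟩ := line_shift hd hinv hc hmid hp k
    have := (hn n le_rfl).1
    have := hP k hk
    have := hd.tri (r ^ (-n : ℤ) • o) p (r ^ (k : ℤ) • p)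
    omega
  rcases le_total 0 k with h | h
  · lift k to ℕ using h
    exact key k (by omega)
  · obtain ⟨l, rfl⟩ : ∃ l : ℕ, k = -l := ⟨k.natAbs, by omega⟩
    rw [zpow_neg, hd.symm, dist_inv_smul hd hinv]
    exact key l (by omega)

include hM

theorem line_step (hy : Hyp d δ) {p q : V} (hp : p ∈ M) (hq : q ∈ M) : ∃ ε : ℤ,
    d p (r ^ ε • q) + d p q ≤ d o (r • o) + (2 * c' + 2 * δ + 2 * c) ∨
    d p (r ^ ε • q) + d o (r • o) ≤ d p q + (2 * c' + 2 * δ + 2 * c) := by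
  have hclose : ∀ q ∈ M, ∃ n₀ : ℕ, ∀ n : ℕ, n₀ ≤ n →
      d p q + d (r ^ (-n : ℤ) • o) p ≤ d (r ^ (-n : ℤ) • o) q + (c' + δ) ∨
      d p q + d (r ^ (-n : ℤ) • o) q ≤ d (r ^ (-n : ℤ) • o) p + (c' + δ) := by
    intro q hq
    obtain ⟨n₁, h1⟩ := hmid p hp
    obtain ⟨n₂, h2⟩ := hmid q hq
    refine ⟨max n₁ n₂, fun n hn => ?_⟩
    have h1 := h1 n (by omega)
    have h2 := h2 n (by omega)
    rcases le_total (d (r ^ (-n : ℤ) • o) p) (d (r ^ (-n : ℤ) • o) q) with h | h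
    · left
      have := btw_close hd hy h1 h2 h
      omega
    · right
      have := btw_close hd hy h2 h1 h
      have := hd.symm p q
      omega
  obtain ⟨n₁, h1⟩ := line_shift hd hinv hc hmid hq 1
  obtain ⟨n₂, h2⟩ := line_shift hd hinv hc hmid (hM q hq (-1)) 1
  obtain ⟨n₃, h3⟩ := hclose q hq
  obtain ⟨n₄, h4⟩ := hclose _ (hM q hq 1)
  obtain ⟨n₅, h5⟩ := hclose _ (hM q hq (-1))
  obtain ⟨n, hn⟩ : ∃ n, n = n₁ + n₂ + n₃ + n₄ + n₅ := ⟨_, rfl⟩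
  have h1 := h1 n (by omega)
  have h2 := h2 n (by omega)
  have h3 := h3 n (by omega)
  have h4 := h4 n (by omega)
  have h5 := h5 n (by omega)
  rw [← mul_smul, ← zpow_add] at h2
  simp only [Nat.cast_one, zpow_one, add_neg_cancel, zpow_zero, one_smul] at h1 h2 h4
  have t1 := hd.tri (r ^ (-n : ℤ) • o) p q
  have t2 := hd.tri (r ^ (-n : ℤ) • o) q p
  have s := hd.symm p q
  rcases h3 with h3 | h3
  · refine ⟨-1, ?_⟩
    omega
  · refine ⟨1, ?_⟩
    rw [zpow_one]
    omega

theorem line_tr (hy : Hyp d δ) {p q : V} {b : ℕ} (hp : p ∈ M) (hq : q ∈ M)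
    (hb0 : 0 < b) (hb : 2 * c' + 2 * δ + 2 * c ≤ b) (hP : 500 * b ≤ d o (r • o))
    (hpq : d o (r • o) ≤ d p q + 110 * b) : ∃ k : ℤ, 2 * d p (r ^ k • q) + 10 * b ≤ d p q := by
  obtain ⟨_, ⟨k, rfl⟩, hk⟩ := WellFounded.has_min (measure (fun x => d p x)).wf
    (Set.range fun k : ℤ => r ^ k • q) ⟨_, 0, rfl⟩
  have hmin : ∀ l : ℤ, d p (r ^ k • q) ≤ d p (r ^ l • q) := fun l => not_lt.1 (hk _ ⟨l, rfl⟩)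
  refine ⟨k, ?_⟩
  obtain ⟨ε, h1⟩ := line_step hd hinv hc hM hmid hy hp hq
  obtain ⟨ε', h2⟩ := line_step hd hinv hc hM hmid hy hp (hM q hq k)
  have m1 := hmin ε
  have m2 := hmin (ε' + k)
  rw [← mul_smul, ← zpow_add] at h2
  omega

end

/-- The family of translates of the coarse convex hull of a periodic sequence. -/
def lineSet {G V : Type*} [Group G] [MulAction G V] (d : V → V → ℕ) (r : G) (y : ℤ → V) :
    G ⧸ Subgroup.zpowers r → Set V :=
  fun c => {x | ∃ g : G, (g : G ⧸ Subgroup.zpowers r) = c ∧ Near d y 0 (g⁻¹ • x)}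

section
variable {G V : Type*} [Group G] [MulAction G V] {d : V → V → ℕ} {δ c m A' Δ : ℕ} {r : G} {o : V}
  {s : ℤ → G} (hd : IsGeod d) (hinv : ∀ (g : G) x y, d (g • x) (g • y) = d x y) (hy : Hyp d δ)
  (hsm : ∀ i, s (i + m) = r * s i)

include hsm in
theorem periodic_zpow (k i : ℤ) : s (i + m * k) = r ^ k * s i := by
  induction k using Int.induction_on with
  | zero => simp
  | succ k ih =>
    have e : i + m * ((k : ℤ) + 1) = i + m * k + m := by ring
    rw [e, hsm, ih, zpow_add, zpow_one, ← mul_assoc, ← zpow_one_add, ← zpow_add_one, add_comm]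
  | pred k ih =>
    have := hsm (i + m * (-(k : ℤ) - 1))
    have e : i + m * (-(k : ℤ) - 1) + m = i + m * -k := by ring
    rw [e, ih] at this
    rw [eq_inv_mul_iff_mul_eq.2 this.symm, zpow_sub_one]
    group

include hinv hsm in
theorem Near.zpow {C : ℕ} {x : V} (h : Near d (fun i => s i • o) C x) (k : ℤ) :
    Near d (fun i => s i • o) C (r ^ k • x) := by
  obtain ⟨i, j, hij, h⟩ := h
  refine ⟨i + m * k, j + m * k, by omega, ?_⟩
  simp only [periodic_zpow hsm, mul_smul, hinv]
  exact h

include hinv hsm in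
theorem mem_lineSet {g : G} {x : V} :
    x ∈ lineSet d r (fun i => s i • o) (g : G ⧸ Subgroup.zpowers r) ↔
      Near d (fun i => s i • o) 0 (g⁻¹ • x) := by
  refine ⟨?_, fun h => ⟨g, rfl, h⟩⟩
  rintro ⟨g', hg, h⟩
  obtain ⟨k, hk⟩ := Subgroup.mem_zpowers_iff.1 (QuotientGroup.eq.1 hg)
  have e : g⁻¹ = r ^ (-k) * g'⁻¹ := by rw [zpow_neg, hk]; group
  rw [e, mul_smul]
  exact h.zpow hinv hsm _

include hd hinv hy hsm in
theorem rotFam_line (hc : Chn d (fun i => s i • o) c) (hm : 1 ≤ m) (h0 : s 0 = 1)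
    (hl : ∀ i, c < d (s i • o) (s (i + 1) • o)) (hu : ∀ i, d (s i • o) (s (i + 1) • o) ≤ A')
    (hover : ∀ f : G, (∃ k₀ : ℤ, ∀ k, k₀ < k → k ≤ k₀ + 5 →
      Near d (fun i => s i • o) (60 * c + 100 * δ + 10) (f • s k • o)) → f ∈ Subgroup.zpowers r)
    (hΔ : 6 * A' + 40 * c + 60 * δ + 10 ≤ Δ)
    (hP : 500 * bgiConst δ (8 * c + 20 * δ + 2) Δ ≤ d o (r • o)) :
    RotFam G d (lineSet d r fun i => s i • o) δ (8 * c + 20 * δ + 2) Δ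
      (d o (r • o) - 4 * c - 100 * bgiConst δ (8 * c + 20 * δ + 2) Δ) (d o (r • o) - 4 * c) := by
  have hB := le_bgiConst δ (8 * c + 20 * δ + 2) Δ
  obtain ⟨B, hBe⟩ : ∃ B, B = bgiConst δ (8 * c + 20 * δ + 2) Δ := ⟨_, rfl⟩
  rw [← hBe] at hB hP ⊢
  have hz : ∀ n : ℤ, r ^ n • o = s (m * n) • o := fun n => by
    have := periodic_zpow hsm n 0
    rw [zero_add, h0, mul_one] at this
    rw [this]
  have hcr : Chn d (fun n : ℤ => r ^ n • o) c := fun i j k hij hjk => by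
    simp only [hz]
    exact hc _ _ _ (by nlinarith) (by nlinarith)
  have hM : ∀ p ∈ {x | Near d (fun i => s i • o) 0 x}, ∀ k : ℤ,
      r ^ k • p ∈ {x | Near d (fun i => s i • o) 0 x} := fun p hp k => Near.zpow hinv hsm hp k
  have hmid : ∀ p ∈ {x | Near d (fun i => s i • o) 0 x}, ∃ n₀ : ℕ, ∀ n : ℕ, n₀ ≤ n →
      d (r ^ (-n : ℤ) • o) p + d p (r ^ (n : ℤ) • o) ≤
        d (r ^ (-n : ℤ) • o) (r ^ (n : ℤ) • o) + 2 * c := by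
    intro p hp
    obtain ⟨i, j, hij, h⟩ := Near.far hd hc hp
    refine ⟨i.natAbs + j.natAbs, fun n hn => ?_⟩
    have hn' : (n : ℤ) ≤ m * n := by nlinarith
    rw [hz, hz]
    have := h (m * (-n)) (by rw [mul_neg]; omega) (m * n) (by omega)
    omega
  have hqc := qc_line hd hy hc
  have hsm' : ∀ (g : G) (c : G ⧸ Subgroup.zpowers r) x,
      g • x ∈ lineSet d r (fun i => s i • o) (g • c) ↔ x ∈ lineSet d r (fun i => s i • o) c := by
    intro g c x
    obtain ⟨g', rfl⟩ := QuotientGroup.mk_surjective c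
    have e : g • (g' : G ⧸ Subgroup.zpowers r) = ((g * g' : G) : G ⧸ Subgroup.zpowers r) := rfl
    rw [e, mem_lineSet hinv hsm, mem_lineSet hinv hsm, mul_inv_rev, mul_smul, inv_smul_smul]
  have hset : lineSet d r (fun i => s i • o) ((1 : G) : G ⧸ Subgroup.zpowers r) =
      {x | Near d (fun i => s i • o) 0 x} := by
    ext x
    rw [mem_lineSet hinv hsm, inv_one, one_smul]
    rfl
  have hstab : ∀ g g' : G, g • (g' : G ⧸ Subgroup.zpowers r) = (g' : G ⧸ Subgroup.zpowers r) →
      ∃ k : ℤ, g = g' * r ^ k * g'⁻¹ := by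
    intro g g' h
    have h : ((g * g' : G) : G ⧸ Subgroup.zpowers r) = g' := h
    obtain ⟨k, hk⟩ := Subgroup.mem_zpowers_iff.1 (QuotientGroup.eq.1 h.symm)
    exact ⟨k, by rw [hk]; group⟩
  refine ⟨hd, hy, hinv, ?_, ?_, hsm', ?_, ?_, ?_, ?_⟩
  · intro c'
    obtain ⟨g, rfl⟩ := QuotientGroup.mk_surjective c'
    have hmem : ∀ x, x ∈ {x | Near d (fun i => s i • o) 0 x} →
        g • x ∈ lineSet d r (fun i => s i • o) (g : G ⧸ Subgroup.zpowers r) := fun x hx => by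
      rw [mem_lineSet hinv hsm, inv_smul_smul]
      exact hx
    obtain ⟨x, hx⟩ := hqc.1
    refine ⟨⟨g • x, hmem x hx⟩, fun x p hp hmin q hq => ?_⟩
    rw [mem_lineSet hinv hsm] at hp hq
    have := hqc.2 (g⁻¹ • x) (g⁻¹ • p) hp (fun q hq => by
      have h1 := hmin (g • q) (hmem q hq)
      rwa [hinv, ← hinv g (g⁻¹ • _), smul_inv_smul]) (g⁻¹ • q) hq
    rwa [hinv, hinv, hinv] at this
  · intro c₁ c₂ hne u v p q hu₁ hv₁ hp hq
    obtain ⟨g, rfl⟩ := QuotientGroup.mk_surjective c₁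
    obtain ⟨g', rfl⟩ := QuotientGroup.mk_surjective c₂
    rw [mem_lineSet hinv hsm] at hu₁ hv₁
    by_contra hpq
    have hproj : ∀ u p, IsProj d (lineSet d r (fun i => s i • o) (g : G ⧸ Subgroup.zpowers r)) u p →
        IsProj d {x | Near d (fun i => s i • o) 0 x} (g⁻¹ • u) (g⁻¹ • p) := by
      refine fun u p h => ⟨(mem_lineSet hinv hsm).1 h.1, fun q hq => ?_⟩
      have h1 := h.2 (g • q) (by rw [mem_lineSet hinv hsm, inv_smul_smul]; exact hq)
      rwa [hinv, ← hinv g (g⁻¹ • _), smul_inv_smul]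
    have htr : ∀ C x, Near d (fun i => (g⁻¹ * g') • s i • o) C x ↔
        Near d (fun i => s i • o) C ((g'⁻¹ * g) • x) := by
      intro C x
      have e : ∀ i, d ((g⁻¹ * g') • s i • o) x = d (s i • o) ((g'⁻¹ * g) • x) := fun i => by
        rw [← hinv (g'⁻¹ * g)]
        congr 1
        rw [← mul_smul]
        group
        exact one_smul G _
      unfold Near
      simp only [e, hinv, hd.symm x]
      simp only [hd.symm ((g'⁻¹ * g) • x)]
    have hc2 : Chn d (fun i => (g⁻¹ * g') • s i • o) c := fun i j k hij hjk => by
      simp only [hinv]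
      exact hc i j k hij hjk
    have hmul : ∀ x : V, (g'⁻¹ * g) • g⁻¹ • x = g'⁻¹ • x := fun x => by
      rw [← mul_smul, mul_inv_cancel_right]
    obtain ⟨k₀, hk⟩ := overlap hd hy hc hc2 (A := A') (n := 5) hu (Chn.far hd hc hl)
      ((htr 0 (g⁻¹ • u)).2 (by rwa [hmul])) ((htr 0 (g⁻¹ • v)).2 (by rwa [hmul]))
      (hproj u p hp) (hproj v q hq) (by rw [hinv]; omega)
    exact hne (QuotientGroup.eq.2 (hover _ ⟨k₀, fun k h1 h2 => (htr _ _).1 (hk k h1 h2)⟩) :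
      (g' : G ⧸ Subgroup.zpowers r) = g).symm
  · intro g c' p hg hg1 hp
    obtain ⟨g', rfl⟩ := QuotientGroup.mk_surjective c'
    obtain ⟨k, rfl⟩ := hstab _ _ hg
    rw [mem_lineSet hinv hsm] at hp
    have hk : k ≠ 0 := by
      rintro rfl
      simp at hg1
    have := line_rot hd hinv hcr hmid (P := d o (r • o) - c) (fun k hk => by
      have := hcr 0 1 k (by omega) (by omega)
      simp only [zpow_zero, zpow_one, one_smul] at this
      omega) hp hk
    rw [mul_smul, mul_smul, ← hinv g'⁻¹ p, inv_smul_smul]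
    omega
  · intro c' p q hp hq hpq
    obtain ⟨g', rfl⟩ := QuotientGroup.mk_surjective c'
    rw [mem_lineSet hinv hsm] at hp hq
    rw [← hinv g'⁻¹ p q] at hpq
    obtain ⟨k, hk⟩ := line_tr hd hinv hcr hM hmid hy (b := B) hp hq (by omega) (by omega) hP
      (by omega)
    refine ⟨g' * r ^ k * g'⁻¹, ?_, ?_⟩
    · change ((g' * r ^ k * g'⁻¹ * g' : G) : G ⧸ Subgroup.zpowers r) = g'
      rw [inv_mul_cancel_right]
      exact (QuotientGroup.eq.2 (by
        rw [inv_mul_cancel_left]; exact Subgroup.zpow_mem_zpowers r k)).symm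
    · rw [mul_smul, mul_smul, ← hinv g'⁻¹ p, inv_smul_smul, ← hinv g'⁻¹ p q]
      omega
  · omega
  · omega

end

theorem exists_periodic {G : Type*} [Group G] {m : ℕ} (hm : 1 ≤ m) (x : ℕ → G) :
    ∃ s : ℤ → G, s 0 = 1 ∧ (∀ i, s (i + m) = s m * s i) ∧
      ∀ i, s (i + 1) = s i * x (i % m).toNat := by
  have hm' : (0 : ℤ) < m := by omega
  obtain ⟨pp, h0, h1⟩ : ∃ pp : ℕ → G, pp 0 = 1 ∧ ∀ n, pp (n + 1) = pp n * x n :=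
    ⟨fun n => Nat.rec 1 (fun n g => g * x n) n, rfl, fun n => rfl⟩
  have hs : ∀ (q : ℤ) (n : ℕ), n < m → ((q * m + n) / (m : ℤ) = q ∧
      (q * m + n) % (m : ℤ) = n) := fun q n hn => by
    constructor
    · rw [add_comm, Int.add_mul_ediv_right _ _ hm'.ne', Int.ediv_eq_zero_of_lt] <;> omega
    · rw [add_comm, Int.add_mul_emod_self_right, Int.emod_eq_of_lt] <;> omega
  have hrep : ∀ i : ℤ, ∃ (q : ℤ) (n : ℕ), n < m ∧ i = q * m + n := fun i =>
    ⟨i / m, (i % m).toNat, by have := Int.emod_lt_of_pos i hm'; omega, by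
      rw [Int.toNat_of_nonneg (Int.emod_nonneg _ hm'.ne'), mul_comm, Int.mul_ediv_add_emod]⟩
  obtain ⟨s, hsd⟩ : ∃ s : ℤ → G, ∀ i, s i = pp m ^ (i / m) * pp (i % m).toNat := ⟨_, fun _ => rfl⟩
  have hs' : ∀ (q : ℤ) (n : ℕ), n < m → s (q * m + n) = pp m ^ q * pp n := fun q n hn => by
    rw [hsd, (hs q n hn).1, (hs q n hn).2, Int.toNat_natCast]
  have hsm : s m = pp m := by
    have := hs' 1 0 hm
    simpa [h0] using this
  refine ⟨s, by simpa [h0] using hs' 0 0 hm, fun i => ?_, fun i => ?_⟩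
  · obtain ⟨q, n, hn, rfl⟩ := hrep i
    have e : q * m + n + m = (1 + q) * m + n := by ring
    rw [e, hs' _ _ hn, hs' _ _ hn, hsm, zpow_one_add, mul_assoc]
  · obtain ⟨q, n, hn, rfl⟩ := hrep i
    rw [(hs q n hn).2, Int.toNat_natCast, hs' _ _ hn, mul_assoc, ← h1]
    rcases Nat.lt_or_ge (n + 1) m with h | h
    · rw [← hs' _ _ h]
      congr 1
      push_cast
      ring
    · have e : q * (m : ℤ) + n + 1 = (q + 1) * m + (0 : ℕ) := by
        obtain rfl : m = n + 1 := by omega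
        push_cast
        ring
      rw [e, hs' _ _ hm, h0, mul_one, zpow_add_one]
      congr
      omega

theorem Chn.le_dist {V : Type*} {d : V → V → ℕ} {y : ℤ → V} {c A : ℕ} (hc : Chn d y c)
    (h : ∀ i, A ≤ d (y i) (y (i + 1))) (m : ℕ) : m * A ≤ d (y 0) (y m) + m * c := by
  induction m with
  | zero => simp
  | succ m ih =>
    have := hc 0 m (m + 1) (by omega) (by omega)
    have := h m
    push_cast
    nlinarith

section
variable {G V : Type*} [Group G] [MulAction G V] {d : V → V → ℕ} {δ C₀ : ℕ} {o : V}
  (hd : IsGeod d) (hinv : ∀ (g : G) x y, d (g • x) (g • y) = d x y) (hy : Hyp d δ)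

include hd hinv hy in
theorem exists_rotFam (hlox : ∀ g : G, (∀ v : V, g • v ≠ v) → Lox d g)
    (hfree : ∀ v w : V, v ≠ w → ∀ g : G, g • v = v → g • w = w → g = 1)
    {F h z : G} (hF : QG d F o C₀) (hh : h ∉ Elem F) (hz : z ∉ Elem F) :
    ∃ C, ∀ M₀, ∃ (r w : G) (y : ℤ → V) (Δ La Lr : ℕ), M₀ ≤ Δ ∧ w ∈ Subgroup.closure {F, h} ∧
      r = w * z ∧ RotFam G d (lineSet d r y) δ C Δ La Lr := by
  obtain ⟨c, D, hD, hchn⟩ := hF.chn_line hd hinv hy (T := {h, z}) (Set.toFinite _)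
    (by rintro t (rfl | rfl) <;> assumption)
  obtain ⟨R, K₁, hmatch⟩ := hF.corner_match hd hinv hy D c (60 * c + 100 * δ + 10)
  obtain ⟨K₂, hrig⟩ := hF.rigid hd hinv hy hlox hfree R D
  refine ⟨8 * c + 20 * δ + 2, fun M₀ => ?_⟩
  obtain ⟨b, hb⟩ : ∃ b : ℕ → ℕ, ∀ n, b n = d o (F ^ (n : ℤ) • o) := ⟨_, fun _ => rfl⟩
  have hb' : ∀ n, b n = d o (F ^ n • o) := fun n => by rw [hb, zpow_natCast]
  have hfar : ∀ m, ∃ K, ∀ n, K ≤ n → m < b n := fun m => by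
    obtain ⟨K, hK⟩ := hF.lox.zpow_far hd hinv o m
    refine ⟨K, fun n hn => ?_⟩
    have := hK 0 n (by omega)
    rwa [zpow_zero, one_smul, ← hb] at this
  have hsup : ∀ i j, b i + b j ≤ b (i + j) + C₀ := fun i j => by
    have := hF.dist_pow hinv (Nat.le_add_right i j)
    simpa [hb'] using this
  have hsub : ∀ i j, b (i + j) ≤ b i + b j := fun i j => by
    have := hd.tri o (F ^ i • o) (F ^ (i + j) • o)
    simp only [hb', pow_add, mul_smul]
    rwa [pow_add, mul_smul, hinv] at this
  have hlin : ∀ n, b n ≤ n * b 1 := fun n => by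
    induction n with
    | zero => simp [hb, hd.self]
    | succ n ih => have := hsub n 1; nlinarith
  obtain ⟨κ, hκ⟩ := hfar (C₀ + 2 * D + 2 * R + 1)
  obtain ⟨W, hW⟩ : ∃ W, W = 6 * (morseConst δ (8 * c + 20 * δ + 2) +
    2 * (8 * c + 20 * δ + 2) + 2 * δ) + 13 := ⟨_, rfl⟩
  obtain ⟨m, hm⟩ : ∃ m, m = 8000 * (W + 1) := ⟨_, rfl⟩
  obtain ⟨E, hE⟩ : ∃ E, E = κ * m * b 1 := ⟨_, rfl⟩
  obtain ⟨N₀, hN₀⟩ := hfar (1000 * (C₀ + D + R + c + δ + E + M₀ + 10))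
  obtain ⟨N, hN⟩ : ∃ N, N = N₀ + K₁ + K₂ := ⟨_, rfl⟩
  have hbN := hN₀ N (by omega)
  obtain ⟨s, hs0, hsm, hsx⟩ := exists_periodic (m := m) (by omega)
    (fun n => F ^ ((N + κ * n : ℕ) : ℤ) * if n = m - 1 then z else h)
  obtain ⟨a, ha⟩ : ∃ a : ℤ → ℕ, ∀ i, a i = N + κ * (i % m).toNat := ⟨_, fun _ => rfl⟩
  obtain ⟨t, ht⟩ : ∃ t : ℤ → G, ∀ i, t i = if (i % m).toNat = m - 1 then z else h :=
    ⟨_, fun _ => rfl⟩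
  have hs : ∀ i, s (i + 1) = s i * F ^ (a i : ℤ) * t i := fun i => by
    rw [hsx, ha, ht, mul_assoc]
  have htT : ∀ i, t i ∈ ({h, z} : Set G) := fun i => by
    rw [ht]
    split_ifs <;> simp
  have htE : ∀ i, t i ∉ Elem F := fun i => by
    rcases htT i with h | h <;> rw [h] <;> assumption
  have htD : ∀ i, d o (t i • o) ≤ D := fun i => hD _ (htT i)
  have hlow : ∀ i, b N ≤ b (a i) + C₀ := fun i => by
    have := hsup N (κ * (i % m).toNat)
    rw [ha]
    omega
  have hup : ∀ i, b (a i) ≤ b N + E := fun i => by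
    have h1 := hsub N (κ * (i % m).toNat)
    have h2 := hlin (κ * (i % m).toNat)
    have h3 : (i % m).toNat ≤ m := by
      have := Int.emod_lt_of_pos i (b := (m : ℤ)) (by omega)
      omega
    have h4 : κ * (i % m).toNat * b 1 ≤ E := by rw [hE]; gcongr
    rw [ha]
    omega
  have hlen : ∀ i, d (s i • o) (s (i + 1) • o) ≤ b (a i) + D ∧
      b (a i) ≤ d (s i • o) (s (i + 1) • o) + D := fun i => by
    rw [hs, hb]
    exact block_len hd hinv (htD i) (s i) (a i)
  have hchain : Chn d (fun i => s i • o) c := hchn t a s hs htT fun i => by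
    rw [← hb]
    have := hlow i
    omega
  have hl : ∀ i, b N - C₀ - D ≤ d (s i • o) (s (i + 1) • o) := fun i => by
    have := hlow i
    have := hlen i
    omega
  have hu : ∀ i, d (s i • o) (s (i + 1) • o) ≤ b N + E + D := fun i => by
    have := hup i
    have := hlen i
    omega
  have haK : ∀ i, K₁ + K₂ ≤ a i := fun i => by rw [ha]; omega
  have hsep₁ : ∀ i j : ℤ, (i % m).toNat < (j % m).toNat →
      d (s i • o) (s (i + 1) • o) + 2 * R < d (s j • o) (s (j + 1) • o) := by
    intro i j hij
    obtain ⟨n, hn⟩ := Nat.exists_eq_add_of_lt hij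
    have h1 := hsup (a i) (κ * (n + 1))
    have h2 : a i + κ * (n + 1) = a j := by rw [ha, ha, hn]; ring
    rw [h2] at h1
    have h3 := hκ (κ * (n + 1)) (Nat.le_mul_of_pos_right _ (by omega))
    have := hlen i
    have := hlen j
    omega
  have hsep : ∀ i j, d (s i • o) (s (i + 1) • o) ≤ d (s j • o) (s (j + 1) • o) + 2 * R →
      d (s j • o) (s (j + 1) • o) ≤ d (s i • o) (s (i + 1) • o) + 2 * R → (m : ℤ) ∣ i - j := by
    intro i j h1 h2
    have h3 := fun h => hsep₁ i j h
    have h4 := fun h => hsep₁ j i h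
    have h5 := Int.emod_nonneg i (b := (m : ℤ)) (by omega)
    have h6 := Int.emod_nonneg j (b := (m : ℤ)) (by omega)
    have h7 : i % m = j % m := by omega
    exact Int.ModEq.dvd h7.symm
  have hover : ∀ f : G, (∃ k₀ : ℤ, ∀ k, k₀ < k → k ≤ k₀ + 5 →
      Near d (fun i => s i • o) (60 * c + 100 * δ + 10) (f • s k • o)) →
      f ∈ Subgroup.zpowers (s m) := by
    rintro f ⟨k₀, hk₀⟩
    have hmt := hmatch t a s hs htE htD hchain (fun i => by have := haK i; omega) f
    obtain ⟨σ, hσ⟩ := hmt (k₀ + 1) (hk₀ _ (by omega) (by omega)) (hk₀ _ (by omega) (by omega))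
      (hk₀ _ (by omega) (by omega))
    obtain ⟨τ, hτ⟩ := hmt (k₀ + 1 + 1) (hk₀ _ (by omega) (by omega)) (hk₀ _ (by omega) (by omega))
      (hk₀ _ (by omega) (by omega))
    obtain ⟨υ, hυ⟩ := hmt (k₀ + 1 + 2) (hk₀ _ (by omega) (by omega)) (hk₀ _ (by omega) (by omega))
      (hk₀ _ (by omega) (by omega))
    have e2 : k₀ + 1 + 2 + 1 = k₀ + 1 + 1 + 2 := by ring
    rw [e2] at hυ
    obtain ⟨rfl, rfl, q, hq⟩ := index_match (y := fun i => s i • o) (y' := fun i => f • s i • o)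
      hd hchain hl hu (fun k => hinv _ _ _) (R := R) (m := m) (by omega) (by omega) (by omega)
      hsep hσ hτ hυ
    have hf : ∀ j : ℤ, d (f • s (k₀ + 1 + 1 + j) • o) (s (σ + j) • o) ≤ R →
        d ((s m ^ (-q) * f) • s (k₀ + 1 + 1 + j) • o) (s (k₀ + 1 + 1 + j) • o) ≤ R := fun j hj => by
      have e : σ + j = k₀ + 1 + 1 + j + m * q := by omega
      rw [e, periodic_zpow hsm, mul_smul] at hj
      rwa [mul_smul, ← hinv (s m ^ q), ← mul_smul (s m ^ q), ← zpow_add, add_neg_cancel,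
        zpow_zero, one_smul]
    have h0 := hf 0 (by simpa using hσ)
    have h1 := hf 1 hτ
    have h2 := hf 2 hυ
    rw [add_zero] at h0
    have e3 : k₀ + 1 + 1 + 2 = k₀ + 1 + 1 + 1 + 1 := by ring
    rw [e3, hs (k₀ + 1 + 1 + 1)] at h2
    rw [hs] at h1 h2
    have := hrig _ _ _ _ _ _ (htE _) (htD _) (htD _) (by have := haK (k₀ + 1 + 1); omega)
      (by have := haK (k₀ + 1 + 1 + 1); omega) h0 h1 h2
    rw [zpow_neg, inv_mul_eq_one] at this
    exact this ▸ Subgroup.zpow_mem_zpowers _ _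
  have hmem : ∀ n : ℕ, n ≤ m - 1 → s n ∈ Subgroup.closure {F, h} := by
    intro n
    induction n with
    | zero => intro; rw [Nat.cast_zero, hs0]; exact one_mem _
    | succ n ih =>
      intro hn
      have hmod : ((n : ℤ) % m).toNat = n := by
        rw [Int.emod_eq_of_lt] <;> omega
      rw [Nat.cast_succ, hs, ht, hmod, if_neg (by omega)]
      exact mul_mem (mul_mem (ih (by omega)) (zpow_mem (Subgroup.subset_closure (by simp)) _))
        (Subgroup.subset_closure (by simp))
  have hbig := hchain.le_dist hl m
  rw [hs0, one_smul] at hbig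
  refine ⟨s m, s (m - 1 : ℕ) * F ^ (a (m - 1 : ℕ) : ℤ), fun i => s i • o,
    6 * (b N + E + D) + 40 * c + 60 * δ + 10, _, _, by omega,
    mul_mem (hmem _ le_rfl) (zpow_mem (Subgroup.subset_closure (by simp)) _), ?_,
    rotFam_line hd hinv hy hsm hchain (by omega) hs0 (fun i => by have := hl i; omega) hu hover
      le_rfl ?_⟩
  · have hmod : (((m - 1 : ℕ) : ℤ) % m).toNat = m - 1 := by
      rw [Int.emod_eq_of_lt] <;> omega
    have := hs (m - 1 : ℕ)
    rw [ht, hmod, if_pos rfl] at this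
    rw [← this]
    congr 1
    omega
  · unfold bgiConst
    rw [← hW]
    obtain ⟨A, hA⟩ : ∃ A, A = b N - C₀ - D := ⟨_, rfl⟩
    rw [← hA] at hbig
    have h1 : 6 * (b N + E + D) + 40 * c + 60 * δ + 10 + 2 * (8 * c + 20 * δ + 2) + δ + 1 ≤
      7 * A := by omega
    have h2 : 2 * (2 * (8 * c + 20 * δ + 2) + δ) ≤ A := by omega
    have h3 : 2 * c ≤ A := by omega
    have h4 : W * (6 * (b N + E + D) + 40 * c + 60 * δ + 10 + 2 * (8 * c + 20 * δ + 2) + δ + 1) ≤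
      W * (7 * A) := by gcongr
    have h5 : m * (2 * c) ≤ m * A := by gcongr
    have h6 : m * A = 8000 * (W * A) + 8000 * A := by rw [hm]; ring
    have h7 : W * (7 * A) = 7 * (W * A) := by ring
    have h8 : m * (2 * c) = 2 * (m * c) := by ring
    omega

end

section
variable {G V : Type*} [Group G] [MulAction G V] {d : V → V → ℕ} {δ C₀ C : ℕ} {o : V}

theorem QG.an_le {F : G} (h : QG d F o C₀) : ∃ M, ∀ (Y : Type _) [MulAction G Y] (L : Y → Set V)
    (Δ La Lr : ℕ) (hR : RotFam G d L δ C Δ La Lr), M ≤ Δ →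
      ∀ (k : ℕ) c, hR.an c o (F ^ k • o) ≤ 38 * bgiConst δ C Δ := by
  obtain ⟨D, hD⟩ : ∃ D, D = d o (F • o) := ⟨_, rfl⟩
  obtain ⟨R, hR'⟩ : ∃ R, R = 2 * C + δ + C₀ + δ + D := ⟨_, rfl⟩
  refine ⟨4 * (2 * R + D) + 1, fun Y _ L Δ La Lr hR hΔ k c => ?_⟩
  have hB := le_bgiConst δ C Δ
  have hLr := hR.le_Lr
  have hBL := hR.B_le
  have hd := hR.hd
  by_contra! hlt
  obtain ⟨p, hp⟩ := exists_proj d (hR.qc c).1 o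
  obtain ⟨q, hq⟩ := exists_proj d (hR.qc c).1 (F ^ k • o)
  have h1 := hR.an_le_dist hp hq
  have h2 := ((hR.qc c).proj_proj hd hR.hy hp hq).resolve_right (by omega)
  have step : ∀ i : ℤ, d (F ^ i • o) (F ^ (i + 1) • o) = D := fun i => by
    rw [zpow_add, mul_smul, hR.inv, zpow_one, hD]
  have hnear : ∀ y, d o y + d y (F ^ k • o) ≤ d o (F ^ k • o) + (2 * C + δ) →
      d y (F • y) ≤ 2 * R + D := by
    intro y hyy
    obtain ⟨i, -, -, hi⟩ := near_seq hd hR.hy (x := fun i : ℤ => F ^ i • o) (i := 0) (j := k)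
      (c := 2 * C + δ) (c' := C₀) (b := D) (y := y) (by omega)
      (fun i h1 h2 => h.chain _ _ _ h1 h2) (fun i _ _ => (step i).le) (by simpa using hyy)
    have e : F ^ (i + 1) • o = F • F ^ i • o := by rw [zpow_add_one, (Commute.zpow_self F i).eq, mul_smul]
    have h3 := step i
    have h4 := hR.inv F (F ^ i • o) y
    rw [e] at h3
    have h5 := hd.tri y (F ^ i • o) (F • y)
    have h6 := hd.tri (F ^ i • o) (F • F ^ i • o) (F • y)
    have := hd.symm y (F ^ i • o)
    omega
  have t1 := hd.tri o p q
  have t2 := hd.tri p q (F ^ k • o)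
  have hp1 := hnear p (by omega)
  have hq1 := hnear q (by have := hd.tri o p q; omega)
  have hc : F • c = c := by
    by_contra hc
    obtain ⟨p', hp'⟩ := exists_proj d (hR.qc c).1 (F • p)
    obtain ⟨q', hq'⟩ := exists_proj d (hR.qc c).1 (F • q)
    have h3 := hR.ov c (F • c) (Ne.symm hc) (F • p) (F • q) p' q' ((hR.Lsmul _ _ _).2 hp.1)
      ((hR.Lsmul _ _ _).2 hq.1) hp' hq'
    have h4 := hp'.2 p hp.1
    have h5 := hq'.2 q hq.1
    have := hd.symm p (F • p)
    have := hd.symm (F • q) q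
    have := hd.tri p (F • p) p'
    have := hd.tri q' (F • q) q
    have := hd.symm q' (F • q)
    have := hd.tri p p' q
    have := hd.tri p' q' q
    omega
  have := hR.rot F c p hc (by rintro rfl; exact h.lox.pow_ne_one hd one_ne_zero (one_pow 1)) hp.1
  omega

theorem exists_track (hd : IsGeod d) (hinv : ∀ (g : G) x y, d (g • x) (g • y) = d x y)
    (hy : Hyp d δ) {g : G} (h : Lox d g) (hW : WPD d g) (C : ℕ) (o : V) :
    ∃ M, ∀ (Y : Type _) [MulAction G Y] (L : Y → Set V)
      (Δ La Lr : ℕ) (hR : RotFam G d L δ C Δ La Lr), M ≤ Δ →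
      ∀ (k : ℕ) c, hR.an c o (g ^ k • o) ≤ 40 * bgiConst δ C Δ := by
  obtain ⟨n, hn, C₀, hF⟩ := exists_qg hd hinv hy h hW o
  obtain ⟨M, hM⟩ := hF.an_le (δ := δ) (C := C)
  refine ⟨M + n * d o (g • o), fun Y _ L Δ La Lr hR hΔ k c => ?_⟩
  have h1 := hM Y L Δ La Lr hR (by omega) (k / n) c
  have h2 := hR.an_tri c o ((g ^ n) ^ (k / n) • o) (g ^ k • o)
  have h3 := hR.an_le c ((g ^ n) ^ (k / n) • o) (g ^ k • o)
  have h4 : d ((g ^ n) ^ (k / n) • o) (g ^ k • o) ≤ n * d o (g • o) := by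
    have e : g ^ k = (g ^ n) ^ (k / n) * g ^ (k % n) := by
      rw [← pow_mul, ← pow_add, Nat.div_add_mod]
    rw [e, mul_smul, hinv]
    exact (dist_pow_le hd hinv g o _).trans
      (Nat.mul_le_mul_right _ (Nat.mod_lt _ (by omega)).le)
  have := le_bgiConst δ C Δ
  omega

end

/-- An action on a hyperbolic space whose elliptic subgroups are the conjugates of the given
factors. -/
structure Good {J : Type} {H : J → Type} [∀ j, Group (H j)] {G V : Type} [Group G] [MulAction G V]
    (d : V → V → ℕ) (δ : ℕ) (φ : ∀ j, H j →* G) (o : J → V) : Prop where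
  hd : IsGeod d
  hy : Hyp d δ
  inv : ∀ (g : G) (x y : V), d (g • x) (g • y) = d x y
  inj : ∀ j, Function.Injective (φ j)
  stab : ∀ j g, g • o j = o j ↔ g ∈ (φ j).range
  orb : ∀ (g : G) (v : V), g • v = v → g ≠ 1 → ∃ j, ∃ x : G, v = x • o j
  ne : ∀ j j' (x : G), x • o j = o j' → j = j'
  inter : ∀ (g : G) (v w : V), g • v = v → g • w = w → g ≠ 1 → v = w
  ell : ∀ (u v : G) (p q s : V), u ≠ 1 → v ≠ 1 → u • p = p → v • q = q → (u * v) • s = s → p = q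
  lox : ∀ g : G, (∀ v : V, g • v ≠ v) → Lox d g
  wpd : ∀ g : G, Lox d g → WPD d g

section
variable {J : Type} {H : J → Type} [∀ j, Group (H j)] {G V : Type} [Group G] [MulAction G V]
  {d : V → V → ℕ} {δ : ℕ} {φ : ∀ j, H j →* G} {o : J → V}

theorem Good.of_rotFam (hG : Good d δ φ o) [Nonempty V] {Y : Type} [MulAction G Y] {L : Y → Set V}
    {C Δ La Lr : ℕ} (hR : RotFam G d L δ C Δ La Lr) :
    Good (quotDist (rotSubgroup G Y) (coneDist d L)) (coneConst δ C)
      (fun j => (QuotientGroup.mk' (rotSubgroup G Y)).comp (φ j)) (fun j => OrbQ.mk _ (o j)) where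
  hd := isGeod_quot hR.isGeod_D hR.coneDist_smul
  hy := hR.hyp_quotient
  inv := quotDist_smul hR.coneDist_smul
  inj j := by
    rw [injective_iff_map_eq_one]
    intro a ha
    have h1 : φ j a ∈ rotSubgroup G Y := (QuotientGroup.eq_one_iff _).1 ha
    exact (injective_iff_map_eq_one _).1 (hG.inj j) a
      (hR.free h1 ((hG.stab j _).2 ⟨a, rfl⟩))
  stab j g := by
    obtain ⟨g, rfl⟩ := QuotientGroup.mk_surjective g
    constructor
    · intro h
      obtain ⟨n, hn, hn'⟩ := OrbQ.mk_eq.1 h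
      have : (n⁻¹ * g) • o j = o j := by rw [mul_smul, ← hn', inv_smul_smul]
      obtain ⟨a, ha⟩ := (hG.stab j _).1 this
      refine ⟨a, ?_⟩
      change ((φ j a : G) : G ⧸ rotSubgroup G Y) = g
      rw [ha, QuotientGroup.mk_mul, (QuotientGroup.eq_one_iff _).2 (inv_mem hn), one_mul]
    · rintro ⟨a, ha⟩
      rw [← ha]
      change OrbQ.mk _ (φ j a • o j) = _
      rw [(hG.stab j _).2 ⟨a, rfl⟩]
  orb g v hv hg := by
    obtain ⟨x, rfl⟩ := OrbQ.exists_rep v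
    obtain ⟨g, rfl, hgx⟩ := OrbQ.lift_fix hv
    obtain ⟨j, y, rfl⟩ := hG.orb g x hgx (by rintro rfl; exact hg rfl)
    exact ⟨j, y, rfl⟩
  ne j j' x h := by
    obtain ⟨x, rfl⟩ := QuotientGroup.mk_surjective x
    obtain ⟨n, -, hn⟩ := OrbQ.mk_eq.1 h
    exact hG.ne _ _ (n⁻¹ * x) (by rw [mul_smul, ← hn, inv_smul_smul])
  inter g v w := hR.stab_inter hG.inter g v w
  ell := hR.elliptic_mul hG.inter hG.ell
  lox := hR.lox_quotient hG.lox
  wpd := hR.wpd_quotient hG.lox hG.wpd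

theorem Good.exists_quotient (hG : Good d δ φ o) {u v f h : G}
    (hf : f ∈ Subgroup.closure {u, v}) (hh : h ∈ Subgroup.closure {u, v}) (hfl : Lox d f)
    (hhf : h ∉ Elem f) (x : G) {T : Set G} (hT : T.Finite) :
    ∃ (N : Subgroup G) (_ : N.Normal) (d' : OrbQ N V → OrbQ N V → ℕ) (δ' : ℕ),
      Good d' δ' (fun j => (QuotientGroup.mk' N).comp (φ j)) (fun j => OrbQ.mk N (o j)) ∧
      (x : G ⧸ N) ∈ Subgroup.closure {(u : G ⧸ N), (v : G ⧸ N)} ∧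
      ∀ g ∈ T, Lox d g → Lox d' (g : G ⧸ N) ∧
        Elem (g : G ⧸ N) ⊆ (fun h : G => (h : G ⧸ N)) '' Elem g := by
  obtain ⟨p, -⟩ := id hfl
  have : Nonempty V := ⟨p⟩
  obtain ⟨n, hn, C₀, hF⟩ := exists_qg hG.hd hG.inv hG.hy hfl (hG.wpd f hfl) p
  have hhF : h ∉ Elem (f ^ n) := fun h' => hhf (Elem.of_pow hn h')
  obtain ⟨z, hz, y, hy, hzy⟩ : ∃ z, z ∉ Elem (f ^ n) ∧
      ∃ y ∈ Subgroup.closure {u, v}, x = z⁻¹ * y := by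
    by_cases hx : x⁻¹ ∈ Elem (f ^ n)
    · refine ⟨h * x⁻¹, fun h' => hhF ?_, h, hh, by group⟩
      simpa using Elem.mul h' (Elem.inv hx)
    · exact ⟨x⁻¹, hx, 1, one_mem _, by group⟩
  obtain ⟨C, hC⟩ := exists_rotFam hG.hd hG.inv hG.hy hG.lox
    (fun v w hvw g hv hw => by_contra fun hg => hvw (hG.inter g v w hv hw hg)) hF hhF hz
  choose! M hM using fun (g : G) (hg : Lox d g) =>
    exists_track hG.hd hG.inv hG.hy hg (hG.wpd g hg) C p
  obtain ⟨M₀, hM₀⟩ : ∃ M₀, ∀ g ∈ T, M g ≤ M₀ := by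
    obtain ⟨M₀, h⟩ := (hT.image M).bddAbove
    exact ⟨M₀, fun g hg => h ⟨g, hg, rfl⟩⟩
  obtain ⟨r, w, y', Δ, La, Lr, hΔ, hw, hr, hR⟩ := hC M₀
  refine ⟨rotSubgroup G _, inferInstance, _, _, hG.of_rotFam hR, ?_, fun g hg hgl => ?_⟩
  · have hrN : r ∈ rotSubgroup G (G ⧸ Subgroup.zpowers r) :=
      mem_rotSubgroup (c := ((1 : G) : G ⧸ Subgroup.zpowers r)) (by
        change ((r * 1 : G) : G ⧸ Subgroup.zpowers r) = _
        rw [mul_one]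
        exact QuotientGroup.eq.2 (by simp))
    set N := rotSubgroup G (G ⧸ Subgroup.zpowers r)
    have key : ∀ a ∈ Subgroup.closure {u, v},
        (a : G ⧸ N) ∈ Subgroup.closure {(u : G ⧸ N), (v : G ⧸ N)} := fun a ha => by
      have := Subgroup.mem_map_of_mem (QuotientGroup.mk' N) ha
      rwa [MonoidHom.map_closure, Set.image_pair] at this
    have hw' : w ∈ Subgroup.closure {u, v} := by
      refine (Subgroup.closure_le _).2 ?_ hw
      rintro _ (rfl | rfl)
      · exact pow_mem hf n
      · exact hh
    have h1 : ((w * z : G) : G ⧸ N) = 1 := hr ▸ (QuotientGroup.eq_one_iff r).2 hrN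
    have h2 : (x : G ⧸ N) = ((w * y : G) : G ⧸ N) := by
      rw [QuotientGroup.mk_mul] at h1
      rw [hzy, QuotientGroup.mk_mul, QuotientGroup.mk_mul, QuotientGroup.mk_inv,
        eq_inv_of_mul_eq_one_left h1]
    rw [h2]
    exact key _ (mul_mem hw' hy)
  · have hLr := hR.le_Lr
    have hLa := hR.B_le
    have := hM g hgl _ _ _ _ _ hR ((hM₀ g hg).trans hΔ)
    exact ⟨hR.lox_track hgl this (by omega),
      hR.elem_track hgl (wstar_of_wpd hG.hd hG.inv hG.hy hgl (hG.wpd g hgl)) this⟩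

end

section
variable {V : Type*} (par : V → V) (lev : V → ℕ)

/-- The ancestor of given level in a rooted tree. -/
def anc (n : ℕ) (v : V) : V := par^[lev v - n] v

/-- The points have a common ancestor of level `n`. -/
def SameAnc (x y : V) (n : ℕ) : Prop :=
  n ≤ lev x ∧ n ≤ lev y ∧ anc par lev n x = anc par lev n y

open Classical in
/-- The level of the last common ancestor. -/
noncomputable def meet (x y : V) : ℕ :=
  Nat.findGreatest (SameAnc par lev x y) (lev x)

/-- The distance in a rooted tree. -/
noncomputable def treeDist (x y : V) : ℕ := lev x + lev y - 2 * meet par lev x y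

variable {par lev} (hl : ∀ v, lev (par v) = lev v - 1) (h0 : ∀ v w, lev v = 0 → lev w = 0 → v = w)
include hl

theorem lev_iterate (k : ℕ) (v : V) : lev (par^[k] v) = lev v - k := by
  induction k with
  | zero => simp
  | succ k ih => rw [Function.iterate_succ_apply', hl, ih]; omega

theorem lev_anc {n : ℕ} {v : V} (h : n ≤ lev v) : lev (anc par lev n v) = n := by
  rw [anc, lev_iterate hl]; omega

theorem anc_anc {m n : ℕ} {v : V} (hm : m ≤ n) (h : n ≤ lev v) :
    anc par lev m (anc par lev n v) = anc par lev m v := by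
  rw [anc, lev_anc hl h, anc, ← Function.iterate_add_apply, anc]
  congr 2; omega

include h0

theorem meet_spec (x y : V) : meet par lev x y ≤ lev x ∧ meet par lev x y ≤ lev y ∧
    anc par lev (meet par lev x y) x = anc par lev (meet par lev x y) y := by
  classical
  unfold meet
  exact Nat.findGreatest_spec (P := SameAnc par lev x y) (m := 0) (Nat.zero_le _)
    ⟨Nat.zero_le _, Nat.zero_le _, h0 _ _ (lev_anc hl (Nat.zero_le _)) (lev_anc hl (Nat.zero_le _))⟩

omit hl h0 in
theorem le_meet {x y : V} {n : ℕ} (h1 : n ≤ lev x) (h2 : n ≤ lev y)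
    (h3 : anc par lev n x = anc par lev n y) : n ≤ meet par lev x y := by
  classical
  exact Nat.le_findGreatest (P := SameAnc par lev x y) h1 ⟨h1, h2, h3⟩

theorem anc_eq {x y : V} {n : ℕ} (h : n ≤ meet par lev x y) :
    anc par lev n x = anc par lev n y := by
  obtain ⟨h1, h2, h3⟩ := meet_spec hl h0 x y
  rw [← anc_anc hl h h1, h3, anc_anc hl h h2]

theorem meet_comm (x y : V) : meet par lev x y = meet par lev y x := by
  have key : ∀ x y, meet par lev x y ≤ meet par lev y x := fun x y => by
    obtain ⟨h1, h2, h3⟩ := meet_spec hl h0 x y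
    exact le_meet h2 h1 h3.symm
  exact le_antisymm (key x y) (key y x)

theorem meet_trans (x y z : V) :
    meet par lev x y ≤ meet par lev x z ∨ meet par lev y z ≤ meet par lev x z := by
  obtain ⟨h1, h2, -⟩ := meet_spec hl h0 x y
  obtain ⟨h3, h4, -⟩ := meet_spec hl h0 y z
  rcases le_total (meet par lev x y) (meet par lev y z) with h | h
  · exact Or.inl (le_meet h1 (h.trans h4) ((anc_eq hl h0 le_rfl).trans (anc_eq hl h0 h)))
  · exact Or.inr (le_meet (h.trans h1) h4 ((anc_eq hl h0 h).trans (anc_eq hl h0 le_rfl)))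

theorem meet_anc {x y : V} {n : ℕ} (hn : n ≤ lev x) (h : meet par lev x y ≤ n) :
    meet par lev (anc par lev n x) y = meet par lev x y := by
  obtain ⟨h1, h2, h3⟩ := meet_spec hl h0 x y
  obtain ⟨h4, h5, h6⟩ := meet_spec hl h0 (anc par lev n x) y
  rw [lev_anc hl hn] at h4
  apply le_antisymm
  · exact le_meet (h4.trans hn) h5 (by rw [← h6, anc_anc hl h4 hn])
  · exact le_meet (by rwa [lev_anc hl hn]) h2 (by rw [anc_anc hl h hn, h3])

omit h0 in
theorem meet_anc_self {x : V} {n : ℕ} (hn : n ≤ lev x) :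
    n ≤ meet par lev x (anc par lev n x) :=
  le_meet hn (lev_anc hl hn).ge (anc_anc hl le_rfl hn).symm

theorem hyp_treeDist : Hyp (treeDist par lev) 0 := by
  intro x y z w
  have hs := meet_spec hl h0
  have e1 := hs x y
  have e2 := hs x z
  have e3 := hs x w
  have e4 := hs y z
  have e5 := hs y w
  have e6 := hs z w
  simp only [treeDist]
  have t := meet_trans hl h0
  have c := meet_comm hl h0
  have t1 := t x z y
  have t2 := t x w y
  have t3 := t z x w
  have t4 := t z y w
  rw [c z y] at t1 t4
  rw [c w y] at t2
  rw [c z x] at t3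
  omega

theorem isGeod_treeDist : IsGeod (treeDist par lev) := by
  have hs := meet_spec hl h0
  have c := meet_comm hl h0
  have key : ∀ x y k, k + meet par lev x y ≤ lev x → ∃ z, treeDist par lev x z = k ∧
      k + treeDist par lev z y = treeDist par lev x y := fun x y k h => by
    have hn : lev x - k ≤ lev x := by omega
    have e1 := meet_anc_self hl hn
    have e2 := meet_anc hl h0 hn (y := y) (by omega)
    have e3 := lev_anc hl hn
    have e4 := hs x (anc par lev (lev x - k) x)
    have e5 := hs x y
    refine ⟨anc par lev (lev x - k) x, ?_, ?_⟩ <;> simp only [treeDist] <;> omega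
  refine ⟨fun x y => ⟨fun h => ?_, ?_⟩, fun x y => ?_, fun x y z => ?_, fun x y k hk => ?_⟩
  · obtain ⟨h1, h2, h3⟩ := hs x y
    simp only [treeDist] at h
    rw [show meet par lev x y = lev x by omega] at h3
    rw [anc, anc, show lev x - lev x = 0 by omega, show lev y - lev x = 0 by omega] at h3
    exact h3
  · rintro rfl
    have := le_meet (le_refl (lev x)) le_rfl (rfl : anc par lev _ x = _)
    simp only [treeDist]; omega
  · simp only [treeDist, c x y]; omega
  · have e1 := hs x y
    have e2 := hs x z
    have e3 := hs y z
    have t := meet_trans hl h0 x y z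
    simp only [treeDist]; omega
  · by_cases h : k + meet par lev x y ≤ lev x
    · exact key x y k h
    · obtain ⟨z, h1, h2⟩ := key y x (treeDist par lev x y - k) (by
        have e1 := hs x y
        rw [c y x]
        simp only [treeDist] at hk ⊢
        omega)
      have s : ∀ x y, treeDist par lev x y = treeDist par lev y x := fun x y => by
        simp only [treeDist, c x y]; omega
      have s1 := s y x
      have s2 := s z x
      have s3 := s y z
      exact ⟨z, by omega, by omega⟩

theorem treeDist_one {x y : V} (h : treeDist par lev x y = 1) :
    par x = y ∧ lev x = lev y + 1 ∨ par y = x ∧ lev y = lev x + 1 := by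
  obtain ⟨h1, h2, h3⟩ := meet_spec hl h0 x y
  simp only [treeDist] at h
  rcases h1.eq_or_lt with h4 | h4
  · rw [h4, anc, anc, Nat.sub_self, show lev y - lev x = 1 by omega] at h3
    exact Or.inr ⟨h3.symm, by omega⟩
  · rw [show meet par lev x y = lev y by omega, anc, anc, Nat.sub_self,
      show lev x - lev y = 1 by omega] at h3
    exact Or.inl ⟨h3, by omega⟩

theorem treeDist_par_le (x : V) : treeDist par lev x (par x) ≤ 1 := by
  have e := meet_anc_self hl (Nat.sub_le (lev x) 1)
  have h := hl x
  rcases Nat.eq_zero_or_pos (lev x) with h1 | h1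
  · rw [h0 (par x) x (by omega) h1, (isGeod_treeDist hl h0).self]; omega
  · rw [anc, show lev x - (lev x - 1) = 1 by omega, Function.iterate_one] at e
    simp only [treeDist]; omega

theorem treeDist_map_le {f : V → V} (hf : ∀ v, treeDist par lev (f v) (f (par v)) ≤ 1) (x y : V) :
    treeDist par lev (f x) (f y) ≤ treeDist par lev x y := by
  have hd := isGeod_treeDist hl h0
  induction hn : treeDist par lev x y generalizing x with
  | zero => rw [(hd.zero _ _).1 hn, hd.self]
  | succ n ih =>
    obtain ⟨z, h1, h2⟩ := hd.mid x y 1 (by omega)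
    have h3 := ih z (by omega)
    have h4 : treeDist par lev (f x) (f z) ≤ 1 := by
      rcases treeDist_one hl h0 h1 with ⟨h, -⟩ | ⟨h, -⟩
      · rw [← h]; exact hf x
      · rw [← h, hd.symm]; exact hf z
    exact (hd.tri _ (f z) _).trans (by omega)

end

section
variable {G V : Type*} [Group G] [MulAction G V] {d : V → V → ℕ} {t : V → ℕ}
  (hd : IsGeod d) (hy : Hyp d 0)

include hd hy

theorem tree_unique {x b q q' : V} (h : d x q + d q b = d x b)
    (h' : d x q' + d q' b = d x b) (he : d x q = d x q') : q = q' := by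
  rw [← hd.zero]
  have := hy q q' x b
  have s1 := hd.symm q x
  have s2 := hd.symm q' x
  omega

theorem finite_Ivl (x b : V) : (Ivl d x b).Finite := by
  refine Set.Finite.of_finite_image (f := d x) ((Set.finite_Iic (d x b)).subset ?_) ?_
  · rintro _ ⟨q, hq, rfl⟩
    have : d x q + d q b = d x b := hq
    exact Set.mem_Iic.2 (by omega)
  · exact fun q hq q' hq' h => tree_unique hd hy hq hq' h

variable (hp : ∀ x y, (d x y + t x + t y) % 2 = 0)
include hp

theorem tree_branch {x a b : V} (h : d a b < d x a + d x b) :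
    ∃ q, d x q = 1 ∧ d x q + d q a = d x a ∧ d x q + d q b = d x b := by
  have h1 := hp a b
  have h2 := hp x a
  have h3 := hp x b
  have t1 := hd.tri a x b
  have t2 := hd.tri x a b
  have s := hd.symm a x
  obtain ⟨q, h4, h5⟩ := hd.mid x a 1 (by omega)
  refine ⟨q, h4, by omega, ?_⟩
  have := hy q b x a
  have s1 := hd.symm q x
  have s2 := hd.symm b x
  have s3 := hd.symm b a
  have := hd.tri x q b
  omega

variable (hinv : ∀ (g : G) (x y : V), d (g • x) (g • y) = d x y)
include hinv

theorem tree_lox (ht : ∀ (g : G) x, t (g • x) % 2 = t x % 2) [Nonempty V] {g : G}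
    (hg : ∀ v : V, g • v ≠ v) : Lox d g := by
  obtain ⟨p, -, hmin⟩ := WellFounded.has_min (measure (fun p : V => d p (g • p))).wf Set.univ
    Set.univ_nonempty
  replace hmin : ∀ x, d p (g • p) ≤ d x (g • x) := fun x => not_lt.1 (hmin x trivial)
  obtain ⟨D, hD⟩ : ∃ D, D = d p (g • p) := ⟨_, rfl⟩
  have hD0 : D ≠ 0 := fun h => hg p ((hd.zero _ _).1 (hD ▸ h)).symm
  have hD2 : 2 ≤ D := by
    have := hp p (g • p)
    have := ht g p
    omega
  have h2 : d p (g • g • p) = 2 * D := by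
    by_contra hne
    have e := hinv g p (g • p)
    have s := hd.symm p (g • p)
    obtain ⟨q, h1, h2, h3⟩ := tree_branch hd hy hp (x := g • p) (a := p) (b := g • g • p) (by
      have := hd.tri p (g • p) (g • g • p)
      omega)
    have h4 := hmin (g⁻¹ • q)
    rw [smul_inv_smul] at h4
    have e1 := hinv g p (g⁻¹ • q)
    have e2 := hinv g (g⁻¹ • q) (g • p)
    rw [smul_inv_smul] at e1 e2
    have := hy (g⁻¹ • q) q p (g • p)
    have s1 := hd.symm (g⁻¹ • q) p
    have s2 := hd.symm q (g • p)
    omega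
  have key : ∀ k : ℕ, d p (g ^ k • p) = k * D ∧ d p (g ^ (k + 1) • p) = (k + 1) * D := fun k => by
    induction k with
    | zero => exact ⟨by simp [hd.self], by simp [hD]⟩
    | succ k ih =>
      refine ⟨by exact_mod_cast ih.2, ?_⟩
      obtain ⟨i1, i2⟩ := ih
      have e : ∀ x y, d (g ^ k • x) (g ^ k • y) = d x y := fun x y => hinv _ x y
      have e1 : g ^ (k + 1) • p = g ^ k • g • p := by rw [pow_succ, mul_smul]
      have e2 : g ^ (k + 1 + 1) • p = g ^ k • g • g • p := by rw [pow_succ, pow_succ]; simp [mul_smul]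
      have f1 : d (g ^ k • p) (g ^ (k + 1) • p) = D := by rw [e1, e, hD]
      have f2 : d (g ^ k • p) (g ^ (k + 1 + 1) • p) = 2 * D := by rw [e2, e, h2]
      have f3 : d (g ^ (k + 1) • p) (g ^ (k + 1 + 1) • p) = D := by rw [e1, e2, e, hinv, hD]
      have := hy p (g ^ (k + 1) • p) (g ^ k • p) (g ^ (k + 1 + 1) • p)
      have s := hd.symm (g ^ (k + 1) • p) (g ^ k • p)
      have := hd.tri p (g ^ (k + 1) • p) (g ^ (k + 1 + 1) • p)
      have a1 : (k + 1) * D = k * D + D := by ring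
      have a2 : (k + 1 + 1) * D = k * D + 2 * D := by ring
      omega
  refine ⟨p, 1, fun k => ?_⟩
  rw [(key k).1]
  nlinarith

omit hp in
theorem tree_inter (hedge : ∀ (g : G) (v w : V), d v w = 1 → g • v = v → g • w = w → g = 1)
    {g : G} {v w : V} (hv : g • v = v) (hw : g • w = w) (hg : g ≠ 1) : v = w := by
  by_contra hne
  obtain ⟨q, h1, h2⟩ := hd.mid v w 1 (by have := (hd.zero v w).not.2 hne; omega)
  have e1 := hinv g v q
  have e2 := hinv g q w
  rw [hv] at e1
  rw [hw] at e2
  exact hg (hedge g v q h1 hv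
    (tree_unique hd hy (x := v) (b := w) (by omega) (by omega) (by omega)))

theorem tree_ell (hedge : ∀ (g : G) (v w : V), d v w = 1 → g • v = v → g • w = w → g = 1)
    {u v : G} {p q s : V} (hu : u ≠ 1) (hv : v ≠ 1) (hup : u • p = p) (hvq : v • q = q)
    (hs : (u * v) • s = s) : p = q := by
  have key : ∀ (u : G) (p s r : V), u ≠ 1 → u • p = p → u • r = s → d r s = d p r + d p s :=
    fun u p s r hu hup hr => by
    by_contra hne
    obtain ⟨x, h1, h2, h3⟩ := tree_branch hd hy hp (x := p) (a := r) (b := s) (by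
      have := hd.tri r p s
      have := hd.symm r p
      omega)
    have e1 := hinv u p x
    have e2 := hinv u x r
    have e3 := hinv u p r
    rw [hup] at e1 e3
    rw [hr] at e2 e3
    exact hu (hedge u p x h1 hup
      (tree_unique hd hy (x := p) (b := s) (by omega) (by omega) (by omega)))
  rw [mul_smul] at hs
  have k1 := key u p s (v • s) hu hup hs
  have k2 := key v q (v • s) s hv hvq rfl
  rw [← hd.zero]
  have := hinv u p (v • s)
  have := hinv v q s
  rw [hup, hs] at *
  rw [hvq] at *
  have := hy p q s (v • s)
  have s1 := hd.symm s (v • s)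
  omega

omit hp in
theorem tree_wpd (hedge : ∀ (g : G) (v w : V), d v w = 1 → g • v = v → g • w = w → g = 1)
    {g : G} (hg : Lox d g) : WPD d g := by
  intro o C
  obtain ⟨κ, hκ⟩ := hg.bound hd hinv o
  refine ⟨κ * (2 * C + 2) + 1, fun K hK => ?_⟩
  obtain ⟨q, hq⟩ : ∃ q, q = g ^ K • o := ⟨_, rfl⟩
  have hfar : 2 * C + 2 ≤ d o q := by
    by_contra h
    have h1 := hκ K
    rw [← hq] at h1
    have : κ * (d o q + 1) ≤ κ * (2 * C + 2) := Nat.mul_le_mul_left _ (by omega)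
    omega
  rw [← hq]
  obtain ⟨x₀, h1, h2⟩ := hd.mid o q C (by omega)
  obtain ⟨x₁, h3, h4⟩ := hd.mid x₀ q 1 (by omega)
  have key : ∀ x : V, d o x + d x q = d o q → C ≤ d o x → C ≤ d x q → ∀ h : G,
      d o (h • o) ≤ C → d q (h • q) ≤ C → h • x ∈ Ivl d o q := fun x e1 e2 e3 h e4 e5 => by
    change d o (h • x) + d (h • x) q = d o q
    have f1 := hinv h o x
    have f2 := hinv h x q
    have f3 := hinv h o q
    have a1 := hy o (h • x) (h • o) (h • q)
    have a2 := hy q (h • x) o (h • q)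
    have a3 := hd.tri o (h • x) (h • q)
    have a4 := hd.tri o (h • x) q
    have s1 := hd.symm (h • x) (h • o)
    have s2 := hd.symm (h • x) q
    have s3 := hd.symm (h • x) o
    have s4 := hd.symm q o
    have z1 := (hd.zero o (h • x)).1
    have z2 := (hd.zero q (h • x)).1
    by_cases c1 : d o (h • x) = 0
    · rw [← z1 c1, hd.self]; omega
    · by_cases c2 : d q (h • x) = 0
      · rw [← z2 c2, hd.self]; omega
      · omega
  have t1 := hd.tri o x₀ x₁
  have t2 := hd.tri o x₁ q
  refine Set.Finite.of_finite_image (f := fun h : G => (h • x₀, h • x₁))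
    (((finite_Ivl hd hy o q).prod (finite_Ivl hd hy o q)).subset ?_) ?_
  · rintro _ ⟨h, ⟨hh1, hh2⟩, rfl⟩
    exact ⟨key x₀ (by omega) (by omega) (by omega) h hh1 hh2,
      key x₁ (by omega) (by omega) (by omega) h hh1 hh2⟩
  · intro h _ h' _ e
    obtain ⟨e1, e2⟩ := Prod.mk.inj e
    refine (inv_mul_eq_one.1 (hedge (h⁻¹ * h') x₀ x₁ h3 ?_ ?_))
    · rw [mul_smul, inv_smul_eq_iff]; exact e1.symm
    · rw [mul_smul, inv_smul_eq_iff]; exact e2.symm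

end

open Monoid

section
variable {J : Type} {H : J → Type} [∀ j, Group (H j)]

/-- The Bass--Serre tree of a free product, with the group elements as additional vertices. -/
abbrev BassSerre (H : J → Type) [∀ j, Group (H j)] : Type :=
  CoprodI H ⊕ Σ j, CoprodI H ⧸ (CoprodI.of : H j →* CoprodI H).range

variable [DecidableEq J] [∀ j, DecidableEq (H j)]

/-- The reduced word of the inverse of an element. -/
def wd (g : CoprodI H) : CoprodI.Word H := CoprodI.Word.equiv g⁻¹

/-- The shortest element of the left coset of a factor. -/
def tl (j : J) (g : CoprodI H) : CoprodI H := (CoprodI.Word.equivPair j (wd g)).tail.prod⁻¹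

theorem wd_prod (w : CoprodI.Word H) : wd w.prod⁻¹ = w := by
  rw [wd, inv_inv]; exact CoprodI.Word.equiv.apply_symm_apply w

theorem prod_wd (g : CoprodI H) : (wd g).prod = g⁻¹ := CoprodI.Word.equiv.symm_apply_apply _

theorem wd_tl (j : J) (g : CoprodI H) : wd (tl j g) = (CoprodI.Word.equivPair j (wd g)).tail :=
  wd_prod _

theorem tl_mul (j : J) (g : CoprodI H) (h : H j) : tl j (g * CoprodI.of h) = tl j g := by
  have : wd (g * CoprodI.of h) = CoprodI.of h⁻¹ • wd g := by
    rw [wd, mul_inv_rev, map_inv]; exact mul_smul (CoprodI.of h)⁻¹ g⁻¹ (CoprodI.Word.empty : CoprodI.Word H)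
  rw [tl, this, CoprodI.Word.equivPair_smul_same, tl]

theorem tl_eq (j : J) (g : CoprodI H) :
    tl j g = g * CoprodI.of (CoprodI.Word.equivPair j (wd g)).head := by
  have := congrArg CoprodI.Word.prod (CoprodI.Word.equivPair_head_smul_equivPair_tail (i := j) (wd g))
  rw [CoprodI.Word.prod_smul, prod_wd] at this
  rw [tl, eq_comm, eq_inv_iff_mul_eq_one, mul_assoc, this, mul_inv_cancel]

theorem tl_of_ne {j : J} {g : CoprodI H} (h : (wd g).fstIdx ≠ some j) : tl j g = g := by
  rw [tl, CoprodI.Word.equivPair_eq_of_fstIdx_ne h, prod_wd, inv_inv]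

theorem length_tl {j : J} {g : CoprodI H} (h : (wd g).fstIdx = some j) :
    (wd g).toList.length = (wd (tl j g)).toList.length + 1 := by
  rw [wd_tl]
  have e : CoprodI.Word.rcons (CoprodI.Word.equivPair j (wd g)) = wd g :=
    (CoprodI.Word.equivPair j).symm_apply_apply _
  have hh : (CoprodI.Word.equivPair j (wd g)).head ≠ 1 := fun h1 => by
    rw [CoprodI.Word.rcons, dif_pos h1] at e
    exact (CoprodI.Word.equivPair j (wd g)).fstIdx_ne (by rw [e, h])
  conv_lhs => rw [← e, CoprodI.Word.rcons, dif_neg hh]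
  simp [CoprodI.Word.cons]

/-- The parent in the Bass--Serre tree rooted at the identity. -/
noncomputable def bsPar : BassSerre H → BassSerre H
  | .inl g => match (wd g).fstIdx with
    | none => .inl g
    | some j => .inr ⟨j, (g : CoprodI H ⧸ _)⟩
  | .inr ⟨j, c⟩ => .inl (tl j c.out)

/-- The level in the Bass--Serre tree rooted at the identity. -/
noncomputable def bsLev : BassSerre H → ℕ
  | .inl g => 2 * (wd g).toList.length
  | .inr ⟨j, c⟩ => 2 * (wd (tl j c.out)).toList.length + 1

theorem tl_out (j : J) (g : CoprodI H) :
    tl j (g : CoprodI H ⧸ (CoprodI.of : H j →* CoprodI H).range).out = tl j g := by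
  obtain ⟨⟨_, h, rfl⟩, hh⟩ := QuotientGroup.mk_out_eq_mul (CoprodI.of : H j →* CoprodI H).range g
  rw [hh]
  exact tl_mul j g h

omit [DecidableEq J] [∀ j, DecidableEq (H j)] in
theorem fstIdx_eq_none {w : CoprodI.Word H} (h : w.fstIdx = none) : w = .empty := by
  rcases w with ⟨l, h1, h2⟩
  cases l with
  | nil => rfl
  | cons a l => simp [CoprodI.Word.fstIdx] at h

theorem bsLev_par (v : BassSerre H) : bsLev (bsPar v) = bsLev v - 1 := by
  rcases v with g | ⟨j, c⟩
  · simp only [bsPar]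
    split
    · next h => simp [bsLev, fstIdx_eq_none h, CoprodI.Word.empty]
    · next j h => simp only [bsLev, tl_out, length_tl h]; omega
  · simp [bsPar, bsLev]

theorem bsLev_zero (v w : BassSerre H) (hv : bsLev v = 0) (hw : bsLev w = 0) : v = w := by
  have key : ∀ v : BassSerre H, bsLev v = 0 → v = .inl 1 := fun v hv => by
    rcases v with g | ⟨j, c⟩
    · have : (wd g).toList = [] := by simpa [bsLev] using hv
      have e : wd g = .empty := CoprodI.Word.ext this
      have := prod_wd g
      rw [e, CoprodI.Word.prod_empty] at this
      rw [inv_eq_one.1 this.symm]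
    · simp [bsLev] at hv
  rw [key v hv, key w hw]

theorem bs_edge (g : CoprodI H) (j : J) :
    bsPar (.inl g) = .inr ⟨j, (g : CoprodI H ⧸ _)⟩ ∨
      bsPar (.inr ⟨j, (g : CoprodI H ⧸ _)⟩) = .inl g := by
  by_cases h : (wd g).fstIdx = some j
  · left; simp only [bsPar, h]
  · right; simp only [bsPar, tl_out, tl_of_ne h]

/-- The metric on the Bass--Serre tree. -/
noncomputable def bsDist : BassSerre H → BassSerre H → ℕ := treeDist bsPar bsLev

theorem bs_par_cases (v : BassSerre H) : bsPar v = v ∨ ∃ (g : CoprodI H) (j : J),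
    (v = .inl g ∧ bsPar v = .inr ⟨j, (g : CoprodI H ⧸ _)⟩) ∨
      (bsPar v = .inl g ∧ v = .inr ⟨j, (g : CoprodI H ⧸ _)⟩) := by
  rcases v with g | ⟨j, c⟩
  · cases h : (wd g).fstIdx with
    | none => left; simp only [bsPar, h]
    | some j => right; exact ⟨g, j, Or.inl ⟨rfl, by simp only [bsPar, h]⟩⟩
  · right
    refine ⟨tl j c.out, j, Or.inr ⟨rfl, ?_⟩⟩
    rw [tl_eq, QuotientGroup.mk_mul_of_mem _ (MonoidHom.mem_range.2 ⟨_, rfl⟩), QuotientGroup.out_eq']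

theorem isGeod_bs : IsGeod (bsDist (H := H)) := isGeod_treeDist bsLev_par bsLev_zero

theorem bs_edge_le (g : CoprodI H) (j : J) :
    bsDist (.inl g) (.inr ⟨j, (g : CoprodI H ⧸ _)⟩) ≤ 1 := by
  rcases bs_edge g j with h | h
  · rw [← h]; exact treeDist_par_le bsLev_par bsLev_zero _
  · rw [isGeod_bs.symm, ← h]; exact treeDist_par_le bsLev_par bsLev_zero _

theorem bs_smul_le (g : CoprodI H) (x y : BassSerre H) : bsDist (g • x) (g • y) ≤ bsDist x y := by
  refine treeDist_map_le bsLev_par bsLev_zero (f := fun x => g • x) (fun v => ?_) x y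
  change bsDist _ _ ≤ 1
  rcases bs_par_cases v with h | ⟨a, j, ⟨h1, h2⟩ | ⟨h1, h2⟩⟩
  · rw [h, isGeod_bs.self]; omega
  · rw [h2, h1]; exact bs_edge_le (g * a) j
  · rw [h1, h2, isGeod_bs.symm]; exact bs_edge_le (g * a) j

theorem bs_smul (g : CoprodI H) (x y : BassSerre H) : bsDist (g • x) (g • y) = bsDist x y := by
  refine le_antisymm (bs_smul_le g x y) ?_
  have := bs_smul_le g⁻¹ (g • x) (g • y)
  rwa [inv_smul_smul, inv_smul_smul] at this

omit [DecidableEq J] [∀ j, DecidableEq (H j)] in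
theorem bs_free {g : CoprodI H} {a : CoprodI H} (h : g • (.inl a : BassSerre H) = .inl a) :
    g = 1 := by
  have : g * a = a := Sum.inl_injective h
  exact mul_eq_right.1 this

theorem bs_adj {v w : BassSerre H} (h : bsDist v w = 1) :
    ∃ (a : CoprodI H), v = .inl a ∨ w = .inl a := by
  rcases treeDist_one bsLev_par bsLev_zero h with ⟨h1, h2⟩ | ⟨h1, h2⟩
  · rcases bs_par_cases v with h | ⟨a, j, ⟨h3, -⟩ | ⟨h3, -⟩⟩
    · rw [← h1, h] at h2; omega
    · exact ⟨a, Or.inl h3⟩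
    · exact ⟨a, Or.inr (h1 ▸ h3)⟩
  · rcases bs_par_cases w with h | ⟨a, j, ⟨h3, -⟩ | ⟨h3, -⟩⟩
    · rw [← h1, h] at h2; omega
    · exact ⟨a, Or.inr h3⟩
    · exact ⟨a, Or.inl (h1 ▸ h3)⟩

theorem bs_parity (x y : BassSerre H) : (bsDist x y + bsLev x + bsLev y) % 2 = 0 := by
  have := meet_spec bsLev_par bsLev_zero x y
  simp only [bsDist, treeDist]
  omega

theorem bsLev_smul (g : CoprodI H) (x : BassSerre H) : bsLev (g • x) % 2 = bsLev x % 2 := by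
  rcases x with a | ⟨j, c⟩
  · change bsLev (.inl (g * a)) % 2 = _
    simp [bsLev]
  · change bsLev (.inr ⟨j, g • c⟩) % 2 = _
    simp only [bsLev]; omega

theorem good_coprodI : Good (bsDist (H := H)) 0 (fun j => (CoprodI.of : H j →* CoprodI H))
    (fun j => .inr ⟨j, ((1 : CoprodI H) : CoprodI H ⧸ _)⟩) := by
  have hd := isGeod_bs (H := H)
  have hy : Hyp (bsDist (H := H)) 0 := hyp_treeDist bsLev_par bsLev_zero
  have hedge : ∀ (g : CoprodI H) (v w : BassSerre H), bsDist v w = 1 → g • v = v → g • w = w →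
      g = 1 := fun g v w h hv hw => by
    obtain ⟨a, rfl | rfl⟩ := bs_adj h
    · exact bs_free hv
    · exact bs_free hw
  refine ⟨hd, hy, bs_smul, CoprodI.of_injective, fun j g => ?_, fun g v hv hg => ?_,
    fun j j' x h => ?_, fun g v w hv hw hg => tree_inter hd hy bs_smul hedge hv hw hg,
    fun u v p q s hu hv hup hvq hs => tree_ell hd hy bs_parity bs_smul hedge hu hv hup hvq hs,
    fun g hg => tree_lox hd hy bs_parity bs_smul bsLev_smul hg,
    fun g hg => tree_wpd hd hy bs_smul hedge hg⟩
  · change (Sum.inr ⟨j, ((g * 1 : CoprodI H) : CoprodI H ⧸ _)⟩ : BassSerre H) = _ ↔ _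
    rw [mul_one, Sum.inr.injEq, Sigma.mk.injEq, heq_eq_eq, eq_comm, QuotientGroup.eq]
    simp
  · rcases v with a | ⟨j, c⟩
    · exact absurd (bs_free hv) hg
    · obtain ⟨x, rfl⟩ := QuotientGroup.mk_surjective c
      refine ⟨j, x, ?_⟩
      change _ = (Sum.inr ⟨j, ((x * 1 : CoprodI H) : CoprodI H ⧸ _)⟩ : BassSerre H)
      rw [mul_one]
  · exact congrArg Sigma.fst (Sum.inr_injective h)

end

section
variable {J : Type} {H : J → Type} [∀ j, Group (H j)] {Γ : Type} [Group Γ]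

/-- A quotient of a group together with a good action. -/
structure Stage (ψ : ∀ j, H j →* Γ) where
  G : Type
  V : Type
  [grp : Group G]
  [act : MulAction G V]
  π : Γ →* G
  surj : Function.Surjective π
  d : V → V → ℕ
  δ : ℕ
  o : J → V
  good : Good d δ (fun j => π.comp (ψ j)) o

namespace Stage
attribute [instance] Stage.grp Stage.act

variable {ψ : ∀ j, H j →* Γ}

/-- The element acts loxodromically. -/
def Lx (s : Stage ψ) (g : Γ) : Prop := Lox s.d (s.π g)

/-- The second element is in the elementary subgroup of the first one. -/
def El (s : Stage ψ) (g h : Γ) : Prop := s.π h ∈ Elem (s.π g)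

theorem exists_next (s : Stage ψ) (u v x : Γ) {T : Set Γ} (hT : T.Finite) :
    ∃ s' : Stage ψ, s.π.ker ≤ s'.π.ker ∧
      (∀ f ∈ Subgroup.closure {u, v}, ∀ h ∈ Subgroup.closure {u, v}, s.Lx f → ¬ s.El f h →
        s'.π x ∈ Subgroup.closure {s'.π u, s'.π v}) ∧
      ∀ g ∈ T, s.Lx g → s'.Lx g ∧ ∀ h, s'.El g h → ∃ h', s.El g h' ∧ s'.π h = s'.π h' := by
  by_cases hex : ∃ f ∈ Subgroup.closure {u, v}, ∃ h ∈ Subgroup.closure {u, v}, s.Lx f ∧ ¬ s.El f h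
  · obtain ⟨f, hf, h, hh, hfl, hfh⟩ := hex
    have key : ∀ a ∈ Subgroup.closure {u, v}, s.π a ∈ Subgroup.closure {s.π u, s.π v} :=
      fun a ha => by
        have := Subgroup.mem_map_of_mem s.π ha
        rwa [MonoidHom.map_closure, Set.image_pair] at this
    obtain ⟨N, hN, d', δ', hg, hx, hE⟩ := s.good.exists_quotient (key f hf) (key h hh) hfl hfh
      (s.π x) (hT.image s.π)
    refine ⟨⟨s.G ⧸ N, OrbQ N s.V, (QuotientGroup.mk' N).comp s.π,
      (QuotientGroup.mk'_surjective N).comp s.surj, d', δ', _, hg⟩, fun a ha => ?_,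
      fun _ _ _ _ _ _ => hx, fun g hgT hgl => ?_⟩
    · rw [MonoidHom.mem_ker] at ha ⊢
      rw [MonoidHom.comp_apply, ha, map_one]
    · obtain ⟨h1, h2⟩ := hE _ ⟨g, hgT, rfl⟩ hgl
      refine ⟨h1, fun h hh => ?_⟩
      obtain ⟨h', hh', e⟩ := h2 hh
      obtain ⟨h', rfl⟩ := s.surj h'
      exact ⟨h', hh', e.symm⟩
  · refine ⟨s, le_rfl, fun f hf h hh h1 h2 => absurd ⟨f, hf, h, hh, h1, h2⟩ hex,
      fun g _ hg => ⟨hg, fun h hh => ⟨h, hh, rfl⟩⟩⟩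

/-- Every element acts loxodromically or fixes a vertex. -/
theorem lx_or (s : Stage ψ) (g : Γ) : s.Lx g ∨ ∃ v : s.V, s.π g • v = v := by
  by_cases h : ∃ v : s.V, s.π g • v = v
  · exact Or.inr h
  · exact Or.inl (s.good.lox _ fun v hv => h ⟨v, hv⟩)

end Stage

/-- A sequence of stages deciding everything about the pairs of elements. -/
theorem exists_stages [Countable Γ] {ψ : ∀ j, H j →* Γ} (s₀ : Stage ψ) :
    ∃ s : ℕ → Stage ψ, Monotone (fun n => (s n).π.ker) ∧
      (∀ (u v x : Γ) (m : ℕ), ∃ n, m ≤ n ∧ ∀ f ∈ Subgroup.closure {u, v},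
        ∀ h ∈ Subgroup.closure {u, v}, (s n).Lx f → ¬ (s n).El f h →
        (s (n + 1)).π x ∈ Subgroup.closure {(s (n + 1)).π u, (s (n + 1)).π v}) ∧
      ∀ g : Γ, ∃ m, ∀ n, m ≤ n → (s n).Lx g → (s (n + 1)).Lx g ∧
        ∀ h, (s (n + 1)).El g h → ∃ h', (s n).El g h' ∧ (s (n + 1)).π h = (s (n + 1)).π h' := by
  obtain ⟨e, he⟩ := exists_surjective_nat ((Γ × Γ × Γ) × ℕ)
  obtain ⟨c, hc⟩ := exists_surjective_nat Γ
  choose nx h1 h2 h3 using fun (n : ℕ) (s : Stage ψ) =>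
    s.exists_next (e n).1.1 (e n).1.2.1 (e n).1.2.2 ((Set.finite_Iio n).image c)
  refine ⟨fun n => Nat.rec s₀ nx n, monotone_nat_of_le_succ fun n => h1 n _, fun u v x m => ?_,
    fun g => ?_⟩
  · have hinf : {n | (e n).1 = (u, v, x)}.Infinite := by
      have : (Set.range fun k : ℕ => (((u, v, x), k) : (Γ × Γ × Γ) × ℕ)).Infinite :=
        Set.infinite_range_of_injective fun a b h => (Prod.mk.inj h).2
      refine Set.Infinite.of_image e (this.mono ?_)
      rintro _ ⟨k, rfl⟩
      obtain ⟨n, hn⟩ := he ((u, v, x), k)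
      exact ⟨n, by simp [hn], hn⟩
    obtain ⟨n, hn, hmn⟩ := hinf.exists_gt m
    have := h2 n (Nat.rec s₀ nx n)
    rw [show (e n).1 = (u, v, x) from hn] at this
    exact ⟨n, hmn.le, this⟩
  · obtain ⟨m, rfl⟩ := hc g
    exact ⟨m + 1, fun n hn => h3 n _ _ ⟨m, hn, rfl⟩⟩

end

section
variable {P : Type*} [Group P]

theorem conj_eq_or_inv {C : Subgroup P} [C.Normal] {c : P} (hc : Subgroup.zpowers c = C)
    (hinf : ∀ n : ℤ, c ^ n = 1 → n = 0) (y : P) : y * c * y⁻¹ = c ∨ y * c * y⁻¹ = c⁻¹ := by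
  have key : ∀ y : P, ∃ k : ℤ, c ^ k = y * c * y⁻¹ := fun y => by
    have := Subgroup.Normal.conj_mem ‹_› c (hc ▸ Subgroup.mem_zpowers c) y
    rw [← hc] at this
    exact Subgroup.mem_zpowers_iff.1 this
  obtain ⟨k, hk⟩ := key y
  obtain ⟨l, hl⟩ := key y⁻¹
  have h1 : c ^ (k * l) = c := by
    rw [zpow_mul, hk, conj_zpow, hl]; group
  have h2 := hinf (k * l - 1) (by rw [zpow_sub, h1, zpow_one, mul_inv_cancel])
  rcases Int.eq_one_or_neg_one_of_mul_eq_one (show k * l = 1 by omega) with rfl | rfl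
  · left; rw [← hk, zpow_one]
  · right; rw [← hk, zpow_neg_one]

theorem nonempty_mulEquiv_int {r : P} (hr : ∀ n : ℤ, r ^ n = 1 → n = 0)
    (h : ∀ y, ∃ k : ℤ, r ^ k = y) : Nonempty (P ≃* Multiplicative ℤ) := by
  refine ⟨(MulEquiv.ofBijective (zpowersHom P r) ⟨?_, fun y => ?_⟩).symm⟩
  · rw [injective_iff_map_eq_one]
    intro a ha
    exact Multiplicative.toAdd.injective (hr _ ha)
  · obtain ⟨k, hk⟩ := h y
    exact ⟨Multiplicative.ofAdd k, hk⟩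

theorem nonempty_mulEquiv_dihedral {r t : P} (hr : ∀ n : ℤ, r ^ n = 1 → n = 0) (ht : t * t = 1)
    (htr : t * r * t⁻¹ = r⁻¹) (hK : ∀ k : ℤ, r ^ k ≠ t)
    (h : ∀ y, (∃ k : ℤ, r ^ k = y) ∨ ∃ k : ℤ, t * r ^ k = y) :
    Nonempty (P ≃* DihedralGroup 0) := by
  have e : ∀ k : ℤ, r ^ k * t = t * r ^ (-k) := fun k => by
    have : t * r ^ (-k) * t⁻¹ = r ^ k := by rw [← conj_zpow, htr, zpow_neg, inv_zpow, inv_inv]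
    rw [← this, inv_mul_cancel_right]
  have e1 : ∀ i j : ℤ, t * r ^ (j - i) = r ^ i * (t * r ^ j) := fun i j => by
    rw [← mul_assoc, e, mul_assoc, ← zpow_add, neg_add_eq_sub]
  have e2 : ∀ i j : ℤ, t * r ^ (i + j) = t * r ^ i * r ^ j := fun i j => by
    rw [mul_assoc, zpow_add]
  have e3 : ∀ i j : ℤ, r ^ (j - i) = t * r ^ i * (t * r ^ j) := fun i j => by
    rw [mul_assoc, ← mul_assoc (r ^ i), e, mul_assoc, ← mul_assoc t, ht, one_mul, ← zpow_add,
      neg_add_eq_sub]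
  have e4 : ∀ i : ℤ, t * r ^ i ≠ 1 := fun i hi => hK (-i) (by
    rw [zpow_neg]; exact inv_eq_iff_eq_inv.2 (mul_eq_one_iff_inv_eq.1 hi).symm)
  let f : DihedralGroup 0 →* P := MonoidHom.mk' (fun x => match x with
    | .r (i : ℤ) => r ^ i
    | .sr (i : ℤ) => t * r ^ i) (by
    rintro (i | i) (j | j)
    · exact zpow_add r i j
    · exact e1 i j
    · exact e2 i j
    · exact e3 i j)
  refine ⟨(MulEquiv.ofBijective f ⟨?_, fun y => ?_⟩).symm⟩
  · rw [injective_iff_map_eq_one]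
    rintro (i | i) hi
    · rw [DihedralGroup.one_def]; exact congrArg _ (hr i hi)
    · exact absurd hi (e4 i)
  · obtain ⟨k, hk⟩ | ⟨k, hk⟩ := h y
    · exact ⟨.r k, hk⟩
    · exact ⟨.sr k, hk⟩

/-- A virtually cyclic group without torsion in centralizers of elements of infinite order is
infinite cyclic or infinite dihedral. -/
theorem cyclic_or_dihedral {s : P} (hs : ∀ n : ℤ, s ^ n = 1 → n = 0) {T : Set P} (hT : T.Finite)
    (hcov : ∀ y, ∃ k : ℤ, ∃ t ∈ T, y = s ^ k * t)
    (hZ : ∀ x, x ≠ 1 → ∀ k : ℤ, k ≠ 0 → x * s ^ k = s ^ k * x → ∀ n : ℤ, x ^ n = 1 → n = 0) :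
    Nonempty (P ≃* Multiplicative ℤ) ∨ Nonempty (P ≃* DihedralGroup 0) := by
  have hfin : (Subgroup.zpowers s).FiniteIndex := by
    have := hT.to_subtype
    have : Finite (P ⧸ Subgroup.zpowers s) :=
      Finite.of_surjective (fun t : T => ((t⁻¹ : P) : P ⧸ Subgroup.zpowers s)) fun y => by
        obtain ⟨y, rfl⟩ := QuotientGroup.mk_surjective y
        obtain ⟨k, t, ht, h⟩ := hcov y⁻¹
        refine ⟨⟨t, ht⟩, QuotientGroup.eq.2 (Subgroup.mem_zpowers_iff.2 ⟨-k, ?_⟩)⟩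
        have h' : y = t⁻¹ * s ^ (-k) := by rw [← inv_inv y, h]; group
        rw [h']; group
    exact Subgroup.finiteIndex_of_finite_quotient
  obtain ⟨C, hC⟩ : ∃ C, C = (Subgroup.zpowers s).normalCore := ⟨_, rfl⟩
  have hCn : C.Normal := hC ▸ inferInstance
  have hCf : C.FiniteIndex := hC ▸ inferInstance
  have hCs : C ≤ Subgroup.zpowers s := hC ▸ Subgroup.normalCore_le _
  obtain ⟨c, hc⟩ : ∃ c, Subgroup.zpowers c = C := by
    have : IsCyclic C := isCyclic_of_injective (Subgroup.inclusion hCs)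
      (Subgroup.inclusion_injective hCs)
    exact C.isCyclic_iff_exists_zpowers_eq_top.1 this
  have hCi : C.index ≠ 0 := hCf.index_ne_zero
  obtain ⟨m, hm⟩ := Subgroup.mem_zpowers_iff.1 (hCs (hc ▸ Subgroup.mem_zpowers c))
  have hm0 : m ≠ 0 := by
    rintro rfl
    have h1 := C.pow_index_mem s
    obtain ⟨k, hk⟩ := Subgroup.mem_zpowers_iff.1 (hc.ge h1)
    rw [← hm, zpow_zero, one_zpow] at hk
    have h2 := hs C.index (by rw [zpow_natCast, hk])
    exact hCi (by exact_mod_cast h2)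
  have hcinf : ∀ n : ℤ, c ^ n = 1 → n = 0 := fun n h => by
    rw [← hm, ← zpow_mul] at h
    exact (mul_eq_zero.1 (hs _ h)).resolve_left hm0
  have htors : ∀ x, x * c = c * x → ∀ n : ℕ, n ≠ 0 → x ^ n = 1 → x = 1 := fun x h n hn hx => by
    by_contra h1
    exact hn (by exact_mod_cast hZ x h1 m hm0 (by rw [hm, h]) n (by rw [zpow_natCast, hx]))
  obtain ⟨K, hK⟩ : ∃ K, K = Subgroup.centralizer {c} := ⟨_, rfl⟩
  have hKm : ∀ y, y ∈ K ↔ y * c = c * y := fun y => by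
    rw [hK, Subgroup.mem_centralizer_singleton_iff]
  obtain ⟨r, hrK, hr⟩ : ∃ r ∈ K, ∀ y ∈ K, ∃ k : ℤ, r ^ k = y := by
    have hcK : c ∈ K := (hKm c).2 rfl
    have hcc : (⟨c, hcK⟩ : K) ∈ Subgroup.center K := Subgroup.mem_center_iff.2 fun y =>
      Subtype.ext ((hKm y).1 y.2)
    have hle : C.subgroupOf K ≤ Subgroup.center K := fun y hy => by
      obtain ⟨k, hk⟩ := Subgroup.mem_zpowers_iff.1 (hc ▸ Subgroup.mem_subgroupOf.1 hy)
      have : y = (⟨c, hcK⟩ : K) ^ k := Subtype.ext (by simp [hk])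
      rw [this]
      exact zpow_mem hcc k
    have hcf : (Subgroup.center K).FiniteIndex := Subgroup.finiteIndex_of_le hle
    have hinj : Function.Injective (MonoidHom.transferCenterPow K) := by
      rw [injective_iff_map_eq_one]
      intro y hy
      have h1 : (y : P) ^ (Subgroup.center K).index = 1 := by
        have := congrArg (fun z : Subgroup.center K => ((z : K) : P)) hy
        simpa using this
      exact Subtype.ext (htors y ((hKm y).1 y.2) _ hcf.index_ne_zero h1)
    have hcomm : ∀ x y : K, x * y = y * x := fun x y => hinj (by
      rw [map_mul, map_mul]
      exact Subtype.ext (Subgroup.mem_center_iff.1 (MonoidHom.transferCenterPow K y).2 _))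
    let _ : CommGroup K := { (inferInstance : Group K) with mul_comm := hcomm }
    have hcy : IsCyclic K := by
      refine isCyclic_of_injective (((powMonoidHom C.index : K →* K)).codRestrict
        (Subgroup.zpowers (⟨c, hcK⟩ : K)) fun y => ?_) ?_
      · have := C.pow_index_mem (y : P)
        obtain ⟨k, hk⟩ := Subgroup.mem_zpowers_iff.1 (hc.ge this)
        exact Subgroup.mem_zpowers_iff.2 ⟨k, Subtype.ext (by simpa using hk)⟩
      · rw [injective_iff_map_eq_one]
        intro y hy
        have h1 : (y : P) ^ C.index = 1 := by
          have := congrArg (fun z : K => (z : P)) (congrArg Subtype.val hy)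
          simpa using this
        exact Subtype.ext (htors y ((hKm y).1 y.2) _ hCi h1)
    obtain ⟨r, hr⟩ := hcy.exists_generator
    refine ⟨r, r.2, fun y hy => ?_⟩
    obtain ⟨k, hk⟩ := Subgroup.mem_zpowers_iff.1 (hr ⟨y, hy⟩)
    exact ⟨k, by simpa using congrArg Subtype.val hk⟩
  obtain ⟨l, hl⟩ := hr c ((hKm c).2 rfl)
  have hl0 : l ≠ 0 := by
    rintro rfl
    exact one_ne_zero (hcinf 1 (by rw [← hl]; simp))
  have hrinf : ∀ n : ℤ, r ^ n = 1 → n = 0 := fun n h => by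
    refine hcinf n ?_
    rw [← hl, ← zpow_mul, mul_comm, zpow_mul, h, one_zpow]
  by_cases htop : ∀ y, y ∈ K
  · exact Or.inl (nonempty_mulEquiv_int hrinf fun y => hr y (htop y))
  · right
    push Not at htop
    obtain ⟨t, ht⟩ := htop
    have hflip : ∀ y, y ∉ K → y * c * y⁻¹ = c⁻¹ := fun y hy =>
      (conj_eq_or_inv hc hcinf y).resolve_left fun h => hy ((hKm y).2 (mul_inv_eq_iff_eq_mul.1 h))
    have hprod : ∀ y, y ∉ K → t * y ∈ K := fun y hy => by
      rw [hKm, ← mul_inv_eq_iff_eq_mul]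
      have h1 := hflip y hy
      have h2 := hflip t ht
      calc t * y * c * (t * y)⁻¹ = t * (y * c * y⁻¹) * t⁻¹ := by group
        _ = (t * c * t⁻¹)⁻¹ := by rw [h1]; simp only [mul_inv_rev, inv_inv, mul_assoc]
        _ = c := by rw [h2, inv_inv]
    have htr : t * r * t⁻¹ = r⁻¹ := by
      have h1 : t * r * t⁻¹ ∈ K := by
        rw [hKm]
        have e : t⁻¹ * c * t = c⁻¹ := by
          have := hflip t⁻¹ (fun h => ht (by simpa using inv_mem h))
          simpa using this
        have e' : t⁻¹ * c = c⁻¹ * t⁻¹ := by rw [← e]; group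
        have e2 : t * c⁻¹ = c * t := by
          have := hflip t ht
          rw [mul_inv_eq_iff_eq_mul] at this
          rw [mul_inv_eq_iff_eq_mul, mul_assoc, this, mul_inv_cancel_left]
        have e3 : r * c⁻¹ = c⁻¹ * r := by
          have := (hKm r).1 hrK
          rw [mul_inv_eq_iff_eq_mul, mul_assoc, this, inv_mul_cancel_left]
        calc t * r * t⁻¹ * c = t * (r * c⁻¹) * t⁻¹ := by rw [mul_assoc _ _ c, e']; group
          _ = (t * c⁻¹) * r * t⁻¹ := by rw [e3]; group
          _ = c * (t * r * t⁻¹) := by rw [e2]; group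
      obtain ⟨k, hk⟩ := hr _ h1
      have h2 : r ^ (k * l + l) = 1 := by
        rw [zpow_add, zpow_mul, hk, conj_zpow, hl, hflip t ht, inv_mul_cancel]
      have h3 := hrinf _ h2
      have : (k + 1) * l = 0 := by linarith
      have := (mul_eq_zero.1 this).resolve_right hl0
      rw [← hk, show k = -1 by omega, zpow_neg_one]
    have htt : t * t = 1 := by
      obtain ⟨k, hk⟩ := hr _ (hprod t ht)
      have h1 : t * r ^ k * t⁻¹ = r ^ (-k) := by rw [← conj_zpow, htr, inv_zpow, zpow_neg]
      rw [hk, ← mul_assoc, mul_inv_cancel_right, ← hk] at h1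
      have h2 := hrinf (k + k) (by rw [zpow_add]; nth_rw 1 [h1]; rw [zpow_neg, inv_mul_cancel])
      rw [← hk, show k = 0 by omega, zpow_zero]
    refine nonempty_mulEquiv_dihedral hrinf htt htr (fun k h => ht (h ▸ zpow_mem hrK k))
      fun y => ?_
    by_cases hy : y ∈ K
    · exact Or.inl (hr y hy)
    · obtain ⟨k, hk⟩ := hr _ (hprod y hy)
      exact Or.inr ⟨k, by rw [hk, ← mul_assoc, htt, one_mul]⟩

end

/-- A family of malnormal subgroups controlling the proper subgroups and the torsion. -/
structure Tame {J : Type} {H : J → Type} [∀ j, Group (H j)] {S : Type} [Group S]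
    (φ : ∀ j, H j →* S) : Prop where
  inj : ∀ j, Function.Injective (φ j)
  eq_of_conj : ∀ j j' a b x, φ j a = x * φ j' b * x⁻¹ → a ≠ 1 → j = j'
  mem_of_conj : ∀ j a b x, φ j a = x * φ j b * x⁻¹ → a ≠ 1 → x ∈ (φ j).range
  sub : ∀ P : Subgroup S, P ≠ ⊤ → Nonempty (P ≃* Multiplicative ℤ) ∨
    Nonempty (P ≃* DihedralGroup 0) ∨ ∃ j x, ∀ y ∈ P, ∃ a, y = x * φ j a * x⁻¹
  fin : ∀ g : S, IsOfFinOrder g → ∃ j x a, g = x * φ j a * x⁻¹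

section
variable {J : Type} {H : J → Type} [∀ j, Group (H j)] {Γ : Type} [Group Γ]
  {ψ : ∀ j, H j →* Γ} {s : ℕ → Stage ψ} {S : Type} [Group S] {p : Γ →* S}

/-- A sequence of stages together with its limit group. -/
structure IsLim (s : ℕ → Stage ψ) (p : Γ →* S) : Prop where
  mono : Monotone fun n => (s n).π.ker
  dec : ∀ (u v x : Γ) (m : ℕ), ∃ n, m ≤ n ∧ ∀ f ∈ Subgroup.closure {u, v},
    ∀ h ∈ Subgroup.closure {u, v}, (s n).Lx f → ¬ (s n).El f h →
    (s (n + 1)).π x ∈ Subgroup.closure {(s (n + 1)).π u, (s (n + 1)).π v}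
  track : ∀ g : Γ, ∃ m, ∀ n, m ≤ n → (s n).Lx g → (s (n + 1)).Lx g ∧
    ∀ h, (s (n + 1)).El g h → ∃ h', (s n).El g h' ∧ (s (n + 1)).π h = (s (n + 1)).π h'
  surj : Function.Surjective p
  one : ∀ a, p a = 1 ↔ ∃ n, (s n).π a = 1

namespace IsLim

theorem π_mono (L : IsLim s p) {a b : Γ} {m n : ℕ} (hmn : m ≤ n) (h : (s m).π a = (s m).π b) :
    (s n).π a = (s n).π b := by
  rw [MonoidHom.eq_iff] at h ⊢
  exact L.mono hmn h

theorem eq_of (L : IsLim s p) {a b : Γ} {n : ℕ} (h : (s n).π a = (s n).π b) : p a = p b := by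
  rw [← inv_mul_eq_one, ← map_inv, ← map_mul]
  exact (L.one _).2 ⟨n, by rw [map_mul, map_inv, h, inv_mul_cancel]⟩

theorem exists_eq (L : IsLim s p) {a b : Γ} (h : p a = p b) (m : ℕ) :
    ∃ n, m ≤ n ∧ (s n).π a = (s n).π b := by
  rw [← inv_mul_eq_one, ← map_inv, ← map_mul] at h
  obtain ⟨n, hn⟩ := (L.one _).1 h
  rw [map_mul, map_inv, inv_mul_eq_one] at hn
  exact ⟨max m n, le_max_left _ _, L.π_mono (le_max_right _ _) hn⟩

theorem dichotomy (L : IsLim s p) (g : Γ) : ∃ m,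
    (∀ n, m ≤ n → (s n).Lx g ∧ ∀ h, (s n).El g h → ∃ h', (s m).El g h' ∧ p h = p h') ∨
    ∀ n, m ≤ n → ∃ v : (s n).V, (s n).π g • v = v := by
  obtain ⟨m, hm⟩ := L.track g
  by_cases hex : ∃ n, m ≤ n ∧ (s n).Lx g
  · obtain ⟨n₀, hn₀, hl⟩ := hex
    refine ⟨n₀, Or.inl fun n hn => ?_⟩
    induction n, hn using Nat.le_induction with
    | base => exact ⟨hl, fun h hh => ⟨h, hh, rfl⟩⟩
    | succ n hn ih =>
      obtain ⟨h1, h2⟩ := hm n (hn₀.trans hn) ih.1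
      refine ⟨h1, fun h hh => ?_⟩
      obtain ⟨h', hh', e⟩ := h2 h hh
      obtain ⟨h'', hh'', e'⟩ := ih.2 h' hh'
      exact ⟨h'', hh'', (L.eq_of e).trans e'⟩
  · exact ⟨m, Or.inr fun n hn => ((s n).lx_or g).resolve_left fun h => hex ⟨n, hn, h⟩⟩

theorem zpow_eq_zero (L : IsLim s p) {g : Γ} {m : ℕ} (hg : ∀ n, m ≤ n → (s n).Lx g) (k : ℤ)
    (h : p g ^ k = 1) : k = 0 := by
  by_contra hk
  rw [← map_zpow, ← map_one p] at h
  obtain ⟨n, hn, h⟩ := L.exists_eq h m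
  rw [map_zpow, map_one] at h
  refine Lox.pow_ne_one (s n).good.hd (hg n hn) (k := k.natAbs) (Int.natAbs_ne_zero.2 hk) ?_
  rcases Int.natAbs_eq k with e | e <;> rw [e] at h
  · rwa [zpow_natCast] at h
  · rwa [zpow_neg, inv_eq_one, zpow_natCast] at h

/-- A proper subgroup with an element staying loxodromic. -/
theorem of_lox (L : IsLim s p) {P : Subgroup S} (hP : P ≠ ⊤) {g : Γ} (hgP : p g ∈ P) {m : ℕ}
    (hg : ∀ n, m ≤ n → (s n).Lx g ∧ ∀ h, (s n).El g h → ∃ h', (s m).El g h' ∧ p h = p h') :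
    Nonempty (P ≃* Multiplicative ℤ) ∨ Nonempty (P ≃* DihedralGroup 0) := by
  have hcov : ∀ h, p h ∈ P → ∃ h', (s m).El g h' ∧ p h = p h' := fun h hh => by
    obtain ⟨x, hx⟩ : ∃ x, x ∉ P := by
      by_contra hc
      push Not at hc
      exact hP (eq_top_iff.2 fun x _ => hc x)
    obtain ⟨x, rfl⟩ := L.surj x
    obtain ⟨n, hn, hd⟩ := L.dec g h x m
    refine (hg n hn).2 h ?_
    by_contra hE
    have h1 := hd g (Subgroup.subset_closure (by simp)) h (Subgroup.subset_closure (by simp))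
      (hg n hn).1 hE
    rw [← Set.image_pair, ← MonoidHom.map_closure] at h1
    obtain ⟨w, hw, e⟩ := h1
    have h2 : Subgroup.closure {g, h} ≤ P.comap p := by
      rw [Subgroup.closure_le]
      rintro _ (rfl | rfl)
      · exact hgP
      · exact hh
    exact hx (L.eq_of e ▸ h2 hw)
  have hne : ∀ n, m ≤ n → Nonempty (s n).V := fun n hn => by
    obtain ⟨o, -⟩ := (hg n hn).1
    exact ⟨o⟩
  have hinf : ∀ k : ℤ, p g ^ k = 1 → k = 0 := L.zpow_eq_zero fun n hn => (hg n hn).1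
  have hGm := (s m).good
  have := hne m le_rfl
  obtain ⟨T, hT, hcT⟩ := elem_finite hGm.hd hGm.inv hGm.hy (hg m le_rfl).1
    (hGm.wpd _ (hg m le_rfl).1)
  choose σ hσ using (s m).surj
  refine cyclic_or_dihedral (s := (⟨p g, hgP⟩ : P)) (T := {t | (t : S) ∈ (fun t => p (σ t)) '' T})
    (fun n hn => hinf n (by simpa using congrArg Subtype.val hn))
    ((hT.image _).preimage Subtype.val_injective.injOn) ?_ ?_
  · rintro ⟨y, hy⟩
    obtain ⟨h, rfl⟩ := L.surj y
    obtain ⟨h', hE, e⟩ := hcov h hy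
    obtain ⟨k, t, ht, e'⟩ := hcT _ hE
    have e2 : p h = p g ^ k * p (σ t) := by
      rw [e, ← map_zpow, ← map_mul]
      exact L.eq_of (n := m) (by rw [map_mul, map_zpow, hσ, e'])
    have ht' : p (σ t) ∈ P := by
      have : p (σ t) = (p g ^ k)⁻¹ * p h := by rw [e2, inv_mul_cancel_left]
      rw [this]
      exact mul_mem (inv_mem (zpow_mem hgP k)) hy
    exact ⟨k, ⟨_, ht'⟩, ⟨t, ht, rfl⟩, Subtype.ext (by simpa using e2)⟩
  · rintro ⟨x, hxP⟩ hx1 k hk hc n hn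
    obtain ⟨h, rfl⟩ := L.surj x
    have hc' : p (h * g ^ k * h⁻¹) = p (g ^ k) := by
      have := congrArg Subtype.val hc
      simp only [Subgroup.coe_mul, SubgroupClass.coe_zpow] at this
      rw [map_mul, map_mul, map_inv, map_zpow, this, mul_inv_cancel_right]
    obtain ⟨N, hN, e⟩ := L.exists_eq hc' m
    have hG := (s N).good
    have := hne N hN
    have h1 : (s N).π h ≠ 1 := fun h1 => hx1 (Subtype.ext (by
      simpa using L.eq_of (n := N) (a := h) (b := 1) (by rw [h1, map_one])))
    simp only [map_mul, map_inv, map_zpow] at e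
    obtain ⟨a, b, ha, hb, e⟩ := commute_pow hG.hd hG.inv hG.hy hG.lox
      (fun v w hvw g hv hw => by_contra fun hg => hvw (hG.inter g v w hv hw hg))
      (hg N hN).1 (hG.wpd _ (hg N hN).1) h1 hk e
    have e2 : p h ^ a = p g ^ b := by
      rw [← map_pow, ← map_zpow]
      exact L.eq_of (n := N) (by rw [map_pow, map_zpow, e])
    have hn' : p h ^ n = 1 := by simpa using congrArg Subtype.val hn
    have h3 := hinf (b * n) (by
      rw [zpow_mul, ← e2, ← zpow_natCast, ← zpow_mul, mul_comm, zpow_mul, hn', one_zpow])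
    exact (mul_eq_zero.1 h3).resolve_left hb

theorem conj_of_fix (L : IsLim s p) {n : ℕ} {h z : Γ} {j : J}
    (hh : (s n).π h • (s n).π z • (s n).o j = (s n).π z • (s n).o j) :
    ∃ a, p h = p z * p (ψ j a) * (p z)⁻¹ := by
  have h1 : (s n).π (z⁻¹ * h * z) • (s n).o j = (s n).o j := by
    rw [map_mul, map_mul, map_inv, mul_smul, mul_smul, hh, inv_smul_smul]
  obtain ⟨a, ha⟩ := ((s n).good.stab j _).1 h1
  refine ⟨a, ?_⟩
  rw [L.eq_of (n := n) ha, map_mul, map_mul, map_inv]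
  group

theorem fix_of_conj (L : IsLim s p) {h z : Γ} {j : J} {a : H j}
    (hh : p h = p z * p (ψ j a) * (p z)⁻¹) (m : ℕ) : ∃ n, m ≤ n ∧
    ∀ k, n ≤ k → (s k).π h • (s k).π z • (s k).o j = (s k).π z • (s k).o j := by
  rw [← map_mul, ← map_inv, ← map_mul] at hh
  obtain ⟨n, hn, e⟩ := L.exists_eq hh m
  refine ⟨n, hn, fun k hk => ?_⟩
  rw [L.π_mono hk e, map_mul, map_mul, map_inv, mul_smul, mul_smul, inv_smul_smul,
    show (s k).π (ψ j a) • (s k).o j = (s k).o j from ((s k).good.stab j _).2 ⟨a, rfl⟩]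

theorem conj_of_ell (L : IsLim s p) {g : Γ} (hg1 : p g ≠ 1) {m : ℕ}
    (hg : ∀ n, m ≤ n → ∃ v : (s n).V, (s n).π g • v = v) :
    ∃ j z a, p g = p z * p (ψ j a) * (p z)⁻¹ := by
  obtain ⟨v, hv⟩ := hg m le_rfl
  obtain ⟨j, z, rfl⟩ := (s m).good.orb _ v hv fun h => hg1 (by
    simpa using L.eq_of (n := m) (a := g) (b := 1) (by rw [h, map_one]))
  obtain ⟨z, rfl⟩ := (s m).surj z
  exact ⟨j, z, L.conj_of_fix hv⟩

theorem ne_one (L : IsLim s p) {g : Γ} (hg : p g ≠ 1) (n : ℕ) : (s n).π g ≠ 1 := fun h =>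
  hg (by simpa using L.eq_of (n := n) (a := g) (b := 1) (by rw [h, map_one]))

theorem tame [Nonempty J] (L : IsLim s p) : Tame fun j => p.comp (ψ j) where
  inj j := by
    rw [injective_iff_map_eq_one]
    intro a ha
    obtain ⟨n, hn⟩ := (L.one _).1 ha
    exact (injective_iff_map_eq_one _).1 ((s n).good.inj j) a hn
  eq_of_conj j j' a b x h ha := by
    obtain ⟨x, rfl⟩ := L.surj x
    obtain ⟨n, -, h1⟩ := L.fix_of_conj (h : p (ψ j a) = p x * p (ψ j' b) * (p x)⁻¹) 0
    have hG := (s n).good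
    have h2 := hG.inter _ _ _ (h1 n le_rfl) ((hG.stab j _).2 ⟨a, rfl⟩)
      fun h => ha ((injective_iff_map_eq_one _).1 (hG.inj j) a h)
    exact (hG.ne _ _ _ h2).symm
  mem_of_conj j a b x h ha := by
    obtain ⟨x, rfl⟩ := L.surj x
    obtain ⟨n, -, h1⟩ := L.fix_of_conj (h : p (ψ j a) = p x * p (ψ j b) * (p x)⁻¹) 0
    have hG := (s n).good
    have h2 := hG.inter _ _ _ (h1 n le_rfl) ((hG.stab j _).2 ⟨a, rfl⟩)
      fun h => ha ((injective_iff_map_eq_one _).1 (hG.inj j) a h)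
    obtain ⟨c, hc⟩ := (hG.stab j _).1 h2
    exact ⟨c, L.eq_of (n := n) hc⟩
  sub P hP := by
    by_cases hlox : ∃ g m, p g ∈ P ∧
        ∀ n, m ≤ n → (s n).Lx g ∧ ∀ h, (s n).El g h → ∃ h', (s m).El g h' ∧ p h = p h'
    · obtain ⟨g, m, hgP, hg⟩ := hlox
      rw [← or_assoc]
      exact Or.inl (L.of_lox hP hgP hg)
    · right; right
      have hell : ∀ g, p g ∈ P → ∃ m, ∀ n, m ≤ n → ∃ v : (s n).V, (s n).π g • v = v :=
        fun g hgP => by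
          obtain ⟨m, hm⟩ := L.dichotomy g
          exact ⟨m, hm.resolve_left fun h => hlox ⟨g, m, hgP, h⟩⟩
      by_cases hbot : ∀ y ∈ P, y = 1
      · exact ⟨Classical.arbitrary J, 1, fun y hy => ⟨1, by simp [hbot y hy]⟩⟩
      · push Not at hbot
        obtain ⟨y, hy, hy1⟩ := hbot
        obtain ⟨g, rfl⟩ := L.surj y
        obtain ⟨m, hm⟩ := hell g hy
        obtain ⟨j, z, a, hza⟩ := L.conj_of_ell hy1 hm
        refine ⟨j, p z, fun y hyP => ?_⟩
        by_cases hy2 : y = 1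
        · exact ⟨1, by simp [hy2]⟩
        obtain ⟨h, rfl⟩ := L.surj y
        obtain ⟨m₁, h₁⟩ := hell h hyP
        obtain ⟨m₂, h₂⟩ := hell (g * h) (by rw [map_mul]; exact mul_mem hy hyP)
        obtain ⟨m₃, -, h₃⟩ := L.fix_of_conj hza 0
        obtain ⟨M, e1, e2, e3⟩ : ∃ M, m₁ ≤ M ∧ m₂ ≤ M ∧ m₃ ≤ M :=
          ⟨m₁ + m₂ + m₃, by omega, by omega, by omega⟩
        obtain ⟨q, hq⟩ := h₁ M e1
        obtain ⟨w, hw⟩ := h₂ M e2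
        rw [map_mul] at hw
        have := (s M).good.ell _ _ _ _ _ (L.ne_one hy1 M) (L.ne_one hy2 M) (h₃ M e3) hq hw
        rw [← this] at hq
        exact L.conj_of_fix hq
  fin g hg := by
    obtain ⟨g, rfl⟩ := L.surj g
    by_cases h1 : p g = 1
    · exact ⟨Classical.arbitrary J, 1, 1, by simp [h1]⟩
    obtain ⟨m, hm | hm⟩ := L.dichotomy g
    · obtain ⟨n, hn, e⟩ := isOfFinOrder_iff_pow_eq_one.1 hg
      have := L.zpow_eq_zero (fun n hn => (hm n hn).1) n (by rw [zpow_natCast, e])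
      omega
    · obtain ⟨j, z, a, h⟩ := L.conj_of_ell h1 hm
      exact ⟨j, p z, a, h⟩

end IsLim

theorem Stage.exists_tame [Nonempty J] [Countable Γ] (s₀ : Stage ψ) :
    ∃ (S : Type) (_ : Group S) (φ : ∀ j, H j →* S), Tame φ := by
  obtain ⟨s, h1, h2, h3⟩ := exists_stages s₀
  refine ⟨Γ ⧸ ⨆ n, (s n).π.ker, inferInstance, _,
    IsLim.tame (s := s) (p := QuotientGroup.mk' (⨆ n, (s n).π.ker)) ⟨h1, h2, h3,
      QuotientGroup.mk'_surjective _, fun a => ?_⟩⟩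
  rw [QuotientGroup.mk'_apply, QuotientGroup.eq_one_iff,
    Subgroup.mem_iSup_of_directed h1.directed_le]
  rfl

end

section
variable {S : Type} [Group S]

/-- Rotations in an infinite cyclic or infinite dihedral subgroup. -/
theorem exists_rotations {P : Subgroup S}
    (hP : Nonempty (P ≃* Multiplicative ℤ) ∨ Nonempty (P ≃* DihedralGroup 0)) :
    ∃ (R : S → Prop) (r : S), r ∈ P ∧ (∀ n : ℤ, r ^ n = 1 → n = 0) ∧
      (∀ x ∈ P, R x → ∃ k : ℤ, x = r ^ k) ∧
      (∀ x ∈ P, ∀ y ∈ P, R x → y * x * y⁻¹ = x ∨ y * x * y⁻¹ = x⁻¹) ∧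
      (∀ x ∈ P, ¬ R x → x ≠ 1 ∧ x * x = 1) ∧
      ∀ x ∈ P, ∀ y ∈ P, (R (x * y) ↔ (R x ↔ R y)) := by
  rcases hP with ⟨⟨e⟩⟩ | ⟨⟨e⟩⟩
  · have hg : ∀ n : ℤ, Multiplicative.ofAdd (1 : ℤ) ^ n = Multiplicative.ofAdd n := fun n => by
      rw [← ofAdd_zsmul, smul_eq_mul, mul_one]
    refine ⟨fun _ => True, (e.symm (Multiplicative.ofAdd 1)).1, (e.symm _).2, fun n hn => ?_,
      fun x hx _ => ⟨Multiplicative.toAdd (e ⟨x, hx⟩), ?_⟩, fun x hx y hy _ => Or.inl ?_,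
      by simp, by simp⟩
    · rw [← SubgroupClass.coe_zpow, ← map_zpow, hg, OneMemClass.coe_eq_one,
        MulEquiv.map_eq_one_iff] at hn
      exact Multiplicative.ofAdd.injective hn
    · rw [← SubgroupClass.coe_zpow, ← map_zpow, hg, ofAdd_toAdd, MulEquiv.symm_apply_apply]
    · have : (⟨y, hy⟩ : P) * ⟨x, hx⟩ = ⟨x, hx⟩ * ⟨y, hy⟩ := e.injective (by
        rw [map_mul, map_mul, mul_comm])
      rw [show y * x = x * y from congrArg Subtype.val this, mul_inv_cancel_right]
  · have hg : ∀ n : ℤ, (DihedralGroup.r 1 : DihedralGroup 0) ^ n = DihedralGroup.r n := fun n => by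
      rw [DihedralGroup.r_one_zpow]; exact congrArg _ Int.cast_id
    have hp : ∀ n : ℤ, (e.symm (.r 1)).1 ^ n = (e.symm (.r n)).1 := fun n => by
      rw [← SubgroupClass.coe_zpow, ← map_zpow, hg]
    have hx : ∀ x ∈ P, ∃ a, x = (e.symm a).1 := fun x hx => ⟨e ⟨x, hx⟩, by simp⟩
    have hR : ∀ a, (∃ i, (e.symm a).1 = (e.symm (DihedralGroup.r i)).1) ↔
        ∃ i, a = DihedralGroup.r i := fun a => by
      simp only [Subtype.val_inj, e.symm.injective.eq_iff]
    refine ⟨fun x => ∃ i, x = (e.symm (DihedralGroup.r i)).1, (e.symm (.r 1)).1, (e.symm _).2,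
      fun n hn => ?_, fun x _ hx => ?_, fun x _ y hy hr => ?_, fun x hxP hr => ?_,
      fun x hxP y hyP => ?_⟩
    · rw [← SubgroupClass.coe_zpow, ← map_zpow, hg, OneMemClass.coe_eq_one,
        MulEquiv.map_eq_one_iff, DihedralGroup.one_def] at hn
      exact DihedralGroup.r.inj hn
    · obtain ⟨i, rfl⟩ := hx
      exact ⟨i, (hp i).symm⟩
    · obtain ⟨i, rfl⟩ := hr
      obtain ⟨a, rfl⟩ := hx y hy
      simp only [← InvMemClass.coe_inv, ← Subgroup.coe_mul, ← map_mul, ← map_inv, Subtype.val_inj,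
        e.symm.injective.eq_iff]
      rcases a with j | j
      · left; simp
      · right; simp
    · obtain ⟨a, rfl⟩ := hx x hxP
      replace hr := (hR a).not.1 hr
      rcases a with j | j
      · exact absurd ⟨j, rfl⟩ hr
      · rw [← Subgroup.coe_mul, ← map_mul, Ne, OneMemClass.coe_eq_one, OneMemClass.coe_eq_one,
          MulEquiv.map_eq_one_iff, MulEquiv.map_eq_one_iff, DihedralGroup.sr_mul_self,
          DihedralGroup.one_def]
        exact ⟨nofun, rfl⟩
    · obtain ⟨a, rfl⟩ := hx x hxP
      obtain ⟨b, rfl⟩ := hx y hyP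
      beta_reduce
      rw [← Subgroup.coe_mul, ← map_mul, hR, hR, hR]
      rcases a with i | i <;> rcases b with j | j <;> simp

end

namespace Tame
variable {J : Type} {H : J → Type} [∀ j, Group (H j)] {S : Type} [Group S] {φ : ∀ j, H j →* S}

theorem ne_one (h : Tame φ) {j : J} {a : H j} (ha : a ≠ 1) : φ j a ≠ 1 := fun e =>
  ha ((injective_iff_map_eq_one _).1 (h.inj j) a e)

theorem eq_of_eq (h : Tame φ) {j j' : J} {a : H j} {b : H j'} (e : φ j a = φ j' b) (ha : a ≠ 1) :
    j = j' := h.eq_of_conj j j' a b 1 (by simpa using e) ha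

theorem mem_of_conj_eq_or (h : Tame φ) {j : J} {a : H j} (ha : a ≠ 1) {y : S}
    (hy : y * φ j a * y⁻¹ = φ j a ∨ y * φ j a * y⁻¹ = (φ j a)⁻¹) : y ∈ (φ j).range := by
  rcases hy with e | e
  · exact h.mem_of_conj j a a y e.symm ha
  · exact h.mem_of_conj j a⁻¹ a y (by rw [e, map_inv]) (inv_ne_one.2 ha)

theorem pair (h : Tame φ) {j : J} {a : H j} (ha : a ≠ 1) {y : S} (hy : y ∉ (φ j).range) :
    Subgroup.closure {φ j a, y} = ⊤ ∨
      (φ j a * φ j a = 1 ∧ ((y ≠ 1 ∧ y * y = 1) ∨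
        (φ j a * y ≠ 1 ∧ (φ j a * y) * (φ j a * y) = 1))) := by
  refine or_iff_not_imp_left.2 fun hP => ?_
  have hxP : φ j a ∈ Subgroup.closure {φ j a, y} := Subgroup.subset_closure (by simp)
  have hyP : y ∈ Subgroup.closure {φ j a, y} := Subgroup.subset_closure (by simp)
  rcases or_assoc.2 (h.sub _ hP) with hP | ⟨j', z, hc⟩
  · obtain ⟨R, r, -, -, -, h1, h2, h3⟩ := exists_rotations hP
    have hRx : ¬ R (φ j a) := fun hR => hy (h.mem_of_conj_eq_or ha (h1 _ hxP _ hyP hR))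
    refine ⟨(h2 _ hxP hRx).2, ?_⟩
    by_cases hRy : R y
    · exact Or.inr (h2 _ (mul_mem hxP hyP) (by rw [h3 _ hxP _ hyP]; tauto))
    · exact Or.inl (h2 _ hyP hRy)
  · obtain ⟨b, hb⟩ := hc _ hxP
    obtain rfl := h.eq_of_conj _ _ _ _ _ hb ha
    have hz := h.mem_of_conj _ _ _ _ hb ha
    obtain ⟨c, rfl⟩ := hc _ hyP
    exact absurd (mul_mem (mul_mem hz ⟨c, rfl⟩) (inv_mem hz)) hy

theorem sup (h : Tame φ) {i j : J} (hij : i ≠ j) {a : H i} (ha : a ≠ 1) {b c : H j} (hb : b ≠ 1)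
    (hc : c ≠ 1) (hbc : b ≠ c) {P : Subgroup S} (haP : φ i a ∈ P) (hbP : φ j b ∈ P)
    (hcP : φ j c ∈ P) : P = ⊤ := by
  by_contra hP
  rcases or_assoc.2 (h.sub _ hP) with hP | ⟨j', z, hz⟩
  · obtain ⟨R, r, -, -, -, h1, h2, h3⟩ := exists_rotations hP
    have key : ∀ b : H j, b ≠ 1 → φ j b ∈ P → ¬ R (φ j b) := fun b hb hbP hR => by
      obtain ⟨d, hd⟩ := h.mem_of_conj_eq_or hb (h1 _ hbP _ haP hR)
      exact hij (h.eq_of_eq hd.symm ha)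
    refine key (b * c) (fun e => hbc ?_) (by rw [map_mul]; exact mul_mem hbP hcP) ?_
    · have e2 := (h2 _ hcP (key c hc hcP)).2
      rw [← map_mul] at e2
      have e3 := (injective_iff_map_eq_one _).1 (h.inj j) _ e2
      exact mul_right_cancel (e.trans e3.symm)
    · rw [map_mul, h3 _ hbP _ hcP]
      have := key b hb hbP
      have := key c hc hcP
      tauto
  · obtain ⟨b', e⟩ := hz _ haP
    obtain ⟨b'', e'⟩ := hz _ hbP
    exact hij ((h.eq_of_conj _ _ _ _ _ e ha).trans (h.eq_of_conj _ _ _ _ _ e' hb).symm)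

theorem isSimpleGroup (h : Tame φ) {i j : J} (hij : i ≠ j) {a : H i} (ha : a * a ≠ 1) {b : H j}
    (hb : b ≠ 1) : IsSimpleGroup S where
  exists_pair_ne := ⟨_, _, h.ne_one hb⟩
  eq_bot_or_eq_top_of_normal N hN := by
    have ha1 : a ≠ 1 := fun e => ha (by simp [e])
    have hout : ∀ j', ∃ x, x ∉ (φ j').range := fun j' => by
      by_cases e : j' = i
      · exact ⟨φ j b, fun ⟨c, hc⟩ => hij (e.symm.trans (h.eq_of_eq hc.symm hb).symm)⟩
      · exact ⟨φ i a, fun ⟨c, hc⟩ => e (h.eq_of_eq hc.symm ha1).symm⟩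
    by_contra hcon
    obtain ⟨hbot, htop⟩ := not_or.1 hcon
    rcases or_assoc.2 (h.sub _ htop) with hP | ⟨j', z, hz⟩
    · obtain ⟨R, r, hrN, hr, h0, h1, h2, h3⟩ := exists_rotations hP
      have hnorm : (Subgroup.zpowers r).Normal := by
        refine ⟨fun x hx g => ?_⟩
        obtain ⟨k, rfl⟩ := Subgroup.mem_zpowers_iff.1 hx
        rw [← conj_zpow]
        refine zpow_mem ?_ k
        have hN' := hN.conj_mem r hrN g
        have hR : R (g * r * g⁻¹) := by
          by_contra hR
          have e := (h2 _ hN' hR).2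
          have e' : r ^ (2 : ℤ) = 1 := by
            rw [← pow_two, conj_pow, conj_eq_one_iff] at e
            exact_mod_cast e
          exact absurd (hr 2 e') (by norm_num)
        obtain ⟨l, hl⟩ := h0 _ hN' hR
        exact Subgroup.mem_zpowers_iff.2 ⟨l, hl.symm⟩
      have hconj := conj_eq_or_inv (c := r) rfl hr
      have haa : φ i (a * a) * r * (φ i (a * a))⁻¹ = r := by
        rw [map_mul]
        have e : φ i a * φ i a * r * (φ i a * φ i a)⁻¹
          = φ i a * (φ i a * r * (φ i a)⁻¹) * (φ i a)⁻¹ := by group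
        rw [e]
        rcases hconj (φ i a) with e | e
        · rw [e, e]
        · rw [e, ← conj_inv, e, inv_inv]
      have hrK : r ∈ (φ i).range := h.mem_of_conj_eq_or ha (Or.inl (by
        rw [mul_inv_eq_iff_eq_mul] at haa ⊢
        exact haa.symm))
      obtain ⟨c, rfl⟩ := hrK
      have hc : c ≠ 1 := fun e => one_ne_zero (hr 1 (by simp [e]))
      obtain ⟨x, hx⟩ := hout i
      exact hx (h.mem_of_conj_eq_or hc (hconj x))
    · obtain ⟨n, hn, hn1⟩ := N.bot_or_exists_ne_one.resolve_left hbot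
      obtain ⟨c, rfl⟩ := hz n hn
      have hc : c ≠ 1 := fun e => hn1 (by simp [e])
      obtain ⟨x, hx⟩ := hout j'
      obtain ⟨c', hc'⟩ := hz _ (hN.conj_mem _ hn (z * x * z⁻¹))
      refine hx (h.mem_of_conj j' c' c x ?_ fun e => ?_)
      · have : z * (x * φ j' c * x⁻¹) * z⁻¹ = z * φ j' c' * z⁻¹ := by rw [← hc']; group
        exact (mul_left_cancel (mul_right_cancel this)).symm
      · rw [e, map_one, mul_one, mul_inv_cancel, conj_eq_one_iff] at hc'
        exact hn1 hc'

end Tame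

section
variable {I : Type}

/-- A family of types with the integers added. -/
def ExtFam (H : I → Type) : Option I → Type
  | none => Multiplicative ℤ
  | some i => H i

instance (H : I → Type) [∀ i, Group (H i)] : ∀ j, Group (ExtFam H j)
  | none => inferInstanceAs (Group (Multiplicative ℤ))
  | some i => inferInstanceAs (Group (H i))

instance (H : I → Type) [∀ i, Countable (H i)] : ∀ j, Countable (ExtFam H j)
  | none => inferInstanceAs (Countable (Multiplicative ℤ))
  | some i => inferInstanceAs (Countable (H i))

theorem countable_coprodI {J : Type} {H : J → Type} [Countable J] [∀ j, Group (H j)]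
    [∀ j, Countable (H j)] : Countable (Monoid.CoprodI H) := by
  classical
  have hw : Function.Injective fun w : Monoid.CoprodI.Word H => w.toList := fun _ _ h =>
    Monoid.CoprodI.Word.ext h
  have := hw.countable
  exact (Monoid.CoprodI.Word.equiv (M := H)).injective.countable

theorem exists_tame {J : Type} {H : J → Type} [Countable J] [Nonempty J] [∀ j, Group (H j)]
    [∀ j, Countable (H j)] : ∃ (S : Type) (_ : Group S) (φ : ∀ j, H j →* S), Tame φ := by
  classical
  have := countable_coprodI (H := H)
  exact Stage.exists_tame (ψ := fun j => (Monoid.CoprodI.of : H j →* Monoid.CoprodI H))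
    ⟨Monoid.CoprodI H, BassSerre H, MonoidHom.id _, Function.surjective_id, _, _, _, good_coprodI⟩

end
end Olsh

/-- Theorem O (Ol'shanskii): a countable family of countable nontrivial groups
(with at least two members) embeds into a 2-generated simple group `S` satisfying
properties (1)-(7); the image subgroups are `K i := (φ i).range`. -/
theorem olshanskii_embedding_into_two_generated_simple_group
    (I : Type) [Countable I] [Nontrivial I]
    (H : I → Type) [∀ i, Group (H i)] [∀ i, Countable (H i)] [∀ i, Nontrivial (H i)] :
    ∃ (S : Type) (_ : Group S),
      IsSimpleGroup S ∧
      (∃ s t : S, Subgroup.closure {s, t} = ⊤) ∧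
      ∃ φ : ∀ i, H i →* S,
        (∀ i, Function.Injective (φ i)) ∧
        -- (1)
        (∀ i j : I, i ≠ j → 3 ≤ Cardinal.mk (H j) →
          Subgroup.closure (Set.range (φ i) ∪ Set.range (φ j)) = ⊤) ∧
        -- (2)
        (∀ i j : I, i ≠ j → (φ i).range ⊓ (φ j).range = ⊥) ∧
        -- (3)
        (∀ g : S, IsOfFinOrder g → ∃ i : I, ∃ h ∈ (φ i).range, IsConj h g) ∧
        -- (4)
        (∀ P : Subgroup S, P ≠ ⊤ →
          Nonempty (P ≃* Multiplicative ℤ) ∨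
          Nonempty (P ≃* DihedralGroup 0) ∨
          ∃ (i : I) (x : S), P ≤ Subgroup.map (MulAut.conj x).toMonoidHom (φ i).range) ∧
        -- (5)
        (∀ i : I, ∀ x ∈ (φ i).range, x ≠ 1 → ∀ y : S, y ∉ (φ i).range →
          Subgroup.closure {x, y} = ⊤ ∨
          ((x ≠ 1 ∧ x ^ 2 = 1) ∧ (y ≠ 1 ∧ y ^ 2 = 1)) ∨
          ((x ≠ 1 ∧ x ^ 2 = 1) ∧ (x * y ≠ 1 ∧ (x * y) ^ 2 = 1))) ∧
        -- (6)
        (∀ i j : I, i ≠ j → ∀ x : S,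
          (φ i).range ⊓ Subgroup.map (MulAut.conj x).toMonoidHom (φ j).range = ⊥) ∧
        -- (7)
        (∀ i : I, ∀ x : S, x ∉ (φ i).range →
          (φ i).range ⊓ Subgroup.map (MulAut.conj x).toMonoidHom (φ i).range = ⊥) := by
  obtain ⟨S, gS, φ', h⟩ := Olsh.exists_tame (H := Olsh.ExtFam H)
  let φ : ∀ i, H i →* S := fun i => φ' (some i)
  have hne : ∀ i, ∃ b : H i, b ≠ 1 := fun i => exists_ne 1
  obtain ⟨i₀, i₁, hi⟩ := exists_pair_ne I
  obtain ⟨b₀, hb₀⟩ := hne i₀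
  let a : Olsh.ExtFam H none := Multiplicative.ofAdd (1 : ℤ)
  have hazpow : ∀ n : ℤ, a ^ n = (Multiplicative.ofAdd n : Olsh.ExtFam H none) := fun n =>
    (ofAdd_zsmul n (1 : ℤ)).symm.trans (congrArg Multiplicative.ofAdd (mul_one n))
  have hainf : ∀ n : ℤ, a ^ n = 1 → n = 0 := fun n hn =>
    Multiplicative.ofAdd.injective ((hazpow n).symm.trans hn)
  have haa : a * a ≠ 1 := fun e => two_ne_zero (hainf 2 (by rw [zpow_two, e]))
  have ha : a ≠ 1 := fun e => haa (by rw [e, mul_one])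
  have hagen : ∀ c : Olsh.ExtFam H none, ∃ n : ℤ, c = a ^ n := fun c => ⟨_, (hazpow c).symm⟩
  have hmem : ∀ {i : I} {x y : S},
      y ∈ Subgroup.map (MulAut.conj x).toMonoidHom (φ i).range ↔ ∃ c, y = x * φ i c * x⁻¹ := by
    intro i x y
    constructor
    · rintro ⟨_, ⟨c, rfl⟩, rfl⟩
      exact ⟨c, rfl⟩
    · rintro ⟨c, rfl⟩
      exact ⟨_, ⟨c, rfl⟩, rfl⟩
  have hdisj : ∀ i j : I, i ≠ j → ∀ x : S,
      (φ i).range ⊓ Subgroup.map (MulAut.conj x).toMonoidHom (φ j).range = ⊥ := by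
    intro i j hij x
    rw [eq_bot_iff]
    rintro _ ⟨⟨b, rfl⟩, hy⟩
    obtain ⟨c, hc⟩ := hmem.1 hy
    by_contra hb
    refine hij (Option.some.inj (h.eq_of_conj _ _ _ _ _ hc ?_))
    rintro rfl
    exact hb (map_one _)
  have hpair : Subgroup.closure {φ' none a, φ i₀ b₀} = ⊤ := by
    refine (h.pair ha ?_).resolve_right fun e => ?_
    · rintro ⟨c, hc⟩
      have := h.eq_of_eq hc.symm hb₀
      simp at this
    · refine haa ((injective_iff_map_eq_one _).1 (h.inj none) _ ?_)
      rw [map_mul, e.1]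
  refine ⟨S, gS, h.isSimpleGroup (i := none) (j := some i₀) (by simp) haa hb₀, ⟨_, _, hpair⟩, φ,
    fun i => h.inj _, fun i j hij hj => ?_, fun i j hij => ?_, fun g hg => ?_, fun P hP => ?_,
    fun i x hx hx1 y hy => ?_, hdisj, fun i x hx => ?_⟩
  · obtain ⟨b, hb⟩ := hne i
    obtain ⟨c, hc⟩ := hne j
    obtain ⟨d, hd1, hdc⟩ := Cardinal.exists_ne_ne_of_three_le hj 1 c
    refine h.sup (i := some i) (j := some j) (by simpa using hij) hb hc hd1 hdc.symm ?_ ?_ ?_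
    · exact Subgroup.subset_closure (Or.inl ⟨b, rfl⟩)
    · exact Subgroup.subset_closure (Or.inr ⟨c, rfl⟩)
    · exact Subgroup.subset_closure (Or.inr ⟨d, rfl⟩)
  · have h1 : (φ j).range ≤ Subgroup.map (MulAut.conj (1 : S)).toMonoidHom (φ j).range := by
      rintro _ ⟨c, rfl⟩
      exact hmem.2 ⟨c, by simp⟩
    exact eq_bot_iff.2 ((inf_le_inf_left _ h1).trans (hdisj i j hij 1).le)
  · obtain ⟨j, x, c, rfl⟩ := h.fin g hg
    rcases j with - | i
    · obtain ⟨n, hn, e⟩ := isOfFinOrder_iff_pow_eq_one.1 hg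
      obtain ⟨k, rfl⟩ := hagen c
      rw [conj_pow, conj_eq_one_iff, ← map_pow] at e
      have e1 := (injective_iff_map_eq_one _).1 (h.inj none) _ e
      have e2 := hainf (k * n) (by rw [zpow_mul, zpow_natCast, e1])
      have hk : k = 0 := (mul_eq_zero.1 e2).resolve_right (by omega)
      exact ⟨i₀, 1, one_mem _, by rw [hk]; simp⟩
    · exact ⟨i, φ i c, ⟨c, rfl⟩, isConj_iff.2 ⟨x, rfl⟩⟩
  · rcases h.sub P hP with h1 | h1 | ⟨j, x, hx⟩
    · exact Or.inl h1
    · exact Or.inr (Or.inl h1)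
    · rcases j with - | i
      · have hle : P ≤ Subgroup.zpowers (x * φ' none a * x⁻¹) := fun y hy => by
          obtain ⟨c, rfl⟩ := hx y hy
          obtain ⟨k, rfl⟩ := hagen c
          exact Subgroup.mem_zpowers_iff.2 ⟨k, by rw [conj_zpow, map_zpow]⟩
        have hcyc : IsCyclic P := isCyclic_of_injective (Subgroup.inclusion hle)
          (Subgroup.inclusion_injective hle)
        obtain ⟨c, hc⟩ := hcyc.exists_generator
        by_cases hc1 : c = 1
        · refine Or.inr (Or.inr ⟨i₀, 1, fun y hy => ?_⟩)
          have hy1 := hc ⟨y, hy⟩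
          rw [hc1, Subgroup.zpowers_one_eq_bot, Subgroup.mem_bot] at hy1
          rw [show y = 1 from congrArg Subtype.val hy1]
          exact one_mem _
        · refine Or.inl (Olsh.nonempty_mulEquiv_int (r := c) (fun n hn => ?_) fun y =>
            Subgroup.mem_zpowers_iff.1 (hc y))
          obtain ⟨k, hk⟩ := Subgroup.mem_zpowers_iff.1 (hle c.2)
          have hn' : (c : S) ^ n = 1 := by simpa using congrArg Subtype.val hn
          rw [← hk, ← zpow_mul, conj_zpow, conj_eq_one_iff, ← map_zpow] at hn'
          have e := hainf _ ((injective_iff_map_eq_one _).1 (h.inj none) _ hn')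
          refine (mul_eq_zero.1 e).resolve_left fun hk0 => hc1 (Subtype.ext ?_)
          rw [← hk, hk0, zpow_zero, Subgroup.coe_one]
      · exact Or.inr (Or.inr ⟨i, x, fun y hy => hmem.2 (hx y hy)⟩)
  · obtain ⟨b, rfl⟩ := hx
    have hb : b ≠ 1 := fun e => hx1 (by rw [e, map_one])
    rcases h.pair (j := some i) hb hy with h1 | ⟨h1, h2 | h2⟩
    · exact Or.inl h1
    · exact Or.inr (Or.inl ⟨⟨hx1, (pow_two _).trans h1⟩, h2.1, (pow_two _).trans h2.2⟩)
    · exact Or.inr (Or.inr ⟨⟨hx1, (pow_two _).trans h1⟩, h2.1, (pow_two _).trans h2.2⟩)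
  · rw [eq_bot_iff]
    rintro _ ⟨⟨b, rfl⟩, hy⟩
    obtain ⟨c, hc⟩ := hmem.1 hy
    by_contra hb
    refine hx (h.mem_of_conj _ _ _ _ hc ?_)
    rintro rfl
    exact hb (map_one _)
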